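/- Let 𝒱 = {φ_Λ}_{Λ∈𝒞} be a positive, continuous, T-invariant specification on X = S^ℤ, let s ∈ S, and set f(x) = φ_{{0}}(x)/φ_{{0}}(s_0 x). If there exist β < 1/2 and a nonnegative sequence (a_n) with ∑_n a_n < ∞ such that max{log r_{(-∞,n]}(f), log r_{[-n,∞)}(f)} ≤ β n⁻¹ + a_n for all n ≥ 1, then 𝒱 has a unique Gibbs state μ; moreover μ is T-invariant and (X,ℬ,μ,T) is Bernoulli. -/

import Mathlib

open MeasureTheory Filter Set Asymptotics

noncomputable section

namespace GibbsFormal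

/-- The configuration space `X = S^ℤ`. -/
abbrev Conf (S : Type) := ℤ → S

variable {S : Type} [Fintype S] [Nonempty S] [DecidableEq S]
  [TopologicalSpace S] [DiscreteTopology S]
  [MeasurableSpace S] [MeasurableSingletonClass S]

/-- The configuration obtained from `x` by replacing its coordinates on `Λ` by `ζ`. -/
def ov (x : Conf S) (Λ : Finset ℤ) (ζ : Λ → S) : Conf S :=
  fun i => if h : i ∈ Λ then ζ ⟨i, h⟩ else x i

/-- The configuration `x'_Λ x_{Λᶜ}`, agreeing with `x'` on `Λ` and with `x` off `Λ`. -/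
def merge (Λ : Finset ℤ) (x' x : Conf S) : Conf S :=
  fun i => if i ∈ Λ then x' i else x i

/-- The configuration `s_n x`. -/
def upd (s : S) (n : ℤ) (x : Conf S) : Conf S :=
  fun i => if i = n then s else x i

/-- The shift `Tⁿ`:  `(Tⁿ x) i = x (i + n)`. -/
def shift (n : ℤ) (x : Conf S) : Conf S := fun i => x (i + n)

/-- The sub-σ-algebra `ℬ_Λ` of the Borel (= product) σ-algebra, generated by
coordinates in `Λ`. -/
def cylSA (Λ : Set ℤ) : MeasurableSpace (Conf S) :=
  MeasurableSpace.comap (fun x => Λ.restrict x) inferInstance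

/-- The cylinder set `[ζ]_Λ`. -/
def cylEvent (Λ : Finset ℤ) (ζ : Λ → S) : Set (Conf S) :=
  {y | ∀ i : Λ, y i = ζ i}

/-- `r_Λ(f) = sup {f x / f y : x_Λ = y_Λ}`. -/
def rSup (Λ : Set ℤ) (f : Conf S → ℝ) : ℝ :=
  sSup {r : ℝ | ∃ x y : Conf S, (∀ i ∈ Λ, x i = y i) ∧ f x / f y = r}

/-- `r̄_Λ(f) = inf {f x / f y : x_Λ = y_Λ}`. -/
def rInf (Λ : Set ℤ) (f : Conf S → ℝ) : ℝ :=
  sInf {r : ℝ | ∃ x y : Conf S, (∀ i ∈ Λ, x i = y i) ∧ f x / f y = r}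

/-- A specification `𝒱 = {φ_Λ}` on `S^ℤ`:  a family of nonnegative Borel functions
satisfying the normalisation and consistency conditions.  (The value on the empty set
is normalised to `1`, which is forced by the unguarded normalisation condition.) -/
structure Specification (A : Type) [Fintype A] [MeasurableSpace A] where
  φ : Finset ℤ → Conf A → ℝ
  nonneg : ∀ Λ x, 0 ≤ φ Λ x
  measurable : ∀ Λ, Measurable (φ Λ)
  sum_one : ∀ (Λ : Finset ℤ) (x : Conf A), ∑ ζ : Λ → A, φ Λ (ov x Λ ζ) = 1
  consistent : ∀ (K Λ : Finset ℤ), K ⊆ Λ → ∀ x : Conf A,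
    φ Λ x = φ K x * ∑ ζ : K → A, φ Λ (ov x K ζ)

/-- A positive specification. -/
def Specification.Positive (V : Specification S) : Prop := ∀ Λ x, 0 < V.φ Λ x

/-- A continuous specification. -/
def Specification.IsCont (V : Specification S) : Prop := ∀ Λ, Continuous (V.φ Λ)

/-- A `T`-invariant specification: `φ_{n+Λ}(x) = φ_Λ(Tⁿ x)`. -/
def Specification.TInvariant (V : Specification S) : Prop :=
  ∀ (n : ℤ) (Λ : Finset ℤ) (x : Conf S),
    V.φ (Λ.image fun i => n + i) x = V.φ Λ (shift n x)

/-- The DLR (Gibbs) condition for a family `φfam` of conditional probabilities: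
for each finite nonempty `Λ` and each pattern `ζ` on `Λ`, the conditional probability
of the cylinder `[ζ]_Λ` given `ℬ_{Λᶜ}` is `x ↦ φfam Λ (ζ x_{Λᶜ})`, `μ`-a.e. -/
def GibbsCond (φfam : Finset ℤ → Conf S → ℝ) (μ : Measure (Conf S)) : Prop :=
  ∀ (Λ : Finset ℤ), Λ.Nonempty → ∀ ζ : Λ → S,
    (fun x => φfam Λ (ov x Λ ζ)) =ᵐ[μ]
      μ[(cylEvent Λ ζ).indicator (fun _ => (1 : ℝ)) | cylSA ((↑Λ : Set ℤ)ᶜ)]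

/-- `μ` is a Gibbs state for the specification `V`. -/
def IsGibbs (V : Specification S) (μ : Measure (Conf S)) : Prop :=
  IsProbabilityMeasure μ ∧ GibbsCond V.φ μ

/-- `g ∈ 𝒢_X`: a nonnegative bounded `ℬ_{ℤ⁻}`-measurable function with
`∑_{s ∈ S} g (s_0 x) = 1`. -/
def MemG (g : Conf S → ℝ) : Prop :=
  (∃ C, ∀ x, |g x| ≤ C) ∧ (∀ x, 0 ≤ g x) ∧
    Measurable[cylSA (Set.Iic (0 : ℤ))] g ∧
    ∀ x : Conf S, ∑ s : S, g (upd s 0 x) = 1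

/-- `μ` is a `g`-chain: for every `n` the conditional probability of the symbol at
site `n` given `ℬ_{(-∞,n-1]}` is `x ↦ g (Tⁿ (s_n x))`, `μ`-a.e. -/
def IsGChain (g : Conf S → ℝ) (μ : Measure (Conf S)) : Prop :=
  IsProbabilityMeasure μ ∧ ∀ (n : ℤ) (s : S),
    (fun x => g (shift n (upd s n x))) =ᵐ[μ]
      μ[({y : Conf S | y n = s}).indicator (fun _ => (1 : ℝ)) | cylSA (Set.Iic (n - 1))]

/-- The probability `π^𝒱_{[0,n]}([x]_{{0}} | x)`. -/
def piG (V : Specification S) (n : ℕ) (x : Conf S) : ℝ :=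
  ∑ ζ : (Finset.Icc (0 : ℤ) (n : ℤ)) → S,
    V.φ (Finset.Icc (0 : ℤ) (n : ℤ)) (ov x (Finset.Icc (0 : ℤ) (n : ℤ)) ζ) *
      (if ov x (Finset.Icc (0 : ℤ) (n : ℤ)) ζ 0 = x 0 then 1 else 0)

/-- A specification sequence of the form `{([0,n], f_n)}`: each `f_n` is bounded,
strictly positive and `ℬ_{[0,n-1]ᶜ}`-measurable. -/
def IsSpecSeq (f : ℕ → Conf S → ℝ) : Prop :=
  ∀ n : ℕ, (∃ C, ∀ x, f n x ≤ C) ∧ (∀ x, 0 < f n x) ∧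
    Measurable[cylSA ((Set.Ico (0 : ℤ) (n : ℤ))ᶜ)] (f n)

/-- `{([0,n], f_n)}` is a specification sequence for the family `φfam`. -/
def IsSpecSeqForFam (φfam : Finset ℤ → Conf S → ℝ) (f : ℕ → Conf S → ℝ) : Prop :=
  IsSpecSeq f ∧ ∀ (n : ℕ) (x : Conf S),
    φfam (Finset.Icc (0 : ℤ) (n : ℤ)) x =
      (∏ j ∈ Finset.range (n + 1), f j x) /
        ∑ ζ : (Finset.Icc (0 : ℤ) (n : ℤ)) → S,
          ∏ j ∈ Finset.range (n + 1), f j (ov x (Finset.Icc (0 : ℤ) (n : ℤ)) ζ)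

/-- `{([0,n], f_n)}` is a specification sequence for the specification `V`. -/
def IsSpecSeqFor (V : Specification S) (f : ℕ → Conf S → ℝ) : Prop :=
  IsSpecSeqForFam V.φ f

/-- The operator `L_{m,n} h (x) = ∑_{y ∈ [x]_{[m,n]ᶜ}} (∏_{i=m}^n f_i y) · h y`. -/
def Lop (f : ℕ → Conf S → ℝ) (m n : ℕ) (h : Conf S → ℝ) (x : Conf S) : ℝ :=
  ∑ ζ : (Finset.Icc (m : ℤ) (n : ℤ)) → S,
    (∏ i ∈ Finset.Icc m n, f i (ov x (Finset.Icc (m : ℤ) (n : ℤ)) ζ)) *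
      h (ov x (Finset.Icc (m : ℤ) (n : ℤ)) ζ)

/-- The ratio bounds `ρ_k^{(n)}(x,y)` (with `ρ_{-1}^{(n)}` for negative `k`). -/
def rho (f : ℕ → Conf S → ℝ) (k : ℤ) (n : ℕ) (x y : Conf S) : ℝ :=
  if k < 0 then
    sInf {r : ℝ | ∃ m : ℕ,
      Lop f m (m + n) (fun _ => 1) x / Lop f m (m + n) (fun _ => 1) y = r}
  else
    sInf {r : ℝ | ∃ (m : ℕ) (ζ : (Finset.Icc (m : ℤ) ((m : ℤ) + k)) → S),
      Lop f m (m + n) ((cylEvent (Finset.Icc (m : ℤ) ((m : ℤ) + k)) ζ).indicator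
          fun _ => 1) x /
        Lop f m (m + n) ((cylEvent (Finset.Icc (m : ℤ) ((m : ℤ) + k)) ζ).indicator
          fun _ => 1) y = r}

/-- A `T`-invariant interaction potential `Φ = {Φ_Λ}`. -/
structure Potential (A : Type) [Fintype A] [MeasurableSpace A] where
  Φ : Finset ℤ → Conf A → ℝ
  measurable : ∀ Λ : Finset ℤ, Λ.Nonempty → Measurable[cylSA (↑Λ : Set ℤ)] (Φ Λ)
  bounded : ∀ Λ : Finset ℤ, ∃ C, ∀ x, |Φ Λ x| ≤ C
  invariant : ∀ (n : ℤ) (Λ : Finset ℤ), Λ.Nonempty → ∀ x : Conf A,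
    Φ (Λ.image fun i => n + i) x = Φ Λ (shift n x)

/-- `var(h) = sup h − inf h`. -/
def pvar (h : Conf S → ℝ) : ℝ := (⨆ x, h x) - ⨅ x, h x

/-- `‖h‖ = sup |h|`. -/
def pnorm (h : Conf S → ℝ) : ℝ := ⨆ x, |h x|

/-- `∑_{Λ ∋ 0} ‖Φ_Λ‖ < ∞`. -/
def NormSummable (P : Potential S) : Prop :=
  Summable fun Λ : {Λ : Finset ℤ // (0 : ℤ) ∈ Λ} => pnorm (P.Φ ↑Λ)

/-- `∑_{Λ ∋ 0, Λ ∩ [n,∞) ≠ ∅} var(Φ_Λ)`. -/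
def varTail (P : Potential S) (n : ℕ) : ℝ :=
  ∑' Λ : {Λ : Finset ℤ // (0 : ℤ) ∈ Λ ∧ ∃ i ∈ Λ, (n : ℤ) ≤ i}, pvar (P.Φ ↑Λ)

/-- The Hamiltonian `H_Λ(x) = ∑_{K ∩ Λ ≠ ∅} Φ_K(x)`. -/
def HPot (P : Potential S) (Λ : Finset ℤ) (x : Conf S) : ℝ :=
  ∑' K : {K : Finset ℤ // (K ∩ Λ).Nonempty}, P.Φ ↑K x

/-- The specification `𝒱_Φ` associated with an interaction potential. -/
def potPhi (P : Potential S) (Λ : Finset ℤ) (x : Conf S) : ℝ :=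
  Real.exp (-HPot P Λ x) / ∑ ζ : Λ → S, Real.exp (-HPot P Λ (ov x Λ ζ))

/-- `μ` is a Gibbs state for the potential `P`. -/
def IsGibbsPot (P : Potential S) (μ : Measure (Conf S)) : Prop :=
  IsProbabilityMeasure μ ∧ GibbsCond (potPhi P) μ

/-- `(T,μ)` is Bernoulli: the shift on `(S^ℤ, μ)` is measure-theoretically isomorphic
(mod 0) to the shift on `A^ℤ` carrying an i.i.d. product probability measure for some
finite alphabet `A` (wlog `A = Fin m`). -/
def IsBernoulliSystem (μ : Measure (Conf S)) : Prop :=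
  ∃ (m : ℕ) (p : Fin m → ENNReal) (ν : Measure (ℤ → Fin m)),
    IsProbabilityMeasure ν ∧ (∑ a, p a = 1) ∧
    (∀ (Λ : Finset ℤ) (ζ : Λ → Fin m),
      ν {y : ℤ → Fin m | ∀ i : Λ, y ↑i = ζ i} = ∏ i : Λ, p (ζ i)) ∧
    ∃ (θ : Conf S → ℤ → Fin m) (θinv : (ℤ → Fin m) → Conf S),
      Measurable θ ∧ Measurable θinv ∧ μ.map θ = ν ∧
      (∀ᵐ x ∂μ, θ (shift 1 x) = fun i => θ x (i + 1)) ∧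
      (∀ᵐ x ∂μ, θinv (θ x) = x) ∧ (∀ᵐ y ∂ν, θ (θinv y) = y)

/-- The recursively defined quantities `p_k^{(n)}` of Lemma 3.3 (`k = -1` is encoded
by any negative argument). -/
def pSeq (v : ℕ → ℝ) : ℕ → ℤ → ℝ
  | 0, k => if k < 0 then 1 else v 0
  | n + 1, k =>
    if k < 0 then 1
    else v k.toNat * pSeq v n (k - 1) +
      ∑ j ∈ Finset.Ico k.toNat (n + 1), (v (j + 1) - v j) * pSeq v n (j : ℤ)

set_option linter.unusedSectionVars false

section Words

variable {A B : Type} [Fintype A] [Fintype B]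

/-- The finite set of words of length `n`. -/
def wd (A : Type) [Fintype A] : ℕ → Finset (List A)
  | 0 => {[]}
  | n + 1 => ((Finset.univ : Finset A) ×ˢ wd A n).map
      ⟨fun p => p.1 :: p.2, fun p q h => by
        simp only [List.cons.injEq] at h
        exact Prod.ext h.1 h.2⟩

@[simp] lemma mem_wd {n : ℕ} {w : List A} : w ∈ wd A n ↔ w.length = n := by
  induction n generalizing w with
  | zero => simp [wd]
  | succ n ih =>
    cases w with
    | nil => simp [wd]
    | cons a w =>
      rw [List.length_cons, Nat.add_right_cancel_iff, ← ih, wd, Finset.mem_map]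
      constructor
      · rintro ⟨⟨b, v⟩, h, h'⟩
        obtain ⟨rfl, rfl⟩ := List.cons.inj h'
        exact (Finset.mem_product.1 h).2
      · exact fun h => ⟨(a, w), by simp [h], rfl⟩

lemma sum_wd_zero (F : List A → ℝ) : ∑ w ∈ wd A 0, F w = F [] := by simp [wd]

lemma sum_wd_succ (n : ℕ) (F : List A → ℝ) :
    ∑ w ∈ wd A (n + 1), F w = ∑ a, ∑ w ∈ wd A n, F (a :: w) := by
  rw [wd, Finset.sum_map, Finset.sum_product]; rfl

lemma sum_wd_add (m n : ℕ) (F : List A → ℝ) :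
    ∑ w ∈ wd A (m + n), F w = ∑ u ∈ wd A m, ∑ v ∈ wd A n, F (u ++ v) := by
  induction m generalizing F with
  | zero => simp [sum_wd_zero]
  | succ m ih =>
    rw [show m + 1 + n = (m + n) + 1 by ring, sum_wd_succ, sum_wd_succ]
    exact Finset.sum_congr rfl fun a _ => ih _

lemma sum_wd_one (F : List A → ℝ) : ∑ w ∈ wd A 1, F w = ∑ a, F [a] := by
  rw [sum_wd_succ]; simp [sum_wd_zero]

lemma sum_wd_snoc (n : ℕ) (F : List A → ℝ) :
    ∑ w ∈ wd A (n + 1), F w = ∑ w ∈ wd A n, ∑ a, F (w ++ [a]) := by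
  rw [sum_wd_add]
  exact Finset.sum_congr rfl fun a _ => sum_wd_one _

/-- A stationary process with strictly positive cylinder probabilities. -/
structure Proc (A : Type) [Fintype A] where
  P : List A → ℝ
  pos : ∀ w, 0 < P w
  nil : P [] = 1
  snoc : ∀ w, ∑ a, P (w ++ [a]) = P w
  cons : ∀ w, ∑ a, P (a :: w) = P w

/-- Conditional probability of the word `z` given the past `u`. -/
def Proc.law (p : Proc A) (u z : List A) : ℝ := p.P (u ++ z) / p.P u

namespace Proc

variable (p : Proc A)

lemma law_pos (u z : List A) : 0 < p.law u z := div_pos (p.pos _) (p.pos _)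

lemma law_nonneg (u z : List A) : 0 ≤ p.law u z := (p.law_pos u z).le

@[simp] lemma law_nil (u : List A) : p.law u [] = 1 := by
  simp [law, (p.pos u).ne']

lemma law_nil_left (z : List A) : p.law [] z = p.P z := by simp [law, p.nil]

lemma law_append (u z w : List A) : p.law u (z ++ w) = p.law u z * p.law (u ++ z) w := by
  have h1 := (p.pos u).ne'
  have h2 := (p.pos (u ++ z)).ne'
  simp only [law, List.append_assoc]
  field_simp

lemma law_cons (u w : List A) (a : A) :
    p.law u (a :: w) = p.law u [a] * p.law (u ++ [a]) w := p.law_append u [a] w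

lemma sum_P_append (w : List A) (n : ℕ) : ∑ v ∈ wd A n, p.P (w ++ v) = p.P w := by
  induction n with
  | zero => simp [sum_wd_zero]
  | succ n ih =>
    rw [sum_wd_snoc, ← ih]
    refine Finset.sum_congr rfl fun v _ => ?_
    simpa using p.snoc (w ++ v)

lemma sum_P_prepend (w : List A) (n : ℕ) : ∑ v ∈ wd A n, p.P (v ++ w) = p.P w := by
  induction n with
  | zero => simp [sum_wd_zero]
  | succ n ih =>
    rw [sum_wd_succ, Finset.sum_comm, ← ih]
    refine Finset.sum_congr rfl fun v _ => ?_
    simpa using p.cons (v ++ w)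

lemma sum_law (u : List A) (n : ℕ) : ∑ z ∈ wd A n, p.law u z = 1 := by
  simp only [law]
  rw [← Finset.sum_div, sum_P_append, div_self (p.pos u).ne']

lemma sum_law_one (u : List A) : ∑ a, p.law u [a] = 1 := by
  rw [← sum_wd_one (fun w => p.law u w), sum_law]

lemma sum_P (n : ℕ) : ∑ z ∈ wd A n, p.P z = 1 := by
  simpa [law_nil_left] using p.sum_law [] n

lemma law_le_one (u z : List A) : p.law u z ≤ 1 := by
  rw [← p.sum_law u z.length]
  exact Finset.single_le_sum (f := fun z => p.law u z) (fun z _ => p.law_nonneg u z) (by simp)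

/-- Splitting the expectation of a function of `m + n` symbols. -/
lemma sum_law_add (u : List A) (m n : ℕ) (F : List A → ℝ) :
    ∑ z ∈ wd A (m + n), p.law u z * F z =
      ∑ x ∈ wd A m, p.law u x * ∑ y ∈ wd A n, p.law (u ++ x) y * F (x ++ y) := by
  rw [sum_wd_add]
  refine Finset.sum_congr rfl fun x _ => ?_
  rw [Finset.mul_sum]
  refine Finset.sum_congr rfl fun y _ => ?_
  rw [law_append]; ring

end Proc

end Words

section Couplings

variable {α β γ : Type}

/-- `κ` is a coupling of the weights `p` on `s` and `q` on `t`. -/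
structure IsCpl (s : Finset α) (t : Finset β) (κ : α → β → ℝ) (p : α → ℝ) (q : β → ℝ) :
    Prop where
  nonneg : ∀ x ∈ s, ∀ y ∈ t, 0 ≤ κ x y
  row : ∀ x ∈ s, ∑ y ∈ t, κ x y = p x
  col : ∀ y ∈ t, ∑ x ∈ s, κ x y = q y

/-- The expectation of `c` under `κ`. -/
def cost (s : Finset α) (t : Finset β) (κ c : α → β → ℝ) : ℝ :=
  ∑ x ∈ s, ∑ y ∈ t, κ x y * c x y

variable {s : Finset α} {t : Finset β} {u : Finset γ}

namespace IsCpl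

variable {κ κ₁ κ₂ : α → β → ℝ} {p p₁ p₂ : α → ℝ} {q q₁ q₂ : β → ℝ}

lemma add (h₁ : IsCpl s t κ₁ p₁ q₁) (h₂ : IsCpl s t κ₂ p₂ q₂) :
    IsCpl s t (fun x y => κ₁ x y + κ₂ x y) (fun x => p₁ x + p₂ x) (fun y => q₁ y + q₂ y) where
  nonneg x hx y hy := add_nonneg (h₁.nonneg x hx y hy) (h₂.nonneg x hx y hy)
  row x hx := by rw [Finset.sum_add_distrib, h₁.row x hx, h₂.row x hx]
  col y hy := by rw [Finset.sum_add_distrib, h₁.col y hy, h₂.col y hy]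

lemma smul (h : IsCpl s t κ p q) {a : ℝ} (ha : 0 ≤ a) :
    IsCpl s t (fun x y => a * κ x y) (fun x => a * p x) (fun y => a * q y) where
  nonneg x hx y hy := mul_nonneg ha (h.nonneg x hx y hy)
  row x hx := by rw [← Finset.mul_sum, h.row x hx]
  col y hy := by rw [← Finset.mul_sum, h.col y hy]

lemma congr (h : IsCpl s t κ p q) (hp : ∀ x ∈ s, p x = p₁ x) (hq : ∀ y ∈ t, q y = q₁ y) :
    IsCpl s t κ p₁ q₁ :=
  ⟨h.nonneg, fun x hx => (h.row x hx).trans (hp x hx), fun y hy => (h.col y hy).trans (hq y hy)⟩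

lemma symm (h : IsCpl s t κ p q) : IsCpl t s (fun y x => κ x y) q p :=
  ⟨fun y hy x hx => h.nonneg x hx y hy, h.col, h.row⟩

lemma left_nonneg (h : IsCpl s t κ p q) : ∀ x ∈ s, 0 ≤ p x := fun x hx => by
  rw [← h.row x hx]; exact Finset.sum_nonneg fun y hy => h.nonneg x hx y hy

lemma right_nonneg (h : IsCpl s t κ p q) : ∀ y ∈ t, 0 ≤ q y := h.symm.left_nonneg

lemma le_left (h : IsCpl s t κ p q) {x : α} {y : β} (hx : x ∈ s) (hy : y ∈ t) : κ x y ≤ p x := by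
  rw [← h.row x hx]
  exact Finset.single_le_sum (f := fun y => κ x y) (fun y hy => h.nonneg x hx y hy) hy

lemma le_right (h : IsCpl s t κ p q) {x : α} {y : β} (hx : x ∈ s) (hy : y ∈ t) : κ x y ≤ q y :=
  h.symm.le_left hy hx

lemma sum_eq (h : IsCpl s t κ p q) : ∑ x ∈ s, p x = ∑ y ∈ t, q y := by
  rw [← Finset.sum_congr rfl h.row, ← Finset.sum_congr rfl h.col, Finset.sum_comm]

lemma cost_left (h : IsCpl s t κ p q) (F : α → ℝ) :
    cost s t κ (fun x _ => F x) = ∑ x ∈ s, p x * F x := by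
  refine Finset.sum_congr rfl fun x hx => ?_
  rw [← Finset.sum_mul, h.row x hx]

lemma cost_right (h : IsCpl s t κ p q) (F : β → ℝ) :
    cost s t κ (fun _ y => F y) = ∑ y ∈ t, q y * F y := by
  rw [cost, Finset.sum_comm]
  exact h.symm.cost_left F

lemma cost_mono (h : IsCpl s t κ p q) {c c' : α → β → ℝ}
    (hc : ∀ x ∈ s, ∀ y ∈ t, c x y ≤ c' x y) : cost s t κ c ≤ cost s t κ c' :=
  Finset.sum_le_sum fun x hx => Finset.sum_le_sum fun y hy =>
    mul_le_mul_of_nonneg_left (hc x hx y hy) (h.nonneg x hx y hy)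

lemma cost_const (h : IsCpl s t κ p q) (a : ℝ) :
    cost s t κ (fun _ _ => a) = (∑ x ∈ s, p x) * a := by
  rw [h.cost_left (fun _ => a), Finset.sum_mul]

lemma cost_nonneg (h : IsCpl s t κ p q) {c : α → β → ℝ}
    (hc : ∀ x ∈ s, ∀ y ∈ t, 0 ≤ c x y) : 0 ≤ cost s t κ c :=
  Finset.sum_nonneg fun x hx => Finset.sum_nonneg fun y hy =>
    mul_nonneg (h.nonneg x hx y hy) (hc x hx y hy)

lemma diag [DecidableEq α] (hp : ∀ x ∈ s, 0 ≤ p x) :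
    IsCpl s s (fun x y => if x = y then p x else 0) p p where
  nonneg x hx y _ := by split_ifs; exacts [hp x hx, le_rfl]
  row x hx := by simp [hx]
  col y hy := by simp [hy]

lemma prod (hp : ∀ x ∈ s, 0 ≤ p x) (hq : ∀ y ∈ t, 0 ≤ q y) (h : ∑ x ∈ s, p x = ∑ y ∈ t, q y) :
    IsCpl s t (fun x y => p x * q y / ∑ x ∈ s, p x) p q := by
  have key : ∀ {δ : Type} (r : Finset δ) (f : δ → ℝ), (∀ x ∈ r, 0 ≤ f x) → ∀ x ∈ r,
      f x * (∑ x ∈ r, f x) / (∑ x ∈ r, f x) = f x := by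
    intro δ r f hf x hx
    by_cases h0 : ∑ x ∈ r, f x = 0
    · rw [(Finset.sum_eq_zero_iff_of_nonneg hf).1 h0 x hx]; simp
    · field_simp
  refine ⟨fun x hx y hy => div_nonneg (mul_nonneg (hp x hx) (hq y hy)) (Finset.sum_nonneg hp),
    fun x hx => ?_, fun y hy => ?_⟩
  · rw [← Finset.sum_div, ← Finset.mul_sum, ← h, key s p hp x hx]
  · simp only [mul_comm (p _)]
    rw [← Finset.sum_div, ← Finset.mul_sum, h, key t q hq y hy]

/-- Gluing couplings along a common marginal. -/
lemma glue {κ' : β → γ → ℝ} {r : γ → ℝ} (h : IsCpl s t κ p q) (h' : IsCpl t u κ' q r) :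
    IsCpl s u (fun x z => ∑ y ∈ t, κ x y * κ' y z / q y) p r := by
  have h0 := h.right_nonneg
  refine ⟨fun x hx z hz => Finset.sum_nonneg fun y hy => div_nonneg
    (mul_nonneg (h.nonneg x hx y hy) (h'.nonneg y hy z hz)) (h0 y hy), fun x hx => ?_,
    fun z hz => ?_⟩
  · rw [Finset.sum_comm, ← h.row x hx]
    refine Finset.sum_congr rfl fun y hy => ?_
    rw [← Finset.sum_div, ← Finset.mul_sum, h'.row y hy]
    by_cases hq : q y = 0
    · have := h.le_right hx hy
      rw [hq] at this
      simp [le_antisymm this (h.nonneg x hx y hy)]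
    · field_simp
  · rw [Finset.sum_comm, ← h'.col z hz]
    refine Finset.sum_congr rfl fun y hy => ?_
    rw [← Finset.sum_div, ← Finset.sum_mul, h.col y hy]
    by_cases hq : q y = 0
    · have := h'.le_left hy hz
      rw [hq] at this
      simp [le_antisymm this (h'.nonneg y hy z hz)]
    · field_simp

lemma glue_cost {κ' : β → γ → ℝ} {r : γ → ℝ} (h : IsCpl s t κ p q) (h' : IsCpl t u κ' q r)
    {c : α → γ → ℝ} {c₁ : α → β → ℝ} {c₂ : β → γ → ℝ}
    (hc : ∀ x ∈ s, ∀ y ∈ t, ∀ z ∈ u, c x z ≤ c₁ x y + c₂ y z) :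
    cost s u (fun x z => ∑ y ∈ t, κ x y * κ' y z / q y) c ≤ cost s t κ c₁ + cost t u κ' c₂ := by
  have h0 := h.right_nonneg
  have e1 : ∀ x ∈ s, ∀ y ∈ t, ∑ z ∈ u, κ x y * κ' y z / q y = κ x y := by
    intro x hx y hy
    rw [← Finset.sum_div, ← Finset.mul_sum, h'.row y hy]
    by_cases hq : q y = 0
    · have := h.le_right hx hy
      rw [hq] at this
      simp [le_antisymm this (h.nonneg x hx y hy)]
    · field_simp
  have e2 : ∀ y ∈ t, ∀ z ∈ u, ∑ x ∈ s, κ x y * κ' y z / q y = κ' y z := by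
    intro y hy z hz
    rw [← Finset.sum_div, ← Finset.sum_mul, h.col y hy]
    by_cases hq : q y = 0
    · have := h'.le_left hy hz
      rw [hq] at this
      simp [le_antisymm this (h'.nonneg y hy z hz)]
    · field_simp
  calc cost s u (fun x z => ∑ y ∈ t, κ x y * κ' y z / q y) c
      = ∑ x ∈ s, ∑ z ∈ u, ∑ y ∈ t, κ x y * κ' y z / q y * c x z := by
        simp only [cost, Finset.sum_mul]
    _ ≤ ∑ x ∈ s, ∑ z ∈ u, ∑ y ∈ t,
          (κ x y * κ' y z / q y * c₁ x y + κ x y * κ' y z / q y * c₂ y z) := by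
        refine Finset.sum_le_sum fun x hx => Finset.sum_le_sum fun z hz =>
          Finset.sum_le_sum fun y hy => ?_
        rw [← mul_add]
        exact mul_le_mul_of_nonneg_left (hc x hx y hy z hz) (div_nonneg
          (mul_nonneg (h.nonneg x hx y hy) (h'.nonneg y hy z hz)) (h0 y hy))
    _ = (∑ x ∈ s, ∑ y ∈ t, (∑ z ∈ u, κ x y * κ' y z / q y) * c₁ x y) +
          ∑ y ∈ t, ∑ z ∈ u, (∑ x ∈ s, κ x y * κ' y z / q y) * c₂ y z := by
        simp only [Finset.sum_add_distrib, Finset.sum_mul]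
        congr 1
        · exact Finset.sum_congr rfl fun x _ => Finset.sum_comm
        · rw [Finset.sum_comm]
          conv_rhs => rw [Finset.sum_comm]
          exact Finset.sum_congr rfl fun z _ => Finset.sum_comm
    _ = _ := by
        congr 1
        · exact Finset.sum_congr rfl fun x hx => Finset.sum_congr rfl fun y hy => by
            rw [e1 x hx y hy]
        · exact Finset.sum_congr rfl fun y hy => Finset.sum_congr rfl fun z hz => by
            rw [e2 y hy z hz]

end IsCpl

lemma cost_add_fun {κ c c' : α → β → ℝ} :
    cost s t κ (fun x y => c x y + c' x y) = cost s t κ c + cost s t κ c' := by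
  simp only [cost, mul_add, Finset.sum_add_distrib]

lemma cost_mul_left {κ c : α → β → ℝ} (a : ℝ) :
    cost s t κ (fun x y => a * c x y) = a * cost s t κ c := by
  simp only [cost, Finset.mul_sum]
  exact Finset.sum_congr rfl fun x _ => Finset.sum_congr rfl fun y _ => by ring

lemma cost_add_cpl {κ κ' c : α → β → ℝ} :
    cost s t (fun x y => κ x y + κ' x y) c = cost s t κ c + cost s t κ' c := by
  simp only [cost, add_mul, Finset.sum_add_distrib]

lemma cost_smul_cpl {κ c : α → β → ℝ} (a : ℝ) :
    cost s t (fun x y => a * κ x y) c = a * cost s t κ c := by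
  simp only [cost, Finset.mul_sum, mul_assoc]

lemma cost_diag [DecidableEq α] {p : α → ℝ} {c : α → α → ℝ} (hc : ∀ x ∈ s, c x x = 0) :
    cost s s (fun x y => if x = y then p x else 0) c = 0 := by
  refine Finset.sum_eq_zero fun x hx => Finset.sum_eq_zero fun y _ => ?_
  dsimp only
  split_ifs with h
  · rw [← h, hc x hx, mul_zero]
  · simp

/-- If `p ≥ (1 - δ) q` then `p` and `q` can be coupled with little mass off the diagonal. -/
lemma exists_cpl_of_le [DecidableEq α] {p q : α → ℝ} {δ : ℝ} (hδ : 0 ≤ δ) (hδ1 : δ ≤ 1)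
    (hq : ∀ x ∈ s, 0 ≤ q x)
    (hp1 : ∑ x ∈ s, p x = 1) (hq1 : ∑ x ∈ s, q x = 1) (h : ∀ x ∈ s, (1 - δ) * q x ≤ p x) :
    ∃ κ, IsCpl s s κ p q ∧ cost s s κ (fun x y => if x = y then 0 else 1) ≤ δ := by
  have c1 := IsCpl.diag (s := s) (p := fun x => (1 - δ) * q x)
    (fun x hx => mul_nonneg (by linarith) (hq x hx))
  have c2 := IsCpl.prod (s := s) (t := s) (p := fun x => p x - (1 - δ) * q x)
    (q := fun x => δ * q x) (fun x hx => by linarith [h x hx])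
    (fun x hx => mul_nonneg hδ (hq x hx))
    (by rw [Finset.sum_sub_distrib, ← Finset.mul_sum, ← Finset.mul_sum, hp1, hq1]; ring)
  refine ⟨_, (c1.add c2).congr (fun x _ => by ring) (fun x _ => by ring), ?_⟩
  rw [cost_add_cpl, cost_diag (by simp), zero_add]
  refine (c2.cost_mono (c' := fun _ _ => 1) fun x _ y _ => by split_ifs <;> norm_num).trans ?_
  rw [c2.cost_const, Finset.sum_sub_distrib, ← Finset.mul_sum, hp1, hq1]
  linarith

end Couplings

section Concat

variable {A B : Type} [Fintype A] [Fintype B]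

/-- Concatenation of a coupling of initial segments with couplings of continuations. -/
def ccat (m : ℕ) (κ₁ : List A → List B → ℝ) (κ₂ : List A → List B → List A → List B → ℝ)
    (z : List A) (w : List B) : ℝ :=
  κ₁ (z.take m) (w.take m) * κ₂ (z.take m) (w.take m) (z.drop m) (w.drop m)

lemma ccat_append {m : ℕ} {κ₁ : List A → List B → ℝ}
    {κ₂ : List A → List B → List A → List B → ℝ} {x z : List A} {y w : List B}
    (hx : x.length = m) (hy : y.length = m) :
    ccat m κ₁ κ₂ (x ++ z) (y ++ w) = κ₁ x y * κ₂ x y z w := by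
  simp [ccat, ← hx, show x.length = y.length by omega]

lemma cost_ccat (m n : ℕ) (κ₁ : List A → List B → ℝ)
    (κ₂ : List A → List B → List A → List B → ℝ) (c : List A → List B → ℝ) :
    cost (wd A (m + n)) (wd B (m + n)) (ccat m κ₁ κ₂) c =
      cost (wd A m) (wd B m) κ₁ (fun x y => cost (wd A n) (wd B n) (κ₂ x y)
        (fun z w => c (x ++ z) (y ++ w))) := by
  simp only [cost]
  rw [sum_wd_add]
  refine Finset.sum_congr rfl fun x hx => ?_
  simp only [sum_wd_add m n (A := B)]
  rw [Finset.sum_comm]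
  refine Finset.sum_congr rfl fun y hy => ?_
  rw [Finset.mul_sum]
  refine Finset.sum_congr rfl fun z _ => ?_
  rw [Finset.mul_sum]
  refine Finset.sum_congr rfl fun w _ => ?_
  rw [ccat_append (mem_wd.1 hx) (mem_wd.1 hy), mul_assoc]

lemma IsCpl.ccat {m n : ℕ} {κ₁ : List A → List B → ℝ}
    {κ₂ : List A → List B → List A → List B → ℝ} {p₁ p : List A → ℝ} {q₁ q : List B → ℝ}
    {p₂ : List A → List A → ℝ} {q₂ : List B → List B → ℝ}
    (h₁ : IsCpl (wd A m) (wd B m) κ₁ p₁ q₁)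
    (h₂ : ∀ x ∈ wd A m, ∀ y ∈ wd B m, IsCpl (wd A n) (wd B n) (κ₂ x y) (p₂ x) (q₂ y))
    (hp : ∀ x ∈ wd A m, ∀ z ∈ wd A n, p (x ++ z) = p₁ x * p₂ x z)
    (hq : ∀ x ∈ wd B m, ∀ z ∈ wd B n, q (x ++ z) = q₁ x * q₂ x z) :
    IsCpl (wd A (m + n)) (wd B (m + n)) (ccat m κ₁ κ₂) p q := by
  have hsplit : ∀ {C : Type} (z : List C), z.length = m + n →
      ∃ x y, x.length = m ∧ y.length = n ∧ z = x ++ y := fun z hz =>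
    ⟨z.take m, z.drop m, by simp [hz], by simp [hz], by simp⟩
  refine ⟨fun z hz w hw => ?_, fun z hz => ?_, fun w hw => ?_⟩
  · obtain ⟨x, x', hx, hx', rfl⟩ := hsplit z (mem_wd.1 hz)
    obtain ⟨y, y', hy, hy', rfl⟩ := hsplit w (mem_wd.1 hw)
    rw [ccat_append hx hy]
    exact mul_nonneg (h₁.nonneg _ (by simpa) _ (by simpa))
      ((h₂ x (by simpa) y (by simpa)).nonneg _ (by simpa) _ (by simpa))
  · obtain ⟨x, x', hx, hx', rfl⟩ := hsplit z (mem_wd.1 hz)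
    rw [sum_wd_add, hp x (by simpa) x' (by simpa), ← h₁.row x (by simpa), Finset.sum_mul]
    refine Finset.sum_congr rfl fun y hy => ?_
    rw [← (h₂ x (by simpa) y hy).row x' (by simpa), Finset.mul_sum]
    exact Finset.sum_congr rfl fun y' _ => ccat_append hx (mem_wd.1 hy)
  · obtain ⟨y, y', hy, hy', rfl⟩ := hsplit w (mem_wd.1 hw)
    rw [sum_wd_add, hq y (by simpa) y' (by simpa), ← h₁.col y (by simpa), Finset.sum_mul]
    refine Finset.sum_congr rfl fun x hx => ?_
    rw [← (h₂ x hx y (by simpa)).col y' (by simpa), Finset.mul_sum]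
    exact Finset.sum_congr rfl fun x' _ => ccat_append (mem_wd.1 hx) hy

end Concat

section Ham

variable {A : Type} [Fintype A] [DecidableEq A]

/-- The number of mismatches between two words. -/
def ham : List A → List A → ℝ
  | a :: u, b :: v => (if a = b then 0 else 1) + ham u v
  | _, _ => 0

@[simp] lemma ham_nil_left (v : List A) : ham [] v = 0 := by cases v <;> rfl
@[simp] lemma ham_nil_right (v : List A) : ham v [] = 0 := by cases v <;> rfl
@[simp] lemma ham_cons (a b : A) (u v : List A) :
    ham (a :: u) (b :: v) = (if a = b then 0 else 1) + ham u v := rfl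

lemma ham_nonneg (u v : List A) : 0 ≤ ham u v := by
  induction u generalizing v with
  | nil => simp
  | cons a u ih => cases v with
    | nil => simp
    | cons b v => rw [ham_cons]; have := ih v; split_ifs <;> linarith

lemma ham_le (u v : List A) : ham u v ≤ u.length := by
  induction u generalizing v with
  | nil => simp
  | cons a u ih => cases v with
    | nil => simp; positivity
    | cons b v => rw [ham_cons]; have := ih v; push_cast [List.length_cons]; split_ifs <;> linarith

lemma ham_append {u v : List A} (h : u.length = v.length) (u' v' : List A) :
    ham (u ++ u') (v ++ v') = ham u v + ham u' v' := by
  induction u generalizing v with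
  | nil => obtain rfl := List.length_eq_zero_iff.1 h.symm; simp
  | cons a u ih => cases v with
    | nil => simp at h
    | cons b v => simp only [List.cons_append, ham_cons, ih (by simpa using h)]; ring

@[simp] lemma ham_self (u : List A) : ham u u = 0 := by
  induction u with
  | nil => simp
  | cons a u ih => simp [ih]

lemma ham_comm (u v : List A) : ham u v = ham v u := by
  induction u generalizing v with
  | nil => simp
  | cons a u ih => cases v with
    | nil => simp
    | cons b v => simp [ih v, eq_comm]

end Ham

section VWB

variable {A : Type} [Fintype A] [DecidableEq A] (p : Proc A)

/-- The conditional laws on `n` symbols given any two pasts can be coupled with at most `c`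
expected mismatches. -/
def Proc.Ebd (n : ℕ) (c : ℝ) : Prop :=
  ∀ u v, ∃ κ, IsCpl (wd A n) (wd A n) κ (p.law u) (p.law v) ∧ cost (wd A n) (wd A n) κ ham ≤ c

/-- Very weak Bernoulli, uniformly in the past. -/
def Proc.VWB : Prop := ∀ ε > 0, ∃ N₀ : ℕ, ∀ N ≥ N₀, p.Ebd N (ε * N)

variable {p}

lemma Proc.Ebd.mono {n : ℕ} {c d : ℝ} (h : p.Ebd n c) (hcd : c ≤ d) : p.Ebd n d := fun u v => by
  obtain ⟨κ, h1, h2⟩ := h u v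
  exact ⟨κ, h1, h2.trans hcd⟩

lemma cost_ham_ccat {m n : ℕ} {κ₁ : List A → List A → ℝ}
    {κ₂ : List A → List A → List A → List A → ℝ} {p₁ q₁ : List A → ℝ}
    {p₂ q₂ : List A → List A → ℝ} {g : List A → List A → ℝ}
    (h₁ : IsCpl (wd A m) (wd A m) κ₁ p₁ q₁)
    (h₂ : ∀ x ∈ wd A m, ∀ y ∈ wd A m, IsCpl (wd A n) (wd A n) (κ₂ x y) (p₂ x) (q₂ y))
    (hp : ∀ x ∈ wd A m, ∑ z ∈ wd A n, p₂ x z = 1)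
    (hc : ∀ x ∈ wd A m, ∀ y ∈ wd A m, cost (wd A n) (wd A n) (κ₂ x y) ham ≤ g x y) :
    cost (wd A (m + n)) (wd A (m + n)) (ccat m κ₁ κ₂) ham ≤
      cost (wd A m) (wd A m) κ₁ ham + cost (wd A m) (wd A m) κ₁ g := by
  rw [cost_ccat, ← cost_add_fun]
  refine h₁.cost_mono fun x hx y hy => ?_
  have e : cost (wd A n) (wd A n) (κ₂ x y) (fun z w => ham (x ++ z) (y ++ w)) =
      cost (wd A n) (wd A n) (κ₂ x y) (fun z w => ham x y + ham z w) := by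
    congr 1; ext z w
    exact ham_append ((mem_wd.1 hx).trans (mem_wd.1 hy).symm) _ _
  rw [e, cost_add_fun, (h₂ x hx y hy).cost_const, hp x hx, one_mul]
  linarith [hc x hx y hy]

lemma Proc.Ebd.add {m n : ℕ} {c d : ℝ} (h : p.Ebd m c) (h' : p.Ebd n d) :
    p.Ebd (m + n) (c + d) := fun u v => by
  obtain ⟨κ, h1, h2⟩ := h u v
  choose κ' h3 h4 using fun x y => h' (u ++ x) (v ++ y)
  refine ⟨ccat m κ κ', h1.ccat (fun x _ y _ => h3 x y) (fun x _ z _ => p.law_append u x z)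
    (fun x _ z _ => p.law_append v x z), ?_⟩
  refine (cost_ham_ccat (g := fun _ _ => d) h1 (fun x _ y _ => h3 x y)
    (fun x _ => p.sum_law _ _) fun x _ y _ => h4 x y).trans ?_
  rw [h1.cost_const, p.sum_law]
  linarith

lemma cost_ham_le {n : ℕ} {κ : List A → List A → ℝ} {P Q : List A → ℝ}
    (h : IsCpl (wd A n) (wd A n) κ P Q) :
    cost (wd A n) (wd A n) κ ham ≤ (∑ x ∈ wd A n, P x) * n := by
  rw [← h.cost_const]
  refine h.cost_mono fun x hx y _ => ?_
  have := ham_le x y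
  rwa [mem_wd.1 hx] at this

lemma Proc.ebd_self (n : ℕ) : p.Ebd n n := fun u v => by
  have h := IsCpl.prod (s := wd A n) (t := wd A n) (p := p.law u) (q := p.law v)
    (fun z _ => p.law_nonneg u z) (fun z _ => p.law_nonneg v z) (by rw [p.sum_law, p.sum_law])
  refine ⟨_, h, (cost_ham_le h).trans ?_⟩
  rw [p.sum_law, one_mul]

lemma Proc.Ebd.mul {b : ℕ} {c : ℝ} (h : p.Ebd b c) (n : ℕ) : p.Ebd (n * b) (n * c) := by
  induction n with
  | zero => simpa using p.ebd_self 0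
  | succ n ih =>
    rw [Nat.succ_mul]
    exact (ih.add h).mono (by push_cast; linarith)

/-- Reweighting the first marginal of a coupling by a density, at a cost controlled by the
variance of the density. -/
lemma exists_cpl_density_block {n : ℕ} {P Q ρ : List A → ℝ} {κ : List A → List A → ℝ} {c s m : ℝ}
    (h : IsCpl (wd A n) (wd A n) κ P Q) (hc : cost (wd A n) (wd A n) κ ham ≤ c)
    (hP : ∑ x ∈ wd A n, P x = 1) (hρ : ∀ x, 0 ≤ ρ x) (hs : 0 < s)
    (hm : ∑ x ∈ wd A n, P x * ρ x = m) :
    ∃ κ', IsCpl (wd A n) (wd A n) κ' (fun x => P x * ρ x) (fun y => m * Q y) ∧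
      cost (wd A n) (wd A n) κ' ham ≤
        m * c + n / 2 * (s / 2 + (∑ x ∈ wd A n, P x * ρ x ^ 2 - m ^ 2) / (2 * s)) := by
  have hP0 := h.left_nonneg
  have hm0 : 0 ≤ m := hm ▸ Finset.sum_nonneg fun x hx => mul_nonneg (hP0 x hx) (hρ x)
  have hQ : ∑ x ∈ wd A n, Q x = 1 := h.sum_eq ▸ hP
  set κa : List A → List A → ℝ := fun x y => κ x y * min (ρ x) m with hκa
  have ha : IsCpl (wd A n) (wd A n) κa (fun x => P x * min (ρ x) m)
      (fun y => ∑ x ∈ wd A n, κa x y) :=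
    ⟨fun x hx y hy => mul_nonneg (h.nonneg x hx y hy) (le_min (hρ x) hm0),
      fun x hx => by rw [← h.row x hx, Finset.sum_mul], fun y _ => rfl⟩
  have hle : ∀ y ∈ wd A n, ∑ x ∈ wd A n, κa x y ≤ m * Q y := fun y hy => by
    rw [← h.col y hy, Finset.mul_sum]
    refine Finset.sum_le_sum fun x hx => ?_
    rw [hκa, mul_comm m]
    exact mul_le_mul_of_nonneg_left (min_le_right _ _) (h.nonneg x hx y hy)
  have hb := IsCpl.prod (s := wd A n) (t := wd A n)
    (p := fun x => P x * (ρ x - min (ρ x) m)) (q := fun y => m * Q y - ∑ x ∈ wd A n, κa x y)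
    (fun x hx => mul_nonneg (hP0 x hx) (sub_nonneg.2 (min_le_left _ _)))
    (fun y hy => sub_nonneg.2 (hle y hy))
    (by
      rw [Finset.sum_sub_distrib, ← Finset.mul_sum, hQ, ← ha.sum_eq, ← hm]
      simp only [mul_sub, Finset.sum_sub_distrib]; ring)
  refine ⟨_, (ha.add hb).congr (fun x _ => by ring) (fun y _ => by ring), ?_⟩
  rw [cost_add_cpl]
  refine add_le_add ?_ ((cost_ham_le hb).trans ?_)
  · refine le_trans ?_ (mul_le_mul_of_nonneg_left hc hm0)
    rw [← cost_smul_cpl]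
    refine Finset.sum_le_sum fun x hx => Finset.sum_le_sum fun y hy =>
      mul_le_mul_of_nonneg_right ?_ (ham_nonneg _ _)
    change κ x y * min (ρ x) m ≤ m * κ x y
    rw [mul_comm m]
    exact mul_le_mul_of_nonneg_left (min_le_right _ _) (h.nonneg x hx y hy)
  · have key : ∑ x ∈ wd A n, P x * (ρ x - min (ρ x) m) ≤
        ∑ x ∈ wd A n, P x * ((ρ x - m) / 2 + s / 4 + (ρ x - m) ^ 2 / (4 * s)) := by
      refine Finset.sum_le_sum fun x hx => mul_le_mul_of_nonneg_left ?_ (hP0 x hx)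
      have e : (ρ x - m) / 2 + s / 4 + (ρ x - m) ^ 2 / (4 * s) =
        (ρ x - m + s) ^ 2 / (4 * s) := by field_simp; ring
      rw [e]
      rcases le_total (ρ x) m with h' | h'
      · rw [min_eq_left h', sub_self]; positivity
      · rw [min_eq_right h', le_div_iff₀ (by positivity)]
        nlinarith [sq_nonneg (ρ x - m - s)]
    have e2 : ∑ x ∈ wd A n, P x * ((ρ x - m) / 2 + s / 4 + (ρ x - m) ^ 2 / (4 * s)) =
        (s / 2 + (∑ x ∈ wd A n, P x * ρ x ^ 2 - m ^ 2) / (2 * s)) / 2 := by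
      have : ∀ x, P x * ((ρ x - m) / 2 + s / 4 + (ρ x - m) ^ 2 / (4 * s)) =
        (P x * ρ x) * (1 / 2 - m / (2 * s)) + P x * (s / 4 - m / 2 + m ^ 2 / (4 * s)) +
          P x * ρ x ^ 2 * (1 / (4 * s)) := fun x => by field_simp; ring
      simp only [this, Finset.sum_add_distrib, ← Finset.sum_mul, hP, hm]
      field_simp; ring
    rw [e2] at key
    have hn : (0 : ℝ) ≤ n := Nat.cast_nonneg _
    nlinarith [mul_le_mul_of_nonneg_right key hn]

lemma Proc.Ebd.exists_cpl_density {b : ℕ} {c s : ℝ} (h : p.Ebd b c) (hs : 0 < s) (n : ℕ) :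
    ∀ (u v : List A) (ρ : List A → ℝ), (∀ z, 0 ≤ ρ z) → ∀ m,
      ∑ z ∈ wd A (n * b), p.law u z * ρ z = m →
      ∃ κ, IsCpl (wd A (n * b)) (wd A (n * b)) κ (fun z => p.law u z * ρ z)
          (fun z => m * p.law v z) ∧
        cost (wd A (n * b)) (wd A (n * b)) κ ham ≤ m * (n * c) + b / 2 *
          (n * s / 2 + (∑ z ∈ wd A (n * b), p.law u z * ρ z ^ 2 - m ^ 2) / (2 * s)) := by
  induction n with
  | zero =>
    intro u v ρ hρ m hm
    simp only [Nat.zero_mul, sum_wd_zero, Proc.law_nil, one_mul] at hm ⊢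
    refine ⟨fun _ _ => m, ⟨fun _ _ _ _ => hm ▸ hρ _, fun x hx => ?_, fun x hx => ?_⟩, ?_⟩
    · obtain rfl := List.length_eq_zero_iff.1 (mem_wd.1 hx)
      simp [wd, hm]
    · obtain rfl := List.length_eq_zero_iff.1 (mem_wd.1 hx)
      simp [wd]
    · simp [cost, sum_wd_zero, hm]
  | succ n ih =>
    intro u v ρ hρ m hm
    rw [Nat.succ_mul, add_comm (n * b) b] at hm ⊢
    set ρ₁ : List A → ℝ := fun x => ∑ y ∈ wd A (n * b), p.law (u ++ x) y * ρ (x ++ y) with hρ₁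
    have hρ₁0 : ∀ x, 0 ≤ ρ₁ x := fun x =>
      Finset.sum_nonneg fun y _ => mul_nonneg (p.law_nonneg _ _) (hρ _)
    rw [p.sum_law_add] at hm
    obtain ⟨κ₀, hκ₀, hc₀⟩ := h u v
    obtain ⟨κ₁, hκ₁, hc₁⟩ := exists_cpl_density_block hκ₀ hc₀ (p.sum_law _ _) hρ₁0 hs hm
    set R : List A → ℝ := fun x => ∑ y ∈ wd A (n * b), p.law (u ++ x) y * ρ (x ++ y) ^ 2 with hR
    have hex : ∀ x y, ∃ κ, IsCpl (wd A (n * b)) (wd A (n * b)) κ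
        (fun z => if ρ₁ x = 0 then p.law (u ++ x) z else p.law (u ++ x) z * ρ (x ++ z) / ρ₁ x)
        (p.law (v ++ y)) ∧ ρ₁ x * cost (wd A (n * b)) (wd A (n * b)) κ ham ≤
          ρ₁ x * (n * c) + b / 2 * (n * s / 2 + (R x - ρ₁ x ^ 2) / (2 * s)) := by
      intro x y
      by_cases h0 : ρ₁ x = 0
      · obtain ⟨κ, h1, h2⟩ := p.ebd_self (n * b) (u ++ x) (v ++ y)
        refine ⟨κ, by simpa [h0] using h1, ?_⟩
        have : 0 ≤ R x := Finset.sum_nonneg fun y _ => mul_nonneg (p.law_nonneg _ _) (sq_nonneg _)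
        rw [h0]
        simp only [zero_mul, zero_add]
        have : 0 ≤ (R x - 0 ^ 2) / (2 * s) := div_nonneg (by simpa) (by positivity)
        positivity
      · have hpos : 0 < ρ₁ x := lt_of_le_of_ne (hρ₁0 x) (Ne.symm h0)
        obtain ⟨κ, h1, h2⟩ := ih (u ++ x) (v ++ y) (fun z => ρ (x ++ z)) (fun z => hρ _) (ρ₁ x) rfl
        refine ⟨fun z w => (ρ₁ x)⁻¹ * κ z w, (h1.smul (inv_nonneg.2 hpos.le)).congr
          (fun z _ => by simp only [h0, if_false]; ring) (fun z _ => by field_simp), ?_⟩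
        rw [cost_smul_cpl, mul_inv_cancel_left₀ h0]
        exact h2
    choose κ₂ h₂ hc₂ using hex
    refine ⟨ccat b κ₁ κ₂, hκ₁.ccat (fun x _ y _ => h₂ x y) (fun x _ z hz => ?_)
      (fun x _ z _ => by rw [p.law_append]; ring), ?_⟩
    · rw [p.law_append]
      split_ifs with h0
      · have := (Finset.sum_eq_zero_iff_of_nonneg (fun y _ =>
          mul_nonneg (p.law_nonneg (u ++ x) y) (hρ (x ++ y)))).1 h0 z hz
        rw [h0, mul_assoc, this]; ring
      · have h0' : ∑ y ∈ wd A (n * b), p.law (u ++ x) y * ρ (x ++ y) ≠ 0 := h0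
        simp only [hρ₁]
        field_simp
    · have hsum : ∀ x ∈ wd A b, ∑ z ∈ wd A (n * b), (if ρ₁ x = 0 then p.law (u ++ x) z else
          p.law (u ++ x) z * ρ (x ++ z) / ρ₁ x) = 1 := fun x _ => by
        rw [(h₂ x x).sum_eq, p.sum_law]
      refine (cost_ham_ccat hκ₁ (fun x _ y _ => h₂ x y) hsum (fun x _ y _ => le_rfl)).trans ?_
      have e1 : cost (wd A b) (wd A b) κ₁ (fun x y => cost (wd A (n * b)) (wd A (n * b)) (κ₂ x y) ham)
          ≤ ∑ x ∈ wd A b, p.law u x *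
            (ρ₁ x * (n * c) + b / 2 * (n * s / 2 + (R x - ρ₁ x ^ 2) / (2 * s))) := by
        refine Finset.sum_le_sum fun x hx => ?_
        by_cases h0 : ρ₁ x = 0
        · have z0 : ∑ y ∈ wd A b, κ₁ x y * cost (wd A (n * b)) (wd A (n * b)) (κ₂ x y) ham = 0 := by
            refine Finset.sum_eq_zero fun y hy => ?_
            have h1 := hκ₁.le_left hx hy
            rw [h0, mul_zero] at h1
            rw [le_antisymm h1 (hκ₁.nonneg x hx y hy), zero_mul]
          rw [z0]
          refine mul_nonneg (p.law_nonneg _ _) ?_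
          have h3 := hc₂ x x
          rw [h0, zero_mul] at h3
          rwa [h0]
        · have hpos : 0 < ρ₁ x := lt_of_le_of_ne (hρ₁0 x) (Ne.symm h0)
          set T := ρ₁ x * (n * c) + b / 2 * (n * s / 2 + (R x - ρ₁ x ^ 2) / (2 * s)) with hT
          calc ∑ y ∈ wd A b, κ₁ x y * cost (wd A (n * b)) (wd A (n * b)) (κ₂ x y) ham
              ≤ ∑ y ∈ wd A b, κ₁ x y * (T / ρ₁ x) := by
                refine Finset.sum_le_sum fun y hy => mul_le_mul_of_nonneg_left ?_
                  (hκ₁.nonneg x hx y hy)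
                rw [le_div_iff₀ hpos, mul_comm]
                exact hc₂ x y
            _ = p.law u x * T := by
                rw [← Finset.sum_mul, hκ₁.row x hx]; field_simp
      have e2 : ∑ x ∈ wd A b, p.law u x *
            (ρ₁ x * (n * c) + b / 2 * (n * s / 2 + (R x - ρ₁ x ^ 2) / (2 * s))) =
          m * (n * c) + b / 2 * (n * s / 2 + ((∑ x ∈ wd A b, p.law u x * R x) -
            ∑ x ∈ wd A b, p.law u x * ρ₁ x ^ 2) / (2 * s)) := by
        have : ∀ x, p.law u x *
            (ρ₁ x * (n * c) + b / 2 * (n * s / 2 + (R x - ρ₁ x ^ 2) / (2 * s))) =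
          (p.law u x * ρ₁ x) * (n * c) + p.law u x * (b / 2 * (n * s / 2)) +
          (p.law u x * R x) * (b / 2 * (1 / (2 * s))) -
            (p.law u x * ρ₁ x ^ 2) * (b / 2 * (1 / (2 * s))) := fun x => by
          field_simp; ring
        simp only [this, Finset.sum_add_distrib, Finset.sum_sub_distrib, ← Finset.sum_mul, p.sum_law]
        rw [hm]
        field_simp; ring
      have e3 : ∑ z ∈ wd A (b + n * b), p.law u z * ρ z ^ 2 = ∑ x ∈ wd A b, p.law u x * R x := by
        rw [p.sum_law_add]
      rw [e3]
      rw [e2] at e1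
      refine (add_le_add hc₁ e1).trans (le_of_eq ?_)
      push_cast
      field_simp
      ring

end VWB

section Overlap

variable {A : Type} [Fintype A] [DecidableEq A] {p : Proc A}

/-- The words `u` and `v` share their last `k` symbols. -/
def Agr (k : ℕ) (u v : List A) : Prop :=
  ∃ u' v' w : List A, w.length = k ∧ u = u' ++ w ∧ v = v' ++ w

lemma agr_zero (u v : List A) : Agr 0 u v := ⟨u, v, [], rfl, by simp, by simp⟩

lemma Agr.append {k : ℕ} {u v : List A} (h : Agr k u v) (z : List A) :
    Agr (k + z.length) (u ++ z) (v ++ z) := by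
  obtain ⟨u', v', w, hw, rfl, rfl⟩ := h
  exact ⟨u', v', w ++ z, by simp [hw], by simp, by simp⟩

lemma Agr.symm {k : ℕ} {u v : List A} (h : Agr k u v) : Agr k v u := by
  obtain ⟨u', v', w, hw, rfl, rfl⟩ := h
  exact ⟨v', u', w, hw, rfl, rfl⟩

/-- As `Proc.Ebd`, but only for pasts sharing their last `k` symbols. -/
def Proc.EbdK (p : Proc A) (k n : ℕ) (c : ℝ) : Prop :=
  ∀ u v, Agr k u v → ∃ κ, IsCpl (wd A n) (wd A n) κ (p.law u) (p.law v) ∧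
    cost (wd A n) (wd A n) κ ham ≤ c

lemma Proc.Ebd.ebdK {n : ℕ} {c : ℝ} (h : p.Ebd n c) (k : ℕ) : p.EbdK k n c := fun u v _ => h u v

lemma exists_cpl_stage {m N k : ℕ} {e₁ e₂ o r : ℝ} {u v : List A} {κ : List A → List A → ℝ}
    (huv : Agr k u v) (h₁ : p.EbdK (k + m) N e₁) (h₂ : p.Ebd N e₂) (h12 : e₁ ≤ e₂) (ho : 0 ≤ o)
    (hκ : IsCpl (wd A m) (wd A m) κ (fun z => p.law u z - o * p.law v z)
      (fun z => (1 - o) * p.law v z))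
    (hr : cost (wd A m) (wd A m) κ ham ≤ r) :
    ∃ κ', IsCpl (wd A (m + N)) (wd A (m + N)) κ' (p.law u) (p.law v) ∧
      cost (wd A (m + N)) (wd A (m + N)) κ' ham ≤ r + (o * e₁ + (1 - o) * e₂) := by
  have hex : ∀ x y, ∃ κ, IsCpl (wd A N) (wd A N) κ (p.law (u ++ x)) (p.law (v ++ y)) ∧
      (x ∈ wd A m → cost (wd A N) (wd A N) κ ham ≤ if x = y then e₁ else e₂) := by
    intro x y
    by_cases hx : x ∈ wd A m
    · by_cases hxy : x = y
      · subst hxy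
        have := huv.append x
        rw [mem_wd.1 hx] at this
        obtain ⟨κ, h, h'⟩ := h₁ _ _ this
        exact ⟨κ, h, fun _ => by simpa using h'⟩
      · obtain ⟨κ, h, h'⟩ := h₂ (u ++ x) (v ++ y)
        exact ⟨κ, h, fun _ => by simpa [hxy] using h'⟩
    · obtain ⟨κ, h, h'⟩ := h₂ (u ++ x) (v ++ y)
      exact ⟨κ, h, fun h => absurd h hx⟩
  choose κ₂ h3 h4 using hex
  have hd := IsCpl.diag (s := wd A m) (p := fun x => o * p.law v x)
    (fun x _ => mul_nonneg ho (p.law_nonneg _ _))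
  have h5 : IsCpl (wd A m) (wd A m) _ (p.law u) (p.law v) :=
    (hd.add hκ).congr (fun x _ => by ring) (fun x _ => by ring)
  refine ⟨_, h5.ccat (fun x _ y _ => h3 x y) (fun x _ z _ => p.law_append u x z)
    (fun x _ z _ => p.law_append v x z), ?_⟩
  refine (cost_ham_ccat h5 (fun x _ y _ => h3 x y)
    (fun x _ => p.sum_law _ _) fun x hx y _ => h4 x y hx).trans ?_
  rw [cost_add_cpl, cost_add_cpl, cost_diag (by simp), zero_add]
  refine add_le_add hr (add_le_add ?_ ?_)
  · have h6 : cost (wd A m) (wd A m) (fun x y => if x = y then o * p.law v x else 0)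
        (fun x y => if x = y then e₁ else e₂) =
        cost (wd A m) (wd A m) (fun x y => if x = y then o * p.law v x else 0) fun _ _ => e₁ :=
      Finset.sum_congr rfl fun x _ => Finset.sum_congr rfl fun y _ => by
        dsimp only; split_ifs <;> simp
    rw [h6, hd.cost_const, ← Finset.mul_sum, p.sum_law, mul_one]
  · refine (hκ.cost_mono (c' := fun _ _ => e₂) fun x _ y _ => ?_).trans ?_
    · split_ifs; exacts [h12, le_rfl]
    · rw [hκ.cost_const, Finset.sum_sub_distrib, ← Finset.mul_sum, p.sum_law, p.sum_law, mul_one]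

lemma Proc.pow_le_law {c : ℝ} (hc : 0 ≤ c) (h : ∀ u a, c ≤ p.law u [a]) (u z : List A) :
    c ^ z.length ≤ p.law u z := by
  induction z generalizing u with
  | nil => simp
  | cons a z ih =>
    rw [p.law_cons, List.length_cons, pow_succ, mul_comm]
    exact mul_le_mul (h u a) (ih _) (by positivity) (p.law_nonneg _ _)

lemma exists_cpl_residual {b n : ℕ} {D ε o : ℝ} (hE : p.Ebd b ((D + ε) * b)) (hε : 0 < ε)
    (ho : 0 ≤ o) (hn : 1 ≤ 3 * ε ^ 2 * n) (u v : List A)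
    (hov : ∀ z ∈ wd A (n * b), o * p.law v z ≤ p.law u z) :
    ∃ κ, IsCpl (wd A (n * b)) (wd A (n * b)) κ (fun z => p.law u z - o * p.law v z)
      (fun z => (1 - o) * p.law v z) ∧
      cost (wd A (n * b)) (wd A (n * b)) κ ham ≤ ((1 - o) * D + 2 * ε) * (n * b : ℕ) := by
  have hρ : ∀ z ∈ wd A (n * b), p.law u z * max 0 (1 - o * p.law v z / p.law u z) =
      p.law u z - o * p.law v z := by
    intro z hz
    have hpz := p.law_pos u z
    rw [max_eq_right]
    · field_simp
    · rw [sub_nonneg, div_le_one hpz]; exact hov z hz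
  obtain ⟨κ, hκ, hκc⟩ := hE.exists_cpl_density (s := ε) hε n u v
    (fun z => max 0 (1 - o * p.law v z / p.law u z)) (fun z => le_max_left _ _) (1 - o) (by
      rw [Finset.sum_congr rfl hρ, Finset.sum_sub_distrib, ← Finset.mul_sum, p.sum_law,
        p.sum_law, mul_one])
  refine ⟨κ, hκ.congr hρ (fun _ _ => rfl), hκc.trans ?_⟩
  have hsq : ∑ z ∈ wd A (n * b), p.law u z * max 0 (1 - o * p.law v z / p.law u z) ^ 2 ≤ 1 := by
    refine le_of_le_of_eq (Finset.sum_le_sum fun z _ =>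
      mul_le_of_le_one_right (p.law_nonneg _ _) ?_) (p.sum_law u (n * b))
    refine pow_le_one₀ (le_max_left _ _) (max_le zero_le_one ?_)
    have : 0 ≤ o * p.law v z / p.law u z :=
      div_nonneg (mul_nonneg ho (p.law_nonneg _ _)) (p.law_nonneg _ _)
    linarith
  generalize ∑ z ∈ wd A (n * b), p.law u z * max 0 (1 - o * p.law v z / p.law u z) ^ 2 = T at hsq ⊢
  have h1 : (T - (1 - o) ^ 2) / (2 * ε) ≤ 3 / 2 * (n * ε) := by
    rw [div_le_iff₀ (by positivity)]
    nlinarith [sq_nonneg (1 - o)]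
  have h4 : (b : ℝ) / 2 * (n * ε / 2 + (T - (1 - o) ^ 2) / (2 * ε)) ≤
      b / 2 * (n * ε / 2 + 3 / 2 * (n * ε)) := by gcongr
  have h6 : 0 ≤ o * ε * (n * b) := by positivity
  push_cast
  calc _ ≤ (1 - o) * (n * ((D + ε) * b)) + b / 2 * (n * ε / 2 + 3 / 2 * (n * ε)) :=
        add_le_add le_rfl h4
    _ ≤ _ := by ring_nf; ring_nf at h6; linarith

/-- Multiscale bound: pasts sharing more symbols have a better bound on the mismatch. -/
lemma ebdK_of_overlap {t b l N : ℕ} {D ε o N1 : ℝ} (hE : p.Ebd b ((D + ε) * b)) (hε : 0 < ε)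
    (ho : 0 ≤ o) (hl : 1 ≤ l) (hlo : 1 ≤ (l + 1) * o)
    (ht : 1 ≤ 3 * ε ^ 2 * t)
    (hov : ∀ k ≥ t * b, ∀ u v, Agr k u v → ∀ z ∈ wd A (l * k), o * p.law v z ≤ p.law u z)
    (hN : ∀ N' < N, p.Ebd N' (((1 - o) * D + 3 * ε) * N' + N1)) (d q : ℕ) (hq : 1 ≤ q) (N' : ℕ)
    (hN' : N' < N) (hle : (l + 1) ^ d * (q * (t * b)) ≤ q * (t * b) + N') :
    p.EbdK (q * (t * b)) N'
      (((1 - o) * D + 3 * ε) * N' + N1 - ε * d * (q * (t * b) : ℕ)) := by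
  induction d generalizing q N' with
  | zero => simpa using (hN N' hN').ebdK _
  | succ d ih =>
    set k := q * (t * b) with hk
    have hpow : 1 ≤ (l + 1) ^ d := Nat.one_le_pow _ _ (by omega)
    have h1 : (l + 1) ^ d * (l * k + k) ≤ k + N' := by
      calc _ = (l + 1) ^ (d + 1) * k := by ring
        _ ≤ _ := hle
    have h2 : l * k + k ≤ k + N' := (Nat.le_mul_of_pos_left _ hpow).trans h1
    obtain ⟨M, rfl⟩ : ∃ M, N' = l * k + M := ⟨N' - l * k, by omega⟩
    intro u v huv
    have htk : t * b ≤ k := Nat.le_mul_of_pos_left _ hq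
    have hnb : l * k = l * q * t * b := by rw [hk]; ring
    obtain ⟨κ, hκ, hκc⟩ := exists_cpl_residual hE hε ho (n := l * q * t) (by
      have : (t : ℝ) ≤ (l * q * t : ℕ) := by
        exact_mod_cast Nat.le_mul_of_pos_left t (Nat.mul_pos hl hq)
      exact ht.trans (by gcongr)) u v (by rw [← hnb]; exact hov k htk u v huv)
    rw [← hnb] at hκ hκc
    have hEq : (l + 1) * q * (t * b) = k + l * k := by rw [hk]; ring
    have h3 := ih ((l + 1) * q) (Nat.mul_pos (by omega) hq) M (by omega) (by
      rw [hEq, add_comm k]; omega)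
    rw [hEq] at h3
    obtain ⟨κ', hκ', hc'⟩ := exists_cpl_stage huv h3 (hN M (by omega)) (by
      have : 0 ≤ ε * d * (k + l * k : ℕ) := by positivity
      linarith) ho hκ hκc
    refine ⟨κ', hκ', hc'.trans ?_⟩
    push_cast
    have h4 : 0 ≤ ε * d * k * ((l + 1) * o - 1) :=
      mul_nonneg (by positivity) (by linarith)
    have h5 : (k : ℝ) ≤ l * k := by
      have : (1 : ℝ) ≤ l := by exact_mod_cast hl
      exact le_mul_of_one_le_left (Nat.cast_nonneg _) this
    have h6 := mul_le_mul_of_nonneg_left h5 hε.le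
    nlinarith

/-- Overlap of the conditional laws across geometrically growing scales improves the asymptotic
mismatch rate by a factor `1 - o`. -/
lemma Proc.exists_ebd_improve {c o D : ℝ} {l K : ℕ} (hc : 0 < c) (hc1 : ∀ u a, c ≤ p.law u [a])
    (hl : 1 ≤ l) (ho : 0 < o) (ho1 : o ≤ 1) (hlo : 1 ≤ (l + 1) * o) (hD : 0 ≤ D)
    (hov : ∀ k ≥ K, ∀ u v, Agr k u v → ∀ z ∈ wd A (l * k), o * p.law v z ≤ p.law u z)
    (hgood : ∀ η > 0, ∃ b ≥ 1, p.Ebd b ((D + η) * b)) :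
    ∀ η > 0, ∃ b ≥ 1, p.Ebd b (((1 - o) * D + η) * b) := by
  intro η hη
  obtain ⟨ε, hε, rfl⟩ : ∃ ε > 0, η = 4 * ε := ⟨η / 4, by positivity, by ring⟩
  obtain ⟨b, hb, hE⟩ := hgood ε hε
  obtain ⟨t, ht⟩ := exists_nat_gt (1 / (3 * ε ^ 2) + K + 1)
  have hfrac : 0 ≤ 1 / (3 * ε ^ 2) := by positivity
  have hK0 : (0 : ℝ) ≤ K := Nat.cast_nonneg _
  have ht1 : 1 ≤ t := by
    have : (1 : ℝ) ≤ t := by linarith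
    exact_mod_cast this
  have htK : K ≤ t := by
    have : (K : ℝ) ≤ t := by linarith
    exact_mod_cast this
  have hte : 1 ≤ 3 * ε ^ 2 * t := by
    have := (div_le_iff₀ (by positivity)).1 (show 1 / (3 * ε ^ 2) ≤ t by linarith)
    linarith
  set c' := (1 - o) * D + 3 * ε with hc'
  have hc'0 : 0 ≤ c' := by have : 0 ≤ (1 - o) * D := mul_nonneg (by linarith) hD; linarith
  set K0 := t * b with hK0def
  have hK01 : 1 ≤ K0 := Nat.mul_pos ht1 hb
  set o' := min 1 (c ^ K0) with ho'
  have ho'0 : 0 < o' := lt_min one_pos (by positivity)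
  obtain ⟨J, hJ⟩ := exists_nat_gt (1 / (o' * ε))
  have hJ' : 1 ≤ o' * ε * J := by
    have := (div_lt_iff₀ (by positivity)).1 hJ
    linarith
  set N1 := K0 + (l + 1) ^ J * K0 with hN1
  have main : ∀ N : ℕ, p.Ebd N (c' * N + N1) := by
    intro N
    induction N using Nat.strong_induction_on with
    | _ N ihN =>
    by_cases hNN : N < N1
    · refine (p.ebd_self N).mono ?_
      have : (N : ℝ) ≤ N1 := by exact_mod_cast hNN.le
      have : 0 ≤ c' * N := by positivity
      linarith
    push Not at hNN
    obtain ⟨M, rfl⟩ : ∃ M, N = K0 + M := ⟨N - K0, by omega⟩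
    have hst := ebdK_of_overlap hE hε ho.le hl hlo hte (fun k hk => hov k
      (htK.trans ((Nat.le_mul_of_pos_right _ hb).trans hk))) ihN J 1 le_rfl M (by omega) (by
        rw [one_mul, ← hK0def]; omega)
    rw [one_mul, ← hK0def, ← hc'] at hst
    intro u v
    have hres := IsCpl.prod (s := wd A K0) (t := wd A K0)
      (p := fun z => p.law u z - o' * p.law v z) (q := fun z => (1 - o') * p.law v z)
      (fun z hz => by
        have h1 : o' ≤ p.law u z := by
          have := p.pow_le_law hc.le hc1 u z
          rw [mem_wd.1 hz] at this
          exact (min_le_right _ _).trans this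
        have h2 : o' * p.law v z ≤ o' := mul_le_of_le_one_right ho'0.le (p.law_le_one _ _)
        linarith)
      (fun z _ => mul_nonneg (by have := min_le_left 1 (c ^ K0); linarith) (p.law_nonneg _ _))
      (by rw [Finset.sum_sub_distrib, ← Finset.mul_sum, ← Finset.mul_sum, p.sum_law, p.sum_law]; ring)
    have hrc : cost (wd A K0) (wd A K0) _ ham ≤ (1 - o') * K0 := (hres.cost_mono
      (c' := fun _ _ => (K0 : ℝ)) fun x hx y _ => by
        have := ham_le x y; rwa [mem_wd.1 hx] at this).trans (by
      rw [hres.cost_const, Finset.sum_sub_distrib, ← Finset.mul_sum, p.sum_law, p.sum_law, mul_one])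
    obtain ⟨κ, hκ, hκc⟩ := exists_cpl_stage (agr_zero u v) (by rwa [zero_add])
      (ihN M (by omega)) (by
        have : 0 ≤ ε * J * K0 := by positivity
        linarith) ho'0.le hres hrc
    refine ⟨κ, hκ, hκc.trans ?_⟩
    push_cast
    have h1 : (K0 : ℝ) * 1 ≤ K0 * (o' * ε * J) := by gcongr
    have h2 : 0 ≤ c' * K0 := by positivity
    have h3 : 0 ≤ o' * K0 := by positivity
    nlinarith
  obtain ⟨N, hN⟩ := exists_nat_gt (N1 / ε + 1)
  have hN0 : (0 : ℝ) ≤ N1 / ε := by positivity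
  refine ⟨N, ?_, (main N).mono ?_⟩
  · have : (1 : ℝ) ≤ N := by linarith
    exact_mod_cast this
  · have : (N1 : ℝ) ≤ ε * N := by
      have := (div_le_iff₀ hε).1 (show (N1 : ℝ) / ε ≤ N by linarith)
      linarith
    rw [hc']; nlinarith

lemma Proc.VWB.of_good (h : ∀ η > 0, ∃ b ≥ 1, p.Ebd b (η * b)) : p.VWB := by
  intro ε hε
  obtain ⟨b, hb, hE⟩ := h (ε / 2) (by positivity)
  obtain ⟨N₀, hN₀⟩ := exists_nat_gt (2 * b / ε)
  refine ⟨N₀, fun N hN => ?_⟩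
  have h1 := (hE.mul (N / b)).add (p.ebd_self (N % b))
  rw [Nat.div_add_mod' N b] at h1
  refine h1.mono ?_
  have h2 : ((N / b * b : ℕ) : ℝ) ≤ N := by exact_mod_cast Nat.div_mul_le_self N b
  have h3 : ((N % b : ℕ) : ℝ) ≤ b := by exact_mod_cast (Nat.mod_lt N hb).le
  have h4 : (N₀ : ℝ) ≤ N := by exact_mod_cast hN
  have h5 := (div_lt_iff₀ hε).1 (hN₀.trans_le h4)
  push_cast at h2
  nlinarith

/-- A process whose conditional laws overlap across scales is very weak Bernoulli. -/
theorem Proc.vwb_of_overlap {c o : ℝ} {l K : ℕ} (hc : 0 < c) (hc1 : ∀ u a, c ≤ p.law u [a])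
    (hl : 1 ≤ l) (ho : 0 < o) (ho1 : o ≤ 1) (hlo : 1 ≤ (l + 1) * o)
    (hov : ∀ k ≥ K, ∀ u v, Agr k u v → ∀ z ∈ wd A (l * k), o * p.law v z ≤ p.law u z) :
    p.VWB := by
  have h : ∀ n : ℕ, ∀ η > 0, ∃ b ≥ 1, p.Ebd b (((1 - o) ^ n + η) * b) := by
    intro n
    induction n with
    | zero =>
      intro η hη
      exact ⟨1, le_rfl, (p.ebd_self 1).mono (by simp; linarith)⟩
    | succ n ih =>
      rw [pow_succ']
      exact p.exists_ebd_improve hc hc1 hl ho ho1 hlo (pow_nonneg (by linarith) n) hov ih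
  refine .of_good fun η hη => ?_
  obtain ⟨n, hn⟩ := exists_pow_lt_of_lt_one (half_pos hη) (show 1 - o < 1 by linarith)
  obtain ⟨b, hb, hE⟩ := h n (η / 2) (by positivity)
  exact ⟨b, hb, hE.mono (by gcongr; linarith)⟩

end Overlap

section WindowSums

variable {A : Type} [Fintype A] [DecidableEq A]

lemma Agr.mono {k r : ℕ} {u v : List A} (h : Agr k u v) (hr : r ≤ k) : Agr r u v := by
  obtain ⟨u', v', w, hw, rfl, rfl⟩ := h
  exact ⟨u' ++ w.take (k - r), v' ++ w.take (k - r), w.drop (k - r), by simp [hw]; omega,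
    by simp, by simp⟩

lemma Agr.snoc {k : ℕ} {u v : List A} (h : Agr k u v) (a : A) :
    Agr (k + 1) (u ++ [a]) (v ++ [a]) := h.append [a]

/-- The sum along `z` of a function of the past, starting from the past `u`. -/
def wsum (F : List A → ℝ) : List A → List A → ℝ
  | _, [] => 0
  | u, a :: z => F u + wsum F (u ++ [a]) z

lemma wsum_append (F : List A → ℝ) (u z w : List A) :
    wsum F u (z ++ w) = wsum F u z + wsum F (u ++ z) w := by
  induction z generalizing u with
  | nil => simp [wsum]
  | cons a z ih => simp [wsum, ih, add_assoc]

/-- Window sums depend on the word in a way controlled by the Hamming distance. -/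
lemma wsum_sub_le {F : List A → ℝ} {C η : ℝ} {R : ℕ} (h0 : ∀ w, 0 ≤ F w) (hC : ∀ w, F w ≤ C)
    (hη : 0 ≤ η) (hF : ∀ u v, Agr R u v → F u - F v ≤ η) (z z' : List A)
    (hlen : z.length = z'.length) (r : ℕ) (u v : List A) (huv : Agr r u v) :
    wsum F u z - wsum F v z' ≤ η * z.length + C * ((R - r : ℕ) + R * ham z z') := by
  have hC0 : 0 ≤ C := (h0 []).trans (hC [])
  induction z generalizing z' r u v with
  | nil =>
    obtain rfl : z' = [] := List.length_eq_zero_iff.1 hlen.symm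
    simp only [wsum, sub_self, List.length_nil, ham_self, CharP.cast_eq_zero, mul_zero, zero_add,
      add_zero]
    positivity
  | cons a z ih =>
    obtain _ | ⟨b, z'⟩ := z'
    · simp at hlen
    have hlen' : z.length = z'.length := by simpa using hlen
    rw [wsum, wsum, ham_cons, List.length_cons]
    push_cast
    by_cases hab : a = b
    · subst hab
      have h1 := ih z' hlen' (r + 1) _ _ (huv.snoc a)
      simp only [if_true, zero_add]
      rcases le_or_gt R r with hr | hr
      · have h2 := hF u v (huv.mono hr)
        rw [Nat.sub_eq_zero_of_le hr]
        rw [Nat.sub_eq_zero_of_le (by omega)] at h1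
        linarith
      · have h2 : ((R - r : ℕ) : ℝ) = (R - (r + 1) : ℕ) + 1 := by
          rw [← Nat.cast_succ]; congr 1; omega
        rw [h2]
        have := h0 v
        have := hC u
        nlinarith
    · have h1 := ih z' hlen' 0 (u ++ [a]) (v ++ [b]) (agr_zero _ _)
      simp only [if_neg hab, Nat.sub_zero] at h1 ⊢
      rcases le_or_gt R r with hr | hr
      · have h2 := hF u v (huv.mono hr)
        rw [Nat.sub_eq_zero_of_le hr]
        push_cast
        nlinarith
      · have h2 : (1 : ℝ) ≤ (R - r : ℕ) := by
          have : 1 ≤ R - r := by omega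
          exact_mod_cast this
        have := h0 v
        have := hC u
        nlinarith

lemma wsum_nonneg {F : List A → ℝ} (h0 : ∀ w, 0 ≤ F w) (u z : List A) : 0 ≤ wsum F u z := by
  induction z generalizing u with
  | nil => simp [wsum]
  | cons a z ih => exact add_nonneg (h0 _) (ih _)

lemma wsum_le {F : List A → ℝ} {C : ℝ} (h0 : ∀ w, F w ≤ C) (u z : List A) :
    wsum F u z ≤ C * z.length := by
  induction z generalizing u with
  | nil => simp [wsum]
  | cons a z ih =>
    rw [wsum, List.length_cons]; push_cast
    linarith [h0 u, ih (u ++ [a])]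

end WindowSums

section Entropy

variable {A : Type} [Fintype A] [DecidableEq A] {p : Proc A}

/-- The properties of the processes considered: conditional probabilities bounded below and
asymptotically independent of the remote past, and very weak Bernoulli. -/
structure Proc.Nice (p : Proc A) : Prop where
  lb : ∃ c > 0, ∀ u a, c ≤ p.law u [a]
  cont : ∀ N : ℕ, ∀ δ > 0, ∃ R : ℕ, ∀ u v, Agr R u v → ∀ z ∈ wd A N,
    (1 - δ) * p.law v z ≤ p.law u z
  vwb : p.VWB

/-- The entropy of the next `n` symbols given the past `u`. -/
def Proc.ent (p : Proc A) (n : ℕ) (u : List A) : ℝ :=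
  ∑ z ∈ wd A n, p.law u z * (-Real.log (p.law u z))

lemma Proc.neg_log_law_nonneg (u z : List A) : 0 ≤ -Real.log (p.law u z) := by
  have := Real.log_nonpos (p.law_nonneg u z) (p.law_le_one u z)
  linarith

lemma Proc.ent_nonneg (n : ℕ) (u : List A) : 0 ≤ p.ent n u :=
  Finset.sum_nonneg fun _ _ => mul_nonneg (p.law_nonneg _ _) (p.neg_log_law_nonneg _ _)

lemma Proc.neg_log_law_append (u z w : List A) : -Real.log (p.law u (z ++ w)) =
    -Real.log (p.law u z) + -Real.log (p.law (u ++ z) w) := by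
  rw [p.law_append, Real.log_mul (p.law_pos _ _).ne' (p.law_pos _ _).ne']; ring

lemma Proc.ent_add (m n : ℕ) (u : List A) :
    p.ent (m + n) u = p.ent m u + ∑ x ∈ wd A m, p.law u x * p.ent n (u ++ x) := by
  rw [ent, ent, p.sum_law_add, ← Finset.sum_add_distrib]
  refine Finset.sum_congr rfl fun x _ => ?_
  rw [← mul_add]
  congr 1
  simp only [p.neg_log_law_append, mul_add, Finset.sum_add_distrib, ent]
  rw [← Finset.sum_mul, p.sum_law, one_mul]

@[simp] lemma Proc.ent_zero (u : List A) : p.ent 0 u = 0 := by simp [ent, sum_wd_zero]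

lemma Proc.sum_law_wsum_ent (n : ℕ) (u : List A) :
    ∑ z ∈ wd A n, p.law u z * wsum (p.ent 1) u z = p.ent n u := by
  induction n generalizing u with
  | zero => simp [sum_wd_zero, wsum]
  | succ n ih =>
    rw [add_comm n 1, p.sum_law_add, p.ent_add, sum_wd_one, sum_wd_one]
    have : ∀ a, ∑ y ∈ wd A n, p.law (u ++ [a]) y * wsum (p.ent 1) u ([a] ++ y) =
        p.ent 1 u + p.ent n (u ++ [a]) := by
      intro a
      simp only [List.singleton_append, wsum, mul_add, Finset.sum_add_distrib, ih]
      rw [← Finset.sum_mul, p.sum_law, one_mul]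
    simp only [this, mul_add, Finset.sum_add_distrib]
    rw [← Finset.sum_mul, p.sum_law_one, one_mul]

lemma Proc.ent_one (u : List A) : p.ent 1 u = ∑ a, Real.negMulLog (p.law u [a]) := by
  rw [ent, sum_wd_one]
  exact Finset.sum_congr rfl fun a _ => by rw [Real.negMulLog]; ring

lemma Proc.neg_log_law_le {c : ℝ} (hc : 0 < c) (h : ∀ u a, c ≤ p.law u [a]) (u z : List A) :
    -Real.log (p.law u z) ≤ -Real.log c * z.length := by
  have h1 := Real.log_le_log (by positivity) (p.pow_le_law hc.le h u z)
  rw [Real.log_pow] at h1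
  linarith

lemma Proc.ent_le {c : ℝ} (hc : 0 < c) (h : ∀ u a, c ≤ p.law u [a]) (n : ℕ) (u : List A) :
    p.ent n u ≤ -Real.log c * n := by
  calc p.ent n u ≤ ∑ z ∈ wd A n, p.law u z * (-Real.log c * n) := by
        refine Finset.sum_le_sum fun z hz => mul_le_mul_of_nonneg_left ?_ (p.law_nonneg _ _)
        have := p.neg_log_law_le hc h u z
        rwa [mem_wd.1 hz] at this
    _ = _ := by rw [← Finset.sum_mul, p.sum_law, one_mul]

lemma Proc.Nice.ent_one_cont (hp : p.Nice) {η : ℝ} (hη : 0 < η) :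
    ∃ R : ℕ, ∀ u v, Agr R u v → p.ent 1 u - p.ent 1 v ≤ η := by
  have hu : UniformContinuousOn Real.negMulLog (Icc 0 1) :=
    isCompact_Icc.uniformContinuousOn_of_continuous Real.continuous_negMulLog.continuousOn
  rw [Metric.uniformContinuousOn_iff] at hu
  obtain ⟨δ, hδ, hu⟩ := hu (η / (Fintype.card A + 1)) (by positivity)
  obtain ⟨R, hR⟩ := hp.cont 1 (δ / 2) (by positivity)
  refine ⟨R, fun u v huv => ?_⟩
  rw [p.ent_one, p.ent_one, ← Finset.sum_sub_distrib]
  have : ∀ a, Real.negMulLog (p.law u [a]) - Real.negMulLog (p.law v [a]) ≤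
      η / (Fintype.card A + 1) := by
    intro a
    refine (le_abs_self _).trans (hu _ ⟨p.law_nonneg _ _, p.law_le_one _ _⟩ _
      ⟨p.law_nonneg _ _, p.law_le_one _ _⟩ ?_).le
    have h1 := hR u v huv [a] (by simp)
    have h2 := hR v u huv.symm [a] (by simp)
    have h3 := p.law_le_one u [a]
    have h4 := p.law_le_one v [a]
    rw [Real.dist_eq, abs_lt]
    constructor <;> nlinarith
  refine (Finset.sum_le_sum fun a _ => this a).trans ?_
  rw [Finset.sum_const, Finset.card_univ, nsmul_eq_mul, mul_div_assoc', div_le_iff₀ (by positivity)]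
  nlinarith

lemma Proc.Nice.ent_osc (hp : p.Nice) {η : ℝ} (hη : 0 < η) :
    ∃ N₀ : ℕ, ∀ N ≥ N₀, ∀ u v, p.ent N u - p.ent N v ≤ η * N := by
  obtain ⟨c, hc, hlb⟩ := hp.lb
  obtain ⟨R, hR⟩ := hp.ent_one_cont (half_pos hη)
  set C := -Real.log c with hC
  have hent : ∀ u, p.ent 1 u ≤ C := fun u => by simpa using p.ent_le hc hlb 1 u
  have hC0 : 0 ≤ C := (p.ent_nonneg 1 []).trans (hent [])
  set ε := η / (4 * (C * R + 1)) with hε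
  have hε0 : 0 < ε := by positivity
  obtain ⟨N₀, hN₀⟩ := hp.vwb ε hε0
  obtain ⟨N₁, hN₁⟩ := exists_nat_gt (4 * (C * R) / η)
  refine ⟨max N₀ N₁, fun N hN u v => ?_⟩
  obtain ⟨κ, hκ, hκc⟩ := hN₀ N (le_of_max_le_left hN) u v
  have h1 : cost (wd A N) (wd A N) κ (fun z _ => wsum (p.ent 1) u z) ≤
      cost (wd A N) (wd A N) κ (fun z z' => wsum (p.ent 1) v z' +
        (η / 2 * N + C * R + C * R * ham z z')) := by
    refine hκ.cost_mono fun z hz z' hz' => ?_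
    have := wsum_sub_le (fun w => p.ent_nonneg 1 w) hent (half_pos hη).le hR z z'
      ((mem_wd.1 hz).trans (mem_wd.1 hz').symm) 0 u v (agr_zero _ _)
    rw [mem_wd.1 hz, Nat.sub_zero] at this
    linarith
  rw [hκ.cost_left (wsum (p.ent 1) u), cost_add_fun, cost_add_fun,
    hκ.cost_right (wsum (p.ent 1) v), cost_mul_left, hκ.cost_const, p.sum_law,
    p.sum_law_wsum_ent, p.sum_law_wsum_ent] at h1
  have h2 : C * R * cost (wd A N) (wd A N) κ ham ≤ η / 4 * N := by
    calc _ ≤ C * R * (ε * N) := by gcongr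
      _ ≤ (C * R + 1) * (ε * N) := by gcongr; linarith
      _ = η / 4 * N := by rw [hε]; field_simp
  have h3 : (N₁ : ℝ) ≤ N := by exact_mod_cast le_of_max_le_right hN
  have h4 := (div_lt_iff₀ hη).1 (hN₁.trans_le h3)
  linarith

lemma Proc.Nice.exists_entropy (hp : p.Nice) :
    ∃ h : ℝ, ∀ η > 0, ∃ N₀ : ℕ, ∀ N ≥ N₀, ∀ u, |p.ent N u - h * N| ≤ η * N := by
  obtain ⟨c, hc, hlb⟩ := hp.lb
  have hbdd : ∀ n, BddAbove (range (p.ent n)) := fun n =>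
    ⟨-Real.log c * n, by rintro _ ⟨u, rfl⟩; exact p.ent_le hc hlb n u⟩
  have hle : ∀ n u, p.ent n u ≤ ⨆ u, p.ent n u := fun n u => le_ciSup (hbdd n) u
  have hsub : Subadditive fun n => ⨆ u, p.ent n u := by
    intro m n
    refine ciSup_le fun u => ?_
    rw [p.ent_add]
    refine add_le_add (hle m u) ?_
    calc _ ≤ ∑ x ∈ wd A m, p.law u x * ⨆ u, p.ent n u :=
          Finset.sum_le_sum fun x _ => mul_le_mul_of_nonneg_left (hle _ _) (p.law_nonneg _ _)
      _ = _ := by rw [← Finset.sum_mul, p.sum_law, one_mul]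
  have hlim := hsub.tendsto_lim ⟨0, by
    rintro _ ⟨n, rfl⟩
    exact div_nonneg ((p.ent_nonneg n []).trans (hle n [])) (Nat.cast_nonneg _)⟩
  refine ⟨hsub.lim, fun η hη => ?_⟩
  obtain ⟨N₀, hN₀⟩ := hp.ent_osc (half_pos hη)
  obtain ⟨N₁, hN₁⟩ := (Metric.tendsto_atTop.1 hlim) (η / 2) (by positivity)
  refine ⟨max (max N₀ N₁) 1, fun N hN u => ?_⟩
  have hN0 : N₀ ≤ N := by omega
  have hN1 : N₁ ≤ N := by omega
  have hNpos : (0 : ℝ) < N := by exact_mod_cast (by omega : 0 < N)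
  have h1 := hN₁ N hN1
  rw [Real.dist_eq, abs_lt] at h1
  have h2 : (⨆ u, p.ent N u) ≤ p.ent N u + η / 2 * N :=
    ciSup_le fun v => by linarith [hN₀ N hN0 v u]
  have h3 := hle N u
  have h4 : (⨆ u, p.ent N u) / N * N = ⨆ u, p.ent N u := by field_simp
  rw [abs_le]
  constructor <;> nlinarith [mul_lt_mul_of_pos_right h1.1 hNpos, mul_lt_mul_of_pos_right h1.2 hNpos]

/-- Second moment bound for the information in `n` blocks of length `b`. -/
lemma Proc.sum_law_sq_le {b : ℕ} {h η C : ℝ} (hη : 0 ≤ η) (hh : 0 ≤ h) (hhC : h ≤ C)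
    (hC : ∀ u z, -Real.log (p.law u z) ≤ C * z.length)
    (hb : ∀ u, |p.ent b u - h * b| ≤ η * b) (n : ℕ) (u : List A) :
    ∑ z ∈ wd A (n * b), p.law u z * (-Real.log (p.law u z) - h * (n * b : ℕ)) ^ 2 ≤
      n * (C * b) ^ 2 + n ^ 2 * (C * b * (η * b)) ∧
    |∑ z ∈ wd A (n * b), p.law u z * (-Real.log (p.law u z) - h * (n * b : ℕ))| ≤ n * (η * b) := by
  have hC0 : 0 ≤ C := hh.trans hhC
  induction n generalizing u with
  | zero => simp [sum_wd_zero]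
  | succ n ih =>
    set X : List A → ℝ := fun x => -Real.log (p.law u x) - h * b with hX
    set Y : List A → List A → ℝ := fun x y => -Real.log (p.law (u ++ x) y) - h * (n * b : ℕ) with hY
    have hXY : ∀ x y, -Real.log (p.law u (x ++ y)) - h * ((n + 1) * b : ℕ) = X x + Y x y := by
      intro x y
      rw [p.neg_log_law_append, hX, hY]; push_cast; ring
    have hXb : ∀ x ∈ wd A b, |X x| ≤ C * b := by
      intro x hx
      have h1 := hC u x
      rw [mem_wd.1 hx] at h1
      have h2 := p.neg_log_law_nonneg u x
      have h3 : h * b ≤ C * b := by gcongr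
      have h4 : 0 ≤ h * b := by positivity
      rw [abs_le]; constructor <;> simp only [hX] <;> linarith
    have hXs : |∑ x ∈ wd A b, p.law u x * X x| ≤ η * b := by
      have : ∑ x ∈ wd A b, p.law u x * X x = p.ent b u - h * b := by
        simp only [hX, mul_sub, Finset.sum_sub_distrib, ent]
        rw [← Finset.sum_mul, p.sum_law, one_mul]
      rw [this]; exact hb u
    have hE : ∀ {K : ℝ} {f : List A → ℝ}, (∀ x ∈ wd A b, |f x| ≤ K) →
        |∑ x ∈ wd A b, p.law u x * f x| ≤ K := by
      intro K f hf
      calc _ ≤ ∑ x ∈ wd A b, |p.law u x * f x| := Finset.abs_sum_le_sum_abs _ _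
        _ ≤ ∑ x ∈ wd A b, p.law u x * K := Finset.sum_le_sum fun x hx => by
            rw [abs_mul, abs_of_nonneg (p.law_nonneg _ _)]
            exact mul_le_mul_of_nonneg_left (hf x hx) (p.law_nonneg _ _)
        _ = K := by rw [← Finset.sum_mul, p.sum_law, one_mul]
    have hY2 := fun x => (ih (u ++ x)).1
    have hY1 := fun x => (ih (u ++ x)).2
    rw [show (n + 1) * b = b + n * b by ring, p.sum_law_add, p.sum_law_add]
    rw [show b + n * b = (n + 1) * b by ring]
    simp only [hXY]
    have e1 : ∀ x, ∑ y ∈ wd A (n * b), p.law (u ++ x) y * (X x + Y x y) =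
        X x + ∑ y ∈ wd A (n * b), p.law (u ++ x) y * Y x y := by
      intro x
      simp only [mul_add, Finset.sum_add_distrib]
      rw [← Finset.sum_mul, p.sum_law, one_mul]
    have e2 : ∀ x, ∑ y ∈ wd A (n * b), p.law (u ++ x) y * (X x + Y x y) ^ 2 =
        X x ^ 2 + 2 * (X x * ∑ y ∈ wd A (n * b), p.law (u ++ x) y * Y x y) +
          ∑ y ∈ wd A (n * b), p.law (u ++ x) y * Y x y ^ 2 := by
      intro x
      have : ∀ y, p.law (u ++ x) y * (X x + Y x y) ^ 2 = p.law (u ++ x) y * X x ^ 2 +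
          2 * X x * (p.law (u ++ x) y * Y x y) + p.law (u ++ x) y * Y x y ^ 2 := fun y => by ring
      simp only [this, Finset.sum_add_distrib]
      rw [← Finset.sum_mul, p.sum_law, one_mul, ← Finset.mul_sum, mul_assoc]
    have hn : (0 : ℝ) ≤ n := Nat.cast_nonneg _
    have hbb : (0 : ℝ) ≤ b := Nat.cast_nonneg _
    constructor
    · simp only [e2]
      have hbd : ∀ x ∈ wd A b, X x ^ 2 +
          2 * (X x * ∑ y ∈ wd A (n * b), p.law (u ++ x) y * Y x y) +
          ∑ y ∈ wd A (n * b), p.law (u ++ x) y * Y x y ^ 2 ≤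
          (C * b) ^ 2 + 2 * (C * b * (n * (η * b))) +
            (n * (C * b) ^ 2 + n ^ 2 * (C * b * (η * b))) := by
        intro x hx
        have h1 : X x ^ 2 ≤ (C * b) ^ 2 := sq_le_sq' (abs_le.1 (hXb x hx)).1 (abs_le.1 (hXb x hx)).2
        have h2 : X x * ∑ y ∈ wd A (n * b), p.law (u ++ x) y * Y x y ≤ C * b * (n * (η * b)) := by
          refine (le_abs_self _).trans ?_
          rw [abs_mul]
          exact mul_le_mul (hXb x hx) (hY1 x) (abs_nonneg _) (by positivity)
        have h3 := hY2 x
        simp only [hY]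
        simp only [hY] at h2
        linarith
      refine (Finset.sum_le_sum fun x hx =>
        mul_le_mul_of_nonneg_left (hbd x hx) (p.law_nonneg _ _)).trans ?_
      rw [← Finset.sum_mul, p.sum_law, one_mul]
      push_cast
      have : 0 ≤ C * b * (η * b) := by positivity
      nlinarith
    · simp only [e1]
      simp only [mul_add _ (X _), Finset.sum_add_distrib]
      refine (abs_add_le _ _).trans ?_
      have : |∑ x ∈ wd A b, p.law u x * ∑ y ∈ wd A (n * b), p.law (u ++ x) y * Y x y| ≤
          n * (η * b) := hE fun x _ => hY1 x
      push_cast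
      linarith

/-- Asymptotic equipartition, uniformly in the past. -/
theorem Proc.Nice.exists_aep (hp : p.Nice) : ∃ h : ℝ, 0 ≤ h ∧
    (∀ η > 0, ∃ N₀ : ℕ, ∀ N ≥ N₀, ∀ u, |p.ent N u - h * N| ≤ η * N) ∧
    ∀ δ > 0, ∃ N₀ : ℕ, ∀ N ≥ N₀, ∀ u,
      ∑ z ∈ (wd A N).filter (fun z => δ * N < |-Real.log (p.law u z) - h * N|), p.law u z ≤ δ := by
  obtain ⟨c, hc, hlb⟩ := hp.lb
  obtain ⟨h, hh⟩ := hp.exists_entropy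
  have hC := p.neg_log_law_le hc hlb
  set C := -Real.log c with hCdef
  have hC0 : 0 ≤ C := (p.ent_nonneg 1 []).trans (by simpa using p.ent_le hc hlb 1 [])
  have hh0 : 0 ≤ h := by
    by_contra hneg
    push Not at hneg
    obtain ⟨N₀, hN₀⟩ := hh (-h / 2) (by linarith)
    have h1 := (abs_le.1 (hN₀ (N₀ + 1) (by omega) [])).2
    have h2 := p.ent_nonneg (N₀ + 1) []
    have h3 : (0 : ℝ) < (N₀ + 1 : ℕ) := by positivity
    nlinarith
  have hhC : h ≤ C := by
    by_contra hneg
    push Not at hneg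
    obtain ⟨N₀, hN₀⟩ := hh ((h - C) / 2) (by linarith)
    have h1 := (abs_le.1 (hN₀ (N₀ + 1) (by omega) [])).1
    have h2 := p.ent_le hc hlb (N₀ + 1) []
    have h3 : (0 : ℝ) < (N₀ + 1 : ℕ) := by positivity
    nlinarith
  refine ⟨h, hh0, hh, fun δ hδ => ?_⟩
  -- the deviation bound along multiples of a good block length
  set η := δ ^ 3 / (16 * (C + 1)) with hη
  have hη0 : 0 < η := by positivity
  obtain ⟨b', hb'⟩ := hh η hη0
  obtain ⟨b, hb⟩ : ∃ b, b = b' + 1 := ⟨_, rfl⟩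
  have hbb := hb' b (by omega)
  obtain ⟨n₀, hn₀⟩ := exists_nat_gt (16 * C ^ 2 / δ ^ 3 + 4 * (C + 1) / δ + 1)
  have hq1 : 0 ≤ 16 * C ^ 2 / δ ^ 3 := by positivity
  have hq2 : 0 ≤ 4 * (C + 1) / δ := by positivity
  refine ⟨(n₀ + 1) * b, fun N hN u => ?_⟩
  obtain ⟨n, r, hr, rfl⟩ : ∃ n r, r < b ∧ N = n * b + r :=
    ⟨N / b, N % b, Nat.mod_lt _ (by omega), (Nat.div_add_mod' N b).symm⟩
  have hn : n₀ ≤ n := by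
    by_contra hlt
    push Not at hlt
    have : (n + 1) * b ≤ (n₀ + 1) * b := Nat.mul_le_mul_right _ (by omega)
    nlinarith
  have hn' : (n₀ : ℝ) ≤ n := by exact_mod_cast hn
  have hnpos : (0 : ℝ) < n := by linarith
  have hbpos : (0 : ℝ) < b := by rw [hb]; positivity
  have hrb : (r : ℝ) ≤ b := by exact_mod_cast hr.le
  have hr0 : (0 : ℝ) ≤ r := Nat.cast_nonneg _
  have hsq := (p.sum_law_sq_le hη0.le hh0 hhC hC hbb n u).1
  set L : ℝ := δ / 2 * (n * b : ℕ) with hL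
  have hLpos : 0 < L := by rw [hL]; push_cast; positivity
  -- a deviation at time `N` forces one at the preceding multiple of `b`
  have hdev : ∀ x ∈ wd A (n * b), ∀ y ∈ wd A r,
      δ * (n * b + r : ℕ) < |-Real.log (p.law u (x ++ y)) - h * (n * b + r : ℕ)| →
      L < |-Real.log (p.law u x) - h * (n * b : ℕ)| := by
    intro x hx y hy hlt
    rw [p.neg_log_law_append] at hlt
    have h1 := p.neg_log_law_nonneg (u ++ x) y
    have h2 := hC (u ++ x) y
    rw [mem_wd.1 hy] at h2
    have h3 : C * r ≤ C * b := by gcongr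
    have h4 : h * r ≤ C * b := by gcongr
    have h5 : 0 ≤ h * r := by positivity
    have h6 : |-Real.log (p.law (u ++ x) y) - h * r| ≤ C * b := by
      rw [abs_le]; constructor <;> linarith
    have h7 : C * b ≤ δ / 2 * (n * b) := by
      have h8 : 4 * (C + 1) / δ ≤ n := by linarith
      have h9 := (div_le_iff₀ hδ).1 h8
      have : C * b ≤ (n * δ / 2) * b := by gcongr; linarith
      linarith
    have h10 : |-Real.log (p.law u x) + -Real.log (p.law (u ++ x) y) - h * (n * b + r : ℕ)| ≤
        |-Real.log (p.law u x) - h * (n * b : ℕ)| + |-Real.log (p.law (u ++ x) y) - h * r| := by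
      refine le_trans (le_of_eq ?_) (abs_add_le _ _)
      congr 1; push_cast; ring
    have h11 : 0 ≤ δ * r := by positivity
    rw [hL]; push_cast at hlt h10 ⊢
    linarith
  rw [Finset.sum_filter, show (∑ z ∈ wd A (n * b + r), if δ * (n * b + r : ℕ) <
    |-Real.log (p.law u z) - h * (n * b + r : ℕ)| then p.law u z else 0) =
    ∑ z ∈ wd A (n * b + r), p.law u z * (if δ * (n * b + r : ℕ) <
    |-Real.log (p.law u z) - h * (n * b + r : ℕ)| then 1 else 0) from
      Finset.sum_congr rfl fun z _ => by split_ifs <;> simp, p.sum_law_add]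
  have hpt : ∀ x ∈ wd A (n * b), ∑ y ∈ wd A r, p.law (u ++ x) y * (if δ * (n * b + r : ℕ) <
      |-Real.log (p.law u (x ++ y)) - h * (n * b + r : ℕ)| then (1 : ℝ) else 0) ≤
      (-Real.log (p.law u x) - h * (n * b : ℕ)) ^ 2 / L ^ 2 := by
    intro x hx
    calc _ ≤ ∑ y ∈ wd A r, p.law (u ++ x) y *
          ((-Real.log (p.law u x) - h * (n * b : ℕ)) ^ 2 / L ^ 2) := by
          refine Finset.sum_le_sum fun y hy =>
            mul_le_mul_of_nonneg_left ?_ (p.law_nonneg _ _)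
          split_ifs with hc
          · have := hdev x hx y hy hc
            rw [le_div_iff₀ (by positivity), one_mul]
            rw [sq_le_sq, abs_of_pos hLpos]
            exact this.le
          · positivity
      _ = _ := by rw [← Finset.sum_mul, p.sum_law, one_mul]
  refine (Finset.sum_le_sum fun x hx =>
    mul_le_mul_of_nonneg_left (hpt x hx) (p.law_nonneg _ _)).trans ?_
  have hdiv : ∑ x ∈ wd A (n * b), p.law u x * ((-Real.log (p.law u x) - h * (n * b : ℕ)) ^ 2 / L ^ 2)
      = (∑ x ∈ wd A (n * b), p.law u x * (-Real.log (p.law u x) - h * (n * b : ℕ)) ^ 2) / L ^ 2 := by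
    rw [Finset.sum_div]
    exact Finset.sum_congr rfl fun x _ => by ring
  rw [hdiv, div_le_iff₀ (by positivity)]
  refine hsq.trans ?_
  have h1 : C ^ 2 * 16 ≤ n * δ ^ 3 := by
    have := (div_le_iff₀ (by positivity)).1 (show 16 * C ^ 2 / δ ^ 3 ≤ n by linarith)
    linarith
  have h2 : C * η ≤ δ ^ 3 / 16 := by
    rw [hη, mul_div_assoc', div_le_div_iff₀ (by positivity) (by positivity)]
    have : 0 < δ ^ 3 := by positivity
    nlinarith
  rw [hL]; push_cast
  have h3 : (n : ℝ) * (C * b) ^ 2 ≤ (n * b) ^ 2 * (δ ^ 3 / 16) := by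
    have : 0 ≤ (n : ℝ) * b ^ 2 := by positivity
    nlinarith
  have h4 : (n : ℝ) ^ 2 * (C * b * (η * b)) ≤ (n * b) ^ 2 * (δ ^ 3 / 16) := by
    have : 0 ≤ (n : ℝ) ^ 2 * b ^ 2 := by positivity
    nlinarith
  have h5 : 0 ≤ δ * (n * b : ℝ) ^ 2 * δ ^ 2 := by positivity
  nlinarith

lemma Proc.Nice.entropy_pos {h : ℝ} (hp : p.Nice) (hA : 2 ≤ Fintype.card A)
    (hh : ∀ η > 0, ∃ N₀ : ℕ, ∀ N ≥ N₀, ∀ u, |p.ent N u - h * N| ≤ η * N) : 0 < h := by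
  obtain ⟨c, hc, hlb⟩ := hp.lb
  have hlaw : ∀ u a, p.law u [a] ≤ 1 - c := by
    intro u a
    obtain ⟨b, hb⟩ := Fintype.exists_ne_of_one_lt_card (by omega : 1 < Fintype.card A) a
    have h1 : ∑ x ∈ ({a, b} : Finset A), p.law u [x] ≤ ∑ x, p.law u [x] :=
      Finset.sum_le_sum_of_subset_of_nonneg (Finset.subset_univ _) fun _ _ _ => p.law_nonneg _ _
    rw [Finset.sum_pair hb.symm, p.sum_law_one] at h1
    linarith [hlb u b]
  have h1 : ∀ u, c ≤ p.ent 1 u := by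
    intro u
    calc c = ∑ a, p.law u [a] * c := by rw [← Finset.sum_mul, p.sum_law_one, one_mul]
      _ ≤ ∑ a, p.law u [a] * -Real.log (p.law u [a]) := by
          refine Finset.sum_le_sum fun a _ => mul_le_mul_of_nonneg_left ?_ (p.law_nonneg _ _)
          have := Real.log_le_sub_one_of_pos (p.law_pos u [a])
          linarith [hlaw u a]
      _ = p.ent 1 u := by rw [ent, sum_wd_one]
  have h2 : ∀ n u, c * n ≤ p.ent n u := by
    intro n
    induction n with
    | zero => simp
    | succ n ih =>
      intro u
      rw [add_comm, p.ent_add, sum_wd_one]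
      have : c * n ≤ ∑ x, p.law u [x] * p.ent n (u ++ [x]) := by
        calc c * n = ∑ x, p.law u [x] * (c * n) := by rw [← Finset.sum_mul, p.sum_law_one, one_mul]
          _ ≤ _ := Finset.sum_le_sum fun a _ => mul_le_mul_of_nonneg_left (ih _) (p.law_nonneg _ _)
      push_cast
      linarith [h1 u]
  obtain ⟨N₀, hN₀⟩ := hh (c / 2) (by positivity)
  have h3 := (abs_le.1 (hN₀ (N₀ + 1) (by omega) [])).2
  have h4 := h2 (N₀ + 1) []
  have h5 : (0 : ℝ) < (N₀ + 1 : ℕ) := by positivity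
  nlinarith

end Entropy

section Sparse

variable {α β ι : Type} [DecidableEq α] [DecidableEq β] [Fintype ι]

/-- The rows of `κ` with at least two nonzero entries. -/
def badRows (s : Finset α) (t : Finset β) (κ : α → β → ℝ) : Finset α :=
  open Classical in s.filter fun x => ∃ y ∈ t, ∃ y' ∈ t, y ≠ y' ∧ κ x y ≠ 0 ∧ κ x y' ≠ 0

/-- The support of `κ`. -/
def supp (s : Finset α) (t : Finset β) (κ : α → β → ℝ) : Finset (α × β) :=
  (s ×ˢ t).filter fun z => κ z.1 z.2 ≠ 0

lemma mem_supp {s : Finset α} {t : Finset β} {κ : α → β → ℝ} {x : α} {y : β} :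
    (x, y) ∈ supp s t κ ↔ (x ∈ s ∧ y ∈ t) ∧ κ x y ≠ 0 := by simp [supp]

lemma exists_direction {s : Finset α} {t : Finset β} (κ : α → β → ℝ) (F : ι → α → β → ℝ)
    (h : t.card + Fintype.card ι < (badRows s t κ).card) :
    ∃ D : α → β → ℝ, (∀ x y, D x y ≠ 0 → κ x y ≠ 0) ∧ (∃ x ∈ s, ∃ y ∈ t, D x y < 0) ∧
      (∀ x ∈ s, ∑ y ∈ t, D x y = 0) ∧ (∀ y ∈ t, ∑ x ∈ s, D x y = 0) ∧
      ∀ i, cost s t D (F i) = 0 := by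
  classical
  have hB : ∀ x : badRows s t κ, ∃ y y', y ∈ t ∧ y' ∈ t ∧ y ≠ y' ∧ κ x y ≠ 0 ∧ κ x y' ≠ 0 := by
    rintro ⟨x, hx⟩
    obtain ⟨-, y, hy, y', hy', h1, h2, h3⟩ := Finset.mem_filter.1 hx
    exact ⟨y, y', hy, hy', h1, h2, h3⟩
  choose y₁ y₂ hy₁ hy₂ hne hκ₁ hκ₂ using hB
  let d : badRows s t κ → β → ℝ := fun x y => (if y = y₁ x then 1 else 0) - if y = y₂ x then 1 else 0
  let Φ : (badRows s t κ → ℝ) →ₗ[ℝ] (t → ℝ) × (ι → ℝ) :=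
    LinearMap.prod
      (LinearMap.pi fun y => ∑ x, (d x y) • LinearMap.proj x)
      (LinearMap.pi fun i => ∑ x : badRows s t κ, (∑ y ∈ t, d x y * F i x y) • LinearMap.proj x)
  have hker : LinearMap.ker Φ ≠ ⊥ := by
    apply LinearMap.ker_ne_bot_of_finrank_lt
    simpa using h
  obtain ⟨c, hc, hc0⟩ := (Submodule.ne_bot_iff _).1 hker
  have hΦ : Φ c = 0 := hc
  have hcol : ∀ y ∈ t, ∑ x, d x y * c x = 0 := by
    intro y hy
    have := congrFun (congrArg Prod.fst hΦ) ⟨y, hy⟩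
    simpa [Φ] using this
  have hfun : ∀ i, ∑ x : badRows s t κ, (∑ y ∈ t, d x y * F i x y) * c x = 0 := by
    intro i
    have := congrFun (congrArg Prod.snd hΦ) i
    simpa [Φ] using this
  have hsub : badRows s t κ ⊆ s := Finset.filter_subset _ _
  let D : α → β → ℝ := fun x y => if hx : x ∈ badRows s t κ then d ⟨x, hx⟩ y * c ⟨x, hx⟩ else 0
  have hD : ∀ (x : badRows s t κ) y, D x y = d x y * c x := fun x y => by simp [D]
  have hD0 : ∀ x ∉ badRows s t κ, ∀ y, D x y = 0 := fun x hx y => by simp [D, hx]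
  have hsum : ∀ G : α → ℝ, (∀ x ∉ badRows s t κ, G x = 0) →
      ∑ x ∈ s, G x = ∑ x : badRows s t κ, G x := by
    intro G hG
    rw [← Finset.sum_subset hsub fun x _ hx => hG x hx, ← Finset.sum_coe_sort]
  refine ⟨D, ?_, ?_, ?_, ?_, ?_⟩
  · intro x y hxy
    by_cases hx : x ∈ badRows s t κ
    · have h1 := hD ⟨x, hx⟩ y
      simp only at h1
      rw [h1] at hxy
      have h2 : d ⟨x, hx⟩ y ≠ 0 := left_ne_zero_of_mul hxy
      by_cases e1 : y = y₁ ⟨x, hx⟩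
      · rw [e1]; exact hκ₁ ⟨x, hx⟩
      · by_cases e2 : y = y₂ ⟨x, hx⟩
        · rw [e2]; exact hκ₂ ⟨x, hx⟩
        · exact absurd (by simp [d, e1, e2]) h2
    · exact absurd (hD0 x hx y) hxy
  · obtain ⟨x, hx⟩ := Function.ne_iff.1 hc0
    have h1 := hD x (y₁ x)
    have h2 := hD x (y₂ x)
    simp only [d, if_pos, if_neg (hne x), if_neg (hne x).symm] at h1 h2
    rcases lt_or_gt_of_ne hx with hlt | hlt
    · refine ⟨x, hsub x.2, y₁ x, hy₁ x, ?_⟩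
      rw [h1]; simpa using hlt
    · refine ⟨x, hsub x.2, y₂ x, hy₂ x, ?_⟩
      rw [h2]; simpa using hlt
  · intro x _
    by_cases hx : x ∈ badRows s t κ
    · have : ∀ y, D x y = d ⟨x, hx⟩ y * c ⟨x, hx⟩ := hD ⟨x, hx⟩
      simp only [this]
      rw [← Finset.sum_mul]
      simp [d, hy₁, hy₂]
    · exact Finset.sum_eq_zero fun y _ => hD0 x hx y
  · intro y hy
    rw [hsum _ fun x hx => hD0 x hx y]
    simp only [hD]
    exact hcol y hy
  · intro i
    rw [cost, hsum _ fun x hx => by simp [hD0 x hx]]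
    simp only [hD]
    rw [← hfun i]
    refine Finset.sum_congr rfl fun x _ => ?_
    rw [Finset.sum_mul]
    exact Finset.sum_congr rfl fun y _ => by ring

/-- A coupling may be replaced by one with few split rows, keeping finitely many expectations. -/
theorem exists_sparse_cpl {s : Finset α} {t : Finset β} {κ₀ : α → β → ℝ} {p : α → ℝ} {q : β → ℝ}
    (h₀ : IsCpl s t κ₀ p q) (F : ι → α → β → ℝ) :
    ∃ κ, IsCpl s t κ p q ∧ (∀ i, cost s t κ (F i) = cost s t κ₀ (F i)) ∧
      (badRows s t κ).card ≤ t.card + Fintype.card ι := by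
  classical
  let Ok : ℕ → Prop := fun n => ∃ κ, IsCpl s t κ p q ∧
    (∀ i, cost s t κ (F i) = cost s t κ₀ (F i)) ∧ (supp s t κ).card = n
  have hex : ∃ n, Ok n := ⟨_, κ₀, h₀, fun _ => rfl, rfl⟩
  obtain ⟨κ, hκ, hF, hcard⟩ := Nat.find_spec hex
  refine ⟨κ, hκ, hF, ?_⟩
  by_contra hlt
  push Not at hlt
  obtain ⟨D, hDκ, ⟨x₀, hx₀, y₀, hy₀, hneg⟩, hrow, hcol, hcost⟩ := exists_direction κ F hlt
  let N := (s ×ˢ t).filter fun z => D z.1 z.2 < 0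
  have hN : N.Nonempty := ⟨(x₀, y₀), by simp [N, hx₀, hy₀, hneg]⟩
  obtain ⟨z, hz, hzmin⟩ := N.exists_min_image (fun z => κ z.1 z.2 / -D z.1 z.2) hN
  simp only [N, Finset.mem_filter, Finset.mem_product] at hz hzmin
  set τ := κ z.1 z.2 / -D z.1 z.2 with hτ
  have hτ0 : 0 ≤ τ := div_nonneg (hκ.nonneg _ hz.1.1 _ hz.1.2) (by linarith [hz.2])
  let κ' : α → β → ℝ := fun x y => κ x y + τ * D x y
  have hκ' : IsCpl s t κ' p q := by
    refine ⟨fun x hx y hy => ?_, fun x hx => ?_, fun y hy => ?_⟩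
    · rcases lt_or_ge (D x y) 0 with hd | hd
      · have h1 := hzmin (x, y) ⟨⟨hx, hy⟩, hd⟩
        have h2 := (le_div_iff₀ (by simp only; linarith)).1 h1
        simp only at h2
        simp only [κ']; linarith
      · exact add_nonneg (hκ.nonneg x hx y hy) (mul_nonneg hτ0 hd)
    · simp only [κ', Finset.sum_add_distrib]
      rw [hκ.row x hx, ← Finset.mul_sum, hrow x hx]; simp
    · simp only [κ', Finset.sum_add_distrib]
      rw [hκ.col y hy, ← Finset.mul_sum, hcol y hy]; simp
  refine Nat.find_min hex (m := (supp s t κ').card) ?_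
    ⟨κ', hκ', fun i => ?_, rfl⟩
  · rw [← hcard]
    refine Finset.card_lt_card (Finset.ssubset_iff_of_subset ?_ |>.2 ⟨z, ?_, ?_⟩)
    · rintro ⟨x, y⟩ hxy
      obtain ⟨h1, h2⟩ := mem_supp.1 hxy
      refine mem_supp.2 ⟨h1, fun h3 => h2 ?_⟩
      have : D x y = 0 := by_contra fun h => hDκ x y h h3
      simp [κ', this, h3]
    · exact mem_supp.2 ⟨hz.1, hDκ _ _ hz.2.ne⟩
    · intro h
      refine (mem_supp.1 h).2 ?_
      have : D z.1 z.2 ≠ 0 := hz.2.ne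
      simp only [κ', hτ]
      field_simp
      ring
  · rw [show cost s t κ' (F i) = cost s t κ (F i) + τ * cost s t D (F i) by
      rw [← cost_smul_cpl, ← cost_add_cpl], hcost, mul_zero, add_zero, hF]

end Sparse

section Joinings

variable {A B : Type} [Fintype A] [Fintype B] [DecidableEq A] [DecidableEq B]

lemma sum_wd_zip (n : ℕ) (G : List (A × B) → ℝ) :
    ∑ l ∈ wd (A × B) n, G l = ∑ z ∈ wd A n, ∑ w ∈ wd B n, G (z.zip w) := by
  induction n generalizing G with
  | zero => rw [sum_wd_zero, sum_wd_zero, sum_wd_zero]; rfl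
  | succ n ih =>
    rw [sum_wd_succ, sum_wd_succ, Fintype.sum_prod_type]
    refine Finset.sum_congr rfl fun a _ => ?_
    simp only [ih, sum_wd_succ]
    rw [Finset.sum_comm]
    refine Finset.sum_congr rfl fun z _ => Finset.sum_congr rfl fun b _ => ?_
    simp

/-- `J` gives the cylinder probabilities of a stationary joining of `p` and `q`. -/
structure IsJoin (p : Proc A) (q : Proc B) (J : List (A × B) → ℝ) : Prop where
  nonneg : ∀ l, 0 ≤ J l
  snoc : ∀ l, ∑ c, J (l ++ [c]) = J l
  cons : ∀ l, ∑ c, J (c :: l) = J l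
  left : ∀ z, ∑ w ∈ wd B z.length, J (z.zip w) = p.P z
  right : ∀ w, ∑ z ∈ wd A w.length, J (z.zip w) = q.P w

/-- The expectation under `J` of a function of `n` symbols. -/
def jexp (J : List (A × B) → ℝ) (n : ℕ) (V : List (A × B) → ℝ) : ℝ :=
  ∑ l ∈ wd (A × B) n, J l * V l

variable {p : Proc A} {q : Proc B} {J : List (A × B) → ℝ}

lemma IsJoin.isCpl (h : IsJoin p q J) (n : ℕ) :
    IsCpl (wd A n) (wd B n) (fun z w => J (z.zip w)) p.P q.P where
  nonneg _ _ _ _ := h.nonneg _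
  row z hz := by obtain rfl := mem_wd.1 hz; exact h.left z
  col w hw := by obtain rfl := mem_wd.1 hw; exact h.right w

lemma IsJoin.cost_zip (n : ℕ) (V : List (A × B) → ℝ) :
    cost (wd A n) (wd B n) (fun z w => J (z.zip w)) (fun z w => V (z.zip w)) = jexp J n V := by
  rw [jexp, sum_wd_zip]; rfl

lemma IsJoin.jexp_one (h : IsJoin p q J) (n : ℕ) : jexp J n (fun _ => 1) = 1 := by
  rw [jexp, sum_wd_zip]
  refine Eq.trans ?_ (p.sum_P n)
  refine Finset.sum_congr rfl fun z hz => ?_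
  obtain rfl := mem_wd.1 hz
  exact (Finset.sum_congr rfl fun _ _ => mul_one _).trans (h.left z)

lemma jexp_mono (h : IsJoin p q J) {n : ℕ} {V W : List (A × B) → ℝ}
    (hVW : ∀ l ∈ wd (A × B) n, V l ≤ W l) : jexp J n V ≤ jexp J n W :=
  Finset.sum_le_sum fun l hl => mul_le_mul_of_nonneg_left (hVW l hl) (h.nonneg l)

lemma jexp_congr {n : ℕ} {V W : List (A × B) → ℝ}
    (hVW : ∀ l ∈ wd (A × B) n, V l = W l) : jexp J n V = jexp J n W :=
  Finset.sum_congr rfl fun l hl => by rw [hVW l hl]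

lemma jexp_add (n : ℕ) (V W : List (A × B) → ℝ) :
    jexp J n (fun l => V l + W l) = jexp J n V + jexp J n W := by
  simp only [jexp, mul_add, Finset.sum_add_distrib]

lemma IsJoin.jexp_drop (h : IsJoin p q J) (m n : ℕ) (V : List (A × B) → ℝ) :
    jexp J (m + n) (fun l => V (l.drop m)) = jexp J n V := by
  induction m with
  | zero => simp
  | succ m ih =>
    rw [← ih, show m + 1 + n = (m + n) + 1 by ring, jexp, sum_wd_succ, Finset.sum_comm]
    refine Finset.sum_congr rfl fun l _ => ?_
    simp only [List.drop_succ_cons, ← Finset.sum_mul, h.cons]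

lemma IsJoin.jexp_take (h : IsJoin p q J) (m n : ℕ) (V : List (A × B) → ℝ) :
    jexp J (n + m) (fun l => V (l.take n)) = jexp J n V := by
  induction m with
  | zero => exact jexp_congr fun l hl => by rw [List.take_of_length_le (by simpa using (mem_wd.1 hl).le)]
  | succ m ih =>
    rw [← ih, ← add_assoc, jexp, sum_wd_snoc]
    refine Finset.sum_congr rfl fun l hl => ?_
    have : l.length = n + m := mem_wd.1 hl
    simp only [List.take_append_of_le_length (show n ≤ l.length by omega), ← Finset.sum_mul, h.snoc]

lemma agr_drop {C : Type} {l : List C} {k : ℕ} (h : k ≤ l.length) : Agr k l (l.drop (l.length - k)) :=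
  ⟨l.take (l.length - k), [], l.drop (l.length - k), by simp; omega, by simp, by simp⟩

lemma IsJoin.jexp_window (h : IsJoin p q J) {V : List (A × B) → ℝ} {k n : ℕ} (hkn : k ≤ n)
    (hV : ∀ l l', Agr k l l' → V l = V l') : jexp J n V = jexp J k V := by
  obtain ⟨m, rfl⟩ := Nat.exists_eq_add_of_le' hkn
  rw [← h.jexp_drop m k V]
  refine jexp_congr fun l hl => hV _ _ ?_
  have := mem_wd.1 hl
  have h2 := agr_drop (k := k) (l := l) (by omega)
  rwa [show l.length - k = m by omega] at h2

lemma wsum_snoc {C : Type} [Fintype C] [DecidableEq C] (F : List C → ℝ) (u z : List C) (c : C) :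
    wsum F u (z ++ [c]) = wsum F u z + F (u ++ z) := by
  rw [wsum_append]; simp [wsum]

lemma IsJoin.jexp_wsum (h : IsJoin p q J) {V : List (A × B) → ℝ} {k : ℕ}
    (h0 : ∀ l, 0 ≤ V l) (h1 : ∀ l, V l ≤ 1) (hV : ∀ l l', Agr k l l' → V l = V l') (n : ℕ) :
    jexp J n (wsum V []) ≤ (min n k : ℕ) + n * jexp J k V := by
  have hk0 : 0 ≤ jexp J k V := Finset.sum_nonneg fun l _ => mul_nonneg (h.nonneg l) (h0 l)
  induction n with
  | zero => simp [jexp, sum_wd_zero, wsum]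
  | succ n ih =>
    have e : jexp J (n + 1) (wsum V []) = jexp J n (wsum V []) + jexp J n V := by
      rw [← jexp_add, jexp, sum_wd_snoc]
      refine Finset.sum_congr rfl fun l _ => ?_
      simp only [wsum_snoc, List.nil_append, ← Finset.sum_mul, h.snoc]
    rw [e]
    push_cast
    rcases le_or_gt k n with hkn | hkn
    · rw [h.jexp_window hkn hV]
      rw [min_eq_right hkn] at ih
      rw [min_eq_right (by norm_cast; omega)]
      linarith
    · have h2 : jexp J n V ≤ 1 := (jexp_mono h fun l _ => h1 l).trans (h.jexp_one n).le
      rw [min_eq_left hkn.le] at ih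
      rw [min_eq_left (by norm_cast)]
      linarith

end Joinings

section SparseCode

variable {α β ι : Type} [DecidableEq α] [DecidableEq β] [Fintype ι]

/-- A coupling with a measure supported on few points of `t` can be changed, without changing
given expectations, so that the second coordinate is almost a function of the first. -/
lemma exists_code_cpl {s : Finset α} {t T : Finset β} {κ : α → β → ℝ} {p : α → ℝ} {q : β → ℝ}
    [Nonempty β] {δ θ : ℝ}
    (h : IsCpl s t κ p q) (F : ι → α → β → ℝ) (hT : T ⊆ t) (hq : ∑ y ∈ t \ T, q y ≤ δ)
    (hθ : 0 ≤ θ) (hp : ∑ x ∈ s.filter (fun x => θ < p x), p x ≤ δ) :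
    ∃ κ', IsCpl s t κ' p q ∧ (∀ i, cost s t κ' (F i) = cost s t κ (F i)) ∧
      ∃ f : α → β, cost s t κ' (fun x y => if y = f x then 0 else 1) ≤
        2 * δ + (T.card + Fintype.card ι) * θ := by
  classical
  have h₁ : IsCpl s T κ (fun x => ∑ y ∈ T, κ x y) q :=
    ⟨fun x hx y hy => h.nonneg x hx y (hT hy), fun _ _ => rfl, fun y hy => h.col y (hT hy)⟩
  obtain ⟨κ₁, hκ₁, hF, hbad⟩ := exists_sparse_cpl h₁ F
  let f : α → β := fun x => if hx : ∃ y ∈ T, κ₁ x y ≠ 0 then hx.choose else Classical.arbitrary β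
  have hsplit : ∀ g : β → ℝ, ∑ y ∈ t, g y = ∑ y ∈ T, g y + ∑ y ∈ t \ T, g y := fun g => by
    rw [add_comm, Finset.sum_sdiff hT]
  let κ' : α → β → ℝ := fun x y => if y ∈ T then κ₁ x y else κ x y
  have e1 : ∀ x, ∀ g : β → ℝ, ∑ y ∈ T, κ' x y * g y = ∑ y ∈ T, κ₁ x y * g y := fun x g =>
    Finset.sum_congr rfl fun y hy => by simp [κ', hy]
  have e2 : ∀ x, ∀ g : β → ℝ, ∑ y ∈ t \ T, κ' x y * g y = ∑ y ∈ t \ T, κ x y * g y := fun x g =>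
    Finset.sum_congr rfl fun y hy => by simp [κ', (Finset.mem_sdiff.1 hy).2]
  have hcost : ∀ c, cost s t κ' c = cost s T κ₁ c + cost s (t \ T) κ c := fun c => by
    simp only [cost, hsplit, e1, e2, Finset.sum_add_distrib]
  refine ⟨κ', ⟨fun x hx y hy => ?_, fun x hx => ?_, fun y hy => ?_⟩, fun i => ?_, f, ?_⟩
  · by_cases hyT : y ∈ T
    · simpa [κ', hyT] using hκ₁.nonneg x hx y hyT
    · simpa [κ', hyT] using h.nonneg x hx y hy
  · have a1 := e1 x fun _ => 1
    have a2 := e2 x fun _ => 1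
    simp only [mul_one] at a1 a2
    rw [hsplit, a1, a2, hκ₁.row x hx, ← hsplit, h.row x hx]
  · by_cases hyT : y ∈ T
    · simpa [κ', hyT] using hκ₁.col y hyT
    · simpa [κ', hyT] using h.col y hy
  · rw [hcost, hF i]
    simp only [cost, hsplit, Finset.sum_add_distrib]
  · have hp1 : ∀ x ∈ s, ∑ y ∈ T, κ₁ x y ≤ p x := fun x hx => by
      rw [hκ₁.row x hx, ← h.row x hx]
      exact Finset.sum_le_sum_of_subset_of_nonneg hT fun y hy _ => h.nonneg x hx y hy
    have hp0 := h.left_nonneg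
    have b1 : cost s (t \ T) κ (fun x y => if y = f x then 0 else 1) ≤ δ := by
      refine le_trans ?_ hq
      rw [cost, Finset.sum_comm]
      refine Finset.sum_le_sum fun y hy => ?_
      rw [← h.col y (Finset.mem_sdiff.1 hy).1]
      refine Finset.sum_le_sum fun x hx => ?_
      have := h.nonneg x hx y (Finset.mem_sdiff.1 hy).1
      split_ifs <;> simp [this]
    have b2 : cost s T κ₁ (fun x y => if y = f x then 0 else 1) ≤ ∑ x ∈ badRows s T κ₁, p x := by
      have hsub : badRows s T κ₁ ⊆ s := Finset.filter_subset _ _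
      rw [cost, ← Finset.sum_sdiff hsub]
      have z : ∑ x ∈ s \ badRows s T κ₁, ∑ y ∈ T, κ₁ x y * (if y = f x then 0 else 1) = 0 := by
        refine Finset.sum_eq_zero fun x hx => Finset.sum_eq_zero fun y hy => ?_
        obtain ⟨hxs, hxb⟩ := Finset.mem_sdiff.1 hx
        by_cases hy0 : κ₁ x y = 0
        · rw [hy0, zero_mul]
        · have hex : ∃ y ∈ T, κ₁ x y ≠ 0 := ⟨y, hy, hy0⟩
          have hfx : f x = hex.choose := dif_pos hex
          have : y = f x := by
            by_contra hne
            refine hxb (Finset.mem_filter.2 ⟨hxs, y, hy, f x, ?_, hne, hy0, ?_⟩)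
            · rw [hfx]; exact hex.choose_spec.1
            · rw [hfx]; exact hex.choose_spec.2
          simp [this]
      rw [z, zero_add]
      refine Finset.sum_le_sum fun x hx => ?_
      refine le_trans (Finset.sum_le_sum fun y hy => ?_) (hp1 x (hsub hx))
      have := hκ₁.nonneg x (hsub hx) y hy
      split_ifs <;> simp [this]
    have b3 : ∑ x ∈ badRows s T κ₁, p x ≤ δ + (T.card + Fintype.card ι) * θ := by
      rw [← Finset.sum_filter_add_sum_filter_not _ (fun x => θ < p x)]
      refine add_le_add (le_trans ?_ hp) ?_
      · refine Finset.sum_le_sum_of_subset_of_nonneg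
          (Finset.filter_subset_filter _ (Finset.filter_subset _ _)) fun x hx _ => ?_
        exact hp0 x (Finset.mem_filter.1 hx).1
      · calc _ ≤ ∑ x ∈ (badRows s T κ₁).filter (fun x => ¬ θ < p x), θ :=
              Finset.sum_le_sum fun x hx => not_lt.1 (Finset.mem_filter.1 hx).2
          _ ≤ (badRows s T κ₁).card * θ := by
              rw [Finset.sum_const, nsmul_eq_mul]
              gcongr
              exact Finset.filter_subset _ _
          _ ≤ _ := by gcongr; exact_mod_cast hbad
    rw [hcost]
    linarith

end SparseCode

section BaseCoupling

variable {A B ι : Type} [Fintype A] [Fintype B] [DecidableEq A] [DecidableEq B] [Fintype ι]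

lemma ham_zip (z z' : List A) (w w' : List B) :
    ham (z.zip w) (z'.zip w') ≤ ham z z' + ham w w' := by
  induction z generalizing z' w w' with
  | nil => simpa using ham_nonneg w w'
  | cons a z ih =>
    cases z' with
    | nil => simpa using ham_nonneg w w'
    | cons a' z' =>
      cases w with
      | nil => simpa using ham_nonneg (a :: z) (a' :: z')
      | cons b w =>
        cases w' with
        | nil => simpa using ham_nonneg (a :: z) (a' :: z')
        | cons b' w' =>
          have := ih z' w w'
          simp only [List.zip_cons_cons, ham_cons, Prod.mk.injEq]
          split_ifs <;> first | linarith | (exfalso; tauto)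

lemma ham_le_ite (u v : List A) {n : ℕ} (hu : u.length ≤ n) :
    ham u v ≤ n * (if u = v then 0 else 1) := by
  split_ifs with h
  · simp [h]
  · have h1 : (u.length : ℝ) ≤ n := by exact_mod_cast hu
    linarith [ham_le u v]

/-- Extending the second coordinate of a coupling by an independent continuation. -/
lemma IsCpl.extend_right {α : Type} {s : Finset α} {m n : ℕ} {κ : α → List B → ℝ} {p : α → ℝ}
    {q₁ q : List B → ℝ} {q₂ : List B → List B → ℝ} (h : IsCpl s (wd B m) κ p q₁)
    (hq : ∀ w ∈ wd B m, ∀ w' ∈ wd B n, q (w ++ w') = q₁ w * q₂ w w')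
    (h0 : ∀ w w', 0 ≤ q₂ w w') (h1 : ∀ w ∈ wd B m, ∑ w' ∈ wd B n, q₂ w w' = 1) :
    ∃ κ', IsCpl s (wd B (m + n)) κ' p q ∧ ∀ (c c' : α → List B → ℝ),
      (∀ x ∈ s, ∀ w ∈ wd B m, ∀ w' ∈ wd B n, c x (w ++ w') ≤ c' x w) →
      cost s (wd B (m + n)) κ' c ≤ cost s (wd B m) κ c' := by
  have key : ∀ x, ∀ w ∈ wd B m, ∀ w', κ x ((w ++ w').take m) *
      q₂ ((w ++ w').take m) ((w ++ w').drop m) = κ x w * q₂ w w' := fun x w hw w' => by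
    obtain rfl := mem_wd.1 hw
    simp
  refine ⟨fun x w => κ x (w.take m) * q₂ (w.take m) (w.drop m), ⟨fun x hx w hw => ?_,
    fun x hx => ?_, fun w hw => ?_⟩, fun c c' hc => ?_⟩
  · exact mul_nonneg (h.nonneg x hx _ (by have := mem_wd.1 hw; simp [this])) (h0 _ _)
  · rw [sum_wd_add, ← h.row x hx]
    refine Finset.sum_congr rfl fun w hw => ?_
    simp only [key x w hw, ← Finset.mul_sum, h1 w hw, mul_one]
  · have hl := mem_wd.1 hw
    have hm : w.take m ∈ wd B m := by simp [hl]
    have hn : w.drop m ∈ wd B n := by simp [hl]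
    rw [← Finset.sum_mul, h.col _ hm, ← hq _ hm _ hn, List.take_append_drop]
  · rw [cost, cost]
    refine Finset.sum_le_sum fun x hx => ?_
    rw [sum_wd_add]
    refine Finset.sum_le_sum fun w hw => ?_
    calc _ ≤ ∑ w' ∈ wd B n, κ x w * q₂ w w' * c' x w := by
          refine Finset.sum_le_sum fun w' hw' => ?_
          rw [key x w hw]
          exact mul_le_mul_of_nonneg_left (hc x hx w hw w' hw')
            (mul_nonneg (h.nonneg x hx w hw) (h0 _ _))
      _ = _ := by simp only [mul_right_comm _ _ (c' x w), ← Finset.mul_sum, h1 w hw, mul_one]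

/-- The asymptotic equipartition property, uniformly in the past. -/
def Proc.AEP (p : Proc A) (h : ℝ) : Prop := ∀ δ > 0, ∃ N₀ : ℕ, ∀ N ≥ N₀, ∀ u,
  ∑ z ∈ (wd A N).filter (fun z => δ * N < |-Real.log (p.law u z) - h * N|), p.law u z ≤ δ

/-- The last `R` symbols of `u`. -/
def lastk {C : Type} (R : ℕ) (u : List C) : List C := u.drop (u.length - R)

lemma agr_lastk {C : Type} {R : ℕ} {u : List C} (h : R ≤ u.length) : Agr R u (lastk R u) :=
  agr_drop h

lemma lastk_of_le {C : Type} {R : ℕ} {u : List C} (h : u.length ≤ R) : lastk R u = u := by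
  simp [lastk, Nat.sub_eq_zero_of_le h]

variable {p : Proc A} {q : Proc B} {J : List (A × B) → ℝ}

lemma wsum_window_le {C : Type} [Fintype C] [DecidableEq C] {V : List C → ℝ} {k : ℕ}
    (h0 : ∀ l, 0 ≤ V l) (h1 : ∀ l, V l ≤ 1)
    (hV : ∀ l l', Agr k l l' → V l = V l') {z z' : List C} (hz : z.length = z'.length)
    (u v : List C) : wsum V u z ≤ wsum V v z' + k + k * ham z z' := by
  have := wsum_sub_le h0 h1 le_rfl (fun u v h => (sub_eq_zero.2 (hV u v h)).le) z z' hz 0 u v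
    (agr_zero u v)
  simp at this
  linarith

lemma card_typical_le (h δ : ℝ) (n : ℕ) :
    (((wd B n).filter (fun w => ¬ δ * n < |-Real.log (q.law [] w) - h * n|)).card : ℝ) ≤
      Real.exp ((h + δ) * n) := by
  set T := (wd B n).filter (fun w => ¬ δ * n < |-Real.log (q.law [] w) - h * n|) with hT
  have h1 : ∑ w ∈ T, Real.exp (-((h + δ) * n)) ≤ 1 := by
    rw [← q.sum_law [] n]
    refine le_trans (Finset.sum_le_sum fun w hw => ?_) (Finset.sum_le_sum_of_subset_of_nonneg
      (Finset.filter_subset _ _) fun w _ _ => q.law_nonneg [] w)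
    have h2 := not_lt.1 (Finset.mem_filter.1 hw).2
    rw [← Real.exp_log (q.law_pos [] w)]
    refine Real.exp_le_exp.2 ?_
    have := (abs_le.1 h2).2
    linarith
  rw [Finset.sum_const, nsmul_eq_mul, Real.exp_neg] at h1
  have := Real.exp_pos ((h + δ) * n)
  rwa [← div_eq_mul_inv, div_le_one this] at h1

/-- One block of the coding: a coupling under which the second word is almost determined by the
first one. -/
lemma exists_block_code (hJ : IsJoin p q J) {V : ι → List (A × B) → ℝ} {k : ℕ}
    (h0 : ∀ i l, 0 ≤ V i l) (h1 : ∀ i l, V i l ≤ 1)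
    (hV : ∀ i l l', Agr k l l' → V i l = V i l') {h δ e : ℝ} {n₁ n₂ : ℕ} (u : List A)
    (he : p.Ebd n₁ e)
    (hpA : ∑ z ∈ (wd A (n₁ + n₂)).filter
      (fun z => δ * (n₁ + n₂ : ℕ) < |-Real.log (p.law u z) - h * (n₁ + n₂ : ℕ)|), p.law u z ≤ δ)
    (hqA : ∑ w ∈ (wd B n₁).filter (fun w => δ * n₁ < |-Real.log (q.law [] w) - h * n₁|),
      q.law [] w ≤ δ)
    (hθ : (Real.exp ((h + δ) * n₁) + Fintype.card ι) * Real.exp (-((h - δ) * (n₁ + n₂ : ℕ))) ≤ δ) :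
    ∃ κ, IsCpl (wd A (n₁ + n₂)) (wd B n₁) κ (p.law u) q.P ∧
      (∀ i, cost (wd A (n₁ + n₂)) (wd B n₁) κ (fun z w => wsum (V i) [] ((z.take n₁).zip w)) ≤
        n₁ * jexp J k (V i) + 2 * k + k * e) ∧
      ∃ f : List A → List B, cost (wd A (n₁ + n₂)) (wd B n₁) κ
        (fun z w => if w = f z then 0 else 1) ≤ 3 * δ := by
  obtain ⟨κ₀, hκ₀, hκ₀e⟩ := he u []
  have hκ₀' : IsCpl (wd A n₁) (wd A n₁) κ₀ (p.law u) p.P :=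
    hκ₀.congr (fun _ _ => rfl) fun x _ => p.law_nil_left x
  have g := hκ₀'.glue (hJ.isCpl n₁)
  have gc : ∀ i, cost (wd A n₁) (wd B n₁)
      (fun x z => ∑ y ∈ wd A n₁, κ₀ x y * J (y.zip z) / p.P y)
      (fun z w => wsum (V i) [] (z.zip w)) ≤ n₁ * jexp J k (V i) + 2 * k + k * e := by
    intro i
    have a1 := hκ₀'.glue_cost (hJ.isCpl n₁) (c := fun z w => wsum (V i) [] (z.zip w))
      (c₁ := fun z z' => k + k * ham z z') (c₂ := fun z w => wsum (V i) [] (z.zip w))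
      (fun x hx y hy z hz => by
        have hx := mem_wd.1 hx
        have hy := mem_wd.1 hy
        have hz := mem_wd.1 hz
        have b1 := wsum_window_le (h0 i) (h1 i) (hV i) (z := x.zip z) (z' := y.zip z)
          (by simp [hx, hy, hz]) [] []
        have b2 := ham_zip x y z z
        rw [ham_self, add_zero] at b2
        have : (k : ℝ) * ham (x.zip z) (y.zip z) ≤ k * ham x y := by gcongr
        linarith)
    have a2 : cost (wd A n₁) (wd A n₁) κ₀ (fun z z' => k + k * ham z z') ≤ k + k * e := by
      rw [cost_add_fun, cost_mul_left, hκ₀.cost_const, p.sum_law, one_mul]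
      gcongr
    have a3 : cost (wd A n₁) (wd B n₁) (fun z w => J (z.zip w))
        (fun z w => wsum (V i) [] (z.zip w)) ≤ k + n₁ * jexp J k (V i) := by
      rw [IsJoin.cost_zip]
      refine (hJ.jexp_wsum (h0 i) (h1 i) (hV i) n₁).trans ?_
      gcongr
      exact min_le_right _ _
    linarith
  obtain ⟨κ₁, hκ₁, hκ₁c⟩ := g.symm.extend_right (n := n₂) (q := p.law u)
    (q₂ := fun z z' => p.law (u ++ z) z') (fun z _ z' _ => p.law_append u z z')
    (fun z z' => p.law_nonneg _ _) (fun z _ => p.sum_law _ _)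
  have hlog : ∀ (u : List A) (z : List A) (a : ℝ), Real.exp (-a) < p.law u z →
      -Real.log (p.law u z) < a := fun u z a hz => by
    have := Real.log_lt_log (Real.exp_pos _) hz
    rw [Real.log_exp] at this
    linarith
  obtain ⟨κ₂, hκ₂, hF, f, hf⟩ := exists_code_cpl (δ := δ)
    (θ := Real.exp (-((h - δ) * (n₁ + n₂ : ℕ)))) hκ₁.symm
    (fun i z w => wsum (V i) [] ((z.take n₁).zip w))
    (T := (wd B n₁).filter (fun w => ¬ δ * n₁ < |-Real.log (q.law [] w) - h * n₁|))
    (Finset.filter_subset _ _) (by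
      refine le_trans (le_of_eq ?_) hqA
      rw [← Finset.filter_not]
      simp only [not_not, q.law_nil_left]) (Real.exp_pos _).le (by
      refine le_trans (Finset.sum_le_sum_of_subset_of_nonneg ?_ fun z _ _ => p.law_nonneg _ _) hpA
      refine Finset.monotone_filter_right _ fun z _ hz => ?_
      have h2 := hlog _ _ _ hz
      refine lt_of_lt_of_le ?_ (neg_le_abs _)
      linarith)
  refine ⟨κ₂, hκ₂, fun i => ?_, f, hf.trans ?_⟩
  · rw [hF i]
    refine le_trans ?_ (gc i)
    have := hκ₁c (fun w z => wsum (V i) [] ((z.take n₁).zip w))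
      (fun w z => wsum (V i) [] (z.zip w)) (fun w _ z hz z' _ => by
        obtain rfl := mem_wd.1 hz
        simp)
    refine le_trans (le_of_eq ?_) (this.trans (le_of_eq ?_))
    · rw [cost, cost, Finset.sum_comm]
    · rw [cost, cost, Finset.sum_comm]
  · have h3 := card_typical_le (q := q) h δ n₁
    have h4 := Real.exp_pos (-((h - δ) * (n₁ + n₂ : ℕ)))
    nlinarith [mul_le_mul_of_nonneg_right h3 h4.le]

end BaseCoupling

section BaseCoupling2

variable {A B ι : Type} [Fintype A] [Fintype B] [DecidableEq A] [DecidableEq B] [Fintype ι]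
  [Nonempty B] {p : Proc A} {q : Proc B} {J : List (A × B) → ℝ}

lemma typical_count_bound {h δ η : ℝ} {c N n₂ : ℕ} (hδ : 0 < δ) (hη : η ≤ 1)
    (hδh : 8 * δ ≤ η * h) (hN : (1 + c) / (6 * δ ^ 2) ≤ (N : ℝ)) (hn : η * N ≤ n₂) (n₁ : ℕ)
    (hn1 : n₁ + n₂ = N) (hh : 0 < h) :
    (Real.exp ((h + δ) * n₁) + c) * Real.exp (-((h - δ) * N)) ≤ δ := by
  have hN0 : (0 : ℝ) < N := lt_of_lt_of_le (by positivity) hN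
  have e1 : (n₁ : ℝ) = N - n₂ := by rw [← hn1]; push_cast; ring
  have h8 : 8 * δ ≤ h := hδh.trans (by nlinarith)
  have a1 : Real.exp ((h + δ) * n₁) * Real.exp (-((h - δ) * N)) ≤ Real.exp (-(6 * δ * N)) := by
    rw [← Real.exp_add]
    refine Real.exp_le_exp.2 ?_
    rw [e1]
    have h1 : 8 * δ * N ≤ h * n₂ := by
      calc 8 * δ * N ≤ η * h * N := by gcongr
        _ = h * (η * N) := by ring
        _ ≤ _ := by gcongr
    have h2 : 0 ≤ δ * n₂ := by positivity
    linarith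
  have a2 : Real.exp (-((h - δ) * N)) ≤ Real.exp (-(6 * δ * N)) := by
    refine Real.exp_le_exp.2 (neg_le_neg ?_)
    gcongr
    linarith
  have a3 : Real.exp (-(6 * δ * N)) ≤ 1 / (6 * δ * N) := by
    rw [Real.exp_neg, ← one_div]
    gcongr
    linarith [Real.add_one_le_exp (6 * δ * N)]
  have a4 : (1 + c) * (1 / (6 * δ * N)) ≤ δ := by
    rw [mul_one_div, div_le_iff₀ (by positivity)]
    rw [div_le_iff₀ (by positivity)] at hN
    nlinarith
  calc _ = Real.exp ((h + δ) * n₁) * Real.exp (-((h - δ) * N)) + c * Real.exp (-((h - δ) * N)) := by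
        ring
    _ ≤ Real.exp (-(6 * δ * N)) + c * Real.exp (-(6 * δ * N)) := by gcongr
    _ = (1 + c) * Real.exp (-(6 * δ * N)) := by ring
    _ ≤ (1 + c) * (1 / (6 * δ * N)) := by gcongr
    _ ≤ δ := a4

lemma Proc.Nice.exists_cpl_lastk (hp : p.Nice) (N : ℕ) {δ : ℝ} (hδ : 0 < δ) (hδ1 : δ ≤ 1) :
    ∃ R, ∀ u, ∃ κ, IsCpl (wd A N) (wd A N) κ (p.law u) (p.law (lastk R u)) ∧
      cost (wd A N) (wd A N) κ (fun x y => if x = y then 0 else 1) ≤ δ := by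
  obtain ⟨R, hR⟩ := hp.cont N δ hδ
  refine ⟨R, fun u => exists_cpl_of_le hδ.le hδ1 (fun z _ => p.law_nonneg _ _) (p.sum_law _ _)
    (p.sum_law _ _) fun z hz => ?_⟩
  rcases le_or_gt R u.length with h | h
  · exact hR _ _ (agr_lastk h) z hz
  · rw [lastk_of_le h.le]
    nlinarith [p.law_nonneg u z]

set_option maxHeartbeats 2000000 in
theorem exists_base_cpl (hp : p.Nice) (hq : q.Nice) {h : ℝ} (hh : 0 < h) (hpA : p.AEP h)
    (hqA : q.AEP h) (hJ : IsJoin p q J) {V : ι → List (A × B) → ℝ} {k : ℕ}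
    (h0 : ∀ i l, 0 ≤ V i l) (h1 : ∀ i l, V i l ≤ 1)
    (hV : ∀ i l l', Agr k l l' → V i l = V i l') {ε : ℝ} (hε : 0 < ε) (hε1 : ε ≤ 1) :
    ∃ N₀, ∀ N ≥ N₀, ∃ (R : ℕ) (φ : List A → List A → List B), (∀ u z, (φ u z).length = N) ∧
      ∀ l : List (A × B), ∃ κ,
        IsCpl (wd A N) (wd B N) κ (p.law (l.map Prod.fst)) (q.law (l.map Prod.snd)) ∧
        cost (wd A N) (wd B N) κ (fun z w => ham w (φ (lastk R (l.map Prod.fst)) z)) ≤ ε * N ∧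
        ∀ i, cost (wd A N) (wd B N) κ (fun z w => wsum (V i) l (z.zip w)) ≤
          (jexp J k (V i) + ε) * N := by
  set η : ℝ := ε / 8 with hη
  set ε₁ : ℝ := ε / (16 * (k + 1)) with hε₁
  set δ : ℝ := min ε₁ (η * h / 8) with hδ
  have hε₁0 : 0 < ε₁ := by positivity
  have hδ0 : 0 < δ := lt_min hε₁0 (by positivity)
  have hk1 : (k + 1) * ε₁ = ε / 16 := by rw [hε₁]; field_simp
  have hkε : k * ε₁ ≤ ε / 16 := by linarith
  have hε₁' : ε₁ ≤ ε / 16 := by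
    have : 0 ≤ k * ε₁ := by positivity
    linarith
  have hδε : δ ≤ ε₁ := min_le_left _ _
  have hkδ : k * δ ≤ ε / 16 := le_trans (by gcongr) hkε
  have hδh : 8 * δ ≤ η * h := by
    have := min_le_right ε₁ (η * h / 8)
    rw [← hδ] at this
    linarith
  obtain ⟨N₁, hN₁⟩ := hp.vwb ε₁ hε₁0
  obtain ⟨N₂, hN₂⟩ := hq.vwb ε₁ hε₁0
  obtain ⟨N₃, hN₃⟩ := hpA δ hδ0
  obtain ⟨N₄, hN₄⟩ := hqA δ hδ0
  obtain ⟨N₅, hN₅⟩ := exists_nat_ge ((1 + Fintype.card ι) / (6 * δ ^ 2) : ℝ)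
  obtain ⟨N₆, hN₆⟩ := exists_nat_ge ((4 + 3 * k) * 8 / ε : ℝ)
  refine ⟨2 * (N₁ + N₂ + N₃ + N₄ + N₅ + N₆ + 4), fun N hN => ?_⟩
  obtain ⟨R, hR⟩ := hp.exists_cpl_lastk N hδ0 (by linarith : δ ≤ 1)
  have hNr : (2 * (N₁ + N₂ + N₃ + N₄ + N₅ + N₆ + 4) : ℝ) ≤ N := by exact_mod_cast hN
  have hN₁r : (0 : ℝ) ≤ N₁ := Nat.cast_nonneg _
  have hN₂r : (0 : ℝ) ≤ N₂ := Nat.cast_nonneg _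
  have hN₃r : (0 : ℝ) ≤ N₃ := Nat.cast_nonneg _
  have hN₄r : (0 : ℝ) ≤ N₄ := Nat.cast_nonneg _
  have hN₅r : (0 : ℝ) ≤ N₅ := Nat.cast_nonneg _
  have hN₆r : (0 : ℝ) ≤ N₆ := Nat.cast_nonneg _
  set n₂ := ⌈η * N⌉₊ with hn₂
  have hn2l : η * N ≤ n₂ := Nat.le_ceil _
  have hn2u : (n₂ : ℝ) ≤ η * N + 1 := (Nat.ceil_lt_add_one (by positivity)).le
  have hn2N : (n₂ : ℝ) ≤ N / 2 := by nlinarith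
  obtain ⟨n₁, hn₁⟩ : ∃ n₁, N = n₁ + n₂ := ⟨N - n₂, by
    have : n₂ ≤ N := by exact_mod_cast (by linarith : (n₂ : ℝ) ≤ N)
    omega⟩
  have hn1r : (N : ℝ) = n₁ + n₂ := by exact_mod_cast hn₁
  have hn1l : N₁ + N₂ + N₃ + N₄ + N₅ + N₆ + 4 ≤ n₁ := by
    have : ((N₁ + N₂ + N₃ + N₄ + N₅ + N₆ + 4 : ℕ) : ℝ) ≤ n₁ := by push_cast; linarith
    exact_mod_cast this
  have hbig : (4 + 3 * k : ℝ) ≤ ε / 8 * N := by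
    rw [div_le_iff₀ hε] at hN₆
    nlinarith
  have hblock : ∀ u, ∃ κ, IsCpl (wd A N) (wd B n₁) κ (p.law u) q.P ∧
      (∀ i, cost (wd A N) (wd B n₁) κ (fun z w => wsum (V i) [] ((z.take n₁).zip w)) ≤
        n₁ * jexp J k (V i) + 2 * k + k * (ε₁ * n₁)) ∧
      ∃ f : List A → List B, cost (wd A N) (wd B n₁) κ
        (fun z w => if w = f z then 0 else 1) ≤ 3 * δ := by
    intro u
    have := exists_block_code (h := h) (δ := δ) (n₁ := n₁) (n₂ := n₂) hJ h0 h1 hV u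
      (hN₁ n₁ (by omega))
      (by rw [← hn₁]; exact hN₃ N (by omega) u) (hN₄ n₁ (by omega) [])
      (by
        rw [← hn₁]
        exact typical_count_bound hδ0 (by rw [hη]; linarith) hδh (hN₅.trans (by linarith)) hn2l n₁
          hn₁.symm hh)
    rwa [← hn₁] at this
  choose κ₂ hκ₂ hκ₂V f hf using hblock
  let b₀ : B := Classical.arbitrary B
  let φ : List A → List A → List B := fun u z => (f u z ++ List.replicate N b₀).take N
  have hφl : ∀ u z, (φ u z).length = N := fun u z => by simp [φ]
  refine ⟨R, φ, hφl, fun l => ?_⟩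
  set u := l.map Prod.fst with hu
  set v := l.map Prod.snd with hv
  set u' := lastk R u with hu'
  obtain ⟨κL, hκL, hκLc⟩ := hR u
  obtain ⟨κR, hκR, hκRc⟩ := hN₂ n₁ (by omega) [] v
  have hκR' : IsCpl (wd B n₁) (wd B n₁) κR q.P (q.law v) :=
    hκR.congr (fun x _ => q.law_nil_left x) fun _ _ => rfl
  have g1 := hκL.glue (hκ₂ u')
  have g2 := g1.glue hκR'
  obtain ⟨κ, hκ, hκc⟩ := g2.extend_right (n := n₂) (q := q.law v)
    (q₂ := fun w w' => q.law (v ++ w) w') (fun w _ w' _ => q.law_append v w w')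
    (fun w w' => q.law_nonneg _ _) (fun w _ => q.sum_law _ _)
  rw [← hn₁] at hκ hκc
  have hn1N : (n₁ : ℝ) ≤ N := by rw [hn1r]; linarith [(Nat.cast_nonneg n₂ : (0 : ℝ) ≤ n₂)]
  have hε₁n : ε₁ * n₁ ≤ ε₁ * N := by gcongr
  refine ⟨κ, hκ, ?_, fun i => ?_⟩
  · have s1 := hκL.glue_cost (hκ₂ u') (c := fun x z => n₂ + N * if z = f u' x then 0 else 1)
      (c₁ := fun x y => N * if x = y then 0 else 1)
      (c₂ := fun y z => n₂ + N * if z = f u' y then 0 else 1)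
      (fun x _ y _ z _ => by
        by_cases hxy : x = y
        · simp [hxy]
        · have : (0 : ℝ) ≤ N * if z = f u' y then 0 else 1 := by positivity
          have h2 : (N : ℝ) * (if z = f u' x then 0 else 1) ≤ N := by
            split_ifs <;> simp
          simp only [if_neg hxy]
          linarith)
    have s2 := g1.glue_cost hκR' (c := fun x w => n₂ + ham w (f u' x ++ List.replicate N b₀))
      (c₁ := fun x z => n₂ + N * if z = f u' x then 0 else 1) (c₂ := ham)
      (fun x _ z hz w hw => by
        have hz := mem_wd.1 hz
        have hw := mem_wd.1 hw
        by_cases hzx : z = f u' x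
        · have : ham w (f u' x ++ List.replicate N b₀) = ham z w := by
            have h3 := ham_append (hw.trans (hz.symm.trans (congrArg _ hzx))) [] (List.replicate N b₀)
            simp only [List.append_nil, ham_nil_left, add_zero] at h3
            rw [h3, ← hzx, ham_comm]
          rw [if_pos hzx]; linarith
        · have h3 := ham_le w (f u' x ++ List.replicate N b₀)
          have h4 := ham_nonneg z w
          rw [hw] at h3
          rw [if_neg hzx]
          linarith)
    have s3 := hκc (fun z w => ham w (φ u' z))
      (fun x w => n₂ + ham w (f u' x ++ List.replicate N b₀))
      (fun x _ w hw w' hw' => by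
        have hw := mem_wd.1 hw
        have hw' := mem_wd.1 hw'
        set g := f u' x ++ List.replicate N b₀ with hg
        have hgl : N ≤ g.length := by simp [hg]
        have e1 : φ u' x = g.take n₁ ++ (g.drop n₁).take n₂ := by
          show g.take N = _
          rw [hn₁, List.take_add]
        have e2 : ham w g = ham w (g.take n₁) := by
          conv_lhs => rw [← List.append_nil w, ← List.take_append_drop n₁ g]
          rw [ham_append (by simp [hw]; omega)]
          simp
        have e3 := ham_le w' ((g.drop n₁).take n₂)
        rw [e1, ham_append (by simp [hw]; omega), e2]
        rw [hw'] at e3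
        linarith)
    rw [cost_mul_left] at s1
    have s4 : cost (wd A N) (wd B n₁) (κ₂ u') (fun y z => n₂ + N * if z = f u' y then 0 else 1) ≤
        n₂ + N * (3 * δ) := by
      rw [cost_add_fun, cost_mul_left, (hκ₂ u').cost_const, p.sum_law, one_mul]
      gcongr
      exact hf u'
    have s5 : (N : ℝ) * cost (wd A N) (wd A N) κL (fun x y => if x = y then 0 else 1) ≤ N * δ := by
      gcongr
    have s6 : (N : ℝ) * δ ≤ N * (ε / 16) := by gcongr; linarith
    have s7 : ε₁ * N ≤ ε / 16 * N := by gcongr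
    have s8 : (0 : ℝ) ≤ k := Nat.cast_nonneg k
    rw [hη] at hn2u
    linarith
  · have lz : ∀ (x : List A) (w : List B), x.length = N → w.length = n₁ →
        ((x.take n₁).zip w).length = n₁ := fun x w hx hw => by
      simp [hx, hw]; omega
    have s1 := hκL.glue_cost (hκ₂ u') (c := fun x z => wsum (V i) [] ((x.take n₁).zip z))
      (c₁ := fun x y => k + k * (N * if x = y then 0 else 1))
      (c₂ := fun y z => wsum (V i) [] ((y.take n₁).zip z))
      (fun x hx y hy z hz => by
        have hx := mem_wd.1 hx
        have hy := mem_wd.1 hy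
        have hz := mem_wd.1 hz
        have b1 := wsum_window_le (h0 i) (h1 i) (hV i) (z := (x.take n₁).zip z)
          (z' := (y.take n₁).zip z) (by rw [lz x z hx hz, lz y z hy hz]) [] []
        have b2 : ham ((x.take n₁).zip z) ((y.take n₁).zip z) ≤ N * if x = y then 0 else 1 := by
          refine (ham_le_ite _ _ (n := N) (by rw [lz x z hx hz]; omega)).trans ?_
          by_cases hxy : x = y
          · simp [hxy]
          · rw [if_neg hxy]
            split_ifs <;> simp
        have : (k : ℝ) * ham ((x.take n₁).zip z) ((y.take n₁).zip z) ≤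
          k * (N * if x = y then 0 else 1) := by gcongr
        linarith)
    have s2 := g1.glue_cost hκR' (c := fun x w => wsum (V i) l ((x.take n₁).zip w))
      (c₁ := fun x z => wsum (V i) [] ((x.take n₁).zip z)) (c₂ := fun z w => k + k * ham z w)
      (fun x hx z hz w hw => by
        have hx := mem_wd.1 hx
        have hz := mem_wd.1 hz
        have hw := mem_wd.1 hw
        have b1 := wsum_window_le (h0 i) (h1 i) (hV i) (z := (x.take n₁).zip w)
          (z' := (x.take n₁).zip z) (by rw [lz x w hx hw, lz x z hx hz]) l []
        have b2 := ham_zip (x.take n₁) (x.take n₁) w z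
        rw [ham_self, zero_add, ham_comm] at b2
        rw [ham_comm] at b1
        have : (k : ℝ) * ham ((x.take n₁).zip z) ((x.take n₁).zip w) ≤ k * ham z w := by
          gcongr
          rwa [ham_comm z w]
        linarith)
    have s3 := hκc (fun z w => wsum (V i) l (z.zip w))
      (fun x w => wsum (V i) l ((x.take n₁).zip w) + n₂)
      (fun x hx w hw w' hw' => by
        have hx := mem_wd.1 hx
        have hw := mem_wd.1 hw
        have hw' := mem_wd.1 hw'
        have e1 : x.zip (w ++ w') = (x.take n₁).zip w ++ (x.drop n₁).zip w' := by
          conv_lhs => rw [← List.take_append_drop n₁ x]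
          rw [List.zip_append (by simp [hx, hw]; omega)]
        have e2 := wsum_le (h1 i) (l ++ (x.take n₁).zip w) ((x.drop n₁).zip w')
        have e3 : ((x.drop n₁).zip w').length = n₂ := by simp [hx, hw']; omega
        rw [e1, wsum_append]
        rw [e3] at e2
        linarith)
    rw [cost_add_fun, cost_mul_left, cost_mul_left, hκL.cost_const, p.sum_law, one_mul] at s1
    rw [cost_add_fun, cost_mul_left, hκR'.cost_const, q.sum_P, one_mul] at s2
    rw [cost_add_fun, g2.cost_const, p.sum_law, one_mul] at s3
    have s4 := hκ₂V u' i
    have s5 : (k : ℝ) * (N * cost (wd A N) (wd A N) κL (fun x y => if x = y then 0 else 1)) ≤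
        k * (N * δ) := by gcongr
    have s6 : (k : ℝ) * (N * δ) ≤ ε / 16 * N := by nlinarith
    have s7 : (k : ℝ) * (ε₁ * n₁) ≤ ε / 16 * N := by
      calc (k : ℝ) * (ε₁ * n₁) ≤ k * (ε₁ * N) := by gcongr
        _ = k * ε₁ * N := by ring
        _ ≤ _ := by gcongr
    have s8 : (k : ℝ) * cost (wd B n₁) (wd B n₁) κR ham ≤ k * (ε₁ * n₁) := by gcongr
    have hJ0 : 0 ≤ jexp J k (V i) := Finset.sum_nonneg fun l _ => mul_nonneg (hJ.nonneg l) (h0 i l)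
    have s9 : n₁ * jexp J k (V i) ≤ N * jexp J k (V i) := by gcongr
    rw [hη] at hn2u
    linarith

end BaseCoupling2

section Markers

variable {A : Type} [DecidableEq A]

/-- One step of the parsing automaton: a block of `N` symbols starts after a marker `a₁`
read outside of a block. State `N` means that a block has just ended, `N + 1` that the
automaton is waiting for a marker. -/
def pstep (N : ℕ) (a₁ : A) (s : ℕ) (a : A) : ℕ :=
  if s < N then s + 1 else if a = a₁ then 0 else N + 1

/-- The state after reading a word. -/
def pst (N : ℕ) (a₁ : A) (x : List A) : ℕ := x.foldl (pstep N a₁) (N + 1)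

variable {N : ℕ} {a₁ : A}

lemma pstep_le (s : ℕ) (a : A) : pstep N a₁ s a ≤ N + 1 := by
  unfold pstep; split_ifs <;> omega

lemma foldl_pstep_le {s : ℕ} (hs : s ≤ N + 1) (x : List A) :
    x.foldl (pstep N a₁) s ≤ N + 1 := by
  induction x generalizing s with
  | nil => exact hs
  | cons a x ih => exact ih (pstep_le _ _)

lemma pst_le (x : List A) : pst N a₁ x ≤ N + 1 := foldl_pstep_le le_rfl x

lemma pst_append (x y : List A) : pst N a₁ (x ++ y) = y.foldl (pstep N a₁) (pst N a₁ x) :=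
  List.foldl_append

lemma foldl_pstep_add {s : ℕ} (x : List A) (h : s + x.length ≤ N) :
    x.foldl (pstep N a₁) s = s + x.length := by
  induction x generalizing s with
  | nil => rfl
  | cons a x ih =>
    simp only [List.length_cons] at h
    rw [List.foldl_cons, pstep, if_pos (by omega), ih (by omega), List.length_cons]
    omega

lemma foldl_pstep_replicate {a₀ : A} (h : a₀ ≠ a₁) (n : ℕ) {s : ℕ} (hs : s ≤ N + 1)
    (hn : N + 1 ≤ s + n) : (List.replicate n a₀).foldl (pstep N a₁) s = N + 1 := by
  induction n generalizing s with
  | zero => simp; omega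
  | succ n ih =>
    rw [List.replicate_succ, List.foldl_cons]
    refine ih (pstep_le _ _) ?_
    rw [pstep, if_neg h]
    split_ifs <;> omega

end Markers

section Sequential

variable {A B ι : Type} [Fintype A] [Fintype B] [DecidableEq A] [DecidableEq B]
  {p : Proc A} {q : Proc B}

lemma map_fst_append_zip (l : List (A × B)) {z : List A} {w : List B} (h : z.length = w.length) :
    (l ++ z.zip w).map Prod.fst = l.map Prod.fst ++ z := by
  rw [List.map_append, List.map_fst_zip h.le]

lemma map_snd_append_zip (l : List (A × B)) {z : List A} {w : List B} (h : z.length = w.length) :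
    (l ++ z.zip w).map Prod.snd = l.map Prod.snd ++ w := by
  rw [List.map_append, List.map_snd_zip h.ge]

/-- Couplings of the conditional laws given the past `l`. -/
def PCpl (p : Proc A) (q : Proc B) (l : List (A × B)) (n : ℕ) (κ : List A → List B → ℝ) : Prop :=
  IsCpl (wd A n) (wd B n) κ (p.law (l.map Prod.fst)) (q.law (l.map Prod.snd))

lemma PCpl.sum {l : List (A × B)} {n : ℕ} {κ : List A → List B → ℝ} (h : PCpl p q l n κ) (a : ℝ) :
    cost (wd A n) (wd B n) κ (fun _ _ => a) = a := by
  rw [IsCpl.cost_const h, p.sum_law, one_mul]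

lemma exists_pcpl (p : Proc A) (q : Proc B) (l : List (A × B)) (n : ℕ) : ∃ κ, PCpl p q l n κ :=
  ⟨_, IsCpl.prod (fun _ _ => p.law_nonneg _ _) (fun _ _ => q.law_nonneg _ _)
    ((p.sum_law _ _).trans (q.sum_law _ _).symm)⟩

lemma PCpl.append {l : List (A × B)} {m n : ℕ} {κ₁ : List A → List B → ℝ}
    (h₁ : PCpl p q l m κ₁) (V : ι → List (A × B) → ℝ) (c : ι → List A → List B → ℝ)
    (h₂ : ∀ x ∈ wd A m, ∀ y ∈ wd B m, ∃ κ₂, PCpl p q (l ++ x.zip y) n κ₂ ∧ ∀ i,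
      cost (wd A n) (wd B n) κ₂ (fun z w => wsum (V i) (l ++ x.zip y) (z.zip w)) ≤ c i x y) :
    ∃ κ, PCpl p q l (m + n) κ ∧ ∀ i,
      cost (wd A (m + n)) (wd B (m + n)) κ (fun z w => wsum (V i) l (z.zip w)) ≤
        cost (wd A m) (wd B m) κ₁ (fun x y => wsum (V i) l (x.zip y) + c i x y) := by
  have h₂' : ∀ x y, ∃ κ₂, (x ∈ wd A m → y ∈ wd B m → PCpl p q (l ++ x.zip y) n κ₂ ∧ ∀ i,
      cost (wd A n) (wd B n) κ₂ (fun z w => wsum (V i) (l ++ x.zip y) (z.zip w)) ≤ c i x y) := by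
    intro x y
    by_cases hx : x ∈ wd A m
    · by_cases hy : y ∈ wd B m
      · obtain ⟨κ, hκ⟩ := h₂ x hx y hy
        exact ⟨κ, fun _ _ => hκ⟩
      · exact ⟨fun _ _ => 0, fun _ h => absurd h hy⟩
    · exact ⟨fun _ _ => 0, fun h => absurd h hx⟩
  choose κ₂ hκ₂ using h₂'
  refine ⟨ccat m κ₁ κ₂, IsCpl.ccat (p₂ := fun x => p.law (l.map Prod.fst ++ x))
    (q₂ := fun x => q.law (l.map Prod.snd ++ x)) h₁ (fun x hx y hy => ?_)
    (fun x _ z _ => p.law_append _ _ _) (fun x _ z _ => q.law_append _ _ _), fun i => ?_⟩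
  · have e : x.length = y.length := (mem_wd.1 hx).trans (mem_wd.1 hy).symm
    have := (hκ₂ x y hx hy).1
    rwa [PCpl, map_fst_append_zip l e, map_snd_append_zip l e] at this
  · rw [cost_ccat]
    refine IsCpl.cost_mono h₁ fun x hx y hy => ?_
    have e : x.length = y.length := (mem_wd.1 hx).trans (mem_wd.1 hy).symm
    simp only [List.zip_append e, wsum_append]
    rw [cost_add_fun, (hκ₂ x y hx hy).1.sum]
    gcongr
    exact (hκ₂ x y hx hy).2 i

variable {N : ℕ} {a₁ : A}

theorem exists_sequential_cpl {V : ι → List (A × B) → ℝ} {t : ι → ℝ} {ε c : ℝ}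
    (hc : ∀ u, c ≤ p.law u [a₁]) (hc0 : 0 ≤ c) (hcN : 1 ≤ c * (ε * N)) (hε0 : 0 ≤ ε) (hε1 : ε ≤ 1)
    (ht : ∀ i, 0 ≤ t i) (h0 : ∀ i l, 0 ≤ V i l)
    (hwait : ∀ i l, pst N a₁ (l.map Prod.fst) = N + 1 → V i l ≤ 1)
    (hinc : ∀ i l z, pst N a₁ (l.map Prod.fst) = 0 → z.length < N → wsum (V i) l z ≤ N)
    (hblk : ∀ l, pst N a₁ (l.map Prod.fst) = 0 → ∃ κ, PCpl p q l N κ ∧ ∀ i,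
      cost (wd A N) (wd B N) κ (fun z w => wsum (V i) l (z.zip w) + V i (l ++ z.zip w)) ≤
        (t i - ε) * N + 1) (M : ℕ) :
    ∀ l, N ≤ pst N a₁ (l.map Prod.fst) → ∃ κ, PCpl p q l M κ ∧ ∀ i,
      cost (wd A M) (wd B M) κ (fun z w => wsum (V i) l (z.zip w)) ≤
        V i l + t i * M + 2 * N := by
  induction M using Nat.strong_induction_on with
  | _ M ih =>
  intro l hl
  obtain _ | M := M
  · obtain ⟨κ, hκ⟩ := exists_pcpl p q l 0
    refine ⟨κ, hκ, fun i => ?_⟩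
    have : cost (wd A 0) (wd B 0) κ (fun z w => wsum (V i) l (z.zip w)) = 0 := by
      simp [cost, sum_wd_zero, wsum]
    rw [this]
    have := h0 i l
    simp only [CharP.cast_eq_zero, mul_zero, add_zero]
    positivity
  · obtain ⟨κ₁, hκ₁⟩ := exists_pcpl p q l 1
    have main := hκ₁.append (n := M) V (fun i x _ => if x = [a₁] then
        t i * M - ε * N + 1 + 2 * N else t i * M + 1 + 2 * N) ?_
    · rw [add_comm 1 M] at main
      obtain ⟨κ, hκ, hκV⟩ := main
      refine ⟨κ, hκ, fun i => (hκV i).trans ?_⟩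
      have e : cost (wd A 1) (wd B 1) κ₁ (fun x y => wsum (V i) l (x.zip y) +
          if x = [a₁] then t i * M - ε * N + 1 + 2 * N else t i * M + 1 + 2 * N) =
          cost (wd A 1) (wd B 1) κ₁ (fun x _ => (V i l + t i * M + 1 + 2 * N) +
            (-(ε * N)) * if x = [a₁] then 1 else 0) := by
        refine Finset.sum_congr rfl fun x hx => Finset.sum_congr rfl fun y hy => ?_
        obtain ⟨a, rfl⟩ := List.length_eq_one_iff.1 (mem_wd.1 hx)
        obtain ⟨b, rfl⟩ := List.length_eq_one_iff.1 (mem_wd.1 hy)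
        congr 1
        simp only [List.zip_cons_cons, List.zip_nil_left, wsum, add_zero]
        split_ifs <;> ring
      rw [e, cost_add_fun, cost_mul_left, hκ₁.sum, IsCpl.cost_left hκ₁]
      simp only [mul_ite, mul_one, mul_zero, Finset.sum_ite_eq']
      rw [if_pos (by simp)]
      have h1 := hc (l.map Prod.fst)
      have h2 : c * (ε * N) ≤ p.law (l.map Prod.fst) [a₁] * (ε * N) := by gcongr
      have := ht i
      push_cast
      nlinarith
    · intro x hx y hy
      obtain ⟨a, rfl⟩ := List.length_eq_one_iff.1 (mem_wd.1 hx)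
      obtain ⟨b, rfl⟩ := List.length_eq_one_iff.1 (mem_wd.1 hy)
      set l' := l ++ [a].zip [b] with hl'
      have hst : pst N a₁ (l'.map Prod.fst) = if a = a₁ then 0 else N + 1 := by
        rw [hl', map_fst_append_zip l (by simp), pst_append, List.foldl_cons, List.foldl_nil,
          pstep, if_neg (by omega)]
      by_cases ha : a = a₁
      · rw [if_pos ha] at hst
        simp only [ha, if_true]
        rcases le_or_gt N M with hNM | hNM
        · obtain ⟨κ₂, hκ₂, hκ₂V⟩ := hblk l' hst
          obtain ⟨n, rfl⟩ := Nat.exists_eq_add_of_le hNM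
          obtain ⟨κ, hκ, hκV⟩ := hκ₂.append (n := n) V
            (fun i x y => V i (l' ++ x.zip y) + t i * n + 2 * N) fun x hx y hy => by
              refine ih n (by omega) _ ?_
              have hx := mem_wd.1 hx
              rw [map_fst_append_zip _ (hx.trans (mem_wd.1 hy).symm), pst_append, hst,
                foldl_pstep_add _ (by omega)]
              omega
          refine ⟨κ, hκ, fun i => (hκV i).trans ?_⟩
          simp only [← add_assoc]
          rw [cost_add_fun, cost_add_fun, hκ₂.sum, hκ₂.sum]
          have := hκ₂V i
          push_cast
          linarith
        · obtain ⟨κ, hκ⟩ := exists_pcpl p q l' M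
          refine ⟨κ, hκ, fun i => ?_⟩
          have : cost (wd A M) (wd B M) κ (fun z w => wsum (V i) l' (z.zip w)) ≤ N := by
            rw [← hκ.sum (N : ℝ)]
            refine IsCpl.cost_mono hκ fun z hz w hw => hinc i l' _ hst ?_
            simp [mem_wd.1 hz, mem_wd.1 hw, hNM]
          have h1 : ε * N ≤ 1 * N := by gcongr
          have h2 : 0 ≤ t i * M := mul_nonneg (ht i) (Nat.cast_nonneg _)
          linarith
      · rw [if_neg ha] at hst
        obtain ⟨κ, hκ, hκV⟩ := ih M (by omega) l' (by omega)
        refine ⟨κ, hκ, fun i => (hκV i).trans ?_⟩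
        rw [if_neg (by simpa using ha)]
        have := hwait i l' hst
        linarith

end Sequential

section Suffixes

variable {C : Type} [Fintype C] [DecidableEq C]

/-- The indicator of the words ending with `l`. -/
def sfx (l w : List C) : ℝ := if l <:+ w then 1 else 0

lemma sfx_nonneg (l w : List C) : 0 ≤ sfx l w := by unfold sfx; split_ifs <;> simp

lemma sfx_le_one (l w : List C) : sfx l w ≤ 1 := by unfold sfx; split_ifs <;> simp

lemma sfx_of_length_lt {l w : List C} (h : w.length < l.length) : sfx l w = 0 :=
  if_neg fun h' => absurd h'.length_le (by omega)

lemma sfx_append {l v : List C} (h : v.length = l.length) (u : List C) :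
    sfx l (u ++ v) = if v = l then 1 else 0 := by
  unfold sfx
  congr 1
  refine propext ⟨fun h' => ?_, fun h' => h' ▸ List.suffix_append u v⟩
  exact ((List.suffix_of_suffix_length_le h' (List.suffix_append u v) h.ge).eq_of_length h.symm).symm

lemma sum_sfx_snoc_nil (l : List C) : ∑ c, sfx (l ++ [c]) [] = 0 :=
  Finset.sum_eq_zero fun c _ => sfx_of_length_lt (by simp)

lemma sum_sfx_snoc (l w : List C) (a : C) : ∑ c, sfx (l ++ [c]) (w ++ [a]) = sfx l w := by
  have : ∀ c, sfx (l ++ [c]) (w ++ [a]) = if a = c then sfx l w else 0 := by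
    intro c
    unfold sfx
    by_cases h : a = c
    · subst h
      rw [if_pos rfl]
      congr 1
      refine propext ⟨fun ⟨t, ht⟩ => ⟨t, ?_⟩, fun ⟨t, ht⟩ => ⟨t, by rw [← ht, List.append_assoc]⟩⟩
      rw [← List.append_assoc] at ht
      exact List.append_cancel_right ht
    · rw [if_neg h, if_neg]
      intro h'
      have h2 := (List.suffix_append l [c]).trans h'
      rw [List.singleton_suffix_iff_getLast?_eq_some] at h2
      simp at h2
      exact h h2
  simp [this]

lemma sum_sfx_cons (l w : List C) : ∑ c, sfx (c :: l) w + (if w = l then 1 else 0) = sfx l w := by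
  rcases lt_or_ge l.length w.length with h | h
  · obtain ⟨u, v, rfl, hv⟩ : ∃ u v, w = u ++ v ∧ v.length = l.length + 1 :=
      ⟨w.take (w.length - (l.length + 1)), w.drop (w.length - (l.length + 1)), by simp,
        by simp; omega⟩
    obtain _ | ⟨b, v⟩ := v
    · simp at hv
    have hv' : v.length = l.length := by simpa using hv
    rw [if_neg (fun h' => by rw [h'] at h; exact lt_irrefl _ h), add_zero]
    have e : u ++ b :: v = (u ++ [b]) ++ v := by simp
    have : ∀ c, sfx (c :: l) (u ++ b :: v) = if b = c then (if v = l then 1 else 0) else 0 := by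
      intro c
      rw [sfx_append (by simp [hv'])]
      simp [ite_and]
    rw [Finset.sum_congr rfl fun c _ => this c, e, sfx_append hv']
    simp
  · rw [Finset.sum_eq_zero fun c _ => sfx_of_length_lt (by simp; omega), zero_add]
    unfold sfx
    congr 1
    exact propext ⟨fun h' => h' ▸ List.suffix_rfl, fun h' => (h'.eq_of_length (le_antisymm h'.length_le h)).symm⟩

lemma wsum_sum {ι : Type} (s : Finset ι) (a : ι → ℝ) (V : ι → List C → ℝ) (u z : List C) :
    wsum (fun l => ∑ i ∈ s, a i * V i l) u z = ∑ i ∈ s, a i * wsum (V i) u z := by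
  induction z generalizing u with
  | nil => simp [wsum]
  | cons c z ih => simp [wsum, ih, mul_add, Finset.sum_add_distrib]

lemma wsum_mono {V W : List C → ℝ} (h : ∀ l, V l ≤ W l) (u z : List C) :
    wsum V u z ≤ wsum W u z := by
  induction z generalizing u with
  | nil => simp [wsum]
  | cons c z ih => exact add_le_add (h _) (ih _)

lemma wsum_sfx_snoc (l z : List C) (a : C) :
    wsum (fun w => ∑ c, 1 * sfx (l ++ [c]) w) [] (z ++ [a]) = wsum (sfx l) [] z := by
  simp only [one_mul]
  induction z using List.reverseRecOn generalizing a with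
  | nil => simp [wsum, sum_sfx_snoc_nil]
  | append_singleton z b ih => rw [wsum_snoc, ih, wsum_snoc, List.nil_append, List.nil_append, sum_sfx_snoc]

lemma abs_wsum_sfx_snoc (l z : List C) :
    |wsum (fun w => ∑ c, 1 * sfx (l ++ [c]) w) [] z - wsum (sfx l) [] z| ≤ 1 := by
  induction z using List.reverseRecOn with
  | nil => simp [wsum]
  | append_singleton z a _ =>
    rw [wsum_sfx_snoc, wsum_snoc, abs_le]
    constructor <;> linarith [sfx_nonneg l ([] ++ z), sfx_le_one l ([] ++ z)]

lemma wsum_eq_le (l z : List C) :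
    wsum (fun w => if w = l then 1 else 0) [] z ≤ if z.length ≤ l.length then 0 else 1 := by
  induction z using List.reverseRecOn with
  | nil => simp [wsum]
  | append_singleton z a ih =>
    rw [wsum_snoc, List.nil_append, List.length_append, List.length_singleton]
    rcases lt_trichotomy z.length l.length with h | h | h
    · rw [if_pos h.le] at ih
      rw [if_neg (fun e => by rw [e] at h; exact lt_irrefl _ h), if_pos (by omega)]
      linarith
    · rw [if_pos h.le] at ih
      rw [if_neg (show ¬ z.length + 1 ≤ l.length by omega)]
      split_ifs <;> linarith
    · rw [if_neg (by omega)] at ih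
      rw [if_neg (fun e => by rw [e] at h; exact lt_irrefl _ h), if_neg (by omega)]
      linarith

lemma wsum_add (V W : List C → ℝ) (u z : List C) :
    wsum (fun l => V l + W l) u z = wsum V u z + wsum W u z := by
  induction z generalizing u with
  | nil => simp [wsum]
  | cons c z ih => simp only [wsum, ih]; ring

lemma abs_wsum_sfx_cons (l z : List C) :
    |wsum (fun w => ∑ c, 1 * sfx (c :: l) w) [] z - wsum (sfx l) [] z| ≤ 1 := by
  have e : wsum (sfx l) [] z = wsum (fun w => ∑ c, 1 * sfx (c :: l) w) [] z +
      wsum (fun w => if w = l then 1 else 0) [] z := by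
    rw [← wsum_add]
    congr 1
    funext w
    simp only [one_mul, sum_sfx_cons]
  have h1 := wsum_eq_le l z
  have h2 : 0 ≤ wsum (fun w => if w = l then (1 : ℝ) else 0) [] z :=
    wsum_nonneg (fun w => by positivity) _ _
  have h3 : (if z.length ≤ l.length then (0 : ℝ) else 1) ≤ 1 := by split_ifs <;> simp
  rw [e, abs_le]
  constructor <;> linarith

lemma sum_mul_sfx_le {V : List C → ℝ} {k : ℕ} (h0 : ∀ l, 0 ≤ V l)
    (hV : ∀ l l', Agr k l l' → V l = V l') (w : List C) :
    ∑ l ∈ wd C k, V l * sfx l w ≤ V w := by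
  rcases le_or_gt k w.length with h | h
  · rw [Finset.sum_eq_single (w.drop (w.length - k))]
    · rw [hV _ _ (agr_drop h)]
      exact mul_le_of_le_one_right (h0 _) (sfx_le_one _ _)
    · intro l hl hne
      have hl := mem_wd.1 hl
      conv_lhs => rw [← List.take_append_drop (w.length - k) w]
      rw [sfx_append (by simp; omega), if_neg (Ne.symm hne), mul_zero]
    · intro h'
      exact absurd (mem_wd.2 (by simp; omega)) h'
  · rw [Finset.sum_eq_zero fun l hl => ?_]
    · exact h0 _
    · have hl := mem_wd.1 hl
      rw [sfx_of_length_lt (by omega), mul_zero]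

lemma Proc.sum_sfx (p : Proc C) (z : List C) (n : ℕ) :
    ∑ x ∈ wd C n, p.P x * sfx z x = if z.length ≤ n then p.P z else 0 := by
  split_ifs with h
  · obtain ⟨m, rfl⟩ := Nat.exists_eq_add_of_le' h
    rw [sum_wd_add, Finset.sum_comm, Finset.sum_eq_single z]
    · rw [← p.sum_P_prepend z m]
      exact Finset.sum_congr rfl fun u _ => by rw [sfx_append rfl, if_pos rfl, mul_one]
    · intro v hv hne
      exact Finset.sum_eq_zero fun u _ => by
        rw [sfx_append (mem_wd.1 hv), if_neg hne, mul_zero]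
    · intro h'
      exact absurd (mem_wd.2 rfl) h'
  · exact Finset.sum_eq_zero fun x hx => by
      have := mem_wd.1 hx
      rw [sfx_of_length_lt (by omega), mul_zero]

lemma Proc.abs_sum_wsum_sfx (p : Proc C) (z : List C) (n : ℕ) :
    |∑ x ∈ wd C n, p.P x * wsum (sfx z) [] x - n * p.P z| ≤ z.length := by
  have key : ∑ x ∈ wd C n, p.P x * wsum (sfx z) [] x = (n - z.length : ℕ) * p.P z := by
    induction n with
    | zero => simp [sum_wd_zero, wsum]
    | succ n ih =>
      rw [sum_wd_snoc]
      have : ∀ x, ∑ a, p.P (x ++ [a]) * wsum (sfx z) [] (x ++ [a]) =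
          p.P x * wsum (sfx z) [] x + p.P x * sfx z x := by
        intro x
        simp only [wsum_snoc, List.nil_append]
        rw [← Finset.sum_mul, p.snoc, mul_add]
      rw [Finset.sum_congr rfl fun x _ => this x, Finset.sum_add_distrib, ih, p.sum_sfx]
      split_ifs with h
      · rw [Nat.sub_add_comm h]; push_cast; ring
      · rw [show n - z.length = 0 by omega, show n + 1 - z.length = 0 by omega, add_zero]
  have h0 := p.pos z
  have h1 : p.P z ≤ 1 := by simpa [Proc.law_nil_left] using p.law_le_one [] z
  rw [key, abs_le]
  have a1 : ((n - z.length : ℕ) : ℝ) ≤ n := by exact_mod_cast Nat.sub_le _ _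
  have a2 : (n : ℝ) ≤ (n - z.length : ℕ) + z.length := by
    exact_mod_cast (by omega : n ≤ (n - z.length) + z.length)
  have a3 : (0 : ℝ) ≤ z.length := Nat.cast_nonneg _
  constructor <;> nlinarith

end Suffixes

section LimitJoining

variable {A B : Type} [Fintype A] [Fintype B] [DecidableEq A] [DecidableEq B]
  {p : Proc A} {q : Proc B}

lemma wsum_comp_map {C D : Type} (f : C → D) (V : List D → ℝ) (u z : List C) :
    wsum (fun l => V (l.map f)) u z = wsum V (u.map f) (z.map f) := by
  induction z generalizing u with
  | nil => simp [wsum]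
  | cons c z ih => simp [wsum, ih]

lemma sum_sfx_zip_left (z : List A) (l : List (A × B)) :
    ∑ w ∈ wd B z.length, sfx (z.zip w) l = sfx z (l.map Prod.fst) := by
  rcases le_or_gt z.length l.length with h | h
  · obtain ⟨u, v, rfl, hv⟩ : ∃ u v, l = u ++ v ∧ v.length = z.length :=
      ⟨l.take (l.length - z.length), l.drop (l.length - z.length), by simp, by simp; omega⟩
    rw [List.map_append, sfx_append (by simpa), Finset.sum_eq_single (v.map Prod.snd)]
    · rw [sfx_append (by simp [hv])]
      congr 1
      refine propext ⟨fun h => ?_, fun h => ?_⟩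
      · rw [h, List.map_fst_zip (by simp [hv])]
      · rw [← h]
        exact List.zip_unzip v |>.symm.trans (by simp [List.unzip_eq_map])
    · intro w hw hne
      have hw := mem_wd.1 hw
      rw [sfx_append (by simp [hv, hw]), if_neg]
      rintro rfl
      exact hne (by rw [List.map_snd_zip hw.le])
    · intro h'
      exact absurd (mem_wd.2 (by simp [hv])) h'
  · rw [sfx_of_length_lt (by simpa), Finset.sum_eq_zero fun w hw => ?_]
    have := mem_wd.1 hw
    exact sfx_of_length_lt (by simp; omega)

lemma sum_sfx_zip_right (w : List B) (l : List (A × B)) :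
    ∑ z ∈ wd A w.length, sfx (z.zip w) l = sfx w (l.map Prod.snd) := by
  have := sum_sfx_zip_left w (l.map Prod.swap)
  rw [List.map_map] at this
  refine Eq.trans (Finset.sum_congr rfl fun z _ => ?_) this
  unfold sfx
  congr 1
  rw [← List.zip_swap z w]
  exact propext ⟨fun h => h.map _, fun h => by simpa using h.map Prod.swap⟩

/-- Couplings of longer and longer words yield a stationary joining, by averaging over
positions. -/
theorem exists_limit_join {κ : ℕ → List A → List B → ℝ}
    (hκ : ∀ M, IsCpl (wd A M) (wd B M) (κ M) p.P q.P) :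
    ∃ J, IsJoin p q J ∧ ∀ (V : List (A × B) → ℝ) (k : ℕ) (t C : ℝ), (∀ l, 0 ≤ V l) →
      (∀ l l', Agr k l l' → V l = V l') →
      (∀ M, cost (wd A M) (wd B M) (κ M) (fun z w => wsum V [] (z.zip w)) ≤ t * M + C) →
      jexp J k V ≤ t := by
  let avg : ℕ → (List (A × B) → ℝ) → ℝ := fun M V =>
    cost (wd A M) (wd B M) (κ M) (fun z w => wsum V [] (z.zip w)) / M
  have hone : ∀ M (a : ℝ), cost (wd A M) (wd B M) (κ M) (fun _ _ => a) = a := fun M a => by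
    rw [(hκ M).cost_const, p.sum_P, one_mul]
  have hsum : ∀ {ι : Type} (s : Finset ι) (a : ι → ℝ) (V : ι → List (A × B) → ℝ) (M : ℕ),
      avg M (fun l => ∑ i ∈ s, a i * V i l) = ∑ i ∈ s, a i * avg M (V i) := by
    intro ι s a V M
    simp only [avg, wsum_sum, cost]
    simp only [Finset.mul_sum, Finset.sum_div]
    rw [Finset.sum_congr rfl fun x _ => Finset.sum_comm, Finset.sum_comm]
    exact Finset.sum_congr rfl fun i _ => Finset.sum_congr rfl fun x _ =>
      Finset.sum_congr rfl fun y _ => by ring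
  have hbd : ∀ l M, avg M (sfx l) ∈ Icc (0 : ℝ) 1 := fun l M => by
    refine ⟨div_nonneg ((hκ M).cost_nonneg fun z _ w _ => wsum_nonneg (sfx_nonneg l) _ _)
      (Nat.cast_nonneg M), div_le_one_of_le₀ ?_ (Nat.cast_nonneg M)⟩
    rw [← hone M M]
    refine (hκ M).cost_mono fun z hz w hw => (wsum_le (sfx_le_one l) _ _).trans ?_
    simp [mem_wd.1 hz, mem_wd.1 hw]
  have hlim : ∀ l, ∃ x, Tendsto (fun M => avg M (sfx l)) (hyperfilter ℕ) (nhds x) ∧ 0 ≤ x := by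
    intro l
    obtain ⟨x, hx, hx2⟩ := isCompact_Icc.ultrafilter_le_nhds (s := Icc (0 : ℝ) 1)
      ((hyperfilter ℕ).map fun M => avg M (sfx l)) (by
        rw [le_principal_iff]
        exact Filter.mem_map.2 (Filter.Eventually.of_forall fun M => hbd l M))
    exact ⟨x, hx2, hx.1⟩
  choose J hJ hJ0 using hlim
  have hinv : ∀ C : ℝ, Tendsto (fun M : ℕ => C / M) (hyperfilter ℕ) (nhds 0) := fun C =>
    (tendsto_const_div_atTop_nhds_zero_nat C).mono_left Nat.hyperfilter_le_atTop
  have hJsum : ∀ {ι : Type} (s : Finset ι) (a : ι → ℝ) (l : ι → List (A × B)),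
      Tendsto (fun M => avg M (fun w => ∑ i ∈ s, a i * sfx (l i) w)) (hyperfilter ℕ)
        (nhds (∑ i ∈ s, a i * J (l i))) := by
    intro ι s a l
    simp only [hsum]
    exact tendsto_finsetSum _ fun i _ => (hJ (l i)).const_mul _
  have hclose : ∀ {V W : List (A × B) → ℝ} {x y C : ℝ},
      Tendsto (fun M => avg M V) (hyperfilter ℕ) (nhds x) →
      Tendsto (fun M => avg M W) (hyperfilter ℕ) (nhds y) →
      (∀ z, |wsum V [] z - wsum W [] z| ≤ C) → x = y := by
    intro V W x y C hx hy h
    refine sub_eq_zero.1 (tendsto_nhds_unique (hx.sub hy) ?_)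
    refine squeeze_zero_norm (fun M => ?_) (hinv C)
    rw [Real.norm_eq_abs, ← sub_div, abs_div, Nat.abs_cast]
    gcongr
    rw [abs_le]
    constructor
    · rw [neg_le_sub_iff_le_add, ← hone M C, ← cost_add_fun]
      exact (hκ M).cost_mono fun z _ w _ => by linarith [(abs_le.1 (h (z.zip w))).1]
    · rw [sub_le_iff_le_add', ← hone M C, ← cost_add_fun]
      exact (hκ M).cost_mono fun z _ w _ => by linarith [(abs_le.1 (h (z.zip w))).2]
  have hmarg : ∀ {V : List (A × B) → ℝ} {x a C : ℝ},
      Tendsto (fun M => avg M V) (hyperfilter ℕ) (nhds x) →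
      (∀ M : ℕ, |cost (wd A M) (wd B M) (κ M) (fun z w => wsum V [] (z.zip w)) - M * a| ≤ C) →
      x = a := by
    intro V x a C hx h
    refine tendsto_nhds_unique hx ?_
    rw [tendsto_iff_norm_sub_tendsto_zero]
    refine squeeze_zero' (Eventually.of_forall fun _ => norm_nonneg _) ?_ (hinv C)
    filter_upwards [Nat.hyperfilter_le_atTop (eventually_gt_atTop 0)] with M hM
    have hM' : (0 : ℝ) < M := by exact_mod_cast hM
    rw [Real.norm_eq_abs, show avg M V - a = (cost (wd A M) (wd B M) (κ M)
      (fun z w => wsum V [] (z.zip w)) - M * a) / M by simp only [avg]; field_simp, abs_div,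
      Nat.abs_cast]
    gcongr
    exact h M
  refine ⟨J, ⟨hJ0, fun l => ?_, fun l => ?_, fun z => ?_, fun w => ?_⟩, ?_⟩
  · have h1 := hJsum Finset.univ (fun _ => 1) fun c => l ++ [c]
    have := hclose h1 (hJ l) (abs_wsum_sfx_snoc l)
    simpa using this
  · have h1 := hJsum Finset.univ (fun _ => 1) fun c => c :: l
    have := hclose h1 (hJ l) (abs_wsum_sfx_cons l)
    simpa using this
  · have h1 := hJsum (wd B z.length) (fun _ => 1) fun w => z.zip w
    have := hmarg (a := p.P z) (C := z.length) h1 fun M => ?_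
    · simpa using this
    · refine Eq.trans_le ?_ (p.abs_sum_wsum_sfx z M)
      congr 2
      rw [← (hκ M).cost_left]
      refine Finset.sum_congr rfl fun x hx => Finset.sum_congr rfl fun y hy => ?_
      simp only [one_mul, sum_sfx_zip_left]
      rw [wsum_comp_map, List.map_fst_zip ((mem_wd.1 hx).trans (mem_wd.1 hy).symm).le]
      rfl
  · have h1 := hJsum (wd A w.length) (fun _ => 1) fun z => z.zip w
    have := hmarg (a := q.P w) (C := w.length) h1 fun M => ?_
    · simpa using this
    · refine Eq.trans_le ?_ (q.abs_sum_wsum_sfx w M)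
      congr 2
      rw [← (hκ M).cost_right]
      refine Finset.sum_congr rfl fun x hx => Finset.sum_congr rfl fun y hy => ?_
      simp only [one_mul, sum_sfx_zip_right]
      rw [wsum_comp_map, List.map_snd_zip ((mem_wd.1 hx).trans (mem_wd.1 hy).symm).ge]
      rfl
  · intro V k t C h0 hV hc
    have h1 := hJsum (wd (A × B) k) V id
    have h2 : jexp J k V = ∑ i ∈ wd (A × B) k, V i * J (id i) :=
      Finset.sum_congr rfl fun l _ => mul_comm _ _
    have h3 : Tendsto (fun M : ℕ => t + C / M) (hyperfilter ℕ) (nhds (t + 0)) :=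
      tendsto_const_nhds.add (hinv C)
    rw [add_zero] at h3
    rw [h2]
    refine le_of_tendsto_of_tendsto h1 h3 ?_
    filter_upwards [Nat.hyperfilter_le_atTop (eventually_gt_atTop 0)] with M hM
    have hM' : (0 : ℝ) < M := by exact_mod_cast hM
    rw [div_le_iff₀ hM', add_mul, div_mul_cancel₀ _ hM'.ne']
    refine le_trans ((hκ M).cost_mono fun z _ w _ => wsum_mono (sum_mul_sfx_le h0 hV) _ _) (hc M)

end LimitJoining

section Sync

variable {A : Type} [DecidableEq A] {N : ℕ} {a₁ : A}

/-- After reading `x` the state of the automaton does not depend on the initial state. -/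
def Sync (N : ℕ) (a₁ : A) (x : List A) : Prop :=
  ∀ s ≤ N + 1, x.foldl (pstep N a₁) s = x.foldl (pstep N a₁) (N + 1)

lemma Sync.append_right {x : List A} (h : Sync N a₁ x) (y : List A) : Sync N a₁ (x ++ y) :=
  fun s hs => by rw [List.foldl_append, List.foldl_append, h s hs]

lemma Sync.append_left {y : List A} (h : Sync N a₁ y) (x : List A) : Sync N a₁ (x ++ y) :=
  fun s hs => by
    rw [List.foldl_append, List.foldl_append, h _ (foldl_pstep_le hs x),
      h _ (foldl_pstep_le le_rfl x)]

lemma Sync.pst_append {y : List A} (h : Sync N a₁ y) (x : List A) :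
    pst N a₁ (x ++ y) = pst N a₁ y := by
  rw [GibbsFormal.pst_append]; exact h _ (pst_le x)

variable [Fintype A]

open Classical in
lemma Proc.sum_not_sync_le (p : Proc A) {c : ℝ} {a₀ : A} (h : a₀ ≠ a₁) (hc0 : 0 < c)
    (hc : ∀ u a, c ≤ p.law u [a]) (n : ℕ) (u : List A) :
    ∑ z ∈ wd A (n * (N + 1)), p.law u z * (if Sync N a₁ z then 0 else 1) ≤
      (1 - c ^ (N + 1)) ^ n := by
  have hc1 : c ≤ 1 := (hc [] a₁).trans (p.law_le_one _ _)
  have hcN : c ^ (N + 1) ≤ 1 := pow_le_one₀ hc0.le hc1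
  have one : ∀ u, ∑ z ∈ wd A (N + 1), p.law u z * (if Sync N a₁ z then 0 else 1) ≤
      1 - c ^ (N + 1) := by
    intro u
    set z₀ := List.replicate (N + 1) a₀ with hz₀
    have hs : Sync N a₁ z₀ := fun s hs => by
      rw [foldl_pstep_replicate h _ hs (by omega), foldl_pstep_replicate h _ le_rfl (by omega)]
    have h1 : c ^ (N + 1) ≤ p.law u z₀ := by
      have := p.pow_le_law hc0.le hc u z₀
      simpa [hz₀] using this
    have h2 : ∑ z ∈ wd A (N + 1), p.law u z * (if Sync N a₁ z then 0 else 1) +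
        ∑ z ∈ wd A (N + 1), p.law u z * (if z = z₀ then 1 else 0) ≤ 1 := by
      refine le_trans ?_ (p.sum_law u (N + 1)).le
      rw [← Finset.sum_add_distrib]
      refine Finset.sum_le_sum fun z _ => ?_
      have := p.law_nonneg u z
      by_cases hz : z = z₀
      · subst hz
        rw [if_pos hs]
        simp
      · rw [if_neg hz]
        split_ifs <;> simp [this]
    have h3 : ∑ z ∈ wd A (N + 1), p.law u z * (if z = z₀ then 1 else 0) = p.law u z₀ := by
      simp only [mul_ite, mul_one, mul_zero, Finset.sum_ite_eq']
      rw [if_pos (by simp [hz₀])]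
    linarith
  induction n generalizing u with
  | zero =>
    rw [Nat.zero_mul, sum_wd_zero, pow_zero, p.law_nil]
    split_ifs <;> simp
  | succ n ih =>
    rw [Nat.succ_mul, p.sum_law_add, pow_succ]
    have h0 : 0 ≤ 1 - c ^ (N + 1) := by linarith
    calc _ ≤ ∑ x ∈ wd A (n * (N + 1)), p.law u x *
          ((if Sync N a₁ x then 0 else 1) * (1 - c ^ (N + 1))) := by
          refine Finset.sum_le_sum fun x _ => mul_le_mul_of_nonneg_left ?_ (p.law_nonneg _ _)
          by_cases hx : Sync N a₁ x
          · rw [if_pos hx, zero_mul]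
            exact (Finset.sum_eq_zero fun y _ => by
              rw [if_pos (hx.append_right y), mul_zero]).le
          · rw [if_neg hx, one_mul]
            refine le_trans (Finset.sum_le_sum fun y _ => ?_) (one (u ++ x))
            refine mul_le_mul_of_nonneg_left ?_ (p.law_nonneg _ _)
            by_cases hy : Sync N a₁ y
            · rw [if_pos hy, if_pos (hy.append_left x)]
            · rw [if_neg hy]; split_ifs <;> simp
      _ = (∑ x ∈ wd A (n * (N + 1)), p.law u x * (if Sync N a₁ x then 0 else 1)) *
          (1 - c ^ (N + 1)) := by
          rw [Finset.sum_mul]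
          exact Finset.sum_congr rfl fun x _ => by ring
      _ ≤ _ := mul_le_mul_of_nonneg_right (ih u) h0

open Classical in
lemma Proc.exists_sync (p : Proc A) {c : ℝ} {a₀ : A} (h : a₀ ≠ a₁) (hc0 : 0 < c)
    (hc : ∀ u a, c ≤ p.law u [a]) (N : ℕ) {δ : ℝ} (hδ : 0 < δ) :
    ∃ K, ∑ z ∈ wd A K, p.P z * (if Sync N a₁ z then 0 else 1) ≤ δ := by
  have hc1 : c ≤ 1 := (hc [] a₁).trans (p.law_le_one _ _)
  have hcN : c ^ (N + 1) ≤ 1 := pow_le_one₀ hc0.le hc1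
  have h2 : 0 < c ^ (N + 1) := pow_pos hc0 _
  obtain ⟨n, hn⟩ := exists_pow_lt_of_lt_one hδ (show 1 - c ^ (N + 1) < 1 by linarith)
  refine ⟨n * (N + 1), le_trans ?_ hn.le⟩
  simpa [p.law_nil_left] using p.sum_not_sync_le (N := N) h hc0 hc n []

end Sync

section Lastk

variable {A : Type}

lemma length_lastk (R : ℕ) (u : List A) : (lastk R u).length = min R u.length := by
  simp only [lastk, List.length_drop]; omega

lemma lastk_append_add {R N : ℕ} {u z : List A} (hz : z.length = N) :
    lastk (R + N) (u ++ z) = lastk R u ++ z := by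
  rw [lastk, List.length_append, hz, show u.length + N - (R + N) = u.length - R by omega,
    List.drop_append_of_le_length (by omega), lastk]

lemma lastk_append {N : ℕ} {u z : List A} (hz : z.length = N) : lastk N (u ++ z) = z := by
  simp [lastk, ← hz]

lemma lastk_lastk {m K : ℕ} (h : m ≤ K) (u : List A) : lastk m (lastk K u) = lastk m u := by
  rw [lastk, length_lastk, lastk, List.drop_drop, lastk]
  congr 1
  omega

lemma map_lastk {B : Type} (f : A → B) (K : ℕ) (u : List A) :
    (lastk K u).map f = lastk K (u.map f) := by
  simp [lastk]

lemma Agr.lastk_eq {K : ℕ} {u v : List A} (h : Agr K u v) : lastk K u = lastk K v := by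
  obtain ⟨u', v', w, hw, rfl, rfl⟩ := h
  rw [lastk_append hw, lastk_append hw]

lemma take_append_lastk (K : ℕ) (u : List A) : u.take (u.length - K) ++ lastk K u = u :=
  List.take_append_drop _ _

end Lastk

section BlockError

variable {A B : Type} [Fintype A] [Fintype B] [DecidableEq A] [DecidableEq B] {N R : ℕ} {a₁ : A}
  {ψ : List A → List B}

/-- The number of errors of the block code `ψ` in a block that has just ended, plus one;
time spent waiting counts as an error. -/
def blkErr (N R : ℕ) (a₁ : A) (ψ : List A → List B) (l : List (A × B)) : ℝ :=
  if pst N a₁ (l.map Prod.fst) < N then 0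
  else if pst N a₁ (l.map Prod.fst) = N then
    1 + ham (lastk N (l.map Prod.snd)) (ψ (lastk (R + N) (l.map Prod.fst)))
  else 1

lemma blkErr_nonneg (l : List (A × B)) : 0 ≤ blkErr N R a₁ ψ l := by
  unfold blkErr
  split_ifs
  · rfl
  · linarith [ham_nonneg (lastk N (l.map Prod.snd)) (ψ (lastk (R + N) (l.map Prod.fst)))]
  · exact zero_le_one

lemma blkErr_le (l : List (A × B)) : blkErr N R a₁ ψ l ≤ N + 1 := by
  unfold blkErr
  have : (0 : ℝ) ≤ N := Nat.cast_nonneg N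
  split_ifs
  · linarith
  · have h1 := ham_le (lastk N (l.map Prod.snd)) (ψ (lastk (R + N) (l.map Prod.fst)))
    have h2 : ((lastk N (l.map Prod.snd)).length : ℝ) ≤ N := by
      exact_mod_cast (length_lastk _ _).trans_le (min_le_left _ _)
    linarith
  · linarith

lemma blkErr_lastk {K K₀ : ℕ} (hK : K₀ + R + N ≤ K) {l : List (A × B)}
    (hs : Sync N a₁ (lastk K₀ (l.map Prod.fst))) :
    blkErr N R a₁ ψ (lastk K l) = blkErr N R a₁ ψ l := by
  have h1 : pst N a₁ ((lastk K l).map Prod.fst) = pst N a₁ (l.map Prod.fst) := by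
    have e1 := hs.pst_append ((l.map Prod.fst).take ((l.map Prod.fst).length - K₀))
    have e2 : Sync N a₁ (lastk K₀ (lastk K (l.map Prod.fst))) := by
      rwa [lastk_lastk (by omega)]
    have e3 := e2.pst_append ((lastk K (l.map Prod.fst)).take ((lastk K (l.map Prod.fst)).length - K₀))
    rw [take_append_lastk] at e1 e3
    rw [map_lastk, e1, e3, lastk_lastk (by omega)]
  unfold blkErr
  rw [h1, map_lastk, map_lastk, lastk_lastk (by omega), lastk_lastk (by omega)]

lemma wsum_blkErr (z : List (A × B)) (l : List (A × B))
    (h : pst N a₁ (l.map Prod.fst) + z.length ≤ N) : wsum (blkErr N R a₁ ψ) l z = 0 := by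
  induction z generalizing l with
  | nil => rfl
  | cons c z ih =>
    simp only [List.length_cons] at h
    rw [wsum, ih, add_zero, blkErr, if_pos (by omega)]
    rw [List.map_append, pst_append]
    simp only [List.map_cons, List.map_nil, List.foldl_cons, List.foldl_nil]
    rw [pstep, if_pos (by omega)]
    omega

lemma ham_eq_sum {y w : List B} (h : y.length = w.length) :
    ham y w = ∑ j ∈ Finset.range y.length, if y[j]? = w[j]? then 0 else 1 := by
  induction y generalizing w with
  | nil => simp
  | cons a y ih =>
    obtain _ | ⟨b, w⟩ := w
    · simp at h
    rw [ham_cons, List.length_cons, Finset.sum_range_succ', ih (by simpa using h), add_comm]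
    simp

end BlockError

section CodingError

variable {A B : Type} [Fintype A] [Fintype B] [DecidableEq A] [DecidableEq B]

/-- The indicator of an error when the symbol at position `n` of the second word is predicted
from the first word. -/
def cerr (n : ℕ) (Φ : List A → B) (l : List (A × B)) : ℝ :=
  if (l.map Prod.snd)[n]? = some (Φ (l.map Prod.fst)) then 0 else 1

lemma cerr_le_one (n : ℕ) (Φ : List A → B) (l : List (A × B)) : cerr n Φ l ≤ 1 := by
  unfold cerr; split_ifs <;> simp

/-- Up to an error `δ`, the second coordinate is a function of finitely many symbols of the
first one. -/
def Coded (J : List (A × B) → ℝ) (δ : ℝ) : Prop :=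
  ∃ (n k : ℕ) (Φ : List A → B), jexp J (n + 1 + k) (cerr n Φ) < δ

variable {p : Proc A} {q : Proc B} {J : List (A × B) → ℝ} {N R : ℕ} {a₁ : A}
  {ψ : List A → List B}

/-- The window of length `K` ending `r` symbols before the end of a word of length `K + N`. -/
def win {C : Type} (K N r : ℕ) (l : List C) : List C := (l.take (K + N - r)).drop (N - r)

lemma map_win {C D : Type} (f : C → D) (K N r : ℕ) (l : List C) :
    (win K N r l).map f = win K N r (l.map f) := by simp [win]

lemma IsJoin.jexp_win (h : IsJoin p q J) {K N r : ℕ} (hr : r ≤ N) (V : List (A × B) → ℝ) :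
    jexp J (K + N) (fun l => V (win K N r l)) = jexp J K V := by
  have h1 := h.jexp_take r (K + N - r) (fun l => V (l.drop (N - r)))
  have h2 := h.jexp_drop (N - r) K V
  rw [show K + N - r + r = K + N by omega] at h1
  rw [show N - r + K = K + N - r by omega] at h2
  exact h1.trans h2

lemma jexp_sum {ι : Type} (s : Finset ι) (n : ℕ) (V : ι → List (A × B) → ℝ) :
    jexp J n (fun l => ∑ i ∈ s, V i l) = ∑ i ∈ s, jexp J n (V i) := by
  simp only [jexp, Finset.mul_sum]
  rw [Finset.sum_comm]

/-- An error at the `r`-th place of a block that has just ended. The place `0` is the marker. -/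
def posErr (N R : ℕ) (a₁ : A) (ψ : List A → List B) (r : ℕ) (l : List (A × B)) : ℝ :=
  if pst N a₁ (l.map Prod.fst) = N then
    if r = 0 then 1
    else if (lastk N (l.map Prod.snd))[r - 1]? = (ψ (lastk (R + N) (l.map Prod.fst)))[r - 1]?
      then 0 else 1
  else 0

lemma posErr_nonneg (r : ℕ) (l : List (A × B)) : 0 ≤ posErr N R a₁ ψ r l := by
  unfold posErr; split_ifs <;> simp

lemma posErr_sum_le (hψ : ∀ e, (ψ e).length = N) {l : List (A × B)} (hl : N ≤ l.length) :
    (if pst N a₁ (l.map Prod.fst) = N + 1 then (1 : ℝ) else 0) +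
      ∑ r ∈ Finset.range (N + 1), posErr N R a₁ ψ r l ≤ blkErr N R a₁ ψ l := by
  by_cases h : pst N a₁ (l.map Prod.fst) = N
  · have hlen : (lastk N (l.map Prod.snd)).length = N := by
      rw [length_lastk]; simpa using hl
    rw [if_neg (by omega), blkErr, if_neg (by omega), if_pos h, Finset.sum_range_succ',
      ham_eq_sum (hlen.trans (hψ _).symm), hlen]
    simp only [posErr, if_pos h]
    simp [add_comm]
  · rw [Finset.sum_eq_zero fun r _ => by rw [posErr, if_neg h], add_zero]
    unfold blkErr
    rw [if_neg h]
    have := pst_le (N := N) (a₁ := a₁) (l.map Prod.fst)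
    split_ifs <;> first | omega | simp

open Classical in
lemma exists_cerr_le [Nonempty B] {K₀ K : ℕ} (hK : K = K₀ + R + N) (hN : 1 ≤ N)
    (hψ : ∀ e, (ψ e).length = N) :
    ∃ Φ : List A → B, ∀ l : List (A × B), l.length = K + N →
      cerr (K - 1) Φ l ≤
        (if pst N a₁ ((win K N N l).map Prod.fst) = N + 1 then 1 else 0) +
        ∑ r ∈ Finset.range (N + 1), posErr N R a₁ ψ r (win K N r l) +
        (if Sync N a₁ (((l.map Prod.fst).drop N).take K₀) then 0 else 1) := by
  let b₀ : B := Classical.arbitrary B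
  let Φ : List A → B := fun x =>
    if h : ∃ r ≤ N, pst N a₁ (win K N r x) = N then
      ((ψ (lastk (R + N) (win K N h.choose x)))[h.choose - 1]?).getD b₀ else b₀
  refine ⟨Φ, fun l hl => ?_⟩
  set x := l.map Prod.fst with hx
  have hxl : x.length = K + N := by simp [hx, hl]
  set t₁ : ℝ := if pst N a₁ ((win K N N l).map Prod.fst) = N + 1 then 1 else 0 with ht₁
  have t₁0 : 0 ≤ t₁ := by rw [ht₁]; split_ifs <;> simp
  have t₂0 : 0 ≤ ∑ r ∈ Finset.range (N + 1), posErr N R a₁ ψ r (win K N r l) :=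
    Finset.sum_nonneg fun r _ => posErr_nonneg _ _
  by_cases hs : Sync N a₁ ((x.drop N).take K₀)
  swap
  · rw [if_neg hs]
    linarith [cerr_le_one (K - 1) Φ l]
  rw [if_pos hs, add_zero]
  by_cases hw : pst N a₁ ((win K N N l).map Prod.fst) = N + 1
  · rw [ht₁, if_pos hw]
    linarith [cerr_le_one (K - 1) Φ l]
  have hsync : ∀ r ≤ N, Sync N a₁ (win K N r x) := by
    intro r hr
    have e : win K N r x = ((x.take N).drop (N - r)) ++ ((x.drop N).take K₀ ++
        (x.take (K + N - r)).drop (N + K₀)) := by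
      rw [win]
      have e1 : x.take (K + N - r) = x.take N ++ ((x.drop N).take K₀ ++
          (x.take (K + N - r)).drop (N + K₀)) := by
        conv_lhs => rw [← List.take_append_drop (N + K₀) (x.take (K + N - r))]
        rw [List.take_take, min_eq_left (by omega), List.take_add, List.append_assoc]
      conv_lhs => rw [e1]
      rw [List.drop_append_of_le_length (by
        rw [List.length_take, hxl]; exact (Nat.sub_le _ _).trans (le_min le_rfl (Nat.le_add_left _ _)))]
    rw [e]
    exact (hs.append_right _).append_left _
  have hex : ∃ r ≤ N, pst N a₁ (win K N r x) = N := by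
    have hle := pst_le (N := N) (a₁ := a₁) (win K N N x)
    rw [map_win, ← hx] at hw
    refine ⟨pst N a₁ (win K N N x), by omega, ?_⟩
    set r := pst N a₁ (win K N N x) with hr
    have hrN : r ≤ N := by omega
    have e1 : x.take (K + N - r) = (x.take (K + N - r)).take (N - r) ++ win K N r x :=
      (List.take_append_drop _ _).symm
    have e2 : x.take (K + N - r) = x.take K ++ (x.drop K).take (N - r) := by
      rw [show K + N - r = K + (N - r) by omega, List.take_add]
    have e3 : win K N N x = x.take K := by simp [win]
    rw [← (hsync r hrN).pst_append ((x.take (K + N - r)).take (N - r)), ← e1, e2, pst_append,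
      ← e3, ← hr, foldl_pstep_add]
    · simp; omega
    · simp; omega
  have hΦ : Φ x = ((ψ (lastk (R + N) (win K N hex.choose x)))[hex.choose - 1]?).getD b₀ :=
    dif_pos hex
  obtain ⟨hrN, hr⟩ := hex.choose_spec
  set r := hex.choose
  have hge : posErr N R a₁ ψ r (win K N r l) ≤
      ∑ r ∈ Finset.range (N + 1), posErr N R a₁ ψ r (win K N r l) :=
    Finset.single_le_sum (f := fun r => posErr N R a₁ ψ r (win K N r l))
      (fun r _ => posErr_nonneg _ _) (Finset.mem_range.2 (by omega))
  refine le_trans ?_ (add_le_add t₁0 hge)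
  rw [zero_add, posErr, map_win, map_win, if_pos hr]
  by_cases hr0 : r = 0
  · rw [if_pos hr0]; exact cerr_le_one _ _ _
  · rw [if_neg hr0]
    split_ifs with hc
    · have e : (l.map Prod.snd)[K - 1]? = (lastk N (win K N r (l.map Prod.snd)))[r - 1]? := by
        have hyl : (l.map Prod.snd).length = K + N := by simp [hl]
        rw [lastk, win, List.drop_drop, List.getElem?_drop, List.getElem?_take]
        simp only [List.length_drop, List.length_take, hyl]
        rw [if_pos (by omega)]
        congr 1
        omega
      rw [cerr, if_pos]
      rw [e, hc, ← hx, hΦ]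
      have : r - 1 < (ψ (lastk (R + N) (win K N r x))).length := by rw [hψ]; omega
      rw [List.getElem?_eq_getElem this]
      rfl
    · exact cerr_le_one _ _ _

open Classical in
lemma IsJoin.exists_jexp_cerr_le [Nonempty B] (hJ : IsJoin p q J) {K₀ K : ℕ} {a b : ℝ}
    (hK : K = K₀ + R + N) (hN : 1 ≤ N) (hψ : ∀ e, (ψ e).length = N)
    (ha : jexp J K (blkErr N R a₁ ψ) ≤ a)
    (hb : ∑ z ∈ wd A K₀, p.P z * (if Sync N a₁ z then 0 else 1) ≤ b) :
    ∃ Φ : List A → B, jexp J (K + N) (cerr (K - 1) Φ) ≤ a + b := by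
  obtain ⟨Φ, hΦ⟩ := exists_cerr_le (a₁ := a₁) hK hN hψ
  refine ⟨Φ, (jexp_mono hJ fun l hl => hΦ l (mem_wd.1 hl)).trans ?_⟩
  rw [jexp_add, jexp_add, jexp_sum]
  have h1 := hJ.jexp_win (K := K) (N := N) (r := N) le_rfl
    (fun l => if pst N a₁ (l.map Prod.fst) = N + 1 then (1 : ℝ) else 0)
  have h2 : ∀ r ∈ Finset.range (N + 1), jexp J (K + N)
      (fun l => posErr N R a₁ ψ r (win K N r l)) = jexp J K (posErr N R a₁ ψ r) := fun r hr =>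
    hJ.jexp_win (by have := Finset.mem_range.1 hr; omega) _
  have h3 : jexp J (K + N) (fun l => if Sync N a₁ (((l.map Prod.fst).drop N).take K₀)
      then (0 : ℝ) else 1) = ∑ z ∈ wd A K₀, p.P z * (if Sync N a₁ z then 0 else 1) := by
    have e1 := hJ.jexp_drop N K (fun l => if Sync N a₁ ((l.map Prod.fst).take K₀)
      then (0 : ℝ) else 1)
    have e2 := hJ.jexp_take (R + N) K₀ (fun l => if Sync N a₁ (l.map Prod.fst)
      then (0 : ℝ) else 1)
    rw [← add_assoc, ← hK] at e2
    rw [add_comm N K] at e1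
    simp only [List.map_drop] at e1
    simp only [List.map_take] at e2
    rw [e1, e2, ← IsJoin.cost_zip, ← (hJ.isCpl K₀).cost_left]
    refine Finset.sum_congr rfl fun z hz => Finset.sum_congr rfl fun w hw => ?_
    beta_reduce
    rw [List.map_fst_zip ((mem_wd.1 hz).trans (mem_wd.1 hw).symm).le]
  rw [h1, h3, Finset.sum_congr rfl h2, ← jexp_sum, ← jexp_add]
  refine add_le_add ((jexp_mono hJ fun l hl => ?_).trans ha) hb
  have := mem_wd.1 hl
  exact posErr_sum_le hψ (by omega)

end CodingError

section CodedJoining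

variable {A B ι : Type} [Fintype A] [Fintype B] [DecidableEq A] [DecidableEq B] [Fintype ι]
  [Nonempty B] {p : Proc A} {q : Proc B} {J : List (A × B) → ℝ}

open Classical in
/-- Every joining can be approximated by joinings in which the second process is almost a
function of the first one. -/
theorem exists_coded_join (hp : p.Nice) (hq : q.Nice) {h : ℝ} (hh : 0 < h) (hpA : p.AEP h)
    (hqA : q.AEP h) {a₀ a₁ : A} (ha : a₀ ≠ a₁) (hJ : IsJoin p q J)
    {V : ι → List (A × B) → ℝ} {k : ℕ}
    (h0 : ∀ i l, 0 ≤ V i l) (h1 : ∀ i l, V i l ≤ 1)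
    (hV : ∀ i l l', Agr k l l' → V i l = V i l') {ε : ℝ} (hε : 0 < ε) (hε1 : ε ≤ 1) :
    ∃ J', IsJoin p q J' ∧ (∀ i, jexp J' k (V i) ≤ jexp J k (V i) + 2 * ε) ∧
      Coded J' (5 * ε) := by
  obtain ⟨N₀, hN₀⟩ := exists_base_cpl hp hq hh hpA hqA hJ h0 h1 hV hε hε1
  obtain ⟨c, hc0, hc⟩ := hp.lb
  obtain ⟨N₁, hN₁⟩ := exists_nat_ge (1 / (c * ε))
  set N := N₀ + N₁ + 1 with hN
  have hcN : 1 ≤ c * (ε * N) := by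
    rw [div_le_iff₀ (by positivity)] at hN₁
    have : (N₁ : ℝ) ≤ N := by exact_mod_cast (by omega : N₁ ≤ N)
    nlinarith [mul_pos hc0 hε]
  obtain ⟨R, φ, hφ, hblk⟩ := hN₀ N (by omega)
  let ψ : List A → List B := fun e => φ (e.take (e.length - N)) (e.drop (e.length - N))
  have hψ : ∀ e, (ψ e).length = N := fun e => hφ _ _
  have hψa : ∀ u z, z.length = N → ψ (lastk (R + N) (u ++ z)) = φ (lastk R u) z := by
    intro u z hz
    rw [lastk_append_add hz]
    simp [ψ, hz]
  obtain ⟨K₀, hK₀⟩ := p.exists_sync (a₀ := a₀) (a₁ := a₁) ha hc0 hc N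
    (show 0 < ε / (N + 1) by positivity)
  set K := K₀ + R + N with hK
  have hj0 : ∀ i, 0 ≤ jexp J k (V i) := fun i =>
    Finset.sum_nonneg fun l _ => mul_nonneg (hJ.nonneg l) (h0 i l)
  let W : Option ι → List (A × B) → ℝ := fun i => i.elim (blkErr N R a₁ ψ) V
  let t : Option ι → ℝ := fun i => i.elim (2 * ε) fun i => jexp J k (V i) + 2 * ε
  have hseq := exists_sequential_cpl (p := p) (q := q) (V := W) (t := t) (fun u => hc u a₁) hc0.le
    hcN hε.le hε1 (by
      rintro (_ | i)
      · simp only [t, Option.elim]; linarith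
      · simp only [t, Option.elim]; linarith [hj0 i])
    (by
      rintro (_ | i) l
      · exact blkErr_nonneg l
      · exact h0 i l)
    (by
      rintro (_ | i) l hl
      · simp only [W, Option.elim, blkErr]
        rw [if_neg (by omega), if_neg (by omega)]
      · exact h1 i l)
    (by
      rintro (_ | i) l z hl hz
      · simp only [W, Option.elim]
        rw [wsum_blkErr z l (by omega)]
        positivity
      · refine (wsum_le (h1 i) l z).trans ?_
        rw [one_mul]
        exact_mod_cast hz.le)
    (by
      intro l hl
      obtain ⟨κ, hκ, hκφ, hκV⟩ := hblk l
      refine ⟨κ, hκ, ?_⟩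
      have hκ' : PCpl p q l N κ := hκ
      rintro (_ | i)
      · simp only [W, t, Option.elim]
        refine le_trans (hκ.cost_mono (c' := fun z w => ham w (φ (lastk R (l.map Prod.fst)) z) + 1)
          fun z hz w hw => ?_) ?_
        · have hz := mem_wd.1 hz
          have hw := mem_wd.1 hw
          rw [wsum_blkErr _ l (by simp [hl, hz, hw]), zero_add, blkErr,
            map_fst_append_zip l (hz.trans hw.symm), map_snd_append_zip l (hz.trans hw.symm),
            pst_append, hl, foldl_pstep_add _ (by omega), hz, zero_add, if_neg (lt_irrefl _),
            if_pos rfl, lastk_append hw, hψa _ _ hz, add_comm]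
        · rw [cost_add_fun, hκ'.sum]
          linarith
      · simp only [W, t, Option.elim]
        refine le_trans (hκ.cost_mono (c' := fun z w => wsum (V i) l (z.zip w) + 1)
          fun z hz w hw => ?_) ?_
        · linarith [h1 i (l ++ z.zip w)]
        · rw [cost_add_fun, hκ'.sum]
          linarith [hκV i])
  choose κ hκ hκW using fun M => hseq M [] (by simp [pst])
  have hκ' : ∀ M, IsCpl (wd A M) (wd B M) (κ M) p.P q.P := fun M =>
    IsCpl.congr (hκ M) (fun z _ => p.law_nil_left z) fun z _ => q.law_nil_left z
  obtain ⟨J', hJ', hlim⟩ := exists_limit_join hκ'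
  refine ⟨J', hJ', fun i => ?_, ?_⟩
  · refine hlim (V i) k _ (V i [] + 2 * N) (h0 i) (hV i) fun M => ?_
    have := hκW M (some i)
    simp only [W, t, Option.elim] at this
    linarith
  · let F : List (A × B) → ℝ := fun l => if Sync N a₁ (lastk K₀ (l.map Prod.fst)) then 0 else 1
    have hF0 : ∀ l, 0 ≤ F l := fun l => by simp only [F]; split_ifs <;> simp
    have hF1 : ∀ l, F l ≤ 1 := fun l => by simp only [F]; split_ifs <;> simp
    have hFw : ∀ l l', Agr K₀ l l' → F l = F l' := fun l l' h => by
      simp only [F, ← map_lastk, h.lastk_eq]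
    have hFJ : jexp J K₀ F ≤ ε / (N + 1) := by
      rw [← IsJoin.cost_zip]
      refine le_trans (le_of_eq ?_) hK₀
      rw [← (hJ.isCpl K₀).cost_left]
      refine Finset.sum_congr rfl fun z hz => Finset.sum_congr rfl fun w hw => ?_
      simp only [F]
      rw [List.map_fst_zip ((mem_wd.1 hz).trans (mem_wd.1 hw).symm).le,
        lastk_of_le (mem_wd.1 hz).le]
    have hle : ∀ l, blkErr N R a₁ ψ (lastk K l) ≤ blkErr N R a₁ ψ l + (N + 1) * F l := by
      intro l
      by_cases hs : Sync N a₁ (lastk K₀ (l.map Prod.fst))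
      · simp only [F]
        rw [blkErr_lastk hK.ge hs, if_pos hs, mul_zero, add_zero]
      · simp only [F]
        rw [if_neg hs]
        linarith [blkErr_le (N := N) (R := R) (a₁ := a₁) (ψ := ψ) (lastk K l),
          blkErr_nonneg (N := N) (R := R) (a₁ := a₁) (ψ := ψ) l]
    have hG : jexp J' K (fun l => blkErr N R a₁ ψ (lastk K l)) ≤ 3 * ε := by
      refine hlim _ K _ (W none [] + 2 * N + (N + 1) * K₀) (fun l => blkErr_nonneg _)
        (fun l l' h => by rw [h.lastk_eq]) fun M => ?_
      have e1 : cost (wd A M) (wd B M) (κ M) (fun z w => wsum F [] (z.zip w)) ≤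
          K₀ + M * (ε / (N + 1)) := by
        let F' : List A → ℝ := fun x => if Sync N a₁ (lastk K₀ x) then 0 else 1
        have e2 : ∀ κ' : List A → List B → ℝ, IsCpl (wd A M) (wd B M) κ' p.P q.P →
            cost (wd A M) (wd B M) κ' (fun z w => wsum F [] (z.zip w)) =
              ∑ z ∈ wd A M, p.P z * wsum F' [] z := by
          intro κ' hκ'
          rw [← hκ'.cost_left]
          refine Finset.sum_congr rfl fun z hz => Finset.sum_congr rfl fun w hw => ?_
          change κ' z w * wsum (fun l => F' (l.map Prod.fst)) [] (z.zip w) = κ' z w * wsum F' [] z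
          rw [wsum_comp_map, List.map_fst_zip ((mem_wd.1 hz).trans (mem_wd.1 hw).symm).le, List.map_nil]
        rw [e2 _ (hκ' M), ← e2 _ (hJ.isCpl M), IsJoin.cost_zip]
        refine (hJ.jexp_wsum hF0 hF1 hFw M).trans ?_
        have : ((min M K₀ : ℕ) : ℝ) ≤ K₀ := by exact_mod_cast min_le_right _ _
        gcongr
      have e2 := hκW M none
      simp only [W, t, Option.elim] at e2 ⊢
      have e3 : cost (wd A M) (wd B M) (κ M)
          (fun z w => wsum (fun l => blkErr N R a₁ ψ (lastk K l)) [] (z.zip w)) ≤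
          cost (wd A M) (wd B M) (κ M) (fun z w => wsum (blkErr N R a₁ ψ) [] (z.zip w)) +
          (N + 1) * cost (wd A M) (wd B M) (κ M) (fun z w => wsum F [] (z.zip w)) := by
        rw [← cost_mul_left, ← cost_add_fun]
        refine (hκ' M).cost_mono fun z _ w _ => ?_
        have := wsum_mono hle [] (z.zip w)
        rw [wsum_add] at this
        refine this.trans (le_of_eq ?_)
        congr 1
        have := wsum_sum (Finset.univ : Finset Unit) (fun _ => (N + 1 : ℝ)) (fun _ => F) []
          (z.zip w)
        simpa using this
      have e4 : (N + 1 : ℝ) * cost (wd A M) (wd B M) (κ M) (fun z w => wsum F [] (z.zip w)) ≤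
          (N + 1) * K₀ + ε * M := by
        calc _ ≤ (N + 1 : ℝ) * (K₀ + M * (ε / (N + 1))) := by gcongr
          _ = _ := by field_simp
      linarith
    have hG' : jexp J' K (blkErr N R a₁ ψ) ≤ 3 * ε := by
      refine le_trans (le_of_eq (jexp_congr fun l hl => ?_)) hG
      rw [lastk_of_le (mem_wd.1 hl).le]
    obtain ⟨Φ, hΦ⟩ := hJ'.exists_jexp_cerr_le hK (by omega) hψ hG' hK₀
    refine ⟨K - 1, N, Φ, ?_⟩
    rw [show K - 1 + 1 + N = K + N by omega]
    have : ε / (N + 1) ≤ ε := div_le_self hε.le (by linarith [(Nat.cast_nonneg N : (0 : ℝ) ≤ N)])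
    linarith

end CodedJoining

section BaireCategory

variable {A B : Type} [Fintype A] [Fintype B] [DecidableEq A] [DecidableEq B]

/-- Exchange of the two coordinates of a joining. -/
def swp (J : List (A × B) → ℝ) (l : List (B × A)) : ℝ := J (l.map Prod.swap)

lemma swp_swp (J : List (A × B) → ℝ) : swp (swp J) = J := by
  funext l
  simp [swp]

lemma map_swap_zip {z : List A} {w : List B} :
    (w.zip z).map Prod.swap = z.zip w := by
  induction z generalizing w with
  | nil => simp
  | cons a z ih => cases w <;> simp [ih]

variable {p : Proc A} {q : Proc B} {J : List (A × B) → ℝ}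

lemma IsJoin.swp (h : IsJoin p q J) : IsJoin q p (swp J) where
  nonneg _ := h.nonneg _
  snoc l := by
    rw [GibbsFormal.swp, ← h.snoc (l.map Prod.swap)]
    exact Fintype.sum_equiv (Equiv.prodComm B A) _ _ fun c => by simp [GibbsFormal.swp]
  cons l := by
    rw [GibbsFormal.swp, ← h.cons (l.map Prod.swap)]
    exact Fintype.sum_equiv (Equiv.prodComm B A) _ _ fun c => by simp [GibbsFormal.swp]
  left w := by
    rw [← h.right w]
    exact Finset.sum_congr rfl fun z _ => by rw [GibbsFormal.swp, map_swap_zip]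
  right z := by
    rw [← h.left z]
    exact Finset.sum_congr rfl fun w _ => by rw [GibbsFormal.swp, map_swap_zip]

lemma isJoin_prod (p : Proc A) (q : Proc B) :
    IsJoin p q fun l => p.P (l.map Prod.fst) * q.P (l.map Prod.snd) where
  nonneg _ := mul_nonneg (p.pos _).le (q.pos _).le
  snoc l := by
    simp only [List.map_append, List.map_cons, List.map_nil]
    rw [Fintype.sum_prod_type]
    simp only [← Finset.mul_sum, q.snoc, ← Finset.sum_mul, p.snoc]
  cons l := by
    simp only [List.map_cons]
    rw [Fintype.sum_prod_type]
    simp only [← Finset.mul_sum, q.cons, ← Finset.sum_mul, p.cons]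
  left z := by
    have : ∀ w ∈ wd B z.length, p.P ((z.zip w).map Prod.fst) * q.P ((z.zip w).map Prod.snd) =
        p.P z * q.P w := fun w hw => by
      have hw := mem_wd.1 hw
      rw [List.map_fst_zip hw.ge, List.map_snd_zip hw.le]
    rw [Finset.sum_congr rfl this, ← Finset.mul_sum, q.sum_P, mul_one]
  right w := by
    have : ∀ z ∈ wd A w.length, p.P ((z.zip w).map Prod.fst) * q.P ((z.zip w).map Prod.snd) =
        p.P z * q.P w := fun z hz => by
      have hz := mem_wd.1 hz
      rw [List.map_fst_zip hz.le, List.map_snd_zip hz.ge]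
    rw [Finset.sum_congr rfl this, ← Finset.sum_mul, p.sum_P, one_mul]

lemma IsJoin.le_one (h : IsJoin p q J) (l : List (A × B)) : J l ≤ 1 := by
  rw [← h.jexp_one l.length]
  simp only [jexp, mul_one]
  exact Finset.single_le_sum (f := J) (fun x _ => h.nonneg x) (mem_wd.2 rfl)

lemma sfx_eq_of_agr {C : Type} [DecidableEq C] {l w w' : List C} {k : ℕ} (hk : l.length ≤ k)
    (h : Agr k w w') : sfx l w = sfx l w' := by
  obtain ⟨u, v, x, rfl, rfl, rfl⟩ := h
  have : ∀ u : List C, l <:+ u ++ x ↔ l <:+ x := fun u =>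
    ⟨fun h => List.suffix_of_suffix_length_le h (List.suffix_append _ _) hk,
      fun h => h.trans (List.suffix_append _ _)⟩
  simp only [sfx, this]

lemma IsJoin.jexp_sfx (h : IsJoin p q J) {l : List (A × B)} {k : ℕ} (hk : l.length ≤ k) :
    jexp J k (sfx l) = J l := by
  rw [h.jexp_window hk fun w w' => sfx_eq_of_agr le_rfl, jexp,
    Finset.sum_eq_single_of_mem l (mem_wd.2 rfl)]
  · rw [sfx, if_pos (List.suffix_refl l), mul_one]
  · intro w hw hne
    have := sfx_append (mem_wd.1 hw) []
    rw [List.nil_append, if_neg hne] at this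
    rw [this, mul_zero]

lemma exists_coded_near (hp : p.Nice) (hq : q.Nice) {h : ℝ} (hh : 0 < h) (hpA : p.AEP h)
    (hqA : q.AEP h) [Nontrivial A] [Nonempty B] (hJ : IsJoin p q J)
    (I : Finset (List (A × B))) {ε : ℝ} (hε : 0 < ε) (hε1 : ε ≤ 1) :
    ∃ J', IsJoin p q J' ∧ (∀ l ∈ I, |J' l - J l| ≤ 2 * ε) ∧ Coded J' (5 * ε) := by
  obtain ⟨a₀, a₁, ha⟩ := exists_pair_ne A
  set k := I.sup List.length with hk
  have hle : ∀ l ∈ I, l.length ≤ k := fun l hl => Finset.le_sup (f := List.length) hl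
  let V : I × Bool → List (A × B) → ℝ := fun i w =>
    if i.2 then sfx i.1.1 w else 1 - sfx i.1.1 w
  obtain ⟨J', hJ', h1, h2⟩ := exists_coded_join hp hq hh hpA hqA ha hJ (V := V) (k := k)
    (fun i w => by
      simp only [V]
      split_ifs
      · exact sfx_nonneg _ _
      · linarith [sfx_le_one i.1.1 w])
    (fun i w => by
      simp only [V]
      split_ifs
      · exact sfx_le_one _ _
      · linarith [sfx_nonneg i.1.1 w])
    (fun i w w' hww => by simp only [V, sfx_eq_of_agr (hle _ i.1.2) hww])
    hε hε1
  refine ⟨J', hJ', fun l hl => ?_, h2⟩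
  have key : ∀ {J : List (A × B) → ℝ}, IsJoin p q J →
      jexp J k (V (⟨l, hl⟩, true)) = J l ∧ jexp J k (V (⟨l, hl⟩, false)) = 1 - J l := by
    intro J hJ
    have e1 : jexp J k (V (⟨l, hl⟩, true)) = J l := hJ.jexp_sfx (hle l hl)
    refine ⟨e1, ?_⟩
    have := jexp_add (J := J) k (V (⟨l, hl⟩, true)) (V (⟨l, hl⟩, false))
    rw [jexp_congr (W := fun _ => 1) fun w _ => by simp [V], hJ.jexp_one, e1] at this
    linarith
  have h3 := h1 (⟨l, hl⟩, true)
  have h4 := h1 (⟨l, hl⟩, false)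
  rw [(key hJ).1, (key hJ').1] at h3
  rw [(key hJ).2, (key hJ').2] at h4
  rw [abs_le]
  constructor <;> linarith

lemma continuous_jexp (n : ℕ) (V : List (A × B) → ℝ) :
    Continuous fun J : List (A × B) → ℝ => jexp J n V :=
  continuous_finsetSum _ fun l _ => (continuous_apply l).mul continuous_const

lemma isOpen_coded (δ : ℝ) : IsOpen {J : List (A × B) → ℝ | Coded J δ} := by
  simp only [Coded, ofPred_exists]
  exact isOpen_iUnion fun n => isOpen_iUnion fun k => isOpen_iUnion fun Φ =>
    isOpen_lt (continuous_jexp _ _) continuous_const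

lemma isCompact_isJoin (p : Proc A) (q : Proc B) : IsCompact {J | IsJoin p q J} := by
  refine (isCompact_univ_pi fun _ : List (A × B) => isCompact_Icc (a := (0 : ℝ)) (b := 1)
    ).of_isClosed_subset ?_ fun J hJ l _ => ⟨hJ.nonneg l, hJ.le_one l⟩
  have e : {J | IsJoin p q J} = {J : List (A × B) → ℝ | (∀ l, 0 ≤ J l) ∧
      (∀ l, ∑ c, J (l ++ [c]) = J l) ∧ (∀ l, ∑ c, J (c :: l) = J l) ∧
      (∀ z : List A, ∑ w ∈ wd B z.length, J (z.zip w) = p.P z) ∧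
      ∀ w : List B, ∑ z ∈ wd A w.length, J (z.zip w) = q.P w} :=
    Set.ext fun J => ⟨fun h => ⟨h.1, h.2, h.3, h.4, h.5⟩, fun ⟨a, b, c, d, e⟩ => ⟨a, b, c, d, e⟩⟩
  rw [e]
  simp only [ofPred_and, ofPred_forall]
  refine (isClosed_iInter fun l => isClosed_le continuous_const (continuous_apply l)).inter <|
    (isClosed_iInter fun l => isClosed_eq ?_ (continuous_apply l)).inter <|
    (isClosed_iInter fun l => isClosed_eq ?_ (continuous_apply l)).inter <|
    (isClosed_iInter fun l => isClosed_eq ?_ continuous_const).inter <|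
    isClosed_iInter fun l => isClosed_eq ?_ continuous_const
  all_goals exact continuous_finsetSum _ fun _ _ => continuous_apply _

lemma exists_finset_nhds {ι : Type} {J : ι → ℝ} {O : Set (ι → ℝ)} (hO : IsOpen O) (hJ : J ∈ O) :
    ∃ (I : Finset ι) (ε : ℝ), 0 < ε ∧ ∀ J', (∀ l ∈ I, |J' l - J l| < ε) → J' ∈ O := by
  classical
  obtain ⟨I, u, hu, hI⟩ := isOpen_pi_iff.1 hO J hJ
  choose! e he hball using fun l hl => Metric.isOpen_iff.1 (hu l hl).1 _ (hu l hl).2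
  obtain ⟨ε, hε, hεI⟩ : ∃ ε > 0, ∀ l ∈ I, ε ≤ e l := by
    clear hI
    induction I using Finset.induction_on with
    | empty => exact ⟨1, one_pos, by simp⟩
    | insert a s _ ih =>
      obtain ⟨ε, h0, h⟩ := ih (fun l hl => hu l (by simp [hl])) (fun l hl => he l (by simp [hl]))
        (fun l hl => hball l (by simp [hl]))
      refine ⟨min ε (e a), lt_min h0 (he a (by simp)), fun l hl => ?_⟩
      rcases Finset.mem_insert.1 hl with rfl | hl
      · exact min_le_right _ _
      · exact (min_le_left _ _).trans (h l hl)
  exact ⟨I, ε, hε, fun J' h => hI fun l hl => hball l hl <| by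
    rw [Metric.mem_ball, Real.dist_eq]
    exact (h l hl).trans_le (hεI l hl)⟩

/-- Two processes of equal positive entropy have a joining in which each of them is determined by
the other one. -/
theorem exists_coded_both (hp : p.Nice) (hq : q.Nice) {h : ℝ} (hh : 0 < h) (hpA : p.AEP h)
    (hqA : q.AEP h) [Nontrivial A] [Nontrivial B] :
    ∃ J, IsJoin p q J ∧ ∀ δ > 0, Coded J δ ∧ Coded (swp J) δ := by
  let X := {J : List (A × B) → ℝ // IsJoin p q J}
  have : CompactSpace X := isCompact_iff_compactSpace.1 (isCompact_isJoin p q)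
  have hne : Nonempty X := ⟨⟨_, isJoin_prod p q⟩⟩
  have hsw : Continuous (swp : (List (A × B) → ℝ) → List (B × A) → ℝ) :=
    continuous_pi fun l => continuous_apply _
  have hd1 : Dense (⋂ k : ℕ, {J : X | Coded J.1 (1 / (k + 1))}) := by
    refine dense_iInter_of_isOpen (fun k => (isOpen_coded _).preimage continuous_subtype_val)
      fun k => dense_iff_inter_open.2 ?_
    rintro _ ⟨O, hO, rfl⟩ ⟨⟨J, hJ⟩, hJO⟩
    obtain ⟨I, ε, hε, hI⟩ := exists_finset_nhds hO hJO
    obtain ⟨J', hJ', h1, n, m, Φ, h2⟩ := exists_coded_near hp hq hh hpA hqA hJ I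
      (ε := min 1 (min (ε / 3) (1 / (k + 1) / 5))) (by positivity) (min_le_left _ _)
    refine ⟨⟨J', hJ'⟩, hI _ fun l hl => (h1 l hl).trans_lt ?_, n, m, Φ, h2.trans_le ?_⟩
    · linarith [(min_le_right 1 _).trans (min_le_left (ε / 3) (1 / (k + 1) / 5 : ℝ))]
    · linarith [(min_le_right 1 _).trans (min_le_right (ε / 3) (1 / (k + 1) / 5 : ℝ))]
  have hd2 : Dense (⋂ k : ℕ, {J : X | Coded (swp J.1) (1 / (k + 1))}) := by
    refine dense_iInter_of_isOpen
      (fun k => (isOpen_coded _).preimage (hsw.comp continuous_subtype_val))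
      fun k => dense_iff_inter_open.2 ?_
    rintro _ ⟨O, hO, rfl⟩ ⟨⟨J, hJ⟩, hJO⟩
    obtain ⟨I, ε, hε, hI⟩ := exists_finset_nhds hO hJO
    obtain ⟨J', hJ', h1, n, m, Φ, h2⟩ := exists_coded_near hq hp hh hqA hpA hJ.swp
      (I.image fun l => l.map Prod.swap)
      (ε := min 1 (min (ε / 3) (1 / (k + 1) / 5))) (by positivity) (min_le_left _ _)
    refine ⟨⟨swp J', hJ'.swp⟩, hI _ fun l hl => ?_, n, m, Φ, ?_⟩
    · have := h1 _ (Finset.mem_image_of_mem _ hl)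
      have e : swp J (l.map Prod.swap) = J l := by simp [swp]
      rw [e] at this
      refine lt_of_le_of_lt this ?_
      linarith [(min_le_right 1 _).trans (min_le_left (ε / 3) (1 / (k + 1) / 5 : ℝ))]
    · rw [swp_swp]
      refine h2.trans_le ?_
      linarith [(min_le_right 1 _).trans (min_le_right (ε / 3) (1 / (k + 1) / 5 : ℝ))]
  have hG1 : IsGδ (⋂ k : ℕ, {J : X | Coded J.1 (1 / (k + 1))}) :=
    .iInter_of_isOpen fun k => (isOpen_coded _).preimage continuous_subtype_val
  have hG2 : IsGδ (⋂ k : ℕ, {J : X | Coded (swp J.1) (1 / (k + 1))}) :=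
    .iInter_of_isOpen fun k => (isOpen_coded _).preimage (hsw.comp continuous_subtype_val)
  obtain ⟨⟨J, hJ⟩, h1, h2⟩ := (hd1.inter_of_Gδ hG1 hG2 hd2).nonempty
  simp only [mem_iInter, mem_ofPred_eq] at h1 h2
  refine ⟨J, hJ, fun δ hδ => ?_⟩
  obtain ⟨k, hk⟩ := exists_nat_one_div_lt hδ
  obtain ⟨n, m, Φ, h⟩ := h1 k
  obtain ⟨n', m', Φ', h'⟩ := h2 k
  exact ⟨⟨n, m, Φ, h.trans hk⟩, n', m', Φ', h'.trans hk⟩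

end BaireCategory

section Reading

variable {C D : Type}

/-- The word read in the window `[a, a + n)`. -/
def rd (x : ℤ → C) (a : ℤ) (n : ℕ) : List C := List.ofFn fun i : Fin n => x (a + (i : ℤ))

@[simp] lemma length_rd (x : ℤ → C) (a : ℤ) (n : ℕ) : (rd x a n).length = n := by simp [rd]

lemma rd_add (x : ℤ → C) (a : ℤ) (m n : ℕ) : rd x a (m + n) = rd x a m ++ rd x (a + m) n := by
  rw [rd, List.ofFn_add]
  simp [rd, add_assoc]

lemma rd_one (x : ℤ → C) (a : ℤ) : rd x a 1 = [x a] := by simp [rd]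

lemma map_rd (f : C → D) (x : ℤ → C) (a : ℤ) (n : ℕ) :
    (rd x a n).map f = rd (fun i => f (x i)) a n := by
  rw [rd, List.map_ofFn]; rfl

lemma rd_shift (x : ℤ → C) (a b : ℤ) (n : ℕ) :
    rd (fun i => x (i + b)) a n = rd x (a + b) n := by
  simp only [rd, add_right_comm]

lemma getElem?_rd (x : ℤ → C) (a : ℤ) {n i : ℕ} (h : i < n) : (rd x a n)[i]? = some (x (a + i)) := by
  simp [rd, h]

lemma rd_congr {x y : ℤ → C} {a : ℤ} {n : ℕ} (h : ∀ i, a ≤ i → i < a + n → x i = y i) :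
    rd x a n = rd y a n := by
  unfold rd
  congr 1
  funext i
  exact h _ (by omega) (by have := i.2; omega)

lemma rd_eq_rd_iff {x y : ℤ → C} {a : ℤ} {n : ℕ} :
    rd x a n = rd y a n ↔ ∀ i, a ≤ i → i < a + n → x i = y i := by
  refine ⟨fun h i h1 h2 => ?_, rd_congr⟩
  obtain ⟨k, hk⟩ := Int.eq_ofNat_of_zero_le (sub_nonneg.2 h1)
  obtain rfl : i = a + k := by omega
  have := congrArg (·[k]?) h
  simpa [getElem?_rd _ _ (by omega : k < n)] using this

lemma continuous_rd [Finite C] [TopologicalSpace C] [DiscreteTopology C] {Y : Type}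
    [TopologicalSpace Y] (F : List C → Y) (a : ℤ) (n : ℕ) :
    Continuous fun x : ℤ → C => F (rd x a n) := by
  have h : Continuous fun x : ℤ → C => fun i : Fin n => x (a + (i : ℤ)) :=
    continuous_pi fun i => continuous_apply _
  exact (continuous_of_discreteTopology (f := fun z : Fin n → C => F (List.ofFn z))).comp h

lemma measurable_rd [Finite C] [MeasurableSpace C] [MeasurableSingletonClass C] {Y : Type}
    [MeasurableSpace Y] (F : List C → Y) (a : ℤ) (n : ℕ) :
    Measurable fun x : ℤ → C => F (rd x a n) := by
  have h : Measurable fun x : ℤ → C => fun i : Fin n => x (a + (i : ℤ)) :=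
    measurable_pi_iff.2 fun i => measurable_pi_apply _
  exact (Measurable.of_discrete (f := fun z : Fin n → C => F (List.ofFn z))).comp h

end Reading

section Limits

variable {C : Type} [Fintype C] [TopologicalSpace C] [DiscreteTopology C] [MeasurableSpace C]
  [MeasurableSingletonClass C]

lemma borelSpace_of_discrete : BorelSpace C :=
  ⟨by rw [borel_eq_top_of_discrete]; exact top_unique fun s _ => s.toFinite.measurableSet⟩

/-- Compactness of the space of probability measures on `ℤ → C`. -/
lemma exists_limit_measure (m : ℕ → Measure (ℤ → C)) (hm : ∀ n, IsProbabilityMeasure (m n)) :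
    ∃ μ : Measure (ℤ → C), IsProbabilityMeasure μ ∧ ∀ g : (ℤ → C) → ℝ, Continuous g →
      Tendsto (fun n => ∫ x, g x ∂m n) (hyperfilter ℕ : Filter ℕ) (nhds (∫ x, g x ∂μ)) := by
  have := borelSpace_of_discrete (C := C)
  let m' : ℕ → ProbabilityMeasure (ℤ → C) := fun n => ⟨m n, hm n⟩
  obtain ⟨μ, -, hμ⟩ := isCompact_univ.ultrafilter_le_nhds ((hyperfilter ℕ).map m')
    (by simp)
  refine ⟨μ, μ.2, fun g hg => ?_⟩
  have h : Tendsto m' (hyperfilter ℕ : Filter ℕ) (nhds μ) := hμ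
  exact ProbabilityMeasure.tendsto_iff_forall_integral_tendsto.1 h
    (BoundedContinuousFunction.mkOfCompact ⟨g, hg⟩)

end Limits

section Laws

variable {C D : Type} [Fintype C] [MeasurableSpace C] [MeasurableSingletonClass C]
  [Fintype D] [MeasurableSpace D] [MeasurableSingletonClass D]
  {μ ν : Measure (ℤ → C)} {Q : List C → ℝ}

/-- `Q` gives the probabilities of the words under the stationary measure `μ`. -/
def IsLaw (μ : Measure (ℤ → C)) (Q : List C → ℝ) : Prop :=
  ∀ a w, μ.real {x | rd x a w.length = w} = Q w

lemma measurableSet_rd (a : ℤ) (n : ℕ) (P : List C → Prop) : MeasurableSet {x : ℤ → C | P (rd x a n)} :=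
  measurable_rd (fun l => P l) a n (measurableSet_setOfPred.2 measurable_id)

lemma real_rd [IsProbabilityMeasure μ] (a : ℤ) (n : ℕ) (P : List C → Prop) [DecidablePred P] :
    μ.real {x | P (rd x a n)} = ∫ x, (if P (rd x a n) then 1 else 0) ∂μ := by
  rw [← mul_one (μ.real _), ← smul_eq_mul, ← integral_indicator_const _ (measurableSet_rd a n P)]
  exact integral_congr_ae (ae_of_all _ fun x => by
    simp only [indicator_apply, mem_ofPred_eq])

lemma integral_rd [IsProbabilityMeasure μ] (a : ℤ) (n : ℕ) (F : List C → ℝ) :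
    ∫ x, F (rd x a n) ∂μ = ∑ w ∈ wd C n, μ.real {x | rd x a n = w} * F w := by
  classical
  have e : ∀ x : ℤ → C, F (rd x a n) =
      ∑ w ∈ wd C n, {x | rd x a n = w}.indicator (fun _ => F w) x := by
    intro x
    rw [Finset.sum_eq_single_of_mem (rd x a n) (mem_wd.2 (length_rd _ _ _))]
    · rw [indicator_of_mem]; rfl
    · intro w _ hw
      exact indicator_of_notMem (fun h => hw h.symm) _
  simp_rw [e]
  rw [integral_finsetSum _ fun w _ =>
    (integrable_const _).indicator (measurableSet_rd a n fun l => l = w)]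
  refine Finset.sum_congr rfl fun w _ => ?_
  rw [integral_indicator_const _ (measurableSet_rd a n fun l => l = w), smul_eq_mul]

lemma IsLaw.integral [IsProbabilityMeasure μ] (h : IsLaw μ Q) (a : ℤ) (n : ℕ) (F : List C → ℝ) :
    ∫ x, F (rd x a n) ∂μ = ∑ w ∈ wd C n, Q w * F w := by
  rw [integral_rd]
  refine Finset.sum_congr rfl fun w hw => ?_
  obtain rfl := mem_wd.1 hw
  rw [h a w]

open Classical in
lemma IsLaw.real [IsProbabilityMeasure μ] (h : IsLaw μ Q) (a : ℤ) (n : ℕ) (P : List C → Prop) :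
    μ.real {x | P (rd x a n)} = ∑ w ∈ wd C n, Q w * (if P w then 1 else 0) := by
  rw [← h.integral a n, real_rd]

lemma exists_window (I : Finset ℤ) : ∃ (a : ℤ) (n : ℕ), ∀ i ∈ I, a ≤ i ∧ i < a + n := by
  obtain ⟨a, ha⟩ := I.bddBelow
  obtain ⟨b, hb⟩ := I.bddAbove
  exact ⟨a, (b + 1 - a).toNat, fun i hi => ⟨ha hi, by have := hb hi; have := ha hi; omega⟩⟩

lemma ext_of_rd [IsProbabilityMeasure μ] [IsProbabilityMeasure ν]
    (h : ∀ a w, μ.real {x | rd x a w.length = w} = ν.real {x | rd x a w.length = w}) : μ = ν := by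
  classical
  refine IsProjectiveLimit.unique (P := fun I => ν.map I.restrict) (fun I => ?_) fun I => rfl
  refine Measure.ext_iff_singleton.2 fun ζ => ?_
  rw [Measure.map_apply (Finset.measurable_restrict I) (measurableSet_singleton _),
    Measure.map_apply (Finset.measurable_restrict I) (measurableSet_singleton _)]
  obtain ⟨a, n, hI⟩ := exists_window I
  have e : (I.restrict ⁻¹' {ζ} : Set (ℤ → C)) =
      {x | ∀ i : I, (rd x a n)[((i : ℤ) - a).toNat]? = some (ζ i)} := by
    ext x
    rw [mem_preimage, mem_singleton_iff, funext_iff]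
    refine forall_congr' fun i => ?_
    obtain ⟨h1, h2⟩ := hI i i.2
    rw [getElem?_rd _ _ (by omega), Option.some_inj, show a + (((i : ℤ) - a).toNat : ℤ) = i by omega]
    rfl
  rw [e, ← measureReal_eq_measureReal_iff]
  have key : ∀ {ρ : Measure (ℤ → C)} [IsProbabilityMeasure ρ], ρ.real
      {x | ∀ i : I, (rd x a n)[((i : ℤ) - a).toNat]? = some (ζ i)} =
      ∑ w ∈ wd C n, ρ.real {x | rd x a n = w} *
        (if ∀ i : I, w[((i : ℤ) - a).toNat]? = some (ζ i) then 1 else 0) := by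
    intro ρ _
    rw [← integral_rd a n, real_rd a n fun l => ∀ i : I, l[((i : ℤ) - a).toNat]? = some (ζ i)]
  rw [key, key]
  refine Finset.sum_congr rfl fun w hw => ?_
  obtain rfl := mem_wd.1 hw
  rw [h]

lemma IsLaw.unique [IsProbabilityMeasure μ] [IsProbabilityMeasure ν] (h : IsLaw μ Q)
    (h' : IsLaw ν Q) : μ = ν :=
  ext_of_rd fun a w => (h a w).trans (h' a w).symm

lemma measurable_comp_pi {f : C → D} : Measurable fun (x : ℤ → C) i => f (x i) :=
  measurable_pi_iff.2 fun i => (Measurable.of_discrete (f := f)).comp (measurable_pi_apply i)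

open Classical in
lemma IsLaw.map [IsProbabilityMeasure μ] (h : IsLaw μ Q) (f : C → D) :
    IsLaw (μ.map fun x i => f (x i))
      fun w => ∑ l ∈ wd C w.length, Q l * (if l.map f = w then 1 else 0) := by
  intro a w
  rw [map_measureReal_apply measurable_comp_pi
    (measurableSet_rd a w.length fun l => l = w)]
  refine Eq.trans ?_ ((h.real a w.length fun l => l.map f = w).trans
    (Finset.sum_congr rfl fun l _ => by congr))
  simp only [map_rd, preimage_ofPred_eq]

/-- A consistent family of word probabilities is realised by a stationary measure. -/
lemma exists_isLaw [TopologicalSpace C] [DiscreteTopology C] (h0 : ∀ l, 0 ≤ Q l)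
    (hnil : Q [] = 1) (hsnoc : ∀ l, ∑ c, Q (l ++ [c]) = Q l) (hcons : ∀ l, ∑ c, Q (c :: l) = Q l) :
    ∃ μ : Measure (ℤ → C), IsProbabilityMeasure μ ∧ IsLaw μ Q := by
  classical
  have hpre : ∀ i w, ∑ u ∈ wd C i, Q (u ++ w) = Q w := by
    intro i
    induction i with
    | zero => intro w; rw [sum_wd_zero]; rfl
    | succ i ih =>
      intro w
      rw [sum_wd_succ, ← ih w, Finset.sum_comm]
      exact Finset.sum_congr rfl fun u _ => hcons _
  have hpost : ∀ i w, ∑ u ∈ wd C i, Q (w ++ u) = Q w := by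
    intro i
    induction i with
    | zero => intro w; rw [sum_wd_zero, List.append_nil]
    | succ i ih =>
      intro w
      rw [sum_wd_succ, ← hsnoc w]
      refine Finset.sum_congr rfl fun c _ => ?_
      rw [← ih (w ++ [c])]
      simp
  have hC : Nonempty C := by
    by_contra hC
    rw [not_nonempty_iff] at hC
    have := hsnoc []
    simp [hnil] at this
  let c₀ : C := hC.some
  let pt : ℕ → List C → ℤ → C := fun N l i => l.getD (i + N).toNat c₀
  have hpt : ∀ (N : ℕ) (l : List C) (a : ℤ) (i n : ℕ), a + N = i → i + n ≤ l.length →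
      rd (pt N l) a n = (l.drop i).take n := by
    intro N l a i n hi hn
    refine List.ext_getElem? fun k => ?_
    by_cases hk : k < n
    · rw [getElem?_rd _ _ hk, List.getElem?_take, if_pos hk, List.getElem?_drop]
      simp only [pt]
      rw [show (a + k + N).toNat = i + k by omega, List.getD_eq_getElem?_getD,
        List.getElem?_eq_getElem (by omega)]
      rfl
    · rw [List.getElem?_eq_none (by simpa using hk), List.getElem?_eq_none (by simp; omega)]
  let m : ℕ → Measure (ℤ → C) := fun N =>
    ∑ l ∈ wd C (2 * N + 1), ENNReal.ofReal (Q l) • Measure.dirac (pt N l)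
  have hm : ∀ N, IsProbabilityMeasure (m N) := fun N => ⟨by
    simp only [m, Measure.coe_finsetSum, Finset.sum_apply, Measure.smul_apply, smul_eq_mul,
      measure_univ, mul_one]
    rw [← ENNReal.ofReal_sum_of_nonneg fun l _ => h0 l]
    have := hpost (2 * N + 1) []
    simp only [List.nil_append, hnil] at this
    rw [this, ENNReal.ofReal_one]⟩
  obtain ⟨μ, hμ, hlim⟩ := exists_limit_measure m hm
  refine ⟨μ, hμ, fun a w => ?_⟩
  set n := w.length with hn
  let F : List C → ℝ := fun l => if l = w then 1 else 0
  have e : ∀ {ρ : Measure (ℤ → C)} [IsProbabilityMeasure ρ],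
      ρ.real {x | rd x a n = w} = ∫ x, F (rd x a n) ∂ρ := by
    intro ρ _
    rw [real_rd a n fun l => l = w]
  rw [e]
  refine tendsto_nhds_unique (hlim _ (continuous_rd F a n)) ?_
  refine tendsto_const_nhds.congr' (EventuallyEq.symm ?_)
  refine Nat.hyperfilter_le_atTop (eventually_atTop.2 ⟨a.natAbs + n, fun N hN => ?_⟩)
  obtain ⟨i, hi⟩ := Int.eq_ofNat_of_zero_le (show 0 ≤ a + N by omega)
  obtain ⟨j, hj⟩ : ∃ j, 2 * N + 1 = i + (n + j) := ⟨2 * N + 1 - i - n, by omega⟩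
  simp only [m]
  rw [integral_finsetSum_measure fun l _ => by
    refine Integrable.smul_measure ?_ ENNReal.ofReal_ne_top
    exact integrable_dirac (by simp)]
  simp only [integral_smul_measure, integral_dirac, smul_eq_mul]
  rw [hj, sum_wd_add]
  have h1 : ∀ u ∈ wd C i, ∀ v ∈ wd C n, ∀ t ∈ wd C j,
      (ENNReal.ofReal (Q (u ++ (v ++ t)))).toReal * F (rd (pt N (u ++ (v ++ t))) a n) =
      Q (u ++ (v ++ t)) * F v := by
    intro u hu v hv t ht
    have hu := mem_wd.1 hu
    have hv := mem_wd.1 hv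
    rw [ENNReal.toReal_ofReal (h0 _), hpt N _ a i n hi (by simp; omega), ← hu,
      List.drop_left, ← hv, List.take_left]
  have h2 : ∀ u ∈ wd C i, ∑ w ∈ wd C (n + j),
      (ENNReal.ofReal (Q (u ++ w))).toReal * F (rd (pt N (u ++ w)) a n) =
      ∑ v ∈ wd C n, ∑ t ∈ wd C j, Q (u ++ (v ++ t)) * F v := by
    intro u hu
    rw [sum_wd_add]
    exact Finset.sum_congr rfl fun v hv => Finset.sum_congr rfl fun t ht => h1 u hu v hv t ht
  rw [Finset.sum_congr rfl h2, Finset.sum_comm, Finset.sum_eq_single_of_mem w (mem_wd.2 hn.symm)]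
  · simp only [F, if_true, mul_one]
    rw [Finset.sum_comm, Finset.sum_congr rfl fun t _ => hpre i (w ++ t), hpost]
  · intro v _ hv
    simp [F, hv]

end Laws

section Independent

variable {B : Type} [Fintype B]

/-- The process of independent symbols with distribution `P`. -/
def iidProc (P : B → ℝ) (h0 : ∀ b, 0 < P b) (h1 : ∑ b, P b = 1) : Proc B where
  P w := (w.map P).prod
  pos w := List.prod_pos (by simpa using fun b _ => h0 b)
  nil := by simp
  snoc w := by simp [← Finset.mul_sum, h1]
  cons w := by simp [← Finset.sum_mul, h1]

variable {P : B → ℝ} {h0 : ∀ b, 0 < P b} {h1 : ∑ b, P b = 1}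

lemma iidProc_law (u z : List B) : (iidProc P h0 h1).law u z = (z.map P).prod := by
  have := (iidProc P h0 h1).pos u
  rw [Proc.law, div_eq_iff this.ne', mul_comm]
  simp [iidProc]

variable [DecidableEq B]

lemma iidProc_nice [Nonempty B] : (iidProc P h0 h1).Nice := by
  obtain ⟨b₀, hb₀⟩ := Finite.exists_min P
  have hlb : ∀ u a, P b₀ ≤ (iidProc P h0 h1).law u [a] := fun u a => by
    rw [iidProc_law]; simpa using hb₀ a
  refine ⟨⟨P b₀, h0 b₀, hlb⟩, fun N δ hδ => ⟨0, fun u v _ z _ => ?_⟩, ?_⟩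
  · have := (iidProc P h0 h1).law_nonneg v z
    rw [iidProc_law] at this ⊢
    rw [iidProc_law]
    nlinarith
  · exact Proc.vwb_of_overlap (o := 1) (l := 1) (K := 0) (h0 b₀) hlb le_rfl one_pos le_rfl
      (by norm_num) fun k _ u v _ z _ => by rw [iidProc_law, iidProc_law, one_mul]

lemma iidProc_ent (n : ℕ) (u : List B) :
    (iidProc P h0 h1).ent n u = n * ∑ b, Real.negMulLog (P b) := by
  induction n generalizing u with
  | zero => simp
  | succ n ih =>
    have h1 : ∀ v, (iidProc P h0 h1).ent 1 v = ∑ b, Real.negMulLog (P b) := fun v => by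
      rw [Proc.ent_one]
      simp [iidProc_law]
    rw [Proc.ent_add, ih]
    simp only [h1]
    rw [← Finset.sum_mul, Proc.sum_law]
    push_cast
    ring

lemma iidProc_aep [Nonempty B] : (iidProc P h0 h1).AEP (∑ b, Real.negMulLog (P b)) := by
  obtain ⟨h, -, h2, h3⟩ := (iidProc_nice (h0 := h0) (h1 := h1)).exists_aep
  have : ∑ b, Real.negMulLog (P b) = h := by
    refine eq_of_abs_sub_le_all fun η hη => ?_
    obtain ⟨N, hN⟩ := h2 η hη
    have := hN (N + 1) (by omega) []
    rw [iidProc_ent, mul_comm, ← sub_mul, abs_mul, abs_of_pos (by positivity : (0 : ℝ) < (N + 1 : ℕ))]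
      at this
    exact le_of_mul_le_mul_right this (by positivity)
  rw [this]
  exact h3

lemma exists_pmf_entropy {h : ℝ} (hh : 0 < h) : ∃ (m : ℕ) (P : Fin (m + 2) → ℝ),
    (∀ b, 0 < P b) ∧ ∑ b, P b = 1 ∧ ∑ b, Real.negMulLog (P b) = h := by
  obtain ⟨m, hm⟩ := exists_nat_ge (Real.exp h)
  let P : ℝ → Fin (m + 2) → ℝ := fun t b => (1 - t) * (if b = 0 then 1 else 0) + t / (m + 2 : ℕ)
  have hc : Continuous fun t => ∑ b, Real.negMulLog (P t b) :=
    continuous_finsetSum _ fun b _ => Real.continuous_negMulLog.comp (by fun_prop)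
  have hP0 : ∑ b, Real.negMulLog (P 0 b) = 0 := by
    refine Finset.sum_eq_zero fun b _ => ?_
    by_cases hb : b = 0 <;> simp [P, hb]
  have hm0 : (0 : ℝ) < (m + 2 : ℕ) := by positivity
  have hP1 : h ≤ ∑ b, Real.negMulLog (P 1 b) := by
    have : ∀ b, Real.negMulLog (P 1 b) = ((m + 2 : ℕ) : ℝ)⁻¹ * Real.log (m + 2 : ℕ) := fun b => by
      simp only [P, sub_self, zero_mul, zero_add, one_div, Real.negMulLog, Real.log_inv]
      ring
    rw [Finset.sum_congr rfl fun b _ => this b, Finset.sum_const, Finset.card_univ,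
      Fintype.card_fin, nsmul_eq_mul, mul_inv_cancel_left₀ hm0.ne', Real.le_log_iff_exp_le hm0]
    push_cast
    linarith
  obtain ⟨t, ⟨ht0, ht1⟩, ht⟩ := intermediate_value_Icc (zero_le_one' ℝ) hc.continuousOn
    (show h ∈ Icc _ _ from ⟨by rw [hP0]; exact hh.le, hP1⟩)
  have htpos : 0 < t := by
    refine lt_of_le_of_ne ht0 fun h' => ?_
    subst h'
    simp only at ht
    rw [hP0] at ht
    exact hh.ne ht
  refine ⟨m, P t, fun b => ?_, ?_, ht⟩
  · have : 0 ≤ (1 - t) * (if b = 0 then (1 : ℝ) else 0) := by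
      have : 0 ≤ 1 - t := by linarith
      positivity
    have : 0 < t / (m + 2 : ℕ) := by positivity
    simp only [P]
    linarith
  · simp only [P, Finset.sum_add_distrib, ← Finset.mul_sum, Finset.sum_const, Finset.card_univ,
      Fintype.card_fin, nsmul_eq_mul]
    rw [mul_div_cancel₀ _ hm0.ne']
    simp

end Independent

section Factor

variable {A B : Type} [Fintype A] [Fintype B] [DecidableEq A] [DecidableEq B]
  [MeasurableSpace A] [MeasurableSingletonClass A] [MeasurableSpace B] [MeasurableSingletonClass B]
  {p : Proc A} {q : Proc B} {J : List (A × B) → ℝ}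

/-- The eventual value of a sequence, if there is one. -/
def evVal (b₀ : B) (g : ℕ → B) : B :=
  open Classical in if h : ∃ b, ∀ᶠ j in atTop, g j = b then h.choose else b₀

lemma evVal_eq {b₀ b : B} {g : ℕ → B} (h : ∀ᶠ j in atTop, g j = b) : evVal b₀ g = b := by
  have h' : ∃ b, ∀ᶠ j in atTop, g j = b := ⟨b, h⟩
  rw [evVal, dif_pos h']
  obtain ⟨j, h1, h2⟩ := (h.and h'.choose_spec).exists
  exact h2.symm.trans h1

lemma measurable_evVal {X : Type} [MeasurableSpace X] (b₀ : B) {g : ℕ → X → B}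
    (hg : ∀ j, Measurable (g j)) : Measurable fun x => evVal b₀ fun j => g j x := by
  have hE : ∀ b, MeasurableSet {x | ∀ᶠ j in atTop, g j x = b} := by
    intro b
    have : {x | ∀ᶠ j in atTop, g j x = b} = ⋃ N : ℕ, ⋂ j : ℕ, ⋂ _ : N ≤ j, g j ⁻¹' {b} := by
      ext x
      simp [eventually_atTop]
    rw [this]
    exact .iUnion fun N => .iInter fun j => .iInter fun _ => hg j (measurableSet_singleton _)
  refine measurable_to_countable' fun b => ?_
  have : (fun x => evVal b₀ fun j => g j x) ⁻¹' {b} = {x | ∀ᶠ j in atTop, g j x = b} ∪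
      (({x | b₀ = b} : Set X) ∩ ⋂ b', {x | ∀ᶠ j in atTop, g j x = b'}ᶜ) := by
    ext x
    simp only [mem_preimage, mem_singleton_iff, mem_union, mem_inter_iff, mem_iInter, mem_compl_iff,
      mem_ofPred_eq]
    constructor
    · intro h
      by_cases h' : ∃ b, ∀ᶠ j in atTop, g j x = b
      · obtain ⟨b', hb'⟩ := h'
        rw [evVal_eq hb'] at h
        exact Or.inl (h ▸ hb')
      · rw [evVal, dif_neg h'] at h
        exact Or.inr ⟨h, fun b' hb' => h' ⟨b', hb'⟩⟩
    · rintro (h | ⟨h, h'⟩)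
      · exact evVal_eq h
      · rw [evVal, dif_neg (by simpa using h'), h]
  rw [this]
  exact (hE b).union ((MeasurableSet.const _).inter (.iInter fun b' => (hE b').compl))

/-- A joining coded to every precision is carried by the graph of an equivariant map. -/
lemma exists_factor [Nonempty B] {m : Measure (ℤ → A × B)} [IsProbabilityMeasure m]
    (hm : IsLaw m J) (hJ : ∀ δ > 0, Coded J δ) :
    ∃ θ : (ℤ → A) → (ℤ → B), Measurable θ ∧ (∀ x, θ (shift 1 x) = fun i => θ x (i + 1)) ∧
      ∀ᵐ ω ∂m, θ (fun i => (ω i).1) = fun i => (ω i).2 := by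
  choose n k Φ hΦ using fun j : ℕ => hJ ((1 / 2) ^ j) (by positivity)
  let b₀ : B := Classical.arbitrary B
  let θ : (ℤ → A) → (ℤ → B) := fun x i =>
    evVal b₀ fun j => Φ j (rd x (i - n j) (n j + 1 + k j))
  refine ⟨θ, measurable_pi_iff.2 fun i => measurable_evVal b₀ fun j => measurable_rd _ _ _,
    fun x => funext fun i => ?_, ?_⟩
  · simp only [θ]
    congr 1
    funext j
    rw [show shift 1 x = fun i => x (i + 1) from rfl, rd_shift, show i - n j + 1 = i + 1 - n j by ring]
  · suffices h : ∀ i, ∀ᵐ ω ∂m, ∀ᶠ j in atTop,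
        Φ j (rd (fun i => (ω i).1) (i - n j) (n j + 1 + k j)) = (ω i).2 by
      filter_upwards [ae_all_iff.2 h] with ω hω
      exact funext fun i => evVal_eq (hω i)
    intro i
    let E : ℕ → Set (ℤ → A × B) := fun j =>
      {ω | ¬ ((rd ω (i - n j) (n j + 1 + k j)).map Prod.snd)[n j]? =
        some (Φ j ((rd ω (i - n j) (n j + 1 + k j)).map Prod.fst))}
    have hE : ∀ j, m (E j) ≤ ENNReal.ofReal ((1 / 2) ^ j) := by
      intro j
      rw [← ofReal_measureReal]
      refine ENNReal.ofReal_le_ofReal (le_trans (le_of_eq ?_) (hΦ j).le)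
      rw [hm.real _ _ fun l => ¬ (l.map Prod.snd)[n j]? = some (Φ j (l.map Prod.fst)), jexp]
      refine Finset.sum_congr rfl fun l _ => ?_
      rw [cerr]
      by_cases h : (l.map Prod.snd)[n j]? = some (Φ j (l.map Prod.fst))
      · rw [if_neg (not_not.2 h), if_pos h]
      · rw [if_pos h, if_neg h]
    have hsum : ∑' j, m (E j) ≠ ⊤ := by
      refine ne_top_of_le_ne_top ?_ (ENNReal.tsum_le_tsum hE)
      exact (summable_geometric_of_lt_one (by norm_num) (by norm_num)).tsum_ofReal_ne_top
    filter_upwards [ae_eventually_notMem hsum] with ω hω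
    filter_upwards [hω] with j hj
    simp only [E, mem_ofPred_eq, not_not] at hj
    rw [map_rd, map_rd, getElem?_rd _ _ (by omega)] at hj
    simp only [sub_add_cancel, Option.some_inj] at hj
    exact hj.symm

lemma IsJoin.isLaw_fst (hJ : IsJoin p q J) {m : Measure (ℤ → A × B)} [IsProbabilityMeasure m]
    (hm : IsLaw m J) : IsLaw (m.map fun ω i => (ω i).1) p.P := by
  intro a z
  refine (hm.map Prod.fst a z).trans ?_
  beta_reduce
  rw [sum_wd_zip, ← (hJ.isCpl z.length).row z (mem_wd.2 rfl)]
  rw [Finset.sum_eq_single_of_mem z (mem_wd.2 rfl)]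
  · refine Finset.sum_congr rfl fun w hw => ?_
    rw [List.map_fst_zip (mem_wd.1 hw).ge, if_pos rfl, mul_one]
  · intro z' hz' hne
    refine Finset.sum_eq_zero fun w hw => ?_
    rw [List.map_fst_zip ((mem_wd.1 hz').trans (mem_wd.1 hw).symm).le, if_neg hne, mul_zero]

lemma isLaw_swp {m : Measure (ℤ → A × B)} [IsProbabilityMeasure m]
    (hm : IsLaw m J) : IsLaw (m.map fun ω i => (ω i).swap) (swp J) := by
  intro a w
  refine (hm.map Prod.swap a w).trans ?_
  beta_reduce
  rw [Finset.sum_eq_single_of_mem (w.map Prod.swap) (by simp)]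
  · simp [swp]
  · intro l _ hl
    rw [if_neg, mul_zero]
    rintro rfl
    simp at hl

lemma iid_isLaw {P : B → ℝ} {h0 : ∀ b, 0 < P b} {h1 : ∑ b, P b = 1} {ρ : Measure B}
    [IsProbabilityMeasure ρ] (hρ : ∀ b, ρ.real {b} = P b) :
    IsLaw (Measure.infinitePi fun _ : ℤ => ρ) (iidProc P h0 h1).P := by
  intro a w
  have e : {y : ℤ → B | rd y a w.length = w} = ((Finset.univ.image fun i : Fin w.length =>
      a + (i : ℤ) : Finset ℤ) : Set ℤ).pi fun i => {b | w[(i - a).toNat]? = some b} := by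
    ext y
    simp only [Set.mem_pi, Finset.coe_image, Finset.coe_univ, image_univ, mem_range,
      forall_exists_index, forall_apply_eq_imp_iff, mem_ofPred_eq]
    constructor
    · intro h i
      rw [show (a + (i : ℤ) - a).toNat = i by omega]
      exact (congrArg (·[(i : ℕ)]?) h).symm.trans (getElem?_rd _ _ i.2)
    · intro h
      refine List.ext_getElem? fun i => ?_
      by_cases hi : i < w.length
      · have := h ⟨i, hi⟩
        rw [show (a + ((⟨i, hi⟩ : Fin w.length) : ℤ) - a).toNat = i by simp] at this
        rw [this, getElem?_rd _ _ hi]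
      · rw [List.getElem?_eq_none (by simpa using hi), List.getElem?_eq_none (by omega)]
  rw [Measure.real, e, Measure.infinitePi_pi _ fun i _ => Set.Finite.measurableSet (toFinite _),
    Finset.prod_image (by intro i _ j _ h; ext; simpa using h), ENNReal.toReal_prod]
  have : ∀ i : Fin w.length, (ρ {b | w[(a + (i : ℤ) - a).toNat]? = some b}).toReal = P (w.get i) := by
    intro i
    rw [← hρ, Measure.real, show (a + (i : ℤ) - a).toNat = i by omega]
    congr 2
    ext b
    simp [eq_comm]
  rw [Finset.prod_congr rfl fun i _ => this i]
  simp only [iidProc]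
  rw [← List.prod_ofFn]
  congr 1
  exact List.ext_getElem (by simp) (by simp)

end Factor

section Bernoulli

variable {S : Type} [Fintype S] [DecidableEq S] [TopologicalSpace S] [DiscreteTopology S]
  [MeasurableSpace S] [MeasurableSingletonClass S]

theorem isBernoulliSystem_of_nice [Nontrivial S] {p : Proc S} (hp : p.Nice) {μ : Measure (ℤ → S)}
    [IsProbabilityMeasure μ] (hμ : IsLaw μ p.P) : IsBernoulliSystem μ := by
  obtain ⟨h, -, h2, h3⟩ := hp.exists_aep
  have hh : 0 < h := hp.entropy_pos Fintype.one_lt_card h2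
  obtain ⟨m, P, hP0, hP1, hP⟩ := exists_pmf_entropy hh
  have hq := iidProc_nice (h0 := hP0) (h1 := hP1)
  have hqA : (iidProc P hP0 hP1).AEP h := hP ▸ iidProc_aep
  set q := iidProc P hP0 hP1 with hqdef
  obtain ⟨J, hJ, hcoded⟩ := exists_coded_both hp hq hh h3 hqA
  obtain ⟨M, hM, hML⟩ := exists_isLaw hJ.nonneg
    (by have := hJ.left []; rwa [List.length_nil, sum_wd_zero, p.nil] at this) hJ.snoc hJ.cons
  have hsumP : ∑ a, ENNReal.ofReal (P a) = 1 := by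
    rw [← ENNReal.ofReal_sum_of_nonneg fun a _ => (hP0 a).le, hP1, ENNReal.ofReal_one]
  let ρ : Measure (Fin (m + 2)) := (PMF.ofFintype _ hsumP).toMeasure
  have hρ' : ∀ b, ρ {b} = ENNReal.ofReal (P b) := fun b => by
    rw [PMF.toMeasure_apply_singleton _ _ (measurableSet_singleton b)]; rfl
  have hρ : ∀ b, ρ.real {b} = P b := fun b => by
    rw [Measure.real, hρ', ENNReal.toReal_ofReal (hP0 b).le]
  let ν : Measure (ℤ → Fin (m + 2)) := Measure.infinitePi fun _ => ρ
  have hmf : Measurable fun (ω : ℤ → S × Fin (m + 2)) i => (ω i).1 := measurable_comp_pi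
  have hms : Measurable fun (ω : ℤ → S × Fin (m + 2)) i => (ω i).2 := measurable_comp_pi
  have hmw : Measurable fun (ω : ℤ → S × Fin (m + 2)) i => (ω i).swap := measurable_comp_pi
  have := Measure.isProbabilityMeasure_map (μ := M) hmf.aemeasurable
  have := Measure.isProbabilityMeasure_map (μ := M) hms.aemeasurable
  have := Measure.isProbabilityMeasure_map (μ := M) hmw.aemeasurable
  have hMμ : M.map (fun ω i => (ω i).1) = μ := (hJ.isLaw_fst hML).unique hμ
  have hMν : M.map (fun ω i => (ω i).2) = ν := by
    refine IsLaw.unique (Q := q.P) ?_ (iid_isLaw hρ)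
    have := hJ.swp.isLaw_fst (isLaw_swp hML)
    rwa [Measure.map_map measurable_comp_pi hmw] at this
  obtain ⟨θ, hθ, hθs, hθM⟩ := exists_factor hML fun δ hδ => (hcoded δ hδ).1
  obtain ⟨τ, hτ, hτs, hτM⟩ := exists_factor (isLaw_swp hML) fun δ hδ => (hcoded δ hδ).2
  have hτM' := ae_of_ae_map hmw.aemeasurable hτM
  simp only [Prod.fst_swap, Prod.snd_swap] at hτM'
  refine ⟨m + 2, fun a => ENNReal.ofReal (P a), ν, inferInstance, hsumP, fun Λ ζ => ?_,
    θ, τ, hθ, hτ, ?_, ae_of_all _ hθs, ?_, ?_⟩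
  · have e : {y : ℤ → Fin (m + 2) | ∀ i : Λ, y ↑i = ζ i} =
        (Λ : Set ℤ).pi fun i => {b | ∀ h : i ∈ Λ, b = ζ ⟨i, h⟩} := by
      ext y
      simp only [mem_ofPred_eq, Subtype.forall, Set.mem_pi, Finset.mem_coe]
      exact ⟨fun h i hi _ => h i hi, fun h i hi => h i hi hi⟩
    rw [e, Measure.infinitePi_pi _ fun i _ => Set.Finite.measurableSet (toFinite _),
      ← Finset.prod_coe_sort]
    refine Finset.prod_congr rfl fun i _ => ?_
    refine Eq.trans ?_ (hρ' (ζ i))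
    congr 1
    ext b
    simp
  · rw [← hMμ, Measure.map_map hθ hmf, ← hMν]
    exact Measure.map_congr hθM
  · rw [← hMμ, ae_map_iff hmf.aemeasurable (p := fun x => τ (θ x) = x)
      (measurableSet_eq_fun (hτ.comp hθ) measurable_id)]
    filter_upwards [hθM, hτM'] with ω h1 h2
    rw [h1, h2]
  · rw [← hMν, ae_map_iff hms.aemeasurable (p := fun y => θ (τ y) = y)
      (measurableSet_eq_fun (hθ.comp hτ) measurable_id)]
    filter_upwards [hθM, hτM'] with ω h1 h2
    rw [h2, h1]

lemma isBernoulliSystem_of_subsingleton [Subsingleton S] [Nonempty S] (μ : Measure (ℤ → S))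
    [IsProbabilityMeasure μ] : IsBernoulliSystem μ := by
  let θ : (ℤ → S) → ℤ → Fin 1 := fun _ _ => 0
  refine ⟨1, fun _ => 1, μ.map θ, Measure.isProbabilityMeasure_map measurable_const.aemeasurable,
    by simp, fun Λ ζ => ?_, θ, fun _ => Classical.arbitrary _, measurable_const, measurable_const,
    rfl, ae_of_all _ fun _ => rfl, ae_of_all _ fun _ => Subsingleton.elim _ _,
    ae_of_all _ fun _ => Subsingleton.elim _ _⟩
  have := Measure.isProbabilityMeasure_map (μ := μ) (f := θ) measurable_const.aemeasurable
  rw [Finset.prod_const_one, ← measure_univ (μ := μ.map θ)]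
  congr 1
  exact eq_univ_of_forall fun y i => Subsingleton.elim _ _

end Bernoulli

section HouseOfCards

/-- The probability that the house-of-cards chain started at `0`, which climbs from `j` with
probability `E j` and otherwise falls to `0`, is at height at least `k` at time `n`. -/
def hcTail (E : ℕ → ℝ) : ℕ → ℕ → ℝ
  | 0, k => if k = 0 then 1 else 0
  | _ + 1, 0 => 1
  | n + 1, k + 1 => E k * hcTail E n k +
      ∑ j ∈ Finset.Ico k n, (E (j + 1) - E j) * hcTail E n (j + 1)

variable {E : ℕ → ℝ}

@[simp] lemma hcTail_zero_right (n : ℕ) : hcTail E n 0 = 1 := by cases n <;> simp [hcTail]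

lemma hcTail_succ (n k : ℕ) : hcTail E (n + 1) (k + 1) = E k * hcTail E n k +
    ∑ j ∈ Finset.Ico k n, (E (j + 1) - E j) * hcTail E n (j + 1) := rfl

lemma hcTail_eq_zero {n k : ℕ} (h : n < k) : hcTail E n k = 0 := by
  induction n generalizing k with
  | zero => simp [hcTail, h.ne']
  | succ n ih =>
    obtain ⟨k, rfl⟩ : ∃ j, k = j + 1 := ⟨k - 1, by omega⟩
    rw [hcTail_succ, ih (by omega), Finset.Ico_eq_empty (by omega)]
    simp

lemma hcTail_sub (n k : ℕ) : hcTail E (n + 1) (k + 1) - hcTail E (n + 1) (k + 2) =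
    E k * (hcTail E n k - hcTail E n (k + 1)) := by
  rw [hcTail_succ, hcTail_succ]
  rcases lt_or_ge k n with h | h
  · rw [Finset.sum_eq_sum_Ico_succ_bot h]
    ring
  · rw [Finset.Ico_eq_empty (by omega), Finset.Ico_eq_empty (by omega),
      hcTail_eq_zero (show n < k + 1 by omega)]
    ring

variable (hE0 : ∀ j, 0 < E j) (hE1 : ∀ j, E j ≤ 1) (hE : Monotone E)
include hE0 hE

lemma hcTail_nonneg (n k : ℕ) : 0 ≤ hcTail E n k := by
  induction n generalizing k with
  | zero => unfold hcTail; split_ifs <;> norm_num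
  | succ n ih =>
    cases k with
    | zero => simp
    | succ k =>
      rw [hcTail_succ]
      exact add_nonneg (mul_nonneg (hE0 _).le (ih _)) (Finset.sum_nonneg fun j _ =>
        mul_nonneg (sub_nonneg.2 (hE (by omega))) (ih _))

lemma hcTail_mono_left (n k : ℕ) : hcTail E n k ≤ hcTail E (n + 1) k := by
  induction n generalizing k with
  | zero =>
    cases k with
    | zero => simp
    | succ k => rw [hcTail_eq_zero (by omega)]; exact hcTail_nonneg hE0 hE _ _
  | succ n ih =>
    cases k with
    | zero => simp
    | succ k =>
      rw [hcTail_succ, hcTail_succ]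
      refine add_le_add (mul_le_mul_of_nonneg_left (ih k) (hE0 _).le) ?_
      refine (Finset.sum_le_sum fun j _ => mul_le_mul_of_nonneg_left (ih (j + 1))
        (sub_nonneg.2 (hE (by omega)))).trans ?_
      exact Finset.sum_le_sum_of_subset_of_nonneg (Finset.Ico_subset_Ico_right (by omega))
        fun j _ _ => mul_nonneg (sub_nonneg.2 (hE (by omega))) (hcTail_nonneg hE0 hE _ _)

lemma hcTail_add_ge (n k i : ℕ) :
    (∏ j ∈ Finset.Ico k (k + i), E j) * hcTail E n k ≤ hcTail E (n + i) (k + i) := by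
  induction i with
  | zero => simp
  | succ i ih =>
    rw [← add_assoc, Finset.prod_Ico_succ_top (by omega), ← add_assoc, hcTail_succ]
    have := mul_le_mul_of_nonneg_left ih (hE0 (k + i)).le
    have h2 : 0 ≤ ∑ j ∈ Finset.Ico (k + i) (n + i), (E (j + 1) - E j) * hcTail E (n + i) (j + 1) :=
      Finset.sum_nonneg fun j _ => mul_nonneg (sub_nonneg.2 (hE (by omega)))
        (hcTail_nonneg hE0 hE _ _)
    linarith

include hE1

lemma hcTail_le_one (n k : ℕ) : hcTail E n k ≤ 1 := by
  induction n generalizing k with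
  | zero => unfold hcTail; split_ifs <;> norm_num
  | succ n ih =>
    cases k with
    | zero => simp
    | succ k =>
      rcases lt_or_ge n k with h | h
      · rw [hcTail_eq_zero (by omega)]; norm_num
      · rw [hcTail_succ]
        have h1 : E k * hcTail E n k ≤ E k := mul_le_of_le_one_right (hE0 _).le (ih k)
        have h2 : ∑ j ∈ Finset.Ico k n, (E (j + 1) - E j) * hcTail E n (j + 1) ≤
            ∑ j ∈ Finset.Ico k n, (E (j + 1) - E j) := Finset.sum_le_sum fun j _ =>
          mul_le_of_le_one_right (sub_nonneg.2 (hE (by omega))) (ih _)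
        rw [Finset.sum_Ico_sub E h] at h2
        linarith [hE1 n]

lemma hcTail_anti (n k : ℕ) : hcTail E n (k + 1) ≤ hcTail E n k := by
  induction n generalizing k with
  | zero => rw [hcTail_eq_zero (by omega)]; exact hcTail_nonneg hE0 hE _ _
  | succ n ih =>
    cases k with
    | zero => rw [hcTail_zero_right]; exact hcTail_le_one hE0 hE1 hE _ _
    | succ k =>
      have := hcTail_sub (E := E) n k
      have h2 := mul_nonneg (hE0 k).le (sub_nonneg.2 (ih k))
      linarith

omit hE0 hE1 hE in
lemma hcTail_sub_eq (r k : ℕ) : hcTail E (r + k) k - hcTail E (r + k) (k + 1) =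
    (∏ j ∈ Finset.range k, E j) * (1 - hcTail E r 1) := by
  induction k with
  | zero => simp
  | succ k ih => rw [← add_assoc, hcTail_sub, ih, Finset.prod_range_succ]; ring

lemma renewal_bound (n : ℕ) :
    (n + 1) * ((∏ j ∈ Finset.range n, E j) * (1 - hcTail E n 1)) ≤ 1 := by
  have h1 : ∑ k ∈ Finset.range (n + 1), (hcTail E n k - hcTail E n (k + 1)) = 1 := by
    rw [Finset.sum_range_sub', hcTail_eq_zero (show n < n + 1 by omega)]
    simp
  have h2 : ∀ k ∈ Finset.range (n + 1), (∏ j ∈ Finset.range n, E j) * (1 - hcTail E n 1) ≤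
      hcTail E n k - hcTail E n (k + 1) := by
    intro k hk
    have hk' : k ≤ n := by simpa [Nat.lt_succ_iff] using hk
    have := hcTail_sub_eq (E := E) (n - k) k
    rw [Nat.sub_add_cancel hk'] at this
    rw [this]
    have hm : Monotone fun n => hcTail E n 1 :=
      monotone_nat_of_le_succ fun n => hcTail_mono_left hE0 hE n 1
    refine mul_le_mul ?_ (sub_le_sub_left (hm (Nat.sub_le n k)) _)
      (sub_nonneg.2 (hcTail_le_one hE0 hE1 hE _ _)) (Finset.prod_nonneg fun j _ => (hE0 j).le)
    exact Finset.prod_le_prod_of_subset_of_le_one (Finset.range_mono hk')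
      (fun j _ => (hE0 j).le) fun j _ _ => hE1 j
  calc _ = ∑ k ∈ Finset.range (n + 1), (∏ j ∈ Finset.range n, E j) * (1 - hcTail E n 1) := by
        rw [Finset.sum_const, Finset.card_range, nsmul_eq_mul]; push_cast; ring
    _ ≤ _ := (Finset.sum_le_sum h2).trans_eq h1

end HouseOfCards

section Decay

open Real

/-- `R` decays like `β / j`, up to a summable error. -/
structure Decay (R : ℕ → ℝ) (β : ℝ) (b : ℕ → ℝ) : Prop where
  nonneg : ∀ j, 0 ≤ R j
  anti : Antitone R
  pos : 0 < β
  lt : β < 1 / 2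
  b_nonneg : ∀ j, 0 ≤ b j
  summable : Summable b
  le : ∀ j : ℕ, R j ≤ β * (log (j + 2) - log (j + 1)) + b j

lemma inv_le_log_sub (j : ℕ) (hj : 1 ≤ j) :
    (j : ℝ)⁻¹ ≤ log (j + 2) - log (j + 1) + 2 / (j : ℝ) ^ 2 := by
  have hj' : (0 : ℝ) < j := by exact_mod_cast hj
  have h1 : 1 - ((j + 2 : ℝ) / (j + 1))⁻¹ ≤ log ((j + 2 : ℝ) / (j + 1)) :=
    one_sub_inv_le_log_of_pos (by positivity)
  rw [log_div (by positivity) (by positivity)] at h1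
  have h2 : (j : ℝ)⁻¹ ≤ 1 - ((j + 2 : ℝ) / (j + 1))⁻¹ + 2 / (j : ℝ) ^ 2 := by
    rw [inv_div, ← sub_nonneg]
    have : 1 - ((j + 1 : ℝ) / (j + 2)) + 2 / (j : ℝ) ^ 2 - (j : ℝ)⁻¹ = 4 / (j ^ 2 * (j + 2)) := by
      field_simp
      ring
    rw [this]
    positivity
  linarith

lemma decay_of_inv_bound {R a : ℕ → ℝ} {β : ℝ} (hR : ∀ j, 0 ≤ R j) (hanti : Antitone R)
    (hβ0 : 0 < β) (hβ : β < 1 / 2) (ha : ∀ j, 0 ≤ a j) (hs : Summable a)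
    (h : ∀ j : ℕ, 1 ≤ j → R j ≤ β / j + a j) :
    Decay R β fun j => (if j = 0 then R 0 else 0) + (2 / (j : ℝ) ^ 2 + a j) := by
  refine ⟨hR, hanti, hβ0, hβ, fun j => ?_, ?_, fun j => ?_⟩
  · have := hR 0; have := ha j
    split_ifs <;> positivity
  · refine Summable.add (summable_of_ne_finset_zero (s := {0}) fun j hj => ?_)
      (Summable.add ?_ hs)
    · rw [if_neg (by simpa using hj)]
    · simpa [div_eq_mul_inv] using (Real.summable_nat_pow_inv.2 one_lt_two).mul_left 2
  · rcases Nat.eq_zero_or_pos j with rfl | hj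
    · have : log (((0 : ℕ) : ℝ) + 1) ≤ log (((0 : ℕ) : ℝ) + 2) := log_le_log (by simp) (by simp)
      have h2 := mul_nonneg hβ0.le (sub_nonneg.2 this)
      have := ha 0
      simp only [if_true]
      simp at h2 ⊢
      linarith
    · have h1 := h j hj
      have h2 := mul_le_mul_of_nonneg_left (inv_le_log_sub j hj) hβ0.le
      have h3 : β * (2 / (j : ℝ) ^ 2) ≤ 2 / (j : ℝ) ^ 2 :=
        mul_le_of_le_one_left (by positivity) (by linarith)
      rw [if_neg hj.ne']
      rw [div_eq_mul_inv] at h1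
      nlinarith

/-- The climbing probabilities associated with the log-ratio bounds `R`. -/
def climb (R : ℕ → ℝ) (j : ℕ) : ℝ := exp (-2 * R j)

lemma climb_pos (R : ℕ → ℝ) (j : ℕ) : 0 < climb R j := exp_pos _

lemma pow_sub_le {α : ℝ} (hα0 : 0 < α) (hα1 : α ≤ 1) (s : ℕ) :
    (s : ℝ) ^ α ≤ (s + 1 : ℝ) ^ α * (1 - α / (s + 1)) := by
  have h : (s : ℝ) = (s + 1) * (1 + -(1 / (s + 1))) := by field_simp; ring
  have h1 : (1 : ℝ) / (s + 1) ≤ 1 := by rw [div_le_one (by positivity)]; linarith [s.cast_nonneg (α := ℝ)]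
  have h2 := rpow_one_add_le_one_add_mul_self (s := -(1 / ((s : ℝ) + 1))) (by linarith) hα0.le hα1
  conv_lhs => rw [h, mul_rpow (by positivity) (by linarith)]
  refine mul_le_mul_of_nonneg_left (h2.trans_eq ?_) (by positivity)
  ring

lemma sum_rpow_le {α : ℝ} (hα0 : 0 < α) (hα1 : α ≤ 1) (m : ℕ) :
    ∑ s ∈ Finset.range m, (s + 1 : ℝ) ^ (α - 1) ≤ (m : ℝ) ^ α / α := by
  induction m with
  | zero => simp [hα0.ne']
  | succ m ih =>
    rw [Finset.sum_range_succ]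
    have h := pow_sub_le hα0 hα1 m
    have e : (m + 1 : ℝ) ^ (α - 1) = (m + 1 : ℝ) ^ α / (m + 1) := by
      rw [rpow_sub_one (by positivity)]
    rw [e]
    have : (m + 1 : ℝ) ^ α / (m + 1) ≤ ((m + 1 : ℝ) ^ α - (m : ℝ) ^ α) / α := by
      rw [le_div_iff₀ hα0]
      calc _ = (m + 1 : ℝ) ^ α * (α / (m + 1)) := by ring
        _ ≤ _ := by linarith
    push_cast
    rw [sub_div] at this
    linarith

lemma sum_rpow_tail_le {α : ℝ} (hα0 : 0 < α) (hα1 : α ≤ 1) {m : ℕ} (hm : 1 ≤ m) (n : ℕ) :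
    ∑ l ∈ Finset.Ico m n, (l + 1 : ℝ) ^ (-1 - α) ≤ (m : ℝ) ^ (-α) / α := by
  have key : ∀ l : ℕ, 1 ≤ l → (l + 1 : ℝ) ^ (-1 - α) ≤
      -(((l + 1 : ℕ) : ℝ) ^ (-α) / α) - -((l : ℝ) ^ (-α) / α) := by
    intro l hl
    have hl' : (0 : ℝ) < l := by exact_mod_cast hl
    have h := pow_sub_le hα0 hα1 l
    have h1 : α / ((l : ℝ) + 1) < 1 := by
      rw [div_lt_one (by positivity)]; linarith
    have h2 : 0 ≤ α / ((l : ℝ) + 1) := by positivity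
    have h3 : ((l + 1 : ℝ) ^ α)⁻¹ * (1 + α / (l + 1)) ≤ ((l : ℝ) ^ α)⁻¹ := by
      rw [← div_eq_inv_mul, div_le_iff₀ (by positivity), ← div_eq_inv_mul,
        le_div_iff₀ (by positivity)]
      calc _ ≤ (1 + α / (l + 1)) * ((l + 1 : ℝ) ^ α * (1 - α / (l + 1))) :=
            mul_le_mul_of_nonneg_left h (by positivity)
        _ = (l + 1 : ℝ) ^ α * (1 - (α / (l + 1)) ^ 2) := by ring
        _ ≤ _ := mul_le_of_le_one_right (by positivity) (by nlinarith)
    have e : (l + 1 : ℝ) ^ (-1 - α) = ((l + 1 : ℝ) ^ α)⁻¹ / (l + 1) := by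
      rw [show -1 - α = -α - 1 by ring, rpow_sub_one (by positivity), rpow_neg (by positivity)]
    rw [e, rpow_neg (by positivity), rpow_neg (by positivity)]
    push_cast
    rw [neg_sub_neg, ← sub_div, le_div_iff₀ hα0]
    calc _ = ((l + 1 : ℝ) ^ α)⁻¹ * (α / (l + 1)) := by ring
      _ ≤ _ := by linarith
  rcases le_total n m with h | h
  · rw [Finset.Ico_eq_empty (by omega)]
    simp only [Finset.sum_empty]
    positivity
  · calc _ ≤ ∑ l ∈ Finset.Ico m n, (-(((l + 1 : ℕ) : ℝ) ^ (-α) / α) - -((l : ℝ) ^ (-α) / α)) :=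
          Finset.sum_le_sum fun l hl => key l (hm.trans (Finset.mem_Ico.1 hl).1)
      _ = (m : ℝ) ^ (-α) / α - (n : ℝ) ^ (-α) / α := by
          rw [Finset.sum_Ico_sub (fun l : ℕ => -((l : ℝ) ^ (-α) / α)) h]; ring
      _ ≤ _ := by
          have : 0 ≤ (n : ℝ) ^ (-α) / α := by positivity
          linarith

variable {R b : ℕ → ℝ} {β : ℝ} (hR : Decay R β b)
include hR

lemma Decay.climb_le_one (j : ℕ) : climb R j ≤ 1 :=
  exp_le_one_iff.2 (by linarith [hR.nonneg j])

lemma Decay.climb_mono : Monotone (climb R) := fun i j h =>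
  exp_le_exp.2 (by linarith [hR.anti h])

lemma Decay.hcTail_nonneg (n k : ℕ) : 0 ≤ hcTail (climb R) n k :=
  GibbsFormal.hcTail_nonneg (climb_pos R) hR.climb_mono n k

lemma Decay.hcTail_le_one (n k : ℕ) : hcTail (climb R) n k ≤ 1 :=
  GibbsFormal.hcTail_le_one (climb_pos R) hR.climb_le_one hR.climb_mono n k

lemma Decay.sum_b_le (s : Finset ℕ) : ∑ j ∈ s, b j ≤ ∑' j, b j :=
  hR.summable.sum_le_tsum s fun j _ => hR.b_nonneg j

lemma Decay.tsum_nonneg : 0 ≤ ∑' j, b j := _root_.tsum_nonneg hR.b_nonneg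

lemma Decay.prod_climb_ge {s r : ℕ} (h : s ≤ r) :
    exp (-2 * ∑' j, b j) * ((s + 1 : ℝ) / (r + 1)) ^ (2 * β) ≤
      ∏ j ∈ Finset.Ico s r, climb R j := by
  simp only [climb]
  rw [← exp_sum, rpow_def_of_pos (by positivity), ← exp_add, exp_le_exp,
    log_div (by positivity) (by positivity), ← Finset.mul_sum]
  have h1 : ∑ j ∈ Finset.Ico s r, R j ≤ β * (log (r + 1) - log (s + 1)) + ∑' j, b j := by
    calc _ ≤ ∑ j ∈ Finset.Ico s r, (β * (log (j + 2) - log (j + 1)) + b j) :=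
          Finset.sum_le_sum fun j _ => hR.le j
      _ = β * (log (r + 1) - log (s + 1)) + ∑ j ∈ Finset.Ico s r, b j := by
          rw [Finset.sum_add_distrib, ← Finset.mul_sum,
            ← Finset.sum_Ico_sub (fun j : ℕ => log ((j : ℝ) + 1)) h]
          push_cast
          simp only [add_assoc, one_add_one_eq_two]
      _ ≤ _ := by linarith [hR.sum_b_le (Finset.Ico s r)]
  linarith

lemma Decay.one_sub_hcTail_le : ∃ C : ℝ, 1 ≤ C ∧ ∀ N m : ℕ,
    1 - hcTail (climb R) N m ≤ C * ((m : ℝ) / (N + 1)) ^ (1 - 2 * β) := by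
  set α := 1 - 2 * β with hα
  have hα0 : 0 < α := by linarith [hR.lt]
  have hα1 : α < 1 := by linarith [hR.pos]
  set D := exp (2 * ∑' j, b j)
  have hD : 1 ≤ D := one_le_exp (by linarith [hR.tsum_nonneg])
  have hDα : 1 ≤ D / α := (one_le_div hα0).2 (hα1.le.trans hD)
  refine ⟨2 * (D / α), by linarith, fun N m => ?_⟩
  rcases lt_or_ge N (2 * m) with h | h
  · have h1 : (1 / 2 : ℝ) ≤ ((m : ℝ) / (N + 1)) ^ α := by
      have h2 : (1 / 2 : ℝ) ≤ (m : ℝ) / (N + 1) := by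
        rw [div_le_div_iff₀ (by norm_num) (by positivity)]
        have : ((N + 1 : ℕ) : ℝ) ≤ ((2 * m : ℕ) : ℝ) := by exact_mod_cast h
        push_cast at this
        linarith
      calc (1 / 2 : ℝ) = (1 / 2 : ℝ) ^ (1 : ℝ) := (rpow_one _).symm
        _ ≤ (1 / 2 : ℝ) ^ α := rpow_le_rpow_of_exponent_ge (by norm_num) (by norm_num) hα1.le
        _ ≤ _ := rpow_le_rpow (by norm_num) h2 hα0.le
    have := hR.hcTail_nonneg N m
    nlinarith
  · have e : 1 - hcTail (climb R) N m = ∑ s ∈ Finset.range m,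
        (hcTail (climb R) N s - hcTail (climb R) N (s + 1)) := by
      rw [Finset.sum_range_sub', hcTail_zero_right]
    have hN : (0 : ℝ) < N + 1 := by positivity
    have hbd : ∀ s ∈ Finset.range m, hcTail (climb R) N s - hcTail (climb R) N (s + 1) ≤
        (2 * D * ((N : ℝ) + 1) ^ (-α)) * (s + 1 : ℝ) ^ (α - 1) := by
      intro s hs
      rw [Finset.mem_range] at hs
      obtain ⟨r, rfl⟩ : ∃ r, N = r + s := ⟨N - s, by omega⟩
      rw [hcTail_sub_eq]
      have hr := renewal_bound (climb_pos R) hR.climb_le_one hR.climb_mono r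
      have hp := hR.prod_climb_ge (show s ≤ r by omega)
      rw [← Finset.prod_range_mul_prod_Ico _ (show s ≤ r by omega)] at hr
      set t := ∏ j ∈ Finset.range s, climb R j
      set v := 1 - hcTail (climb R) r 1
      set P := ∏ j ∈ Finset.Ico s r, climb R j
      have ht : 0 < t := Finset.prod_pos fun j _ => climb_pos R j
      have hv : 0 ≤ v := sub_nonneg.2 (hR.hcTail_le_one r 1)
      have hr1 : (0 : ℝ) < r + 1 := by positivity
      have hs1 : (0 : ℝ) < s + 1 := by positivity
      have hsr : ((r + s : ℕ) : ℝ) + 1 ≤ 2 * (r + 1) := by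
        have : (s : ℝ) ≤ r := by exact_mod_cast (show s ≤ r by omega)
        push_cast
        linarith
      have h1 : t * v * (exp (-2 * ∑' j, b j) * ((s + 1 : ℝ) / (r + 1)) ^ (2 * β)) ≤
          (r + 1 : ℝ)⁻¹ := by
        refine (mul_le_mul_of_nonneg_left hp (by positivity)).trans ?_
        rw [← one_div, le_div_iff₀ hr1]
        linarith
      have h2 : t * v ≤ D * (r + 1 : ℝ) ^ (-α) * (s + 1 : ℝ) ^ (α - 1) := by
        rw [neg_mul, exp_neg, ← mul_assoc, ← le_div_iff₀ (by positivity),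
          ← div_eq_mul_inv, div_le_iff₀ (exp_pos _)] at h1
        refine h1.trans_eq ?_
        rw [show -α = 2 * β - 1 by rw [hα]; ring, show α - 1 = -(2 * β) by rw [hα]; ring,
          rpow_sub_one (by positivity), rpow_neg (by positivity),
          div_rpow (by positivity) (by positivity)]
        field_simp
        rfl
      have h3 : (r + 1 : ℝ) ^ (-α) ≤ 2 * (((r + s : ℕ) : ℝ) + 1) ^ (-α) := by
        rw [rpow_neg (by positivity), rpow_neg (by positivity), ← div_eq_mul_inv,
          inv_le_comm₀ (by positivity) (by positivity), inv_div, div_le_iff₀ (by norm_num)]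
        calc _ ≤ (2 * (r + 1 : ℝ)) ^ α := rpow_le_rpow (by positivity) hsr hα0.le
          _ = 2 ^ α * (r + 1 : ℝ) ^ α := mul_rpow (by norm_num) (by positivity)
          _ ≤ 2 * (r + 1 : ℝ) ^ α := by
              refine mul_le_mul_of_nonneg_right ?_ (by positivity)
              calc (2 : ℝ) ^ α ≤ 2 ^ (1 : ℝ) :=
                    rpow_le_rpow_of_exponent_le (by norm_num) hα1.le
                _ = 2 := rpow_one _
          _ = _ := mul_comm _ _
      refine h2.trans ?_
      calc _ ≤ D * (2 * (((r + s : ℕ) : ℝ) + 1) ^ (-α)) * (s + 1 : ℝ) ^ (α - 1) := by gcongr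
        _ = _ := by ring
    rw [e]
    refine (Finset.sum_le_sum hbd).trans ?_
    rw [← Finset.mul_sum]
    refine (mul_le_mul_of_nonneg_left (sum_rpow_le hα0 hα1.le m) (by positivity)).trans_eq ?_
    rw [div_rpow (by positivity) (by positivity), rpow_neg (by positivity)]
    ring

lemma Decay.exists_hcTail_ge : ∃ c : ℝ, 0 < c ∧ ∀ N M : ℕ, 3 * M ≤ 2 * N →
    c ≤ hcTail (climb R) N M := by
  obtain ⟨C, hC1, hC⟩ := hR.one_sub_hcTail_le
  set α := 1 - 2 * β with hα
  have hα0 : 0 < α := by linarith [hR.lt]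
  obtain ⟨κ, hκ⟩ : ∃ κ : ℕ, 2 * (4 * C) ^ α⁻¹ ≤ κ := exists_nat_ge _
  have hC0 : 0 < (4 * C) ^ α⁻¹ := by positivity
  have hκ0 : (0 : ℝ) < κ := by linarith
  have hκ0' : 0 < κ := by exact_mod_cast hκ0
  have hhalf : ∀ n k : ℕ, (k : ℝ) / (n + 1) ≤ 2 / κ → 1 / 2 ≤ hcTail (climb R) n k := by
    intro n k h
    have h1 : ((k : ℝ) / (n + 1)) ^ α ≤ (4 * C)⁻¹ := by
      calc _ ≤ (((4 * C) ^ α⁻¹)⁻¹) ^ α := by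
            refine rpow_le_rpow (by positivity) (h.trans ?_) hα0.le
            rw [le_inv_comm₀ (by positivity) hC0, inv_div, le_div_iff₀ (by norm_num)]
            linarith
        _ = _ := by
            rw [inv_rpow (by positivity), ← rpow_mul (by positivity), inv_mul_cancel₀ hα0.ne',
              rpow_one]
    have h2 := mul_le_mul_of_nonneg_left h1 (by linarith : 0 ≤ C)
    have h3 : C * (4 * C)⁻¹ = 1 / 4 := by field_simp
    linarith [hC n k]
  set D := exp (-2 * ∑' j, b j)
  refine ⟨D * (κ : ℝ)⁻¹ * (1 / 2), by positivity, fun N M h => ?_⟩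
  obtain ⟨k, i, rfl, hk, hk'⟩ : ∃ k i, M = k + i ∧ κ * k ≤ M ∧ M + 1 ≤ κ * (k + 1) := by
    refine ⟨M / κ, M - M / κ, ?_, Nat.mul_div_le _ _, Nat.lt_mul_div_succ _ hκ0'⟩
    have := Nat.div_le_self M κ
    omega
  obtain ⟨n, rfl⟩ : ∃ n, N = n + i := ⟨N - i, by omega⟩
  refine le_trans ?_ (hcTail_add_ge (climb_pos R) hR.climb_mono n k i)
  refine mul_le_mul ?_ (hhalf n k ?_) (by norm_num)
    (Finset.prod_nonneg fun j _ => (climb_pos R j).le)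
  · refine le_trans ?_ (hR.prod_climb_ge (show k ≤ k + i by omega))
    refine mul_le_mul_of_nonneg_left ?_ (exp_pos _).le
    have h1 : (κ : ℝ)⁻¹ ≤ (k + 1 : ℝ) / (((k + i : ℕ) : ℝ) + 1) := by
      rw [inv_eq_one_div, div_le_div_iff₀ hκ0 (by positivity)]
      have : (((k + i) + 1 : ℕ) : ℝ) ≤ ((κ * (k + 1) : ℕ) : ℝ) := by exact_mod_cast hk'
      push_cast at this ⊢
      linarith
    have h2 : (k + 1 : ℝ) / (((k + i : ℕ) : ℝ) + 1) ≤ 1 := by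
      rw [div_le_one (by positivity)]
      push_cast
      linarith [i.cast_nonneg (α := ℝ)]
    calc _ ≤ _ := h1
      _ = ((k + 1 : ℝ) / (((k + i : ℕ) : ℝ) + 1)) ^ (1 : ℝ) := (rpow_one _).symm
      _ ≤ _ := rpow_le_rpow_of_exponent_ge (by positivity) h2 (by linarith [hR.lt])
  · rw [div_le_div_iff₀ (by positivity) hκ0]
    have h1 : k * κ ≤ 2 * (n + 1) := by rw [mul_comm k]; omega
    exact_mod_cast h1

lemma Decay.sum_overlap_le : ∃ C : ℝ, ∀ lam : ℝ, 0 < lam → ∀ k m N : ℕ,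
    (k + m + 1 : ℝ) ≤ lam * (k + 1) →
    ∑ l ∈ Finset.range N, R (k + l) * (1 - hcTail (climb R) l m) ≤ β * log lam + C := by
  obtain ⟨C, hC1, hC⟩ := hR.one_sub_hcTail_le
  set α := 1 - 2 * β with hα
  have hα0 : 0 < α := by linarith [hR.lt]
  have hα1 : α < 1 := by linarith [hR.pos]
  refine ⟨C / α + ∑' j, b j, fun lam hlam k m N hlk => ?_⟩
  set g : ℕ → ℝ := fun l => 1 - hcTail (climb R) l m with hg
  have hg0 : ∀ l, 0 ≤ g l := fun l => sub_nonneg.2 (hR.hcTail_le_one l m)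
  have hg1 : ∀ l, g l ≤ 1 := fun l => sub_le_self _ (hR.hcTail_nonneg l m)
  let d : ℕ → ℝ := fun l => log ((k : ℝ) + l + 2) - log ((k : ℝ) + l + 1)
  have hd0 : ∀ l, 0 ≤ d l := fun l => sub_nonneg.2 (log_le_log (by positivity) (by linarith))
  have hd1 : ∀ l : ℕ, d l ≤ (l + 1 : ℝ)⁻¹ := by
    intro l
    have h1 := log_le_sub_one_of_pos (show (0 : ℝ) < (k + l + 2) / (k + l + 1) by positivity)
    rw [log_div (by positivity) (by positivity)] at h1
    refine h1.trans ?_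
    rw [show ((k : ℝ) + l + 2) / (k + l + 1) - 1 = (k + l + 1 : ℝ)⁻¹ by field_simp; ring]
    gcongr
    linarith [k.cast_nonneg (α := ℝ)]
  have h1 : ∀ l, R (k + l) * g l ≤ β * (d l * g l) + b (k + l) := by
    intro l
    have := mul_le_mul_of_nonneg_right (hR.le (k + l)) (hg0 l)
    have h2 := mul_le_of_le_one_right (hR.b_nonneg (k + l)) (hg1 l)
    push_cast at this
    simp only [d]
    nlinarith
  have hb : ∑ l ∈ Finset.range N, b (k + l) ≤ ∑' j, b j := by
    rw [← Finset.sum_image (g := fun l => k + l) (f := b) (by intro i _ j _ h; simpa using h)]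
    exact hR.sum_b_le _
  have hlow : ∀ n, ∑ l ∈ Finset.range n, d l = log ((k : ℝ) + n + 1) - log (k + 1) := by
    intro n
    have := Finset.sum_range_sub (fun l : ℕ => log ((k : ℝ) + l + 1)) n
    simp only [d]
    push_cast at this
    rw [add_zero] at this
    rw [← this]
    refine Finset.sum_congr rfl fun l _ => ?_
    rw [show (k : ℝ) + l + 2 = k + (l + 1) + 1 by ring]
  have hmain : ∑ l ∈ Finset.range N, d l * g l ≤ log lam + C / α := by
    have hle : ∑ l ∈ Finset.range N, d l * g l ≤
        ∑ l ∈ Finset.range m, d l * g l + ∑ l ∈ Finset.Ico m N, d l * g l := by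
      rcases le_total m N with h | h
      · rw [Finset.sum_range_add_sum_Ico _ h]
      · rw [Finset.Ico_eq_empty_of_le h, Finset.sum_empty, add_zero]
        exact Finset.sum_le_sum_of_subset_of_nonneg (Finset.range_mono h) fun l _ _ =>
          mul_nonneg (hd0 l) (hg0 l)
    refine hle.trans (add_le_add ?_ ?_)
    · calc _ ≤ ∑ l ∈ Finset.range m, d l := Finset.sum_le_sum fun l _ =>
            mul_le_of_le_one_right (hd0 l) (hg1 l)
        _ ≤ _ := by
            rw [hlow, ← log_div (by positivity) (by positivity)]
            refine log_le_log (by positivity) ?_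
            rwa [div_le_iff₀ (by positivity)]
    · rcases Nat.eq_zero_or_pos m with rfl | hm
      · refine (Finset.sum_nonpos fun l _ => ?_).trans (by positivity)
        simp [hg]
      · have hm' : (0 : ℝ) < m := by exact_mod_cast hm
        calc _ ≤ ∑ l ∈ Finset.Ico m N, C * (m : ℝ) ^ α * (l + 1 : ℝ) ^ (-1 - α) := by
              refine Finset.sum_le_sum fun l _ => ?_
              calc _ ≤ (l + 1 : ℝ)⁻¹ * (C * ((m : ℝ) / (l + 1)) ^ α) :=
                    mul_le_mul (hd1 l) (hC l m) (hg0 l) (by positivity)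
                _ = _ := by
                    rw [div_rpow (by positivity) (by positivity), show -1 - α = -α - 1 by ring,
                      rpow_sub_one (by positivity), rpow_neg (by positivity)]
                    field_simp
          _ ≤ C * (m : ℝ) ^ α * ((m : ℝ) ^ (-α) / α) := by
              rw [← Finset.mul_sum]
              exact mul_le_mul_of_nonneg_left (sum_rpow_tail_le hα0 hα1.le hm N) (by positivity)
          _ = _ := by
              rw [rpow_neg hm'.le]
              field_simp
  calc _ ≤ ∑ l ∈ Finset.range N, (β * (d l * g l) + b (k + l)) :=
        Finset.sum_le_sum fun l _ => h1 l
    _ = β * ∑ l ∈ Finset.range N, d l * g l + ∑ l ∈ Finset.range N, b (k + l) := by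
        rw [Finset.sum_add_distrib, Finset.mul_sum]
    _ ≤ β * (log lam + C / α) + ∑' j, b j :=
        add_le_add (mul_le_mul_of_nonneg_left hmain hR.pos.le) hb
    _ ≤ _ := by
        have : β * (C / α) ≤ C / α := mul_le_of_le_one_left (by positivity) (by linarith [hR.lt])
        linarith

lemma Decay.sum_overlap_small (m : ℕ) {ε : ℝ} (hε : 0 < ε) : ∃ K : ℕ, ∀ k ≥ K, ∀ N : ℕ,
    ∑ l ∈ Finset.range N, R (k + l) * (1 - hcTail (climb R) l m) ≤ ε := by
  obtain ⟨C, hC1, hC⟩ := hR.one_sub_hcTail_le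
  set α := 1 - 2 * β with hα
  have hα0 : 0 < α := by linarith [hR.lt]
  have hα1 : α < 1 := by linarith [hR.pos]
  set Z := C * (m : ℝ) ^ α * ∑' l : ℕ, (l + 1 : ℝ) ^ (-(1 + α / 2)) with hZ
  have hsum : Summable fun l : ℕ => (l + 1 : ℝ) ^ (-(1 + α / 2)) := by
    have := (Real.summable_nat_rpow (p := -(1 + α / 2))).2 (by linarith)
    exact_mod_cast (summable_nat_add_iff 1).2 this
  have hbt : Tendsto (fun k => ∑' l, b (l + k)) atTop (nhds 0) := tendsto_sum_nat_add b
  have hpt : Tendsto (fun k : ℕ => Z * (k + 1 : ℝ) ^ (-(α / 2))) atTop (nhds (Z * 0)) := by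
    refine Tendsto.const_mul Z ?_
    exact (tendsto_rpow_neg_atTop (half_pos hα0)).comp
      (tendsto_natCast_atTop_atTop.atTop_add tendsto_const_nhds)
  have ht := hbt.add hpt
  rw [mul_zero, add_zero] at ht
  obtain ⟨K, hK⟩ := eventually_atTop.1 (ht.eventually (gt_mem_nhds hε))
  refine ⟨K, fun k hk N => le_trans ?_ (hK k hk).le⟩
  have hg0 : ∀ l, 0 ≤ 1 - hcTail (climb R) l m := fun l => sub_nonneg.2 (hR.hcTail_le_one l m)
  have hg1 : ∀ l, 1 - hcTail (climb R) l m ≤ 1 := fun l => sub_le_self _ (hR.hcTail_nonneg l m)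
  have hterm : ∀ l : ℕ, R (k + l) * (1 - hcTail (climb R) l m) ≤ b (l + k) +
      C * (m : ℝ) ^ α * (l + 1 : ℝ) ^ (-(1 + α / 2)) * (k + 1 : ℝ) ^ (-(α / 2)) := by
    intro l
    have hd : log (((k + l : ℕ) : ℝ) + 2) - log (((k + l : ℕ) : ℝ) + 1) ≤
        (l + 1 : ℝ) ^ (-(1 - α / 2)) * (k + 1 : ℝ) ^ (-(α / 2)) := by
      push_cast
      have h1 := log_le_sub_one_of_pos (show (0 : ℝ) < (k + l + 2) / (k + l + 1) by positivity)
      rw [log_div (by positivity) (by positivity)] at h1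
      refine h1.trans ?_
      rw [show ((k : ℝ) + l + 2) / (k + l + 1) - 1 = (k + l + 1 : ℝ)⁻¹ by field_simp; ring]
      rw [rpow_neg (by positivity), rpow_neg (by positivity), ← mul_inv]
      refine inv_anti₀ (by positivity) ?_
      calc _ ≤ (k + l + 1 : ℝ) ^ (1 - α / 2) * (k + l + 1 : ℝ) ^ (α / 2) := by
            refine mul_le_mul (rpow_le_rpow (by positivity) ?_ (by linarith))
              (rpow_le_rpow (by positivity) ?_ (by linarith)) (by positivity) (by positivity)
            · linarith [k.cast_nonneg (α := ℝ)]
            · linarith [l.cast_nonneg (α := ℝ)]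
        _ = _ := by rw [← rpow_add (by positivity), sub_add_cancel, rpow_one]
    have h2 : (log (((k + l : ℕ) : ℝ) + 2) - log (((k + l : ℕ) : ℝ) + 1)) *
        (1 - hcTail (climb R) l m) ≤
        C * (m : ℝ) ^ α * (l + 1 : ℝ) ^ (-(1 + α / 2)) * (k + 1 : ℝ) ^ (-(α / 2)) := by
      calc _ ≤ ((l + 1 : ℝ) ^ (-(1 - α / 2)) * (k + 1 : ℝ) ^ (-(α / 2))) *
            (C * ((m : ℝ) / (l + 1)) ^ α) := mul_le_mul hd (hC l m) (hg0 l) (by positivity)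
        _ = _ := by
            rw [div_rpow (by positivity) (by positivity),
              show -(1 + α / 2) = -(1 - α / 2) - α by ring,
              rpow_sub (show (0 : ℝ) < (l : ℝ) + 1 by positivity) (-(1 - α / 2)) α]
            ring
    have h3 : 0 ≤ (log (((k + l : ℕ) : ℝ) + 2) - log (((k + l : ℕ) : ℝ) + 1)) :=
      sub_nonneg.2 (log_le_log (by positivity) (by linarith))
    have h4 := mul_le_mul_of_nonneg_right (hR.le (k + l)) (hg0 l)
    have h5 := mul_le_of_le_one_right (hR.b_nonneg (k + l)) (hg1 l)
    have h6 := mul_nonneg h3 (hg0 l)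
    rw [add_comm l k]
    nlinarith [hR.lt, hR.pos]
  refine (Finset.sum_le_sum fun l _ => hterm l).trans ?_
  rw [Finset.sum_add_distrib]
  refine add_le_add ?_ ?_
  · exact ((summable_nat_add_iff k).2 hR.summable).sum_le_tsum _ fun l _ => hR.b_nonneg _
  · rw [← Finset.sum_mul, ← Finset.mul_sum, hZ]
    gcongr
    exact hsum.sum_le_tsum _ fun l _ => by positivity

end Decay

section Tails

variable {S : Type} [Fintype S]

/-- The sequence with first term `a` followed by `c`. -/
def tcons (a : S) (c : ℕ → S) : ℕ → S := fun n => Nat.casesOn n a c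

@[simp] lemma tcons_zero (a : S) (c : ℕ → S) : tcons a c 0 = a := rfl
@[simp] lemma tcons_succ (a : S) (c : ℕ → S) (n : ℕ) : tcons a c (n + 1) = c n := rfl

/-- The sequence which follows `y` before time `j` and `t` from then on. -/
def splice (j : ℕ) (y t : ℕ → S) : ℕ → S := fun n => if n < j then y n else t n

lemma splice_of_lt {j n : ℕ} (h : n < j) (y t : ℕ → S) : splice j y t n = y n := if_pos h

lemma splice_zero (y t : ℕ → S) : splice 0 y t = t := funext fun n => by simp [splice]

lemma splice_splice (j : ℕ) {i : ℕ} (h : j ≤ i) (y y' t : ℕ → S) :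
    splice j (splice i y y') t = splice j y t := by
  funext n
  unfold splice
  split_ifs <;> first | rfl | omega

lemma tcons_splice (a b : S) (c d : ℕ → S) (j : ℕ) :
    tcons a (splice j c d) = splice (j + 1) (tcons a c) (tcons b d) := by
  funext n
  cases n with
  | zero => simp [splice]
  | succ n => simp [splice]

/-- One step of the weighted transfer operator on functions of the future. -/
def tstep (g h : (ℕ → S) → ℝ) : (ℕ → S) → ℝ := fun c => ∑ a, g (tcons a c) * h (tcons a c)

/-- The iterated transfer operator with weights `f 0, …, f (n - 1)`. -/
def titer (f : ℕ → (ℕ → S) → ℝ) : ℕ → ((ℕ → S) → ℝ) → (ℕ → S) → ℝ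
  | 0, h => h
  | n + 1, h => tstep (f n) (titer f n h)

/-- Summation over the first symbols of a pair of sequences. -/
def dsum (W : (ℕ → S) → (ℕ → S) → ℝ) : (ℕ → S) → (ℕ → S) → ℝ :=
  fun c d => ∑ a, ∑ b, W (tcons a c) (tcons b d)

/-- One step of the transfer operator on functions of pairs. -/
def dstep (g : (ℕ → S) → ℝ) (H : (ℕ → S) → (ℕ → S) → ℝ) : (ℕ → S) → (ℕ → S) → ℝ :=
  dsum fun y y' => g y * g y' * H y y'

/-- The iterated transfer operator on functions of pairs. -/
def diter (f : ℕ → (ℕ → S) → ℝ) : ℕ → ((ℕ → S) → (ℕ → S) → ℝ) → (ℕ → S) → (ℕ → S) → ℝ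
  | 0, H => H
  | n + 1, H => dstep (f n) (diter f n H)

variable {f : ℕ → (ℕ → S) → ℝ}

lemma titer_add (f : ℕ → (ℕ → S) → ℝ) (l j : ℕ) (h : (ℕ → S) → ℝ) :
    titer f (l + j) h = titer (fun i => f (l + i)) j (titer f l h) := by
  induction j with
  | zero => rfl
  | succ j ih => rw [← add_assoc, titer, ih]; rfl

lemma titer_congr {f g : ℕ → (ℕ → S) → ℝ} {n : ℕ} (h : ∀ i < n, f i = g i) (k : (ℕ → S) → ℝ) :
    titer f n k = titer g n k := by
  induction n with
  | zero => rfl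
  | succ n ih => rw [titer, titer, ih fun i hi => h i (by omega), h n (by omega)]

lemma diter_succ' (f : ℕ → (ℕ → S) → ℝ) (n : ℕ) (H : (ℕ → S) → (ℕ → S) → ℝ) :
    diter f (n + 1) H = diter (fun i => f (i + 1)) n (dstep (f 0) H) := by
  induction n with
  | zero => rfl
  | succ n ih => rw [diter, ih]; rfl

lemma diter_mul (f : ℕ → (ℕ → S) → ℝ) (n : ℕ) (h k : (ℕ → S) → ℝ) (c d : ℕ → S) :
    diter f n (fun y y' => h y * k y') c d = titer f n h c * titer f n k d := by
  induction n generalizing c d with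
  | zero => rfl
  | succ n ih =>
    simp only [diter, titer, dstep, dsum, tstep, ih, Finset.sum_mul_sum]
    exact Finset.sum_congr rfl fun a _ => Finset.sum_congr rfl fun b _ => by ring

lemma diter_flip (f : ℕ → (ℕ → S) → ℝ) (n : ℕ) (H : (ℕ → S) → (ℕ → S) → ℝ) (c d : ℕ → S) :
    diter f n (fun y y' => H y' y) c d = diter f n H d c := by
  induction n generalizing c d with
  | zero => rfl
  | succ n ih =>
    simp only [diter, dstep, dsum, ih]
    rw [Finset.sum_comm]
    exact Finset.sum_congr rfl fun a _ => Finset.sum_congr rfl fun b _ => by ring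

lemma diter_sub (f : ℕ → (ℕ → S) → ℝ) (n : ℕ) (H K : (ℕ → S) → (ℕ → S) → ℝ) (c d : ℕ → S) :
    diter f n (fun y y' => H y y' - K y y') c d = diter f n H c d - diter f n K c d := by
  induction n generalizing c d with
  | zero => rfl
  | succ n ih =>
    simp only [diter, dstep, dsum, ih, mul_sub, Finset.sum_sub_distrib]

lemma diter_const_mul (f : ℕ → (ℕ → S) → ℝ) (n : ℕ) (r : ℝ) (H : (ℕ → S) → (ℕ → S) → ℝ)
    (c d : ℕ → S) : diter f n (fun y y' => r * H y y') c d = r * diter f n H c d := by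
  induction n generalizing c d with
  | zero => rfl
  | succ n ih =>
    simp only [diter, dstep, dsum, ih, Finset.mul_sum]
    exact Finset.sum_congr rfl fun a _ => Finset.sum_congr rfl fun b _ => by ring

lemma diter_mono (hf : ∀ i y, 0 ≤ f i y) (n : ℕ) {H K : (ℕ → S) → (ℕ → S) → ℝ}
    (h : ∀ y y', H y y' ≤ K y y') (c d : ℕ → S) : diter f n H c d ≤ diter f n K c d := by
  induction n generalizing c d with
  | zero => exact h c d
  | succ n ih =>
    exact Finset.sum_le_sum fun a _ => Finset.sum_le_sum fun b _ =>
      mul_le_mul_of_nonneg_left (ih _ _) (mul_nonneg (hf _ _) (hf _ _))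

/-- Exchanging the tails of the two arguments from any time `j ≥ k` on does not change `H`. -/
def SwapInv (k : ℕ) (H : (ℕ → S) → (ℕ → S) → ℝ) : Prop :=
  ∀ j ≥ k, ∀ y y', H (splice j y y') (splice j y' y) = H y y'

lemma SwapInv.mono {k l : ℕ} {H : (ℕ → S) → (ℕ → S) → ℝ} (h : SwapInv k H) (hkl : k ≤ l) :
    SwapInv l H := fun j hj => h j (hkl.trans hj)

lemma SwapInv.mul {k : ℕ} {H K : (ℕ → S) → (ℕ → S) → ℝ} (h : SwapInv k H) (h' : SwapInv k K) :
    SwapInv k fun y y' => H y y' * K y y' := fun j hj y y' => by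
  beta_reduce; rw [h j hj, h' j hj]

lemma SwapInv.sub {k : ℕ} {H K : (ℕ → S) → (ℕ → S) → ℝ} (h : SwapInv k H) (h' : SwapInv k K) :
    SwapInv k fun y y' => H y y' - K y y' := fun j hj y y' => by
  beta_reduce; rw [h j hj, h' j hj]

lemma SwapInv.dsum {k : ℕ} {H : (ℕ → S) → (ℕ → S) → ℝ} (h : SwapInv (k + 1) H) :
    SwapInv k (dsum H) := fun j hj c d => by
  refine Finset.sum_congr rfl fun a _ => Finset.sum_congr rfl fun b _ => ?_
  rw [tcons_splice a b, tcons_splice b a, h (j + 1) (by omega)]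

/-- The infimum of `g` over the sequences which agree with `y` before time `j`. -/
def lowf (g : (ℕ → S) → ℝ) (j : ℕ) (y : ℕ → S) : ℝ := ⨅ t, g (splice j y t)

section Lowf

variable {g : (ℕ → S) → ℝ} (hg : ∀ y, 0 ≤ g y)

lemma lowf_splice (j : ℕ) {i : ℕ} (h : j ≤ i) (y y' : ℕ → S) :
    lowf g j (splice i y y') = lowf g j y := by
  simp only [lowf, splice_splice j h]

lemma swapInv_lowf (j : ℕ) : SwapInv j fun y y' => lowf g j y * lowf g j y' :=
  fun i hi y y' => by beta_reduce; rw [lowf_splice j hi, lowf_splice j hi]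

include hg

lemma lowf_nonneg (j : ℕ) (y : ℕ → S) : 0 ≤ lowf g j y := Real.iInf_nonneg fun _ => hg _

lemma lowf_bdd (j : ℕ) (y : ℕ → S) : BddBelow (range fun t => g (splice j y t)) :=
  ⟨0, by rintro _ ⟨t, rfl⟩; exact hg _⟩

lemma lowf_le (j : ℕ) (y : ℕ → S) : lowf g j y ≤ g y := by
  have h := ciInf_le (lowf_bdd hg j y) y
  rwa [show splice j y y = y from funext fun n => by simp [splice]] at h

lemma lowf_le_succ (j : ℕ) (y : ℕ → S) : lowf g j y ≤ lowf g (j + 1) y := by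
  have : Nonempty (ℕ → S) := ⟨y⟩
  refine le_ciInf fun t => ?_
  have h := lowf_le hg j (splice (j + 1) y t)
  rwa [lowf_splice j (Nat.le_succ j)] at h

omit hg in
lemma le_lowf {r : ℝ} {j : ℕ} (h : ∀ y y', (∀ n < j, y n = y' n) → r * g y ≤ g y') (y : ℕ → S) :
    r * g y ≤ lowf g j y := by
  have : Nonempty (ℕ → S) := ⟨y⟩
  exact le_ciInf fun t => h _ _ fun n hn => (splice_of_lt hn y t).symm

end Lowf

/-- Weights vary by a factor at most `exp (R j)` among the sequences sharing `j + 1` symbols. -/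
def TailReg (f : ℕ → (ℕ → S) → ℝ) (R : ℕ → ℝ) : Prop :=
  ∀ i j y y', (∀ n < j + 1, y n = y' n) → Real.exp (-R j) * f i y ≤ f i y'

theorem diter_swap_ge {R b : ℕ → ℝ} {β : ℝ} (hR : Decay R β b) (hf0 : ∀ i y, 0 ≤ f i y)
    (hf : TailReg f R) (n k : ℕ) {H : (ℕ → S) → (ℕ → S) → ℝ} (hH0 : ∀ y y', 0 ≤ H y y')
    (hH : SwapInv k H) (c d : ℕ → S) :
    hcTail (climb R) n k * diter f n H d c ≤ diter f n H c d := by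
  have hsymm : ∀ (f : ℕ → (ℕ → S) → ℝ) (n : ℕ) (H : (ℕ → S) → (ℕ → S) → ℝ), SwapInv 0 H →
      diter f n H d c = diter f n H c d := fun f n H hH => by
    rw [← diter_flip f n H c d]
    congr 1
    funext y y'
    have := hH 0 le_rfl y y'
    rwa [splice_zero, splice_zero] at this
  induction n generalizing f k H with
  | zero =>
    rcases Nat.eq_zero_or_pos k with rfl | hk
    · rw [hcTail_zero_right, one_mul, hsymm f 0 H hH]
    · rw [hcTail_eq_zero hk, zero_mul]
      exact hH0 c d
  | succ n ih =>
    have hdn : ∀ {f : ℕ → (ℕ → S) → ℝ}, (∀ i y, 0 ≤ f i y) → ∀ n {H : (ℕ → S) → (ℕ → S) → ℝ},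
        (∀ y y', 0 ≤ H y y') → ∀ c d, 0 ≤ diter f n H c d := fun hf n H hH c d => by
      have := diter_mono hf n hH c d
      have e := diter_const_mul (S := S) (f := ‹_›) n 0 (fun _ _ => 0) c d
      simp only [zero_mul] at e
      rwa [e] at this
    rcases Nat.eq_zero_or_pos k with rfl | hk
    · rw [hcTail_zero_right, one_mul, hsymm f _ H hH]
    obtain ⟨k, rfl⟩ : ∃ j, k = j + 1 := ⟨k - 1, by omega⟩
    rcases lt_or_ge n k with hnk | hnk
    · rw [hcTail_eq_zero (by omega), zero_mul]
      exact hdn hf0 _ hH0 c d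
    set f' : ℕ → (ℕ → S) → ℝ := fun i => f (i + 1) with hf'
    have hf0' : ∀ i y, 0 ≤ f' i y := fun i y => hf0 _ _
    have hfr' : TailReg f' R := fun i => hf (i + 1)
    have ih' := fun k (H : (ℕ → S) → (ℕ → S) → ℝ) (hH0 : ∀ y y', 0 ≤ H y y')
      (hH : SwapInv k H) => ih hf0' hfr' k hH0 hH
    set g := f 0
    have hg : ∀ y, 0 ≤ g y := hf0 0
    let F : ℕ → (ℕ → S) → (ℕ → S) → ℝ := fun j y y' => lowf g j y * lowf g j y'
    let D : ℕ → (ℕ → S) → (ℕ → S) → ℝ := fun j => dsum fun y y' => F (j + 1) y y' * H y y'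
    have hF0 : ∀ j y y', 0 ≤ F j y y' := fun j y y' =>
      mul_nonneg (lowf_nonneg hg j y) (lowf_nonneg hg j y')
    have hFs : ∀ j y y', F j y y' ≤ F (j + 1) y y' := fun j y y' =>
      mul_le_mul (lowf_le_succ hg j y) (lowf_le_succ hg j y') (lowf_nonneg hg _ _)
        (lowf_nonneg hg _ _)
    have hstart : hcTail (climb R) n k * diter f' n (D k) d c ≤ diter f' n (D k) c d :=
      ih' k _ (fun y y' => Finset.sum_nonneg fun a _ => Finset.sum_nonneg fun b _ =>
        mul_nonneg (hF0 _ _ _) (hH0 _ _)) ((swapInv_lowf (k + 1)).mul hH).dsum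
    have hincr : ∀ j, k ≤ j → hcTail (climb R) n (j + 1) *
        (diter f' n (D (j + 1)) d c - diter f' n (D j) d c) ≤
        diter f' n (D (j + 1)) c d - diter f' n (D j) c d := by
      intro j hj
      have e : (fun y y' => D (j + 1) y y' - D j y y') =
          dsum fun y y' => (F (j + 2) y y' - F (j + 1) y y') * H y y' := by
        funext y y'
        simp only [D, dsum, sub_mul, Finset.sum_sub_distrib]
      rw [← diter_sub, ← diter_sub, e]
      refine ih' (j + 1) _ (fun y y' => Finset.sum_nonneg fun a _ => Finset.sum_nonneg fun b _ =>
        mul_nonneg (sub_nonneg.2 (hFs _ _ _)) (hH0 _ _)) (SwapInv.dsum ?_)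
      exact ((swapInv_lowf (j + 2)).sub ((swapInv_lowf (j + 1)).mono (by omega))).mul
        (hH.mono (by omega))
    rw [diter_succ']
    set Z := diter f' n (dstep g H) d c
    have hlow : ∀ j, climb R j * Z ≤ diter f' n (D j) d c := by
      intro j
      rw [← diter_const_mul]
      refine diter_mono hf0' n (fun y y' => ?_) d c
      simp only [D, dstep, dsum, Finset.mul_sum]
      refine Finset.sum_le_sum fun a _ => Finset.sum_le_sum fun b _ => ?_
      rw [← mul_assoc]
      refine mul_le_mul_of_nonneg_right ?_ (hH0 _ _)
      have e : climb R j = Real.exp (-R j) * Real.exp (-R j) := by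
        rw [climb, ← Real.exp_add]; ring_nf
      rw [e, mul_mul_mul_comm]
      exact mul_le_mul (le_lowf (hf 0 j) _) (le_lowf (hf 0 j) _)
        (mul_nonneg (Real.exp_pos _).le (hg _)) (lowf_nonneg hg _ _)
    have hup : diter f' n (D n) c d ≤ diter f' n (dstep g H) c d := by
      refine diter_mono hf0' n (fun y y' => ?_) c d
      refine Finset.sum_le_sum fun a _ => Finset.sum_le_sum fun b _ => ?_
      exact mul_le_mul_of_nonneg_right (mul_le_mul (lowf_le hg _ _) (lowf_le hg _ _)
        (lowf_nonneg hg _ _) (hg _)) (hH0 _ _)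
    have key : ∀ J, k ≤ J → hcTail (climb R) n J * (diter f' n (D J) d c - climb R J * Z) ≤
        diter f' n (D J) c d - (climb R k * hcTail (climb R) n k + ∑ j ∈ Finset.Ico k J,
          (climb R (j + 1) - climb R j) * hcTail (climb R) n (j + 1)) * Z := by
      intro J hJ
      induction J, hJ using Nat.le_induction with
      | base => simp; nlinarith
      | succ J hJ ihJ =>
        rw [Finset.sum_Ico_succ_top hJ]
        have h1 := hincr J hJ
        have h2 := mul_le_mul_of_nonneg_right
          (hcTail_anti (climb_pos R) hR.climb_le_one hR.climb_mono n J) (sub_nonneg.2 (hlow J))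
        nlinarith
    have h1 := key n hnk
    have h2 := mul_nonneg (hR.hcTail_nonneg n n) (sub_nonneg.2 (hlow n))
    rw [hcTail_succ]
    linarith

/-- Replacing the distant future changes the relative weight of an event depending on the first
`m` symbols only by a factor controlled by the house-of-cards chain. -/
theorem titer_cross_ge {R b : ℕ → ℝ} {β : ℝ} (hR : Decay R β b) (hf0 : ∀ i y, 0 ≤ f i y)
    (hf : TailReg f R) (n m : ℕ) {h : (ℕ → S) → ℝ} (h0 : ∀ y, 0 ≤ h y)
    (hm : ∀ y y', (∀ i < m, y i = y' i) → h y = h y') (c d : ℕ → S) :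
    hcTail (climb R) n m * (titer f n h d * titer f n (fun _ => 1) c) ≤
      titer f n h c * titer f n (fun _ => 1) d := by
  have := diter_swap_ge hR hf0 hf n m (H := fun y _ => h y * 1) (fun y y' => by simp [h0 y])
    (fun j hj y y' => by
      beta_reduce; rw [hm _ y fun i hi => splice_of_lt (by omega) _ _]) c d
  rwa [diter_mul f n h (fun _ => 1), diter_mul f n h (fun _ => 1)] at this

lemma titer_pos (hf : ∀ i y, 0 < f i y) [Nonempty S] (n : ℕ) {h : (ℕ → S) → ℝ}
    (h0 : ∀ y, 0 < h y) (c : ℕ → S) : 0 < titer f n h c := by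
  induction n generalizing c with
  | zero => exact h0 c
  | succ n ih =>
    exact Finset.sum_pos (fun a _ => mul_pos (hf _ _) (ih _)) Finset.univ_nonempty

lemma titer_nonneg (hf : ∀ i y, 0 ≤ f i y) (n : ℕ) {h : (ℕ → S) → ℝ}
    (h0 : ∀ y, 0 ≤ h y) (c : ℕ → S) : 0 ≤ titer f n h c := by
  induction n generalizing c with
  | zero => exact h0 c
  | succ n ih => exact Finset.sum_nonneg fun a _ => mul_nonneg (hf _ _) (ih _)

lemma exists_titer_eq_sum (hf : ∀ i y, 0 ≤ f i y) (n : ℕ) (c : ℕ → S) :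
    ∃ (ι : Type) (_ : Fintype ι) (W : ι → ℝ) (y : ι → ℕ → S), (∀ i, 0 ≤ W i) ∧
      ∀ g, titer f n g c = ∑ i, W i * g (y i) := by
  induction n generalizing c with
  | zero => exact ⟨Unit, inferInstance, fun _ => 1, fun _ => c, fun _ => zero_le_one,
      fun g => by simp [titer]⟩
  | succ n ih =>
    choose ι hι W y hW h using fun a : S => ih (tcons a c)
    refine ⟨Σ a, ι a, inferInstance, fun p => f n (tcons p.1 c) * W p.1 p.2, fun p => y p.1 p.2,
      fun p => mul_nonneg (hf _ _) (hW _ _), fun g => ?_⟩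
    rw [titer, tstep, Fintype.sum_sigma]
    refine Finset.sum_congr rfl fun a _ => ?_
    rw [h, Finset.mul_sum]
    exact Finset.sum_congr rfl fun i _ => by ring

end Tails

section Tilt

lemma cross_weight_le {p q a b G ε : ℝ} (hp : 0 ≤ p) (hq : 0 ≤ q) (ha : 0 ≤ a) (hb : 0 ≤ b)
    (hG0 : 0 ≤ G) (hG1 : G ≤ 1) (hε0 : 0 ≤ ε) (hε1 : ε ≤ 1) (hab : G * b ≤ a) (hba : G * a ≤ b)
    (hpq : ε * p ≤ q) (hqp : ε * q ≤ p) :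
    (G + (1 - G) * ε) * (q * a + p * b) ≤ p * a + q * b := by
  have hκ0 : 0 ≤ G + (1 - G) * ε := by nlinarith
  have hκ1 : G + (1 - G) * ε ≤ 1 := by nlinarith
  have key : ∀ p q a b : ℝ, 0 ≤ q → 0 ≤ a → 0 ≤ b → G * a ≤ b → ε * q ≤ p → b ≤ a →
      (G + (1 - G) * ε) * (q * a + p * b) ≤ p * a + q * b := by
    intro p q a b hq ha hb hba hqp hle
    set κ := G + (1 - G) * ε with hκ
    have h1 : 0 ≤ (p - ε * q) * (a - κ * b) :=
      mul_nonneg (by linarith) (by nlinarith)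
    have h2 : 0 ≤ q * ((b - G * a) * (1 - κ * ε) + a * (G * ε * (1 - κ))) := by
      refine mul_nonneg hq (add_nonneg (mul_nonneg (by linarith) ?_) (mul_nonneg ha ?_))
      · nlinarith [mul_le_one₀ hκ1 hε0 hε1]
      · exact mul_nonneg (mul_nonneg hG0 hε0) (by linarith)
    have e : p * a + q * b - κ * (q * a + p * b) = (p - ε * q) * (a - κ * b) +
        q * ((b - G * a) * (1 - κ * ε) + a * (G * ε * (1 - κ))) := by
      have : a * (G * ε * (1 - κ)) = a * (ε + G - κ * (1 + ε * G)) := by rw [hκ]; ring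
      rw [this]; ring
    linarith
  rcases le_total b a with h | h
  · exact key p q a b hq ha hb hba hqp h
  · have := key q p b a hp hb ha hab hpq h
    linarith

lemma exp_neg_mul_le (r : ℝ) {G : ℝ} (hG0 : 0 ≤ G) (hG1 : G ≤ 1) :
    Real.exp (-2 * (r * (1 - G))) ≤ G + (1 - G) * Real.exp (-2 * r) := by
  have := convexOn_exp.2 (mem_univ 0) (mem_univ (-2 * r)) hG0 (sub_nonneg.2 hG1) (by ring)
  simp only [smul_eq_mul, mul_zero, zero_add, Real.exp_zero, mul_one] at this
  rwa [show -2 * (r * (1 - G)) = (1 - G) * (-2 * r) by ring]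

lemma sum_cross_ge {ι : Type} [Fintype ι] {W f f' A B : ι → ℝ} {r G : ℝ} (hW : ∀ i, 0 ≤ W i)
    (hf : ∀ i, 0 ≤ f i) (hf' : ∀ i, 0 ≤ f' i) (hA : ∀ i, 0 ≤ A i) (hB : ∀ i, 0 ≤ B i)
    (h1 : ∀ i, Real.exp (-r) * f i ≤ f' i) (h2 : ∀ i, Real.exp (-r) * f' i ≤ f i) (hr : 0 ≤ r)
    (hG0 : 0 ≤ G) (hG1 : G ≤ 1) (hAB : ∀ i j, G * (A j * B i) ≤ A i * B j) :
    Real.exp (-2 * (r * (1 - G))) * ((∑ i, W i * (f' i * A i)) * ∑ i, W i * (f i * B i)) ≤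
      (∑ i, W i * (f i * A i)) * ∑ i, W i * (f' i * B i) := by
  have hsymm : ∀ u v : ι → ℝ, 2 * ((∑ i, u i) * ∑ i, v i) =
      ∑ i, ∑ j, (u i * v j + u j * v i) := by
    intro u v
    simp only [Finset.sum_add_distrib]
    rw [Finset.sum_comm (f := fun i j => u j * v i), ← Finset.sum_mul_sum]
    ring
  have hle : Real.exp (-2 * (r * (1 - G))) *
      (2 * ((∑ i, W i * (f' i * A i)) * ∑ i, W i * (f i * B i))) ≤
      2 * ((∑ i, W i * (f i * A i)) * ∑ i, W i * (f' i * B i)) := by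
    rw [hsymm, hsymm, Finset.mul_sum]
    refine Finset.sum_le_sum fun i _ => ?_
    rw [Finset.mul_sum]
    refine Finset.sum_le_sum fun j _ => ?_
    have hε : Real.exp (-2 * r) = Real.exp (-r) * Real.exp (-r) := by
      rw [← Real.exp_add]; ring_nf
    have hcmp : ∀ i j, Real.exp (-2 * r) * (f i * f' j) ≤ f j * f' i := by
      intro i j
      rw [hε, mul_mul_mul_comm, mul_comm (f j)]
      exact mul_le_mul (h1 i) (h2 j) (mul_nonneg (Real.exp_pos _).le (hf' j)) (hf' i)
    have := cross_weight_le (p := f i * f' j) (q := f j * f' i) (a := A i * B j) (b := A j * B i)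
      (ε := Real.exp (-2 * r)) (mul_nonneg (hf _) (hf' _)) (mul_nonneg (hf _) (hf' _))
      (mul_nonneg (hA _) (hB _)) (mul_nonneg (hA _) (hB _)) hG0 hG1 (Real.exp_pos _).le
      (Real.exp_le_one_iff.2 (by linarith)) (hAB i j) (hAB j i) (hcmp i j) (hcmp j i)
    have h0 : 0 ≤ f j * f' i * (A i * B j) + f i * f' j * (A j * B i) :=
      add_nonneg (mul_nonneg (mul_nonneg (hf _) (hf' _)) (mul_nonneg (hA _) (hB _)))
        (mul_nonneg (mul_nonneg (hf _) (hf' _)) (mul_nonneg (hA _) (hB _)))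
    have h3 := (mul_le_mul_of_nonneg_right (exp_neg_mul_le r hG0 hG1) h0).trans this
    have h4 := mul_le_mul_of_nonneg_left h3 (mul_nonneg (hW i) (hW j))
    convert h4 using 1 <;> ring
  nlinarith

variable {S : Type} [Fintype S] {f f' : ℕ → (ℕ → S) → ℝ}

/-- Changing the weights changes the relative weight of an event depending on the first `m`
symbols only by a factor controlled by the house-of-cards chain. -/
theorem titer_tilt_ge [Nonempty S] {R b r : ℕ → ℝ} {β : ℝ} (hR : Decay R β b)
    (hf0 : ∀ i y, 0 < f i y) (hf0' : ∀ i y, 0 < f' i y) (hf' : TailReg f' R) (hr : ∀ i, 0 ≤ r i)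
    (h1 : ∀ i y, Real.exp (-r i) * f i y ≤ f' i y) (h2 : ∀ i y, Real.exp (-r i) * f' i y ≤ f i y)
    (N m : ℕ) {h : (ℕ → S) → ℝ} (h0 : ∀ y, 0 ≤ h y)
    (hm : ∀ y y', (∀ i < m, y i = y' i) → h y = h y') (c : ℕ → S) :
    Real.exp (-2 * ∑ l ∈ Finset.range N, r l * (1 - hcTail (climb R) l m)) *
        (titer f' N h c * titer f N (fun _ => 1) c) ≤
      titer f N h c * titer f' N (fun _ => 1) c := by
  set F : ℕ → ℕ → (ℕ → S) → ℝ := fun l i => if i < l then f' i else f i with hF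
  have hFpos : ∀ l i y, 0 < F l i y := fun l i y => by
    simp only [hF]; split_ifs
    exacts [hf0' _ _, hf0 _ _]
  have hF0 : F 0 = f := by funext i; simp [hF]
  have step : ∀ l, l < N → Real.exp (-2 * (r l * (1 - hcTail (climb R) l m))) *
      (titer (F (l + 1)) N h c * titer (F l) N (fun _ => 1) c) ≤
      titer (F l) N h c * titer (F (l + 1)) N (fun _ => 1) c := by
    intro l hl
    obtain ⟨j, rfl⟩ : ∃ j, N = l + 1 + j := ⟨N - (l + 1), by omega⟩
    obtain ⟨ι, _, W, y, hW, hrep⟩ :=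
      exists_titer_eq_sum (f := fun i => f (l + 1 + i)) (fun i y => (hf0 _ y).le) j c
    have hexp : ∀ l' (g : (ℕ → S) → ℝ), l' = l ∨ l' = l + 1 → ∀ k,
        titer (F l') (l + 1 + j) k c = ∑ p : ι × S, W p.1 *
          (F l' l (tcons p.2 (y p.1)) * titer f' l k (tcons p.2 (y p.1))) := by
      intro l' g hl' k
      rw [titer_add, titer_congr (g := fun i => f (l + 1 + i))
        (fun i _ => by simp only [hF]; rw [if_neg (by omega)]), hrep, titer,
        titer_congr (g := f') (fun i hi => by simp only [hF]; rw [if_pos (by omega)]),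
        Fintype.sum_prod_type]
      exact Finset.sum_congr rfl fun i _ => by rw [tstep, Finset.mul_sum]
    have e1 : F l l = f l := by simp [hF]
    have e2 : F (l + 1) l = f' l := by simp [hF]
    rw [hexp l 0 (.inl rfl), hexp l 0 (.inl rfl), hexp (l + 1) 0 (.inr rfl),
      hexp (l + 1) 0 (.inr rfl), e1, e2]
    exact sum_cross_ge (fun p => hW _) (fun _ => (hf0 _ _).le) (fun _ => (hf0' _ _).le)
      (fun _ => titer_nonneg (fun i y => (hf0' i y).le) _ h0 _)
      (fun _ => titer_nonneg (fun i y => (hf0' i y).le) _ (fun _ => zero_le_one) _)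
      (fun _ => h1 _ _) (fun _ => h2 _ _) (hr l) (hR.hcTail_nonneg _ _) (hR.hcTail_le_one _ _)
      (fun p q => titer_cross_ge hR (fun i y => (hf0' i y).le) hf' l m h0 hm _ _)
  have main : ∀ l, l ≤ N →
      Real.exp (-2 * ∑ i ∈ Finset.range l, r i * (1 - hcTail (climb R) i m)) *
        (titer (F l) N h c * titer f N (fun _ => 1) c) ≤
      titer f N h c * titer (F l) N (fun _ => 1) c := by
    intro l hl
    induction l with
    | zero => simp [hF0]
    | succ l ih =>
      have ih := ih (by omega)
      have hs := step l (by omega)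
      have hp1 : 0 < titer (F l) N (fun _ => 1) c := titer_pos (hFpos l) N (fun _ => one_pos) c
      have hp2 : 0 < titer (F (l + 1)) N (fun _ => 1) c :=
        titer_pos (hFpos _) N (fun _ => one_pos) c
      have hp3 : 0 < titer f N (fun _ => 1) c := titer_pos hf0 N (fun _ => one_pos) c
      rw [Finset.sum_range_succ, mul_add, Real.exp_add]
      set E := Real.exp (-2 * ∑ i ∈ Finset.range l, r i * (1 - hcTail (climb R) i m))
      have hE : 0 < E := Real.exp_pos _
      refine le_of_mul_le_mul_right ?_ hp1
      have h3 := mul_le_mul_of_nonneg_left hs (mul_pos hE hp3).le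
      have h4 := mul_le_mul_of_nonneg_right ih hp2.le
      nlinarith
  have := main N le_rfl
  have e : ∀ k, titer (F N) N k = titer f' N k := fun k =>
    titer_congr (fun i hi => by simp only [hF]; rw [if_pos hi]) k
  rwa [e, e] at this

end Tilt

section Words

variable {S : Type}

/-- The word `w` followed by the sequence `c`. -/
def app : List S → (ℕ → S) → ℕ → S
  | [], c => c
  | a :: w, c => tcons a (app w c)

lemma app_append (u v : List S) (c : ℕ → S) : app (u ++ v) c = app u (app v c) := by
  induction u with
  | nil => rfl
  | cons a u ih => simp only [List.cons_append, app, ih]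

lemma app_length_add (w : List S) (c : ℕ → S) (n : ℕ) : app w c (w.length + n) = c n := by
  induction w with
  | nil => simp [app]
  | cons a w ih => rw [List.length_cons, add_right_comm]; exact ih

lemma app_of_le {w : List S} {n : ℕ} (h : w.length ≤ n) (c : ℕ → S) :
    app w c n = c (n - w.length) := by
  obtain ⟨k, rfl⟩ := Nat.exists_eq_add_of_le h
  rw [app_length_add, Nat.add_sub_cancel_left]

lemma app_of_lt {w : List S} {n : ℕ} (h : n < w.length) (c : ℕ → S) : app w c n = w[n] := by
  induction w generalizing n with
  | nil => simp at h
  | cons a w ih =>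
    cases n with
    | zero => rfl
    | succ n => exact ih (by simpa using h)

/-- The configuration with past `x` and future `y`. -/
def cc (x : ℤ → S) (y : ℕ → S) : ℤ → S := fun j => if 0 ≤ j then y j.toNat else x j

/-- The configuration obtained from `x` by writing the word `w` at the sites from `a` on. -/
def put (x : ℤ → S) (a : ℤ) (w : List S) : ℤ → S :=
  fun j => if a ≤ j then (w[(j - a).toNat]?).getD (x j) else x j

lemma put_eq_cc (x : ℤ → S) (w : List S) :
    put x 0 w = cc x (app w fun n => x (w.length + n)) := by
  funext j
  unfold put cc
  split_ifs with h
  · rw [sub_zero]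
    rcases lt_or_ge j.toNat w.length with hj | hj
    · rw [app_of_lt hj, List.getElem?_eq_getElem hj, Option.getD_some]
    · rw [app_of_le hj, List.getElem?_eq_none hj, Option.getD_none]
      congr 1; omega
  · rfl

lemma put_of_notMem (x : ℤ → S) {a j : ℤ} {w : List S} (h : j < a ∨ a + w.length ≤ j) :
    put x a w j = x j := by
  unfold put
  split_ifs with h'
  · rw [List.getElem?_eq_none (by omega), Option.getD_none]
  · rfl

lemma rd_put (x : ℤ → S) (a : ℤ) (w : List S) : rd (put x a w) a w.length = w := by
  refine List.ext_getElem (by simp) fun i h1 h2 => ?_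
  simp [rd, put]

lemma put_rd {x z : ℤ → S} {a : ℤ} {n : ℕ} (h : ∀ j, j < a ∨ a + n ≤ j → z j = x j) :
    put x a (rd z a n) = z := by
  funext j
  by_cases hj : j < a ∨ a + n ≤ j
  · rw [put_of_notMem x (by simpa using hj), h j hj]
  · push Not at hj
    unfold put
    rw [if_pos hj.1, getElem?_rd z a (by omega), Option.getD_some]
    congr 1; omega

lemma put_congr {x y : ℤ → S} {a : ℤ} {w : List S} {P : ℤ → Prop} (h : ∀ j, P j → x j = y j)
    {j : ℤ} (hj : P j ∨ a ≤ j ∧ j < a + w.length) : put x a w j = put y a w j := by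
  unfold put
  split_ifs with h'
  · rcases lt_or_ge (j - a).toNat w.length with h1 | h1
    · rw [List.getElem?_eq_getElem h1]; rfl
    · rw [List.getElem?_eq_none h1]
      exact h j (hj.resolve_right (by omega))
  · exact h j (hj.resolve_right (by omega))

lemma put_shift (x : ℤ → S) (a b : ℤ) (w : List S) :
    put (shift b x) a w = shift b (put x (a + b) w) := by
  funext j
  simp only [put, shift]
  rw [show j + b - (a + b) = j - a by ring]
  simp only [add_le_add_iff_right]

variable [Fintype S] [DecidableEq S]

lemma sum_ov_eq (F : (ℤ → S) → ℝ) (x : ℤ → S) (a : ℤ) (n : ℕ) :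
    ∑ ζ : (Finset.Ico a (a + n)) → S, F (ov x (Finset.Ico a (a + n)) ζ) =
      ∑ w ∈ wd S n, F (put x a w) := by
  have hoff : ∀ (ζ : (Finset.Ico a (a + n)) → S) j, j < a ∨ a + n ≤ j →
      ov x (Finset.Ico a (a + n)) ζ j = x j := fun ζ j hj => by
    rw [ov, dif_neg (by rw [Finset.mem_Ico]; omega)]
  refine Finset.sum_bij (fun ζ _ => rd (ov x (Finset.Ico a (a + n)) ζ) a n)
    (fun ζ _ => by simp [mem_wd]) (fun ζ _ ζ' _ h => ?_) (fun w hw => ?_)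
    (fun ζ _ => by rw [put_rd (hoff ζ)])
  · have h2 := congrArg (put x a) h
    rw [put_rd (hoff ζ), put_rd (hoff ζ')] at h2
    funext i
    have := congrFun h2 i
    simpa [ov] using this
  · rw [mem_wd] at hw
    refine ⟨fun i => put x a w i, Finset.mem_univ _, ?_⟩
    have : ov x (Finset.Ico a (a + n)) (fun i => put x a w i) = put x a w := by
      funext j
      unfold ov
      split_ifs with hj
      · rfl
      · rw [put_of_notMem]
        rw [Finset.mem_Ico] at hj
        rw [hw]; omega
    rw [this]
    conv_lhs => rw [← hw]
    exact rd_put x a w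

end Words

section Ratio

variable {S : Type} [Fintype S] [Nonempty S] [DecidableEq S]
  [TopologicalSpace S] [DiscreteTopology S]

/-- The logarithmic one-sided regularity of `f`. -/
def logReg (f : Conf S → ℝ) (j : ℕ) : ℝ :=
  max (Real.log (rSup (Iic (j : ℤ)) f)) (Real.log (rSup (Ici (-(j : ℤ))) f))

variable {f : Conf S → ℝ} (hf : Continuous f) (hpos : ∀ x, 0 < f x)
include hf hpos

lemma rSup_bdd (Λ : Set ℤ) :
    BddAbove {r : ℝ | ∃ x y : Conf S, (∀ i ∈ Λ, x i = y i) ∧ f x / f y = r} := by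
  have hc : Continuous fun p : Conf S × Conf S => f p.1 / f p.2 :=
    (hf.comp continuous_fst).div (hf.comp continuous_snd) fun p => (hpos _).ne'
  obtain ⟨C, hC⟩ := (isCompact_range hc).bddAbove
  exact ⟨C, by rintro _ ⟨x, y, -, rfl⟩; exact hC ⟨(x, y), rfl⟩⟩

lemma one_le_rSup (Λ : Set ℤ) : 1 ≤ rSup Λ f := by
  obtain ⟨a⟩ := ‹Nonempty S›
  exact le_csSup (rSup_bdd hf hpos Λ) ⟨fun _ => a, fun _ => a, fun _ _ => rfl,
    div_self (hpos _).ne'⟩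

lemma rSup_anti {Λ Λ' : Set ℤ} (h : Λ ⊆ Λ') : rSup Λ' f ≤ rSup Λ f := by
  obtain ⟨a⟩ := ‹Nonempty S›
  exact csSup_le_csSup (rSup_bdd hf hpos Λ)
    ⟨_, fun _ => a, fun _ => a, fun _ _ => rfl, rfl⟩
    fun r ⟨x, y, hxy, hr⟩ => ⟨x, y, fun i hi => hxy i (h hi), hr⟩

lemma exp_neg_log_rSup_le {Λ : Set ℤ} {r : ℝ} (hr : Real.log (rSup Λ f) ≤ r) {x y : Conf S}
    (h : ∀ i ∈ Λ, x i = y i) : Real.exp (-r) * f x ≤ f y := by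
  have h1 : f x / f y ≤ rSup Λ f := le_csSup (rSup_bdd hf hpos Λ) ⟨x, y, h, rfl⟩
  have h2 : rSup Λ f ≤ Real.exp r :=
    (Real.log_le_iff_le_exp (by linarith [one_le_rSup hf hpos Λ])).1 hr
  rw [div_le_iff₀ (hpos y)] at h1
  have h3 : f x ≤ Real.exp r * f y := h1.trans (mul_le_mul_of_nonneg_right h2 (hpos y).le)
  calc Real.exp (-r) * f x ≤ Real.exp (-r) * (Real.exp r * f y) :=
        mul_le_mul_of_nonneg_left h3 (Real.exp_pos _).le
    _ = f y := by rw [← mul_assoc, ← Real.exp_add]; simp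

lemma logReg_nonneg (j : ℕ) : 0 ≤ logReg f j :=
  le_max_of_le_left (Real.log_nonneg (one_le_rSup hf hpos _))

lemma logReg_anti : Antitone (logReg f) := fun i j h => by
  refine max_le_max ?_ ?_
  · exact Real.log_le_log (by linarith [one_le_rSup hf hpos (Iic (j : ℤ))])
      (rSup_anti hf hpos fun t ht => by simp only [mem_Iic] at *; omega)
  · exact Real.log_le_log (by linarith [one_le_rSup hf hpos (Ici (-(j : ℤ)))])
      (rSup_anti hf hpos fun t ht => by simp only [mem_Ici] at *; omega)

end Ratio

section Kern

variable {S : Type} [Fintype S] [Nonempty S] [DecidableEq S]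
  [TopologicalSpace S] [DiscreteTopology S] [MeasurableSpace S] [MeasurableSingletonClass S]
  (V : Specification S)

/-- The ratio `φ_{0}(x) / φ_{0}(s_0 x)`. -/
def Specification.rat (s : S) (x : Conf S) : ℝ := V.φ {0} x / V.φ {0} (upd s 0 x)

/-- The weights of the transfer operators attached to the past `x`. -/
def Specification.wt (s : S) (x : Conf S) (i : ℕ) (y : ℕ → S) : ℝ :=
  V.rat s (shift i (cc x (app (List.replicate i s) y)))

/-- The expectation of `h` under the specification on `[a, a + N)` with boundary condition `x`. -/
def Specification.kern (a : ℤ) (N : ℕ) (h : Conf S → ℝ) (x : Conf S) : ℝ :=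
  ∑ w ∈ wd S N, V.φ (Finset.Ico a (a + N)) (put x a w) * h (put x a w)

variable {V}

lemma Specification.Positive.rat_pos (hpos : V.Positive) (s : S) (x : Conf S) : 0 < V.rat s x :=
  div_pos (hpos _ _) (hpos _ _)

lemma Specification.IsCont.rat (hc : V.IsCont) (hpos : V.Positive) (s : S) :
    Continuous (V.rat s) := by
  refine (hc {0}).div ((hc {0}).comp ?_) fun x => (hpos _ _).ne'
  refine continuous_pi fun i => ?_
  unfold upd
  split_ifs
  exacts [continuous_const, continuous_apply i]

lemma Specification.TInvariant.rat_shift (hinv : V.TInvariant) (hpos : V.Positive) (s : S) {n : ℤ}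
    {Λ : Finset ℤ} (hn : n ∈ Λ) (z : Conf S) :
    V.rat s (shift n z) * V.φ Λ (upd s n z) = V.φ Λ z := by
  have e : upd s 0 (shift n z) = shift n (upd s n z) := by
    funext i; simp [upd, shift]
  have h1 := hinv n {0}
  simp only [Finset.image_singleton, add_zero] at h1
  have h2 : ∀ ζ, ov (upd s n z) {n} ζ = ov z {n} ζ := fun ζ => by
    funext i
    unfold ov upd
    split_ifs with h1 h2
    · rfl
    · simp_all
    · rfl
  have h3 := V.consistent {n} Λ (by simpa using hn) z
  have h4 := V.consistent {n} Λ (by simpa using hn) (upd s n z)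
  simp only [h2] at h4
  rw [Specification.rat, e, ← h1, ← h1, h3, h4, div_mul_eq_mul_div, div_eq_iff (hpos _ _).ne']
  ring

lemma Specification.TInvariant.titer_wt (hinv : V.TInvariant) (hpos : V.Positive) (s : S)
    (x : Conf S) {Λ : Finset ℤ} (n : ℕ) (hΛ : ∀ i : ℕ, i < n → (i : ℤ) ∈ Λ)
    (h : (ℕ → S) → ℝ) (c : ℕ → S) :
    titer (V.wt s x) n h c * V.φ Λ (cc x (app (List.replicate n s) c)) =
      ∑ w ∈ wd S n, V.φ Λ (cc x (app w c)) * h (app w c) := by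
  induction n generalizing c with
  | zero => simp [sum_wd_zero, titer, app, mul_comm]
  | succ n ih =>
    rw [titer, tstep, Finset.sum_mul, sum_wd_snoc, Finset.sum_comm]
    refine Finset.sum_congr rfl fun a _ => ?_
    have e : upd s n (cc x (app (List.replicate n s) (tcons a c))) =
        cc x (app (List.replicate (n + 1) s) c) := by
      rw [List.replicate_succ', app_append]
      funext j
      unfold upd cc
      split_ifs with h1 h2 h2
      · obtain rfl : j.toNat = n := by omega
        have := app_length_add (List.replicate j.toNat s) (app [s] c) 0
        rw [List.length_replicate] at this
        exact this.symm
      · omega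
      · rcases lt_or_ge j.toNat n with h3 | h3
        · rw [app_of_lt (by simpa using h3), app_of_lt (by simpa using h3)]
        · rw [app_of_le (by simpa using h3), app_of_le (by simpa using h3), List.length_replicate]
          obtain ⟨k, hk⟩ : ∃ k, j.toNat - n = k + 1 := ⟨j.toNat - n - 1, by omega⟩
          rw [hk]; rfl
      · rfl
    rw [← e, mul_right_comm, Specification.wt, hinv.rat_shift hpos s (hΛ n (by omega)), mul_comm,
      ih fun i hi => hΛ i (by omega)]
    exact Finset.sum_congr rfl fun w _ => by rw [app_append]; rfl

lemma kern_one (a : ℤ) (N : ℕ) (x : Conf S) : V.kern a N (fun _ => 1) x = 1 := by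
  simp only [Specification.kern, mul_one]
  rw [← sum_ov_eq (V.φ (Finset.Ico a (a + N))), V.sum_one]

lemma Specification.TInvariant.kern_shift (hinv : V.TInvariant) (a : ℤ) (N : ℕ) (h : Conf S → ℝ)
    (x : Conf S) : V.kern 0 N h (shift a x) = V.kern a N (fun z => h (shift a z)) x := by
  refine Finset.sum_congr rfl fun w hw => ?_
  have e : (Finset.Ico 0 (0 + (N : ℤ))).image (fun i => a + i) = Finset.Ico a (a + N) := ?_
  · rw [put_shift, zero_add a, ← hinv, e]
  ext i
  simp only [Finset.mem_image, Finset.mem_Ico]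
  constructor
  · rintro ⟨j, hj, rfl⟩; omega
  · exact fun hi => ⟨i - a, by omega, by omega⟩

end Kern

section Compare

variable {S : Type} [Fintype S] [Nonempty S] [DecidableEq S]
  [TopologicalSpace S] [DiscreteTopology S] [MeasurableSpace S] [MeasurableSingletonClass S]
  {V : Specification S}

/-- A positive, continuous and shift-invariant specification whose ratios are regular. -/
structure Specification.Reg (V : Specification S) (s : S) (β : ℝ) (b : ℕ → ℝ) : Prop where
  pos : V.Positive
  cont : V.IsCont
  inv : V.TInvariant
  decay : Decay (logReg (V.rat s)) β b

variable {s : S} {β : ℝ} {b : ℕ → ℝ}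

lemma cc_of_neg (x : ℤ → S) (y : ℕ → S) {j : ℤ} (h : j < 0) : cc x y j = x j :=
  if_neg (by omega)

lemma cc_of_nonneg (x : ℤ → S) (y : ℕ → S) {j : ℤ} (h : 0 ≤ j) : cc x y j = y j.toNat := if_pos h

lemma Specification.Reg.le_rat (hV : V.Reg s β b) {j : ℕ} {x y : Conf S}
    (h : (∀ i ≤ (j : ℤ), x i = y i) ∨ ∀ i ≥ -(j : ℤ), x i = y i) :
    Real.exp (-logReg (V.rat s) j) * V.rat s x ≤ V.rat s y := by
  rcases h with h | h
  · exact exp_neg_log_rSup_le (hV.cont.rat hV.pos s) (hV.pos.rat_pos s) (le_max_left _ _) h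
  · exact exp_neg_log_rSup_le (hV.cont.rat hV.pos s) (hV.pos.rat_pos s) (le_max_right _ _) h

lemma Specification.Reg.tailReg_wt (hV : V.Reg s β b) (x : Conf S) :
    TailReg (V.wt s x) (logReg (V.rat s)) := by
  intro i j y y' h
  refine hV.le_rat (.inl fun t ht => ?_)
  unfold shift cc
  split_ifs with h1
  · rcases lt_or_ge (t + i).toNat i with h2 | h2
    · rw [app_of_lt (by simpa using h2), app_of_lt (by simpa using h2)]
    · rw [app_of_le (by simpa using h2), app_of_le (by simpa using h2), List.length_replicate]
      exact h _ (by omega)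
  · rfl

lemma kern_eq_titer (hV : V.Reg s β b) (N : ℕ) (h : Conf S → ℝ) (x : Conf S) :
    V.kern 0 N h x = titer (V.wt s x) N (fun t => h (cc x t)) (fun n => x (N + n)) *
      V.φ (Finset.Ico 0 (0 + (N : ℤ))) (cc x (app (List.replicate N s) fun n => x (N + n))) := by
  rw [hV.inv.titer_wt hV.pos s x N fun i hi => by simp [hi]]
  refine Finset.sum_congr rfl fun w hw => ?_
  rw [mem_wd] at hw
  rw [put_eq_cc, hw]

lemma Specification.Reg.kern_future_ge (hV : V.Reg s β b) (N m : ℕ) {h : Conf S → ℝ}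
    (h0 : ∀ z, 0 ≤ h z) (hm : ∀ z z', (∀ j < (m : ℤ), z j = z' j) → h z = h z') {x y : Conf S}
    (hxy : ∀ j < 0, x j = y j) :
    hcTail (climb (logReg (V.rat s))) N m * V.kern 0 N h y ≤ V.kern 0 N h x := by
  have e : cc y = cc x := by
    funext t j
    rcases lt_or_ge j 0 with hj | hj
    · rw [cc_of_neg _ _ hj, cc_of_neg _ _ hj, hxy j hj]
    · rw [cc_of_nonneg _ _ hj, cc_of_nonneg _ _ hj]
  have ew : V.wt s y = V.wt s x := by funext i t; unfold Specification.wt; rw [e]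
  have hx := kern_eq_titer hV N h x
  have hx1 := kern_eq_titer hV N (fun _ => 1) x
  have hy := kern_eq_titer hV N h y
  have hy1 := kern_eq_titer hV N (fun _ => 1) y
  rw [kern_one] at hx1 hy1
  rw [e, ew] at hy hy1
  have key := titer_cross_ge hV.decay (f := V.wt s x) (fun i t => (hV.pos.rat_pos s _).le) (hV.tailReg_wt x) N m
    (h := fun t => h (cc x t)) (fun _ => h0 _) (fun t t' htt => hm _ _ fun j hj => by
      rcases lt_or_ge j 0 with hj' | hj'
      · rw [cc_of_neg _ _ hj', cc_of_neg _ _ hj']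
      · rw [cc_of_nonneg _ _ hj', cc_of_nonneg _ _ hj']
        exact htt _ (by omega)) (fun n => x (N + n)) (fun n => y (N + n))
  set p := V.φ (Finset.Ico 0 (0 + (N : ℤ))) (cc x (app (List.replicate N s) fun n => x (N + n)))
  set q := V.φ (Finset.Ico 0 (0 + (N : ℤ))) (cc x (app (List.replicate N s) fun n => y (N + n)))
  have h2 := mul_le_mul_of_nonneg_right key (mul_nonneg (V.nonneg _ _ : 0 ≤ p) (V.nonneg _ _ : 0 ≤ q))
  rw [hx, hy]
  refine (le_of_eq ?_).trans (h2.trans (le_of_eq ?_))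
  · linear_combination (hcTail (climb (logReg (V.rat s))) N m *
      (titer (V.wt s x) N (fun t => h (cc x t)) (fun n => y (N + n)) * q)) * hx1
  · linear_combination -(titer (V.wt s x) N (fun t => h (cc x t)) (fun n => x (N + n)) * p) * hy1

lemma Specification.Reg.kern_past_ge (hV : V.Reg s β b) (N m k : ℕ) {h : Conf S → ℝ}
    (h0 : ∀ z, 0 ≤ h z) (hm : ∀ z z', (∀ j, 0 ≤ j → j < (m : ℤ) → z j = z' j) → h z = h z')
    {x y : Conf S} (hxy : ∀ j ≥ -(k : ℤ), x j = y j) :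
    Real.exp (-2 * ∑ l ∈ Finset.range N,
      logReg (V.rat s) (k + l) * (1 - hcTail (climb (logReg (V.rat s))) l m)) * V.kern 0 N h y ≤
      V.kern 0 N h x := by
  have ec : (fun n : ℕ => y (N + n)) = fun n : ℕ => x (N + n) := by
    funext n
    exact (hxy _ (by omega)).symm
  have eh : (fun t => h (cc y t)) = fun t => h (cc x t) := by
    funext t
    exact hm _ _ fun j hj _ => by rw [cc_of_nonneg _ _ hj, cc_of_nonneg _ _ hj]
  have hx := kern_eq_titer hV N h x
  have hx1 := kern_eq_titer hV N (fun _ => 1) x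
  have hy := kern_eq_titer hV N h y
  have hy1 := kern_eq_titer hV N (fun _ => 1) y
  rw [kern_one] at hx1 hy1
  rw [ec] at hy hy1
  rw [eh] at hy
  have hag : ∀ i t, (∀ j ≥ -((k + i : ℕ) : ℤ), shift i (cc x (app (List.replicate i s) t)) j =
      shift i (cc y (app (List.replicate i s) t)) j) := by
    intro i t j hj
    unfold shift
    rcases lt_or_ge (j + i) 0 with hj' | hj'
    · rw [cc_of_neg _ _ hj', cc_of_neg _ _ hj']
      exact hxy _ (by omega)
    · rw [cc_of_nonneg _ _ hj', cc_of_nonneg _ _ hj']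
  have key := titer_tilt_ge hV.decay (f := V.wt s x) (f' := V.wt s y)
    (r := fun l => logReg (V.rat s) (k + l))
    (fun i t => (hV.pos.rat_pos s _)) (fun i t => (hV.pos.rat_pos s _)) (hV.tailReg_wt y)
    (fun i => hV.decay.nonneg _) (fun i t => hV.le_rat (.inr (hag i t)))
    (fun i t => hV.le_rat (.inr fun j hj => (hag i t j hj).symm)) N m
    (h := fun t => h (cc x t)) (fun _ => h0 _) (fun t t' htt => hm _ _ fun j hj hj' => by
      rw [cc_of_nonneg _ _ hj, cc_of_nonneg _ _ hj]
      exact htt _ (by omega)) (fun n => x (N + n))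
  set p := V.φ (Finset.Ico 0 (0 + (N : ℤ))) (cc x (app (List.replicate N s) fun n => x (N + n)))
  set q := V.φ (Finset.Ico 0 (0 + (N : ℤ))) (cc y (app (List.replicate N s) fun n => x (N + n)))
  have h2 := mul_le_mul_of_nonneg_right key (mul_nonneg (V.nonneg _ _ : 0 ≤ p) (V.nonneg _ _ : 0 ≤ q))
  set E := Real.exp (-2 * ∑ l ∈ Finset.range N,
      logReg (V.rat s) (k + l) * (1 - hcTail (climb (logReg (V.rat s))) l m))
  rw [hx, hy]
  refine (le_of_eq ?_).trans (h2.trans (le_of_eq ?_))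
  · linear_combination (E *
      (titer (V.wt s y) N (fun t => h (cc x t)) (fun n => x (N + n)) * q)) * hx1
  · linear_combination -(titer (V.wt s x) N (fun t => h (cc x t)) (fun n => x (N + n)) * p) * hy1

/-- Boundary conditions agreeing on the last `k` sites of the past give comparable conditional
weights. -/
theorem Specification.Reg.kern_ge (hV : V.Reg s β b) (N m k : ℕ) {h : Conf S → ℝ}
    (h0 : ∀ z, 0 ≤ h z) (hm : ∀ z z', (∀ j, 0 ≤ j → j < (m : ℤ) → z j = z' j) → h z = h z')
    {x y : Conf S} (hxy : ∀ j ≥ -(k : ℤ), j < 0 → x j = y j) :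
    hcTail (climb (logReg (V.rat s))) N m * (Real.exp (-2 * ∑ l ∈ Finset.range N,
      logReg (V.rat s) (k + l) * (1 - hcTail (climb (logReg (V.rat s))) l m)) *
        V.kern 0 N h y) ≤ V.kern 0 N h x := by
  let z : Conf S := cc x fun n => y n
  have h1 := hV.kern_past_ge N m k h0 hm (x := z) (y := y) (fun j hj => by
    rcases lt_or_ge j 0 with hj' | hj'
    · exact (cc_of_neg _ _ hj').trans (hxy j hj hj')
    · exact (cc_of_nonneg _ _ hj').trans (by rw [Int.toNat_of_nonneg hj']))
  have h2 := hV.kern_future_ge N m h0 (fun z z' hz => hm z z' fun j _ hj => hz j hj) (x := x)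
    (y := z) (fun j hj => (cc_of_neg _ _ hj).symm)
  exact (mul_le_mul_of_nonneg_left h1 (hV.decay.hcTail_nonneg _ _)).trans h2

end Compare

section Reflect

variable {S : Type} [Fintype S] [Nonempty S] [DecidableEq S]
  [TopologicalSpace S] [DiscreteTopology S] [MeasurableSpace S] [MeasurableSingletonClass S]

/-- The reflected configuration. -/
def neg (x : ℤ → S) : ℤ → S := fun j => x (-j)

@[simp] lemma neg_neg_conf (x : ℤ → S) : neg (neg x) = x := by funext j; simp [neg]

/-- The reflected finite set of sites. -/
def negF (Λ : Finset ℤ) : Finset ℤ := Λ.image fun i => -i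

@[simp] lemma mem_negF {Λ : Finset ℤ} {i : ℤ} : i ∈ negF Λ ↔ -i ∈ Λ := by
  simp only [negF, Finset.mem_image]
  exact ⟨by rintro ⟨j, hj, rfl⟩; simpa using hj, fun h => ⟨-i, h, by simp⟩⟩

lemma sum_ov_neg (F : Conf S → ℝ) (x : Conf S) (Λ : Finset ℤ) :
    ∑ ζ : Λ → S, F (neg (ov x Λ ζ)) = ∑ ζ : negF Λ → S, F (ov (neg x) (negF Λ) ζ) := by
  let e : Λ ≃ negF Λ := ⟨fun i => ⟨-i, by simp⟩, fun i => ⟨-i, mem_negF.1 i.2⟩,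
    fun i => by simp, fun i => by simp⟩
  refine Fintype.sum_equiv (e.arrowCongr (Equiv.refl S)) _ _ fun ζ => ?_
  congr 1
  funext j
  simp only [neg, ov, mem_negF]
  split_ifs with h
  · rfl
  · rfl

/-- The reflected specification. -/
def Specification.refl (V : Specification S) : Specification S where
  φ Λ x := V.φ (negF Λ) (neg x)
  nonneg _ _ := V.nonneg _ _
  measurable Λ := (V.measurable _).comp (measurable_pi_lambda _ fun _ => measurable_pi_apply _)
  sum_one Λ x := by rw [sum_ov_neg (V.φ (negF Λ)), V.sum_one]
  consistent K Λ h x := by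
    rw [V.consistent (negF K) (negF Λ) (fun i hi => by simp only [mem_negF] at *; exact h hi),
      sum_ov_neg (V.φ (negF Λ))]

variable {V : Specification S}

lemma refl_kern (N : ℕ) (h : Conf S → ℝ) (x : Conf S) :
    V.refl.kern 0 N h x = V.kern (1 - N) N (fun z => h (neg z)) (neg x) := by
  have e : negF (Finset.Ico 0 (0 + (N : ℤ))) = Finset.Ico (1 - (N : ℤ)) (1 - (N : ℤ) + N) := by
    ext i; simp only [mem_negF, Finset.mem_Ico]; omega
  have h1 := sum_ov_neg (fun z => V.φ (negF (Finset.Ico 0 (0 + (N : ℤ)))) z * h (neg z)) x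
    (Finset.Ico 0 (0 + N))
  rw [e, sum_ov_eq (fun z => V.φ (Finset.Ico (1 - (N : ℤ)) (1 - (N : ℤ) + N)) z * h (neg z)),
    sum_ov_eq (fun z => V.φ (Finset.Ico (1 - (N : ℤ)) (1 - (N : ℤ) + N)) (neg z) * h (neg (neg z)))] at h1
  rw [Specification.kern, Specification.kern, ← h1]
  refine Finset.sum_congr rfl fun w _ => ?_
  rw [neg_neg_conf]
  change V.φ _ _ * _ = _
  rw [e]

lemma logReg_neg (f : Conf S → ℝ) : logReg (fun x => f (neg x)) = logReg f := by
  have key : ∀ (Λ Λ' : Set ℤ), (∀ i, i ∈ Λ' ↔ -i ∈ Λ) →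
      rSup Λ (fun x => f (neg x)) = rSup Λ' f := by
    intro Λ Λ' hΛ
    unfold rSup
    congr 1
    ext r
    constructor
    · rintro ⟨x, y, hxy, rfl⟩
      exact ⟨neg x, neg y, fun i hi => hxy _ ((hΛ i).1 hi), rfl⟩
    · rintro ⟨x, y, hxy, rfl⟩
      exact ⟨neg x, neg y, fun i hi => hxy _ ((hΛ _).2 (by simpa using hi)), by simp⟩
  funext j
  unfold logReg
  rw [key (Iic j) (Ici (-j)) (fun i => by simp only [mem_Ici, mem_Iic]; omega),
    key (Ici (-j)) (Iic j) (fun i => by simp only [mem_Ici, mem_Iic]; omega), max_comm]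

lemma refl_rat (s : S) : V.refl.rat s = fun x => V.rat s (neg x) := by
  funext x
  unfold Specification.rat Specification.refl
  have e1 : negF {0} = {0} := by ext i; simp
  have e2 : neg (upd s 0 x) = upd s 0 (neg x) := by funext i; simp [neg, upd]
  simp only [e1, e2]

variable {s : S} {β : ℝ} {b : ℕ → ℝ}

lemma Specification.Reg.refl (hV : V.Reg s β b) : V.refl.Reg s β b where
  pos _ _ := hV.pos _ _
  cont Λ := (hV.cont _).comp (continuous_pi fun _ => continuous_apply _)
  inv n Λ x := by
    have e : negF (Λ.image fun i => n + i) = (negF Λ).image fun i => -n + i := by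
      ext i
      simp only [mem_negF, Finset.mem_image]
      exact ⟨by rintro ⟨j, hj, h⟩; exact ⟨-j, by simpa using hj, by omega⟩,
        by rintro ⟨j, hj, h⟩; exact ⟨-j, hj, by omega⟩⟩
    have e2 : neg (shift n x) = shift (-n) (neg x) := by
      funext i; simp only [neg, shift]; congr 1; omega
    change V.φ _ _ = V.φ _ _
    rw [e, hV.inv, e2]
  decay := by rw [refl_rat, logReg_neg (V.rat s)]; exact hV.decay

/-- The conditional weights of events in the middle third of a long interval depend on the
boundary condition only up to a constant factor. -/
theorem Specification.Reg.exists_kern_ge (hV : V.Reg s β b) : ∃ c : ℝ, 0 < c ∧ c ≤ 1 ∧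
    ∀ (L : ℕ) (h : Conf S → ℝ), (∀ z, 0 ≤ h z) →
      (∀ z z', (∀ j, (L : ℤ) ≤ j → j < 2 * L → z j = z' j) → h z = h z') → ∀ x y,
      c * V.kern 0 (3 * L) h y ≤ V.kern 0 (3 * L) h x := by
  obtain ⟨c, hc, hcG⟩ := hV.decay.exists_hcTail_ge
  have hc1 : c ≤ 1 := (hcG 0 0 (by omega)).trans (hV.decay.hcTail_le_one 0 0)
  refine ⟨c * c, by positivity, by nlinarith, fun L h h0 hL x y => ?_⟩
  have hk0 : ∀ (V : Specification S) h z, (∀ z, 0 ≤ h z) → 0 ≤ V.kern 0 (3 * L) h z :=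
    fun V h z h0 => Finset.sum_nonneg fun w _ => mul_nonneg (V.nonneg _ _) (h0 _)
  let z : Conf S := cc x fun n => y n
  have h1 := hV.kern_future_ge (3 * L) (2 * L) h0
    (fun z z' hz => hL z z' fun j _ hj => hz j (by push_cast; omega)) (x := x)
    (y := z) (fun j hj => (cc_of_neg _ _ hj).symm)
  have h2 : hcTail (climb (logReg (V.rat s))) (3 * L) (2 * L) * V.kern 0 (3 * L) h y ≤
      V.kern 0 (3 * L) h z := by
    set a : ℤ := (3 * L : ℕ) - 1
    have e : ∀ x, V.kern 0 (3 * L) h x =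
        V.refl.kern 0 (3 * L) (fun t => h (shift (-a) (neg t))) (neg (shift a x)) := by
      intro x
      rw [refl_kern, neg_neg_conf]
      simp only [neg_neg_conf]
      have e1 := hV.inv.kern_shift (1 - (3 * L : ℕ)) (3 * L) (fun t => h t) (shift a x)
      have e2 : shift (1 - ((3 * L : ℕ) : ℤ)) (shift a x) = x := by
        funext i; simp only [shift]; congr 1; omega
      rw [e2] at e1
      rw [e1]
      congr 1
      funext t
      congr 2
      omega
    rw [e, e z]
    have h3 := hV.refl.kern_future_ge (3 * L) (2 * L)
      (h := fun t => h (shift (-a) (neg t))) (fun _ => h0 _) (fun t t' ht => hL _ _ fun j hj hj' => by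
        simp only [shift, neg]
        exact ht _ (by push_cast; omega)) (x := neg (shift a z)) (y := neg (shift a y))
        (fun j hj => by
          simp only [shift, neg, z]
          rw [cc_of_nonneg _ _ (by omega), Int.toNat_of_nonneg (by omega)])
    rwa [refl_rat, logReg_neg (V.rat s)] at h3
  have hG := hcG (3 * L) (2 * L) (by omega)
  have h3 := (mul_le_mul_of_nonneg_right hG (hk0 V h y h0)).trans h2
  have h4 := (mul_le_mul_of_nonneg_right hG (hk0 V h z h0)).trans h1
  nlinarith

end Reflect

section Gibbs

variable {S : Type} [Fintype S] [Nonempty S] [DecidableEq S]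
  [TopologicalSpace S] [DiscreteTopology S] [MeasurableSpace S] [MeasurableSingletonClass S]
  {V : Specification S}

lemma cylSA_le (Λ : Set ℤ) : cylSA (S := S) Λ ≤ MeasurableSpace.pi :=
  (measurable_pi_lambda _ fun _ => measurable_pi_apply _).comap_le

lemma measurable_ov (Λ : Finset ℤ) (ζ : Λ → S) :
    Measurable[cylSA (↑Λ : Set ℤ)ᶜ] fun x : Conf S => ov x Λ ζ := by
  refine @measurable_pi_lambda _ _ _ (cylSA _) _ _ fun i => ?_
  by_cases h : i ∈ Λ
  · simp only [ov, dif_pos h]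
    exact @measurable_const _ _ _ (cylSA _) _
  · simp only [ov, dif_neg h]
    exact (measurable_pi_apply (X := fun _ : ((↑Λ : Set ℤ)ᶜ : Set ℤ) => S) ⟨i, by simpa using h⟩).comp
      (comap_measurable _)

lemma measurable_phi_ov (V : Specification S) (Λ : Finset ℤ) (ζ : Λ → S) :
    Measurable[cylSA (↑Λ : Set ℤ)ᶜ] fun x => V.φ Λ (ov x Λ ζ) :=
  (V.measurable Λ).comp (measurable_ov Λ ζ)

lemma measurableSet_cylEvent (Λ : Finset ℤ) (ζ : Λ → S) : MeasurableSet (cylEvent Λ ζ) := by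
  have : cylEvent Λ ζ = ⋂ i : Λ, (fun y : Conf S => y i) ⁻¹' {ζ i} := by
    ext y; simp [cylEvent]
  rw [this]
  exact MeasurableSet.iInter fun i => measurable_pi_apply _ (measurableSet_singleton _)

lemma phi_ov_le_one (V : Specification S) (Λ : Finset ℤ) (ζ : Λ → S) (x : Conf S) :
    V.φ Λ (ov x Λ ζ) ≤ 1 := by
  rw [← V.sum_one Λ x]
  exact Finset.single_le_sum (f := fun ζ => V.φ Λ (ov x Λ ζ)) (fun _ _ => V.nonneg _ _)
    (Finset.mem_univ ζ)

variable {μ : Measure (Conf S)}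

lemma integrable_phi_ov (V : Specification S) (Λ : Finset ℤ) (ζ : Λ → S) [IsFiniteMeasure μ] :
    Integrable (fun x => V.φ Λ (ov x Λ ζ)) μ :=
  Integrable.of_bound ((measurable_phi_ov V Λ ζ).mono (cylSA_le _) le_rfl).aestronglyMeasurable 1
    (ae_of_all _ fun x => by
      rw [Real.norm_of_nonneg (V.nonneg _ _)]; exact phi_ov_le_one V Λ ζ x)

lemma gibbsCond_setIntegral [IsProbabilityMeasure μ] (h : GibbsCond V.φ μ) {Λ : Finset ℤ}
    (hΛ : Λ.Nonempty) (ζ : Λ → S) {A : Set (Conf S)} (hA : MeasurableSet[cylSA (↑Λ : Set ℤ)ᶜ] A) :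
    ∫ x in A, V.φ Λ (ov x Λ ζ) ∂μ = μ.real (A ∩ cylEvent Λ ζ) := by
  have hA' := cylSA_le _ _ hA
  rw [setIntegral_congr_ae hA' ((h Λ hΛ ζ).mono fun x hx _ => hx),
    setIntegral_condExp (cylSA_le _)
      ((integrable_const (1 : ℝ)).indicator (measurableSet_cylEvent Λ ζ)) hA,
    setIntegral_indicator (measurableSet_cylEvent Λ ζ)]
  simp

lemma gibbsCond_of_setIntegral [IsProbabilityMeasure μ]
    (h : ∀ (Λ : Finset ℤ) (ζ : Λ → S) A, MeasurableSet[cylSA (↑Λ : Set ℤ)ᶜ] A →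
      ∫ x in A, V.φ Λ (ov x Λ ζ) ∂μ = μ.real (A ∩ cylEvent Λ ζ)) : GibbsCond V.φ μ := by
  intro Λ _ ζ
  refine ae_eq_condExp_of_forall_setIntegral_eq (cylSA_le _)
    ((integrable_const (1 : ℝ)).indicator (measurableSet_cylEvent Λ ζ))
    (fun A _ _ => (integrable_phi_ov V Λ ζ).integrableOn) (fun A hA _ => ?_)
    (measurable_phi_ov V Λ ζ).stronglyMeasurable.aestronglyMeasurable
  rw [h Λ ζ A hA, setIntegral_indicator (measurableSet_cylEvent Λ ζ)]
  simp

/-- It suffices to check the Gibbs condition on cylinder sets. -/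
lemma gibbsCond_of_cylinder [IsProbabilityMeasure μ]
    (h : ∀ (Λ : Finset ℤ) (ζ : Λ → S) (J : Finset ((↑Λ : Set ℤ)ᶜ : Set ℤ)) (T : Set (J → S)),
      ∫ x in (((↑Λ : Set ℤ)ᶜ).domRestrict) ⁻¹' (cylinder J T), V.φ Λ (ov x Λ ζ) ∂μ =
        μ.real ((((↑Λ : Set ℤ)ᶜ).domRestrict) ⁻¹' (cylinder J T) ∩ cylEvent Λ ζ)) :
    GibbsCond V.φ μ := by
  refine gibbsCond_of_setIntegral fun Λ ζ A hA => ?_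
  obtain ⟨B, hB, rfl⟩ := hA
  have hr : Measurable fun x : Conf S => ((↑Λ : Set ℤ)ᶜ).domRestrict x :=
    measurable_pi_lambda _ fun _ => measurable_pi_apply _
  let ν₁ : Measure (((↑Λ : Set ℤ)ᶜ : Set ℤ) → S) :=
    (μ.withDensity fun x => ENNReal.ofReal (V.φ Λ (ov x Λ ζ))).map ((↑Λ : Set ℤ)ᶜ).domRestrict
  let ν₂ : Measure (((↑Λ : Set ℤ)ᶜ : Set ℤ) → S) :=
    (μ.restrict (cylEvent Λ ζ)).map ((↑Λ : Set ℤ)ᶜ).domRestrict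
  have h1 : ∀ B, MeasurableSet B → ν₁ B = ENNReal.ofReal
      (∫ x in ((↑Λ : Set ℤ)ᶜ).domRestrict ⁻¹' B, V.φ Λ (ov x Λ ζ) ∂μ) := fun B hB => by
    rw [Measure.map_apply hr hB, withDensity_apply _ (hr hB), ofReal_integral_eq_lintegral_ofReal
      (integrable_phi_ov V Λ ζ).integrableOn (ae_of_all _ fun _ => V.nonneg _ _)]
  have h2 : ∀ B, MeasurableSet B → ν₂ B = ENNReal.ofReal
      (μ.real (((↑Λ : Set ℤ)ᶜ).domRestrict ⁻¹' B ∩ cylEvent Λ ζ)) := fun B hB => by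
    rw [Measure.map_apply hr hB, Measure.restrict_apply (hr hB), ofReal_measureReal]
  have hfin : IsFiniteMeasure ν₁ := ⟨by rw [h1 _ MeasurableSet.univ]; exact ENNReal.ofReal_lt_top⟩
  have hc : ∀ C ∈ measurableCylinders (fun _ : ((↑Λ : Set ℤ)ᶜ : Set ℤ) => S), ν₁ C = ν₂ C := by
    intro C hC
    have hCm := MeasurableSet.of_mem_measurableCylinders hC
    obtain ⟨J, T, -, rfl⟩ := (mem_measurableCylinders _).1 hC
    rw [h1 _ hCm, h2 _ hCm, h]
  have e : ν₁ = ν₂ := ext_of_generate_finite _ generateFrom_measurableCylinders.symm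
    isPiSystem_measurableCylinders hc (hc _ (univ_mem_measurableCylinders _))
  have e' := congrArg (fun ν => (ν B).toReal) e
  beta_reduce at e'
  rwa [h1 B hB, h2 B hB, ENNReal.toReal_ofReal (integral_nonneg fun _ => V.nonneg _ _),
    ENNReal.toReal_ofReal measureReal_nonneg] at e'

lemma sum_ov_swap {Λ I : Finset ℤ} (h : Λ ⊆ I) (x : Conf S) (F : Conf S → Conf S → ℝ) :
    ∑ ζ : I → S, ∑ ξ : Λ → S, F (ov x I ζ) (ov (ov x I ζ) Λ ξ) =
      ∑ ζ : I → S, ∑ ξ : Λ → S, F (ov (ov x I ζ) Λ ξ) (ov x I ζ) := by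
  rw [← Fintype.sum_prod_type', ← Fintype.sum_prod_type']
  let e : (I → S) × (Λ → S) → (I → S) × (Λ → S) := fun p =>
    (fun i => if hi : (i : ℤ) ∈ Λ then p.2 ⟨i, hi⟩ else p.1 i, fun i => p.1 ⟨i, h i.2⟩)
  have he : Function.Involutive e := fun p => by
    refine Prod.ext ?_ ?_
    · funext i
      simp only [e]
      split_ifs <;> rfl
    · funext i
      simp [e]
  refine Fintype.sum_equiv he.toPerm _ _ fun p => ?_
  have e1 : ov (ov x I (e p).1) Λ (e p).2 = ov x I p.1 := by
    funext i
    simp only [ov, e]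
    split_ifs with h1 h2 h2
    · rfl
    · exact absurd (h h1) h2
    · rfl
    · rfl
  have e2 : ov x I (e p).1 = ov (ov x I p.1) Λ p.2 := by
    funext i
    simp only [ov, e]
    split_ifs with h1 h2 h2
    · rfl
    · rfl
    · exact absurd (h h2) h1
    · rfl
  change _ = F (ov (ov x I (e p).1) Λ (e p).2) (ov x I (e p).1)
  rw [e1, e2]

lemma sum_phi_kernel {Λ I : Finset ℤ} (h : Λ ⊆ I) (x : Conf S) (u : Conf S → ℝ) :
    ∑ ζ : I → S, V.φ I (ov x I ζ) * ∑ ξ : Λ → S, V.φ Λ (ov (ov x I ζ) Λ ξ) * u (ov (ov x I ζ) Λ ξ) =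
      ∑ ζ : I → S, V.φ I (ov x I ζ) * u (ov x I ζ) := by
  simp only [Finset.mul_sum]
  rw [sum_ov_swap h x fun y z => V.φ I y * (V.φ Λ z * u z)]
  refine Finset.sum_congr rfl fun ζ _ => ?_
  rw [← Finset.sum_mul, V.consistent Λ I h (ov x I ζ)]
  ring

/-- A continuous specification has a Gibbs state. -/
theorem Specification.IsCont.exists_isGibbs (hc : V.IsCont) : ∃ μ, IsGibbs V μ := by
  obtain ⟨a⟩ := ‹Nonempty S›
  let x₀ : Conf S := fun _ => a
  let I : ℕ → Finset ℤ := fun n => Finset.Ico (-n) n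
  let m : ℕ → Measure (Conf S) := fun n => ∑ ζ : I n → S,
    ENNReal.ofReal (V.φ (I n) (ov x₀ (I n) ζ)) • Measure.dirac (ov x₀ (I n) ζ)
  have hm : ∀ n, IsProbabilityMeasure (m n) := fun n => ⟨by
    simp only [m, Measure.coe_finsetSum, Finset.sum_apply, Measure.smul_apply, measure_univ,
      smul_eq_mul, mul_one]
    rw [← ENNReal.ofReal_sum_of_nonneg fun _ _ => V.nonneg _ _, V.sum_one, ENNReal.ofReal_one]⟩
  have hkern : ∀ n (g : Conf S → ℝ), Continuous g →
      ∫ x, g x ∂m n = ∑ ζ : I n → S, V.φ (I n) (ov x₀ (I n) ζ) * g (ov x₀ (I n) ζ) := by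
    intro n g hg
    have hgm : StronglyMeasurable g := by
      have : BorelSpace S := borelSpace_of_discrete
      exact hg.measurable.stronglyMeasurable
    rw [integral_finsetSum_measure fun ζ _ => (integrable_dirac' hgm (by simp)).smul_measure
      ENNReal.ofReal_ne_top]
    refine Finset.sum_congr rfl fun ζ _ => ?_
    rw [integral_smul_measure, integral_dirac' _ _ hgm, ENNReal.toReal_ofReal (V.nonneg _ _),
      smul_eq_mul]
  obtain ⟨μ, hμ, hlim⟩ := exists_limit_measure m hm
  refine ⟨μ, hμ, gibbsCond_of_cylinder fun Λ ζ J T => ?_⟩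
  set A : Set (Conf S) := ((↑Λ : Set ℤ)ᶜ).domRestrict ⁻¹' (cylinder J T)
  have hAc : IsClopen A := by
    have h1 : Continuous fun x : Conf S => J.restrict (((↑Λ : Set ℤ)ᶜ).domRestrict x) :=
      continuous_pi fun _ => continuous_apply _
    exact (isClopen_discrete T).preimage h1
  have hCc : IsClopen (cylEvent Λ ζ) := by
    have h1 : Continuous fun (x : Conf S) (i : Λ) => x i := continuous_pi fun _ => continuous_apply _
    have : cylEvent Λ ζ = (fun (x : Conf S) (i : Λ) => x i) ⁻¹' {ζ} := by
      ext x; simp [cylEvent, funext_iff]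
    rw [this]
    exact (isClopen_discrete _).preimage h1
  have hov : Continuous fun x : Conf S => ov x Λ ζ := by
    refine continuous_pi fun i => ?_
    unfold ov
    split_ifs
    exacts [continuous_const, continuous_apply i]
  have hcont1 : Continuous (A.indicator fun x => V.φ Λ (ov x Λ ζ)) :=
    ((hc Λ).comp hov).indicator (fun x hx => by simp [hAc.frontier_eq] at hx)
  have hcont2 : Continuous ((A ∩ cylEvent Λ ζ).indicator fun _ => (1 : ℝ)) :=
    continuous_const.indicator (fun x hx => by simp [(hAc.inter hCc).frontier_eq] at hx)
  have hbs : BorelSpace S := borelSpace_of_discrete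
  rw [← integral_indicator hAc.isOpen.measurableSet,
    ← integral_indicator_one (hAc.inter hCc).isOpen.measurableSet]
  refine tendsto_nhds_unique (hlim _ hcont1) ((hlim _ hcont2).congr' ?_)
  have hev : ∀ᶠ n : ℕ in atTop, Λ ⊆ I n := by
    obtain ⟨b, N, hb⟩ := exists_window Λ
    filter_upwards [eventually_ge_atTop (b.natAbs + N)] with n hn i hi
    have := hb i hi
    simp only [I, Finset.mem_Ico]
    omega
  refine Nat.hyperfilter_le_atTop ?_
  filter_upwards [hev] with n hn
  rw [hkern n _ hcont1, hkern n _ hcont2, ← sum_phi_kernel hn]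
  refine Finset.sum_congr rfl fun η _ => ?_
  congr 1
  set y := ov x₀ (I n) η
  have hAy : ∀ ξ : Λ → S, ov y Λ ξ ∈ A ↔ y ∈ A := by
    intro ξ
    have : ((↑Λ : Set ℤ)ᶜ).domRestrict (ov y Λ ξ) = ((↑Λ : Set ℤ)ᶜ).domRestrict y := by
      funext i
      have hi : (i : ℤ) ∉ Λ := fun hi => i.2 (Finset.mem_coe.2 hi)
      simp [ov, hi]
    simp only [A, mem_preimage, this]
  have hCy : ∀ ξ : Λ → S, ov y Λ ξ ∈ cylEvent Λ ζ ↔ ξ = ζ := by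
    intro ξ
    simp only [cylEvent, ov, funext_iff, mem_ofPred_eq]
    exact forall_congr' fun i => by rw [dif_pos i.2]
  rw [Finset.sum_eq_single ζ (fun ξ _ hξ => by
    rw [indicator_of_notMem (fun hh => hξ ((hCy ξ).1 hh.2)), mul_zero]) (by simp)]
  by_cases hy : y ∈ A
  · rw [indicator_of_mem hy, indicator_of_mem (mem_inter ((hAy ζ).2 hy) ((hCy ζ).2 rfl)), mul_one]
  · rw [indicator_of_notMem hy, indicator_of_notMem fun hh => hy ((hAy ζ).1 hh.1), mul_zero]

end Gibbs

section Unique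

variable {S : Type} [Fintype S] [Nonempty S] [DecidableEq S]
  [TopologicalSpace S] [DiscreteTopology S] [MeasurableSpace S] [MeasurableSingletonClass S]
  {V : Specification S}

/-- The function `h` depends only on the coordinates in `[a, a + n)`. -/
def Win (a : ℤ) (n : ℕ) (h : Conf S → ℝ) : Prop :=
  ∀ z z', (∀ j, a ≤ j → j < a + n → z j = z' j) → h z = h z'

variable {a : ℤ} {n : ℕ} {h : Conf S → ℝ}

lemma win_rd (a : ℤ) (n : ℕ) (F : List S → ℝ) : Win a n fun z => F (rd z a n) :=
  fun _ _ hz => congrArg F (rd_congr hz)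

lemma Win.mono (hh : Win a n h) {a' : ℤ} {n' : ℕ} (h1 : a' ≤ a) (h2 : a + n ≤ a' + n') :
    Win a' n' h := fun z z' hz => hh z z' fun j hj hj' => hz j (by omega) (by omega)

lemma Win.eq_rd (hh : Win a n h) (x z : Conf S) : h z = h (put x a (rd z a n)) := by
  refine hh _ _ fun j hj hj' => ?_
  have := congrFun (put_rd (x := z) (z := z) (a := a) (n := n) fun _ _ => rfl) j
  rw [← this]
  exact put_congr (P := fun _ => False) (fun _ h => h.elim) (Or.inr ⟨hj, by simpa using hj'⟩)

lemma Win.continuous (hh : Win a n h) : Continuous h := by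
  obtain ⟨x⟩ : Nonempty (Conf S) := inferInstance
  rw [funext fun z => hh.eq_rd x z]
  exact continuous_rd (fun w => h (put x a w)) a n

lemma Win.measurable (hh : Win a n h) : Measurable h := by
  obtain ⟨x⟩ : Nonempty (Conf S) := inferInstance
  rw [funext fun z => hh.eq_rd x z]
  exact measurable_rd (fun w => h (put x a w)) a n

lemma Specification.IsCont.continuous_kern (hc : V.IsCont) (hh : Win a n h) :
    Continuous (V.kern a n h) := by
  unfold Specification.kern
  refine continuous_finsetSum _ fun w hw => ?_
  rw [mem_wd] at hw
  obtain ⟨x₀⟩ : Nonempty (Conf S) := inferInstance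
  have e : ∀ x, h (put x a w) = h (put x₀ a w) := fun x => hh _ _ fun j hj hj' =>
    put_congr (P := fun _ => False) (fun _ h => h.elim) (Or.inr ⟨hj, by rwa [hw]⟩)
  simp only [e]
  refine ((hc _).comp (continuous_pi fun j => ?_)).mul_const _
  unfold put
  split_ifs
  · rcases w[(j - a).toNat]? with _ | c
    · exact continuous_apply j
    · exact continuous_const
  · exact continuous_apply j

variable {μ ν : Measure (Conf S)}

lemma integrable_of_continuous [IsProbabilityMeasure μ] {g : Conf S → ℝ} (hg : Continuous g) :
    Integrable g μ := by
  have : BorelSpace S := borelSpace_of_discrete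
  obtain ⟨C, hC⟩ := isCompact_univ.exists_bound_of_continuousOn hg.continuousOn
  exact Integrable.of_bound hg.measurable.aestronglyMeasurable C
    (ae_of_all _ fun x => hC x (mem_univ x))

lemma gibbsCond_setIntegral_kern [IsProbabilityMeasure μ] (hμ : GibbsCond V.φ μ) (hn : 0 < n)
    (hh : Win a n h) {A : Set (Conf S)}
    (hA : MeasurableSet[cylSA (↑(Finset.Ico a (a + n)) : Set ℤ)ᶜ] A) :
    ∫ x in A, V.kern a n h x ∂μ = ∫ x in A, h x ∂μ := by
  obtain ⟨x₀⟩ : Nonempty (Conf S) := inferInstance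
  set Λ := Finset.Ico a (a + n)
  have hΛ : Λ.Nonempty := ⟨a, by simp [Λ, hn]⟩
  have e : ∀ x (ζ : Λ → S), h (ov x Λ ζ) = h (ov x₀ Λ ζ) := fun x ζ => hh _ _ fun j hj hj' => by
    have : j ∈ Λ := Finset.mem_Ico.2 ⟨hj, hj'⟩
    simp [ov, this]
  have e1 : ∀ x, V.kern a n h x = ∑ ζ : Λ → S, V.φ Λ (ov x Λ ζ) * h (ov x₀ Λ ζ) := fun x => by
    rw [Specification.kern, ← sum_ov_eq fun y => V.φ Λ y * h y]
    exact Finset.sum_congr rfl fun ζ _ => by rw [e]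
  have e2 : ∀ x, h x = ∑ ζ : Λ → S, (cylEvent Λ ζ).indicator (fun _ => h (ov x₀ Λ ζ)) x := by
    intro x
    rw [Finset.sum_eq_single_of_mem (fun i : Λ => x i) (Finset.mem_univ _)]
    · rw [indicator_of_mem (show x ∈ cylEvent Λ _ from fun i => rfl), ← e x]
      congr 1
      funext i
      simp [ov]
    · intro ζ _ hζ
      exact indicator_of_notMem (fun h' => hζ (funext fun i => (h' i).symm)) _
  simp_rw [e1]
  rw [integral_congr_ae (ae_of_all _ e2), integral_finsetSum _ fun ζ _ => ((integrable_phi_ov V Λ ζ).mul_const _).integrableOn,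
    integral_finsetSum _ fun ζ _ => Integrable.integrableOn
      ((integrable_const (h (ov x₀ Λ ζ))).indicator (measurableSet_cylEvent Λ ζ))]
  refine Finset.sum_congr rfl fun ζ _ => ?_
  rw [integral_mul_const, gibbsCond_setIntegral hμ hΛ ζ hA,
    setIntegral_indicator (measurableSet_cylEvent Λ ζ), setIntegral_const, smul_eq_mul]

/-- Invariance of `μ` under the conditional expectations of `V` on intervals. -/
def IsFix (V : Specification S) (μ : Measure (Conf S)) : Prop :=
  ∀ a n h, 0 < n → Win a n h → ∫ x, V.kern a n h x ∂μ = ∫ x, h x ∂μ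

lemma IsGibbs.isFix (hμ : IsGibbs V μ) : IsFix V μ := fun a n h hn hh => by
  have := hμ.1
  have := gibbsCond_setIntegral_kern hμ.2 hn hh (A := univ) (@MeasurableSet.univ _ (cylSA _))
  simpa using this

lemma measurable_shift (b : ℤ) : Measurable (shift b : Conf S → Conf S) :=
  measurable_pi_lambda _ fun _ => measurable_pi_apply _

lemma IsFix.map_shift (hμ : IsFix V μ) (hc : V.IsCont) (hinv : V.TInvariant) (b : ℤ) :
    IsFix V (μ.map (shift b)) := fun a n h hn hh => by
  have : BorelSpace S := borelSpace_of_discrete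
  rw [integral_map (measurable_shift b).aemeasurable
      (hc.continuous_kern hh).measurable.aestronglyMeasurable,
    integral_map (measurable_shift b).aemeasurable hh.measurable.aestronglyMeasurable,
    ← hμ (a + b) n (fun z => h (shift b z)) hn
      fun z z' hz => hh _ _ fun j hj hj' => hz _ (by omega) (by omega)]
  refine integral_congr_ae (ae_of_all _ fun x => ?_)
  unfold Specification.kern
  refine Finset.sum_congr rfl fun w _ => ?_
  have e : (Finset.Ico a (a + (n : ℤ))).image (fun i => b + i) =
      Finset.Ico (a + b) (a + b + n) := ?_
  · rw [put_shift, ← hinv, e]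
  ext i
  simp only [Finset.mem_image, Finset.mem_Ico]
  constructor
  · rintro ⟨j, hj, rfl⟩; omega
  · exact fun hi => ⟨i - b, by omega, by omega⟩

/-- A lower bound for the integrals of local functions extends to continuous functions. -/
lemma le_integral_of_win [IsProbabilityMeasure μ] [IsProbabilityMeasure ν] {θ : ℝ}
    (H : ∀ a n h, Win a n h → (∀ x, 0 ≤ h x) → θ * ∫ x, h x ∂μ ≤ ∫ x, h x ∂ν)
    {g : Conf S → ℝ} (hg : Continuous g) (h0 : ∀ x, 0 ≤ g x) :
    θ * ∫ x, g x ∂μ ≤ ∫ x, g x ∂ν := by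
  obtain ⟨x₀⟩ : Nonempty (Conf S) := inferInstance
  let G : ℕ → Conf S → ℝ := fun m z => g (put x₀ (-(m : ℤ)) (rd z (-(m : ℤ)) (2 * m)))
  have hG : ∀ m : ℕ, Win (-(m : ℤ)) (2 * m) (G m) := fun m =>
    win_rd _ _ fun w => g (put x₀ (-m) w)
  obtain ⟨C, hC⟩ := isCompact_univ.exists_bound_of_continuousOn hg.continuousOn
  have hlim : ∀ z, Tendsto (fun m => G m z) atTop (nhds (g z)) := fun z => by
    refine (hg.tendsto z).comp (tendsto_pi_nhds.2 fun j => ?_)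
    refine tendsto_const_nhds.congr' ?_
    filter_upwards [eventually_ge_atTop (j.natAbs + 1)] with m hm
    have := congrFun (put_rd (x := z) (z := z) (a := -m) (n := 2 * m) fun _ _ => rfl) j
    rw [← this]
    refine (put_congr (P := fun _ => False) (fun _ h => h.elim) (Or.inr ⟨by omega, ?_⟩)).symm
    rw [length_rd]; omega
  have hT : ∀ (ρ : Measure (Conf S)) [IsProbabilityMeasure ρ],
      Tendsto (fun m => ∫ x, G m x ∂ρ) atTop (nhds (∫ x, g x ∂ρ)) := fun ρ _ =>
    tendsto_integral_of_dominated_convergence (fun _ => C)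
      (fun m => (hG m).measurable.aestronglyMeasurable) (integrable_const _)
      (fun m => ae_of_all _ fun x => hC _ (mem_univ _)) (ae_of_all _ hlim)
  exact le_of_tendsto_of_tendsto' ((hT μ).const_mul θ) (hT ν)
    fun m => H _ _ _ (hG m) fun x => h0 _

variable {s : S} {β : ℝ} {b : ℕ → ℝ}

lemma Specification.Reg.exists_kern_ge_win (hV : V.Reg s β b) : ∃ c : ℝ, 0 < c ∧ c ≤ 1 ∧
    ∀ a n h, Win a n h → (∀ z, 0 ≤ h z) → ∃ a' N, 0 < N ∧ Win a' N h ∧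
      ∀ x y, c * V.kern a' N h y ≤ V.kern a' N h x := by
  obtain ⟨c, hc, hc1, H⟩ := hV.exists_kern_ge
  refine ⟨c, hc, hc1, fun a n h hh h0 => ?_⟩
  let L := max n 1
  have hL1 : n ≤ L := le_max_left _ _
  have hL2 : 1 ≤ L := le_max_right _ _
  refine ⟨a - L, 3 * L, by omega, hh.mono (by omega) (by push_cast; omega), fun x y => ?_⟩
  have e : ∀ z, V.kern (a - L) (3 * L) h z =
      V.kern 0 (3 * L) (fun z => h (shift (-(a - L)) z)) (shift (a - L) z) := fun z => by
    rw [hV.inv.kern_shift]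
    congr 1
    funext z
    congr 1
    funext i
    exact congrArg z (by ring)
  rw [e, e]
  exact H L _ (fun _ => h0 _) (fun z z' hz => hh _ _ fun j hj hj' =>
    hz (j + -(a - L)) (by omega) (by omega)) _ _

lemma IsFix.improve (hV : V.Reg s β b) : ∃ c : ℝ, 0 < c ∧ c ≤ 1 ∧
    ∀ {μ ν : Measure (Conf S)} [IsProbabilityMeasure μ] [IsProbabilityMeasure ν],
      IsFix V μ → IsFix V ν → ∀ {θ : ℝ}, θ ≤ 1 →
      (∀ a n h, Win a n h → (∀ x, 0 ≤ h x) → θ * ∫ x, h x ∂μ ≤ ∫ x, h x ∂ν) →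
      ∀ a n h, Win a n h → (∀ x, 0 ≤ h x) →
        (1 - (1 - c) * (1 - θ)) * ∫ x, h x ∂μ ≤ ∫ x, h x ∂ν := by
  obtain ⟨c, hc, hc1, H⟩ := hV.exists_kern_ge_win
  refine ⟨c, hc, hc1, fun {μ ν} _ _ hμ hν {θ} hθ hP a n h hh h0 => ?_⟩
  obtain ⟨a', N, hN, hw, hk⟩ := H a n h hh h0
  rw [← hμ a' N h hN hw, ← hν a' N h hN hw]
  have hgc := hV.cont.continuous_kern hw
  set g := V.kern a' N h
  obtain ⟨x₀, -, hx₀⟩ := isCompact_univ.exists_isMaxOn univ_nonempty hgc.continuousOn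
  have hM : ∀ x, g x ≤ g x₀ := fun x => hx₀ (mem_univ x)
  have h1 : ∫ x, g x ∂μ ≤ g x₀ := by
    refine (integral_mono (integrable_of_continuous hgc) (integrable_const _) hM).trans ?_
    rw [integral_const, probReal_univ, one_smul]
  have h2 := le_integral_of_win hP (g := fun x => g x - c * g x₀) (hgc.sub continuous_const)
    fun x => sub_nonneg.2 (hk x x₀)
  rw [integral_sub (integrable_of_continuous hgc) (integrable_const _),
    integral_sub (integrable_of_continuous hgc) (integrable_const _)] at h2
  simp only [integral_const, probReal_univ, one_smul] at h2
  nlinarith [mul_le_mul_of_nonneg_left h1 (mul_nonneg (sub_nonneg.2 hθ) hc.le)]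

lemma IsFix.integral_le (hV : V.Reg s β b) [IsProbabilityMeasure μ] [IsProbabilityMeasure ν]
    (hμ : IsFix V μ) (hν : IsFix V ν) (hh : Win a n h) (h0 : ∀ x, 0 ≤ h x) :
    ∫ x, h x ∂μ ≤ ∫ x, h x ∂ν := by
  obtain ⟨c, hc, hc1, H⟩ := IsFix.improve hV
  have key : ∀ m : ℕ, ∀ a n h, Win a n h → (∀ x, 0 ≤ h x) →
      (1 - (1 - c) ^ m) * ∫ x, h x ∂μ ≤ ∫ x, h x ∂ν := by
    intro m
    induction m with
    | zero => intro a n h _ h0; simpa using integral_nonneg h0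
    | succ m ih =>
      intro a n h hh h0
      have := H hμ hν (sub_le_self 1 (pow_nonneg (sub_nonneg.2 hc1) m)) ih a n h hh h0
      rwa [sub_sub_cancel, ← pow_succ'] at this
  have ht : Tendsto (fun m : ℕ => (1 - (1 - c) ^ m) * ∫ x, h x ∂μ) atTop
      (nhds ((1 - 0) * ∫ x, h x ∂μ)) :=
    (tendsto_const_nhds.sub (tendsto_pow_atTop_nhds_zero_of_lt_one (by linarith)
      (by linarith))).mul_const _
  rw [sub_zero, one_mul] at ht
  exact le_of_tendsto' ht fun m => key m a n h hh h0

theorem IsFix.unique (hV : V.Reg s β b) [IsProbabilityMeasure μ] [IsProbabilityMeasure ν]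
    (hμ : IsFix V μ) (hν : IsFix V ν) : μ = ν := by
  refine ext_of_rd fun a w => ?_
  rw [real_rd a w.length (fun l => l = w), real_rd a w.length (fun l => l = w)]
  have hw : Win a w.length fun x => if rd x a w.length = w then 1 else 0 :=
    win_rd a w.length fun l => if l = w then 1 else 0
  have h0 : ∀ x : Conf S, (0 : ℝ) ≤ if rd x a w.length = w then 1 else 0 := fun x => by
    split_ifs <;> norm_num
  exact le_antisymm (IsFix.integral_le hV hμ hν hw h0) (IsFix.integral_le hV hν hμ hw h0)

end Unique

section GibbsProcess

variable {S : Type} [Fintype S] [Nonempty S] [DecidableEq S]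
  [TopologicalSpace S] [DiscreteTopology S] [MeasurableSpace S] [MeasurableSingletonClass S]
  {V : Specification S} {μ : Measure (Conf S)} {Q : List S → ℝ}

/-- The configurations whose past ends with the word `u`. -/
def past (u : List S) : Set (Conf S) := {x | rd x (-u.length) u.length = u}

/-- The indicator of the configurations reading `z` from the origin on. -/
def ind (z : List S) (x : Conf S) : ℝ := if rd x 0 z.length = z then 1 else 0

lemma ind_nonneg (z : List S) (x : Conf S) : 0 ≤ ind z x := by
  unfold ind; split_ifs <;> norm_num

lemma win_ind {z : List S} {n : ℕ} (h : z.length ≤ n) : Win 0 n (ind z) :=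
  (win_rd 0 z.length fun l => if l = z then 1 else 0).mono le_rfl (by omega)

lemma measurableSet_past (u : List S) : MeasurableSet (past u) :=
  measurableSet_rd _ _ fun l => l = u

lemma measurableSet_past_cylSA (u : List S) (n : ℕ) :
    MeasurableSet[cylSA (↑(Finset.Ico (0 : ℤ) (0 + n)) : Set ℤ)ᶜ] (past u) := by
  obtain ⟨a⟩ := ‹Nonempty S›
  have e : past u = (fun x => ov x (Finset.Ico (0 : ℤ) (0 + n)) fun _ => a) ⁻¹' past u := by
    ext x
    have : rd (ov x (Finset.Ico (0 : ℤ) (0 + n)) fun _ => a) (-u.length) u.length =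
        rd x (-u.length) u.length := rd_congr fun i h1 h2 =>
      dif_neg (by rw [Finset.mem_Ico]; omega)
    rw [mem_preimage, past, mem_ofPred_eq, mem_ofPred_eq, this]
  rw [e]
  exact measurable_ov _ _ (measurableSet_past u)

lemma eq_of_mem_past {u v : List S} {k : ℕ} (h : Agr k u v) {x y : Conf S} (hx : x ∈ past u)
    (hy : y ∈ past v) {j : ℤ} (hj : j ≥ -(k : ℤ)) (hj0 : j < 0) : x j = y j := by
  obtain ⟨u', v', w, rfl, rfl, rfl⟩ := h
  have key : ∀ {x : Conf S} {u' : List S}, x ∈ past (u' ++ w) → rd x (-w.length) w.length = w := by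
    intro x u' hx
    rw [past, mem_ofPred_eq, List.length_append, rd_add] at hx
    have := (List.append_inj hx (length_rd _ _ _)).2
    rwa [show (-((u'.length + w.length : ℕ) : ℤ) + u'.length) = -w.length by push_cast; ring] at this
  have := (key hx).trans (key hy).symm
  exact rd_eq_rd_iff.1 this j (by omega) (by omega)

lemma IsLaw.past (hQ : IsLaw μ Q) (u : List S) : μ.real (past u) = Q u := hQ _ u

lemma IsLaw.setIntegral_ind [IsProbabilityMeasure μ] (hQ : IsLaw μ Q) (u z : List S) :
    ∫ x in GibbsFormal.past u, ind z x ∂μ = Q (u ++ z) := by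
  have e : ind z = {x | rd x 0 z.length = z}.indicator fun _ => (1 : ℝ) := by
    funext x
    simp only [ind, indicator_apply, mem_ofPred_eq]
  rw [e, setIntegral_indicator (measurableSet_rd 0 z.length fun l => l = z), setIntegral_const,
    smul_eq_mul, mul_one, ← hQ (-u.length)]
  congr 1
  ext x
  rw [mem_inter_iff, GibbsFormal.past, mem_ofPred_eq, mem_ofPred_eq, mem_ofPred_eq,
    List.length_append, rd_add, neg_add_cancel]
  exact ⟨fun h => by rw [h.1, h.2], fun h => List.append_inj h (length_rd _ _ _)⟩

lemma IsLaw.nil [IsProbabilityMeasure μ] (hQ : IsLaw μ Q) : Q [] = 1 := by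
  rw [← hQ 0 []]
  simp [rd]

lemma IsLaw.snoc [IsProbabilityMeasure μ] (hQ : IsLaw μ Q) (w : List S) :
    ∑ a, Q (w ++ [a]) = Q w := by
  simp_rw [← hQ.setIntegral_ind]
  rw [← integral_finsetSum _ fun a _ =>
    (integrable_of_continuous (win_ind le_rfl).continuous).integrableOn, ← hQ.past]
  have : ∀ x : Conf S, ∑ a, ind [a] x = 1 := fun x => by simp [ind, rd_one]
  simp [this]

lemma IsLaw.cons [IsProbabilityMeasure μ] (hQ : IsLaw μ Q) (w : List S) :
    ∑ a, Q (a :: w) = Q w := by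
  rw [← hQ 1 w]
  have e : {x : Conf S | rd x 1 w.length = w} =
      {x | (fun l : List S => l.tail = w) (rd x 0 (w.length + 1))} := by
    ext x
    rw [mem_ofPred_eq, mem_ofPred_eq, add_comm w.length 1, rd_add, rd_one]
    rfl
  rw [e, hQ.real 0 _ fun l => l.tail = w, sum_wd_succ]
  refine Finset.sum_congr rfl fun a _ => ?_
  rw [Finset.sum_eq_single_of_mem w (mem_wd.2 rfl)]
  · simp
  · intro v _ hv
    simp [hv]

lemma isLaw_of_map_shift (h : ∀ b, μ.map (shift b) = μ) :
    IsLaw μ fun w => μ.real {x | rd x 0 w.length = w} := fun a w => by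
  have hm := measurableSet_rd (C := S) 0 w.length fun l => l = w
  beta_reduce
  conv_rhs => rw [← h a, map_measureReal_apply (measurable_shift a) hm]
  congr 1
  ext x
  rw [mem_preimage, mem_ofPred_eq, mem_ofPred_eq]
  have := rd_shift x 0 a w.length
  rw [zero_add] at this
  rw [← this]
  rfl

lemma setIntegral_past_kern [IsProbabilityMeasure μ] (hμ : GibbsCond V.φ μ) (hQ : IsLaw μ Q)
    (u : List S) {z : List S} {n : ℕ} (hn : 0 < n) (hz : z.length ≤ n) :
    ∫ x in past u, V.kern 0 n (ind z) x ∂μ = Q (u ++ z) := by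
  rw [gibbsCond_setIntegral_kern hμ hn (win_ind hz) (measurableSet_past_cylSA u n),
    hQ.setIntegral_ind]

lemma exists_le_append_singleton [IsProbabilityMeasure μ] (hpos : V.Positive) (hc : V.IsCont)
    (hμ : GibbsCond V.φ μ) (hQ : IsLaw μ Q) :
    ∃ c > 0, ∀ u a, c * Q u ≤ Q (u ++ [a]) := by
  obtain ⟨x₀, -, hx₀⟩ := isCompact_univ.exists_isMinOn (univ_nonempty (α := Conf S))
    (hc (Finset.Ico 0 (0 + (1 : ℕ)))).continuousOn
  refine ⟨_, hpos (Finset.Ico 0 (0 + (1 : ℕ))) x₀, fun u a => ?_⟩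
  rw [← setIntegral_past_kern hμ hQ u one_pos (z := [a]) (by simp), ← hQ.past, mul_comm,
    ← smul_eq_mul, ← setIntegral_const]
  refine setIntegral_mono_on (integrable_const _).integrableOn (integrable_of_continuous
    (hc.continuous_kern (win_ind (by simp)))).integrableOn (measurableSet_past u) fun x _ => ?_
  unfold Specification.kern
  refine le_trans ?_ (Finset.single_le_sum (a := [a]) (fun w _ =>
    mul_nonneg (V.nonneg _ _) (ind_nonneg _ _)) (mem_wd.2 rfl))
  have h1 : ind [a] (put x 0 [a]) = 1 := if_pos (rd_put x 0 [a])
  rw [h1, mul_one]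
  exact hx₀ (mem_univ _)

/-- The process attached to a shift-invariant Gibbs state. -/
def IsLaw.proc [IsProbabilityMeasure μ] (hpos : V.Positive) (hc : V.IsCont)
    (hμ : GibbsCond V.φ μ) (hQ : IsLaw μ Q) : Proc S where
  P := Q
  pos w := by
    obtain ⟨c, hc, h⟩ := exists_le_append_singleton hpos hc hμ hQ
    induction w using List.reverseRecOn with
    | nil => rw [hQ.nil]; exact one_pos
    | append_singleton u a ih => exact (mul_pos hc ih).trans_le (h u a)
  nil := hQ.nil
  snoc := hQ.snoc
  cons := hQ.cons

variable {s : S} {β : ℝ} {b : ℕ → ℝ}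

lemma Decay.tendsto_hcTail {R : ℕ → ℝ} (hR : Decay R β b) (m : ℕ) :
    Tendsto (fun N => hcTail (climb R) N m) atTop (nhds 1) := by
  obtain ⟨C, hC1, hC⟩ := hR.one_sub_hcTail_le
  have hα : 0 < 1 - 2 * β := by linarith [hR.lt]
  have h1 : Tendsto (fun N : ℕ => (m : ℝ) / (N + 1)) atTop (nhds 0) :=
    tendsto_const_nhds.div_atTop (tendsto_atTop_add_const_right _ _ tendsto_natCast_atTop_atTop)
  have h2 := ((h1.rpow_const (Or.inr hα.le)).const_mul C).const_sub 1
  rw [Real.zero_rpow hα.ne', mul_zero, sub_zero] at h2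
  exact tendsto_of_tendsto_of_tendsto_of_le_of_le h2 tendsto_const_nhds
    (fun N => by linarith [hC N m]) fun N => hR.hcTail_le_one N m

/-- Pasts sharing their last `k` symbols give comparable probabilities to the next `m` symbols. -/
lemma Specification.Reg.overlap [IsProbabilityMeasure μ] (hV : V.Reg s β b)
    (hμ : GibbsCond V.φ μ) (hQ : IsLaw μ Q) {k m : ℕ} {σ : ℝ}
    (hσ : ∀ N, ∑ l ∈ Finset.range N,
      logReg (V.rat s) (k + l) * (1 - hcTail (climb (logReg (V.rat s))) l m) ≤ σ)
    {u v z : List S} (huv : Agr k u v) (hz : z.length = m) :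
    Real.exp (-2 * σ) * (Q u * Q (v ++ z)) ≤ Q (u ++ z) * Q v := by
  have hk0 : ∀ N x, 0 ≤ V.kern 0 N (ind z) x := fun N x =>
    Finset.sum_nonneg fun w _ => mul_nonneg (V.nonneg _ _) (ind_nonneg _ _)
  have hQ0 : ∀ w, 0 ≤ Q w := fun w => hQ 0 w ▸ measureReal_nonneg
  have key : ∀ N ≥ m + 1, hcTail (climb (logReg (V.rat s))) N m *
      (Real.exp (-2 * σ) * (Q u * Q (v ++ z))) ≤ Q (u ++ z) * Q v := by
    intro N hN
    set H := hcTail (climb (logReg (V.rat s))) N m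
    have hH : 0 ≤ H := hV.decay.hcTail_nonneg _ _
    have hi := integrable_of_continuous (μ := μ) (hV.cont.continuous_kern (n := N) (a := 0)
      (win_ind (z := z) (by omega)))
    have h1 : ∀ x ∈ past u, ∀ y ∈ past v,
        H * Real.exp (-2 * σ) * V.kern 0 N (ind z) y ≤ V.kern 0 N (ind z) x := by
      intro x hx y hy
      refine le_trans ?_ (hV.kern_ge N m k (h := ind z) (x := x) (y := y) (ind_nonneg z)
        (fun z₁ z₂ h => win_ind hz.le _ _ fun j hj hj' => h j hj (by omega))
        fun j hj hj0 => eq_of_mem_past huv hx hy hj hj0)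
      rw [mul_assoc]
      refine mul_le_mul_of_nonneg_left (mul_le_mul_of_nonneg_right
        (Real.exp_le_exp.2 ?_) (hk0 _ _)) hH
      linarith [hσ N]
    have h2 : ∀ y ∈ past v, H * Real.exp (-2 * σ) * Q u * V.kern 0 N (ind z) y ≤ Q (u ++ z) := by
      intro y hy
      have := setIntegral_mono_on (integrable_const _).integrableOn hi.integrableOn
        (measurableSet_past u) fun x hx => h1 x hx y hy
      rw [setIntegral_const, smul_eq_mul, hQ.past,
        setIntegral_past_kern hμ hQ u (by omega) (by omega)] at this
      linarith
    have := setIntegral_mono_on (hi.const_mul _).integrableOn (integrable_const _).integrableOn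
        (measurableSet_past v) h2
    rw [integral_const_mul, setIntegral_const, smul_eq_mul, hQ.past,
        setIntegral_past_kern hμ hQ v (by omega) (by omega)] at this
    linarith
  have ht := (hV.decay.tendsto_hcTail m).mul_const (Real.exp (-2 * σ) * (Q u * Q (v ++ z)))
  rw [one_mul] at ht
  exact le_of_tendsto ht ((eventually_ge_atTop (m + 1)).mono key)

lemma Specification.Reg.nice [IsProbabilityMeasure μ] (hV : V.Reg s β b)
    (hμ : GibbsCond V.φ μ) (hQ : IsLaw μ Q) : (hQ.proc hV.pos hV.cont hμ).Nice := by
  set p := hQ.proc hV.pos hV.cont hμ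
  have hov : ∀ {k m : ℕ} {σ : ℝ}, (∀ N, ∑ l ∈ Finset.range N,
      logReg (V.rat s) (k + l) * (1 - hcTail (climb (logReg (V.rat s))) l m) ≤ σ) →
      ∀ u v, Agr k u v → ∀ z ∈ wd S m, Real.exp (-2 * σ) * p.law v z ≤ p.law u z := by
    intro k m σ hσ u v huv z hz
    have := hV.overlap hμ hQ hσ huv (mem_wd.1 hz)
    rw [Proc.law, Proc.law, ← mul_div_assoc, div_le_div_iff₀ (p.pos v) (p.pos u)]
    change _ * Q (v ++ z) * Q u ≤ Q (u ++ z) * Q v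
    linarith
  obtain ⟨c, hc, hcQ⟩ := exists_le_append_singleton hV.pos hV.cont hμ hQ
  have hlb : ∀ u a, c ≤ p.law u [a] := fun u a => (le_div_iff₀ (p.pos u)).2 (hcQ u a)
  refine ⟨⟨c, hc, hlb⟩, fun N δ hδ => ?_, ?_⟩
  · obtain ⟨K, hK⟩ := hV.decay.sum_overlap_small N (half_pos hδ)
    refine ⟨K, fun u v huv z hz => le_trans ?_ (hov (hK K le_rfl) u v huv z hz)⟩
    refine mul_le_mul_of_nonneg_right ?_ (p.law_nonneg _ _)
    linarith [Real.add_one_le_exp (-2 * (δ / 2))]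
  · obtain ⟨C, hC⟩ := hV.decay.sum_overlap_le
    have hα : 0 < 1 - 2 * β := by linarith [hV.decay.lt]
    obtain ⟨l, hl1, hl⟩ : ∃ l : ℕ, 1 ≤ l ∧ 2 * C ≤ (1 - 2 * β) * Real.log (l + 1) := by
      have ht : Tendsto (fun l : ℕ => (1 - 2 * β) * Real.log (l + 1)) atTop atTop :=
        (Real.tendsto_log_atTop.comp (tendsto_atTop_add_const_right _ _
          tendsto_natCast_atTop_atTop)).const_mul_atTop hα
      exact ((eventually_ge_atTop 1).and (ht.eventually_ge_atTop _)).exists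
    have hl0 : (0 : ℝ) < l + 1 := by positivity
    have h0 : 0 ≤ β * Real.log (l + 1) + C := by
      simpa using hC (l + 1) hl0 0 0 0 (by norm_num)
    refine Proc.vwb_of_overlap (c := c) (o := Real.exp (-2 * (β * Real.log (l + 1) + C)))
      (l := l) (K := 0) hc hlb hl1 (Real.exp_pos _) (Real.exp_le_one_iff.2 (by linarith)) ?_
      fun k _ u v huv z hz => hov (fun N => hC (l + 1) hl0 k (l * k) N ?_) u v huv z hz
    · rw [← Real.exp_log hl0, ← Real.exp_add, Real.exp_log hl0]
      refine Real.one_le_exp ?_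
      linarith
    · push_cast
      nlinarith [(Nat.cast_nonneg l : (0 : ℝ) ≤ l)]

end GibbsProcess

section Main

variable {S : Type} [Fintype S] [Nonempty S] [DecidableEq S]
  [TopologicalSpace S] [DiscreteTopology S] [MeasurableSpace S] [MeasurableSingletonClass S]
  {V : Specification S} {s : S} {β : ℝ} {b : ℕ → ℝ}

theorem Specification.Reg.exists_unique_bernoulli (hV : V.Reg s β b) : ∃ μ : Measure (Conf S),
    IsGibbs V μ ∧ (∀ ν, IsGibbs V ν → ν = μ) ∧ μ.map (shift 1) = μ ∧ IsBernoulliSystem μ := by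
  obtain ⟨μ, hμ⟩ := hV.cont.exists_isGibbs
  have := hμ.1
  have hshift : ∀ b, μ.map (shift b) = μ := fun b => by
    have := Measure.isProbabilityMeasure_map (μ := μ) (measurable_shift b).aemeasurable
    exact IsFix.unique hV (hμ.isFix.map_shift hV.cont hV.inv b) hμ.isFix
  refine ⟨μ, hμ, fun ν hν => ?_, hshift 1, ?_⟩
  · have := hν.1
    exact IsFix.unique hV hν.isFix hμ.isFix
  · rcases subsingleton_or_nontrivial S with h | h
    · exact isBernoulliSystem_of_subsingleton μ
    · have hQ := isLaw_of_map_shift hshift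
      exact isBernoulliSystem_of_nice (hV.nice hμ.2 hQ) hQ

end Main

/-- A positive, continuous, `T`-invariant specification with
`max {log r_{(-∞,n]}(f), log r_{[-n,∞)}(f)} ≤ β/n + a_n` for some `β < 1/2` and
summable nonnegative `(a_n)` has a unique Gibbs state, which is shift-invariant and
Bernoulli. -/
theorem unique_bernoulli_gibbs_of_log_ratio_bound
    {S : Type} [Fintype S] [Nonempty S] [DecidableEq S]
    [TopologicalSpace S] [DiscreteTopology S]
    [MeasurableSpace S] [MeasurableSingletonClass S]
    (V : Specification S) (hpos : V.Positive) (hcont : V.IsCont)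
    (hinv : V.TInvariant) (s : S) (f : Conf S → ℝ)
    (hf : ∀ x, f x = V.φ {0} x / V.φ {0} (upd s 0 x))
    (β : ℝ) (hβ : β < 1 / 2) (a : ℕ → ℝ) (ha : ∀ n, 0 ≤ a n) (hasum : Summable a)
    (hbound : ∀ n : ℕ, 1 ≤ n →
      max (Real.log (rSup (Set.Iic (n : ℤ)) f)) (Real.log (rSup (Set.Ici (-(n : ℤ))) f))
        ≤ β / (n : ℝ) + a n) :
    ∃ μ : Measure (Conf S), IsGibbs V μ ∧ (∀ ν : Measure (Conf S), IsGibbs V ν → ν = μ) ∧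
      μ.map (shift 1) = μ ∧ IsBernoulliSystem μ := by
  obtain rfl : f = V.rat s := funext hf
  have hc := hcont.rat hpos s
  have hp := hpos.rat_pos s
  have hdecay := decay_of_inv_bound (β := max β (1 / 4)) (logReg_nonneg hc hp) (logReg_anti hc hp)
    (lt_max_of_lt_right (by norm_num)) (max_lt hβ (by norm_num)) ha hasum fun j hj =>
      (hbound j hj).trans (by gcongr; exact le_max_left _ _)
  exact Specification.Reg.exists_unique_bernoulli ⟨hpos, hcont, hinv, hdecay⟩

end GibbsFormal
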